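/- Let M ⊂ ℂ be a bounded connected open set with real-analytic boundary, let n ≥ 3, and let Ω ⊂ ℂⁿ be a bounded strongly pseudoconvex domain with defining function ρ of class C⁴ on an open set U ⊇ closure(Ω). Let f₀ : closure(M) → ℂⁿ be continuous, holomorphic on M, with f₀(closure(M)) ⊆ Ω, let K ⊆ M be compact and ε > 0. Then there exists f : closure(M) → ℂⁿ, continuous on closure(M) and holomorphic on M, with f(M) ⊆ Ω, ρ(f(x)) = 0 for all x ∈ bM, sup_K |f − f₀| < ε, and such that the complex derivative f′ extends continuously to closure(M) with nonvanishing extension (f is an immersion up to the boundary). If moreover n ≥ 4, then f can in addition be chosen injective on closure(M). -/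

import Mathlib

open Complex Metric Set Bornology

/-- Second real Fréchet derivative. -/
noncomputable def D2 {E : Type*} [NormedAddCommGroup E] [NormedSpace ℝ E]
    (ρ : E → ℝ) (z w v : E) : ℝ := fderiv ℝ (fderiv ℝ ρ) z w v

/-- The Levi form `L_ρ(z,w) = (1/4)(D²ρ(z)(w,w) + D²ρ(z)(iw,iw))`. -/
noncomputable def levi {E : Type*} [NormedAddCommGroup E] [NormedSpace ℂ E]
    (ρ : E → ℝ) (z w : E) : ℝ :=
  (1/4) * (D2 ρ z w w + D2 ρ z (Complex.I • w) (Complex.I • w))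

/-- The complex differential `∂ρ(z)(w) = (1/2)(Dρ(z)(w) − i·Dρ(z)(iw))`. -/
noncomputable def cdiff {E : Type*} [NormedAddCommGroup E] [NormedSpace ℂ E]
    (ρ : E → ℝ) (z w : E) : ℂ :=
  (1/2 : ℂ) * ((fderiv ℝ ρ z w : ℂ) - Complex.I * (fderiv ℝ ρ z (Complex.I • w) : ℂ))

open Filter Topology

theorem exists_complex_extension {f : ℝ → ℂ} (hf : AnalyticAt ℝ f 0) :
    ∃ g : ℂ → ℂ, AnalyticAt ℂ g 0 ∧ ∀ᶠ t : ℝ in 𝓝 0, g t = f t := by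
  obtain ⟨p, hp⟩ := hf
  rw [hasFPowerSeriesAt_iff] at hp
  simp only [zero_add] at hp
  obtain ⟨δ, hδ, hball⟩ := Metric.eventually_nhds_iff.1 hp
  have hs : HasSum (fun n => (δ / 2) ^ n • p.coeff n) (f (δ / 2)) :=
    hball (by simp [abs_of_pos hδ]; linarith)
  obtain ⟨C, hC⟩ := hs.summable.norm.tendsto_cofinite_zero.bddAbove_range_of_cofinite
  have hC' : ∀ n, (δ / 2) ^ n * ‖p.coeff n‖ ≤ C := fun n => by
    have := hC ⟨n, rfl⟩
    simpa [norm_smul, abs_of_pos hδ] using this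
  have hsum : ∀ z : ℂ, ‖z‖ < δ / 2 → Summable fun n => z ^ n • p.coeff n := by
    intro z hz
    have hq : ‖z‖ / (δ / 2) < 1 := by rw [div_lt_one (by positivity)]; exact hz
    refine Summable.of_norm_bounded (g := fun n => C * (‖z‖ / (δ / 2)) ^ n)
      ((summable_geometric_of_lt_one (by positivity) hq).mul_left C) fun n => ?_
    rw [smul_eq_mul, norm_mul, norm_pow, div_pow, mul_div_assoc']
    rw [le_div_iff₀ (by positivity)]
    nlinarith [hC' n, pow_nonneg (norm_nonneg z) n]
  refine ⟨fun z => ∑' n, z ^ n • p.coeff n, ?_, ?_⟩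
  · refine ⟨FormalMultilinearSeries.ofScalars (𝕜 := ℂ) ℂ p.coeff, ?_⟩
    refine (hasFPowerSeriesAt_iff (𝕜 := ℂ)).2 ?_
    filter_upwards [Metric.ball_mem_nhds (0 : ℂ) (half_pos hδ)] with z hz
    rw [zero_add]
    have := (hsum z (by simpa using hz)).hasSum
    simpa only [FormalMultilinearSeries.coeff_ofScalars] using this
  · filter_upwards [Metric.ball_mem_nhds (0 : ℝ) (half_pos hδ)] with t ht
    have ht' : |t| < δ / 2 := by simpa using ht
    have h1 : HasSum (fun n => t ^ n • p.coeff n) (f t) :=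
      hball (by simpa using ht'.trans (half_lt_self hδ))
    rw [← h1.tsum_eq]
    refine tsum_congr fun n => ?_
    rw [← ofReal_pow, smul_eq_mul, Complex.real_smul]

/-- The tangential field `i∇r` of the level sets of `r`. -/
noncomputable def tangentField (r : ℂ → ℝ) (z : ℂ) : ℂ :=
  -(fderiv ℝ r z I : ℂ) + I * (fderiv ℝ r z 1 : ℂ)

theorem fderiv_eq_im_tangentField (r : ℂ → ℝ) (z v : ℂ) :
    fderiv ℝ r z v = -(v * (starRingEnd ℂ) (tangentField r z)).im := by
  have : v = v.re • (1 : ℂ) + v.im • I := by simp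
  conv_lhs => rw [this]
  rw [map_add, map_smul, map_smul]
  simp [tangentField]
  ring

theorem tangentField_ne_zero {r : ℂ → ℝ} {z : ℂ} (h : fderiv ℝ r z ≠ 0) :
    tangentField r z ≠ 0 := by
  intro h0
  apply h
  ext v
  all_goals simp [fderiv_eq_im_tangentField, h0]

theorem analyticAt_tangentField {r : ℂ → ℝ} {z : ℂ} (hr : AnalyticAt ℝ r z) :
    AnalyticAt ℝ (tangentField r) z := by
  have h (v : ℂ) : AnalyticAt ℝ (fun z => (fderiv ℝ r z v : ℂ)) z := by
    have h1 : AnalyticAt ℝ (fun z => fderiv ℝ r z v) z :=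
      ((ContinuousLinearMap.apply ℝ ℝ v).analyticAt _).comp hr.fderiv
    exact (ofRealCLM.analyticAt _).comp h1
  exact (h I).neg.add (analyticAt_const.mul (h 1))

theorem hasDerivAt_tangentField_im {r : ℂ → ℝ} {α : ℝ → ℂ} {α' : ℂ} {s : ℝ}
    (hr : DifferentiableAt ℝ r (α s)) (hα : HasDerivAt α α' s) :
    HasDerivAt (fun s => r (α s)) (-(α' * (starRingEnd ℂ) (tangentField r (α s))).im) s := by
  rw [← fderiv_eq_im_tangentField]
  exact hr.hasFDerivAt.comp_hasDerivAt s hα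

/-- Real-analytic parametrization of a regular level set. -/
theorem exists_analytic_level_param {r : ℂ → ℝ} {z₀ : ℂ} (hr : AnalyticAt ℝ r z₀)
    (h0 : r z₀ = 0) (hD : fderiv ℝ r z₀ ≠ 0) :
    ∃ α : ℝ → ℂ, AnalyticAt ℝ α 0 ∧ α 0 = z₀ ∧ deriv α 0 = tangentField r z₀ ∧
      (∀ᶠ s in 𝓝 0, r (α s) = 0) ∧
      ∀ U ∈ 𝓝 (0 : ℝ), ∀ᶠ z in 𝓝 z₀, r z = 0 → z ∈ α '' U := by
  set X := tangentField r z₀ with hX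
  have hX0 : X ≠ 0 := tangentField_ne_zero hD
  have hcX : (starRingEnd ℂ) X ≠ 0 := by simpa using hX0
  set H : ℂ → ℂ := fun z =>
    ((((z - z₀) * (starRingEnd ℂ) X).re : ℂ) - I * (r z : ℂ)) / (starRingEnd ℂ) X with hH
  have hHa : AnalyticAt ℝ H z₀ := by
    have h1 : AnalyticAt ℝ (fun z : ℂ => ((((z - z₀) * (starRingEnd ℂ) X).re : ℝ) : ℂ)) z₀ := by
      have h : AnalyticAt ℝ (fun z : ℂ => (z - z₀) * (starRingEnd ℂ) X) z₀ :=
        (analyticAt_id.sub analyticAt_const).mul analyticAt_const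
      exact ((ofRealCLM.comp reCLM).analyticAt _).comp h
    have h2 : AnalyticAt ℝ (fun z : ℂ => ((r z : ℝ) : ℂ)) z₀ := (ofRealCLM.analyticAt _).comp hr
    exact (h1.sub (analyticAt_const.mul h2)).div_const
  have hHd : HasFDerivAt H ((ContinuousLinearEquiv.refl ℝ ℂ : ℂ ≃L[ℝ] ℂ) : ℂ →L[ℝ] ℂ) z₀ := by
    have h1 : HasFDerivAt (fun z : ℂ => ((((z - z₀) * (starRingEnd ℂ) X).re : ℝ) : ℂ))
        ((ofRealCLM.comp reCLM).comp
          ((ContinuousLinearMap.mul ℝ ℂ).flip ((starRingEnd ℂ) X))) z₀ := by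
      have h : HasFDerivAt (fun z : ℂ => (z - z₀) * (starRingEnd ℂ) X)
          ((ContinuousLinearMap.mul ℝ ℂ).flip ((starRingEnd ℂ) X)) z₀ :=
        ((ContinuousLinearMap.mul ℝ ℂ).flip ((starRingEnd ℂ) X)).hasFDerivAt.comp z₀
          ((hasFDerivAt_id z₀).sub_const z₀)
      exact (ofRealCLM.comp reCLM).hasFDerivAt.comp z₀ h
    have h2 : HasFDerivAt (fun z : ℂ => ((r z : ℝ) : ℂ)) (ofRealCLM.comp (fderiv ℝ r z₀)) z₀ :=
      ofRealCLM.hasFDerivAt.comp z₀ hr.differentiableAt.hasFDerivAt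
    have h3 := (h1.sub (h2.const_mul I)).mul_const ((starRingEnd ℂ) X)⁻¹
    refine h3.congr_fderiv ?_
    ext1 v
    simp only [fderiv_eq_im_tangentField, ← hX, _root_.smul_apply,
        _root_.sub_apply, ContinuousLinearMap.comp_apply,
        ContinuousLinearMap.flip_apply, ContinuousLinearMap.mul_apply', smul_eq_mul,
        ofRealCLM_apply, reCLM_apply, ContinuousLinearEquiv.coe_coe,
        ContinuousLinearEquiv.refl_apply, ofReal_neg]
    rw [inv_mul_eq_iff_eq_mul₀ hcX]
    apply Complex.ext <;> simp <;> ring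
  have hHs : HasStrictFDerivAt H ((ContinuousLinearEquiv.refl ℝ ℂ : ℂ ≃L[ℝ] ℂ) : ℂ →L[ℝ] ℂ) z₀ := by
    have := hHa.hasStrictFDerivAt
    rwa [hHd.fderiv] at this
  have hH0 : H z₀ = 0 := by simp [hH, h0]
  set G := hHs.localInverse H _ z₀ with hG
  have hGa : AnalyticAt ℝ G 0 := by
    have := (hHs.toOpenPartialHomeomorph H).analyticAt_symm' (a := z₀)
      hHs.mem_toOpenPartialHomeomorph_source hHa hHd.fderiv
    simp only [HasStrictFDerivAt.toOpenPartialHomeomorph_coe, hH0] at this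
    exact this
  have hG0 : G 0 = z₀ := by
    have := hHs.localInverse_apply_image
    rwa [hH0] at this
  have hGd : HasFDerivAt G ((ContinuousLinearEquiv.refl ℝ ℂ : ℂ ≃L[ℝ] ℂ) : ℂ →L[ℝ] ℂ) 0 := by
    have := hHs.to_localInverse.hasFDerivAt
    rw [hH0] at this
    exact this
  have hmul : HasDerivAt (fun s : ℝ => (s : ℂ) * X) X 0 := by
    simpa using (ofRealCLM.hasDerivAt (x := (0 : ℝ))).mul_const X
  have hmula : AnalyticAt ℝ (fun s : ℝ => (s : ℂ) * X) 0 :=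
    (ofRealCLM.analyticAt _).mul analyticAt_const
  refine ⟨fun s => G (s * X), ?_, by simp [hG0], ?_, ?_, ?_⟩
  · exact AnalyticAt.fun_comp (by simpa using hGa) hmula
  · refine HasDerivAt.deriv ?_
    have := HasFDerivAt.comp_hasDerivAt (0 : ℝ) (by simpa using hGd) hmul
    exact this
  · have h1 : ∀ᶠ w in 𝓝 (0 : ℂ), H (G w) = w := by
      have := hHs.eventually_right_inverse
      rwa [hH0] at this
    have h2 : Tendsto (fun s : ℝ => (s : ℂ) * X) (𝓝 0) (𝓝 0) := by
      simpa using hmul.continuousAt.tendsto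
    filter_upwards [h2.eventually h1] with s hs
    rw [hH] at hs
    simp only at hs
    rw [div_eq_iff hcX, mul_assoc, mul_conj] at hs
    simpa using congrArg Complex.im hs
  · intro U hU
    have h1 := hHs.eventually_left_inverse
    have h2 : Tendsto (fun z => (((z - z₀) * (starRingEnd ℂ) X).re / normSq X)) (𝓝 z₀) (𝓝 0) := by
      have : Continuous fun z => (((z - z₀) * (starRingEnd ℂ) X).re / normSq X) := by fun_prop
      simpa using this.tendsto z₀
    filter_upwards [h1, h2 hU] with z hz hzU hrz
    refine ⟨_, hzU, ?_⟩
    dsimp only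
    rw [← hG] at hz
    conv_rhs => rw [← hz]
    congr 1
    rw [hH]
    simp only [hrz]
    rw [eq_div_iff hcX, mul_assoc, mul_conj]
    have : (normSq X : ℂ) ≠ 0 := by simpa using hX0
    push_cast
    field_simp
    simp

/-- Local flow lines of the tangential field on a regular analytic level set extend
holomorphically to complex time. -/
theorem exists_holomorphic_flow_line {r : ℂ → ℝ} {z₀ : ℂ} (hr : AnalyticAt ℝ r z₀)
    (h0 : r z₀ = 0) (hD : fderiv ℝ r z₀ ≠ 0) :
    ∃ Γ : ℂ → ℂ, AnalyticAt ℂ Γ 0 ∧ Γ 0 = z₀ ∧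
      (∀ᶠ t : ℝ in 𝓝 0, r (Γ t) = 0 ∧ deriv Γ t = tangentField r (Γ t)) ∧
      ∀ U ∈ 𝓝 (0 : ℝ), ∀ᶠ z in 𝓝 z₀, r z = 0 → ∃ t ∈ U, Γ (t : ℝ) = z := by
  obtain ⟨α₀, hα₀, hα₀0, hα₀d, hα₀r, hα₀o⟩ := exists_analytic_level_param hr h0 hD
  obtain ⟨α, hα, hαα⟩ := exists_complex_extension hα₀
  have hX0 : tangentField r z₀ ≠ 0 := tangentField_ne_zero hD
  have hα0 : α 0 = z₀ := by rw [← hα₀0]; simpa using hαα.self_of_nhds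
  have hk₀ : AnalyticAt ℝ (fun s => deriv α₀ s / tangentField r (α₀ s)) 0 := by
    refine hα₀.deriv.div ?_ (by rwa [hα₀0])
    exact AnalyticAt.fun_comp (by rw [hα₀0]; exact analyticAt_tangentField hr) hα₀
  obtain ⟨k, hk, hkk⟩ := exists_complex_extension hk₀
  have hk0 : k 0 = 1 := by
    have := hkk.self_of_nhds
    rw [hα₀d, hα₀0, div_self hX0] at this
    simpa using this
  have hofr : Tendsto (fun t : ℝ => (t : ℂ)) (𝓝 0) (𝓝 0) := by
    simpa using continuous_ofReal.tendsto 0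
  obtain ⟨δ, hδ, hkδ⟩ := Metric.eventually_nhds_iff_ball.1 hk.eventually_analyticAt
  obtain ⟨Θ₁, hΘ₁⟩ := DifferentiableOn.isExactOn_ball
    (fun z hz => (hkδ z hz).differentiableAt.differentiableWithinAt : DifferentiableOn ℂ k (ball 0 δ))
  set Θ : ℂ → ℂ := fun z => Θ₁ z - Θ₁ 0 with hΘdef
  have hΘ : ∀ z ∈ ball (0 : ℂ) δ, HasDerivAt Θ (k z) z := fun z hz => (hΘ₁ z hz).sub_const _
  have hΘ0 : Θ 0 = 0 := by simp [hΘdef]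
  have hΘa : AnalyticAt ℂ Θ 0 := by
    have : DifferentiableOn ℂ Θ (ball 0 δ) := fun z hz =>
      (hΘ z hz).differentiableAt.differentiableWithinAt
    exact this.analyticAt (ball_mem_nhds _ hδ)
  -- the factor `k` is real at real points
  have hkim : ∀ᶠ s : ℝ in 𝓝 0, (k s).im = 0 := by
    have hra : ∀ᶠ s : ℝ in 𝓝 0, AnalyticAt ℝ r (α₀ s) :=
      hα₀.continuousAt.eventually (by rw [hα₀0]; exact hr.eventually_analyticAt)
    filter_upwards [hkk, hα₀.eventually_analyticAt, hα₀r.eventually_nhds, hra] with s h1 h2 h3 h4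
    have h5 := hasDerivAt_tangentField_im h4.differentiableAt h2.differentiableAt.hasDerivAt
    have h6 : HasDerivAt (fun s => r (α₀ s)) 0 s :=
      (hasDerivAt_const s (0 : ℝ)).congr_of_eventuallyEq h3
    have h7 := h5.unique h6
    rw [neg_eq_zero] at h7
    rw [h1, div_eq_mul_inv, Complex.inv_def, ← mul_assoc, im_mul_ofReal, h7, zero_mul]
  obtain ⟨δ₁, hδ₁, hδ₁k⟩ := Metric.eventually_nhds_iff_ball.1
    (hkim.and (hofr.eventually (ball_mem_nhds (0 : ℂ) hδ)))
  have hΘim : ∀ s ∈ ball (0 : ℝ) δ₁, (Θ s).im = 0 := by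
    have hd : ∀ s ∈ ball (0 : ℝ) δ₁, HasDerivAt (fun s : ℝ => (Θ s).im) 0 s := fun s hs => by
      have := imCLM.hasFDerivAt.comp_hasDerivAt s (hΘ s (hδ₁k s hs).2).comp_ofReal
      rwa [show imCLM (k s) = 0 from (hδ₁k s hs).1] at this
    intro s hs
    have := (convex_ball (0 : ℝ) δ₁).is_const_of_fderivWithin_eq_zero (𝕜 := ℝ)
      (f := fun s : ℝ => (Θ s).im)
      (fun s hs => (hd s hs).differentiableAt.differentiableWithinAt)
      (fun s hs => by
        rw [fderivWithin_of_isOpen isOpen_ball hs]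
        simpa using (hd s hs).hasFDerivAt.fderiv) hs (mem_ball_self hδ₁)
    simpa [hΘ0] using this
  have hΘreal : ∀ s ∈ ball (0 : ℝ) δ₁, (((Θ s).re : ℝ) : ℂ) = Θ s := fun s hs =>
    Complex.ext (by simp) (by simp [hΘim s hs])
  have hΘderiv : deriv Θ 0 = 1 := by rw [(hΘ 0 (mem_ball_self hδ)).deriv, hk0]
  have hΘ'ne : deriv Θ 0 ≠ 0 := by rw [hΘderiv]; exact one_ne_zero
  set σ := hΘa.hasStrictDerivAt.localInverse Θ (deriv Θ 0) 0 hΘ'ne with hσ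
  have hσa : AnalyticAt ℂ σ 0 := by
    have := hΘa.analyticAt_localInverse hΘ'ne
    rwa [hΘ0] at this
  have hσl : ∀ᶠ z in 𝓝 0, σ (Θ z) = z := hΘa.hasStrictDerivAt.eventually_left_inverse hΘ'ne
  have hσr : ∀ᶠ z in 𝓝 0, Θ (σ z) = z := by
    have := hΘa.hasStrictDerivAt.eventually_right_inverse hΘ'ne
    rwa [hΘ0] at this
  have hσ0 : σ 0 = 0 := by have := hσl.self_of_nhds; rwa [hΘ0] at this
  -- real times correspond to real parameters
  have hθ : map (fun s : ℝ => (Θ s).re) (𝓝 0) = 𝓝 0 := by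
    have hs : HasStrictDerivAt (fun s : ℝ => (Θ s).re) 1 0 := by
      have h1 : HasStrictDerivAt Θ 1 (ofRealCLM 0) := by
        have := hΘa.hasStrictDerivAt
        rw [hΘderiv] at this
        simpa using this
      have h2 := h1.hasStrictFDerivAt.restrictScalars ℝ
      have h3 := (reCLM.hasStrictFDerivAt.comp (0 : ℝ)
        (h2.comp (0 : ℝ) ofRealCLM.hasStrictFDerivAt)).hasStrictDerivAt
      simpa using h3
    have := hs.map_nhds_eq one_ne_zero
    simpa [hΘ0] using this
  have hreal : ∀ P : ℝ → Prop, (∀ᶠ s in 𝓝 (0 : ℝ), P s) →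
      ∀ᶠ t : ℝ in 𝓝 0, ∃ s : ℝ, P s ∧ Θ s = t ∧ σ t = s := by
    intro P hP
    rw [← hθ, eventually_map]
    filter_upwards [hP, ball_mem_nhds (0 : ℝ) hδ₁, hofr.eventually hσl] with s h1 h2 h3
    exact ⟨s, h1, (hΘreal s h2).symm, by rw [hΘreal s h2]; exact h3⟩
  refine ⟨fun z => α (σ z), ?_, by simp [hσ0, hα0], ?_, ?_⟩
  · exact AnalyticAt.fun_comp (by rwa [hσ0]) hσa
  · have hP : ∀ᶠ s : ℝ in 𝓝 (0 : ℝ), r (α s) = 0 ∧ HasDerivAt α (k s * tangentField r (α s)) s ∧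
        k s ≠ 0 ∧ (s : ℂ) ∈ ball (0 : ℂ) δ := by
      have hkne : ∀ᶠ s : ℝ in 𝓝 0, k s ≠ 0 :=
        hofr.eventually (hk.continuousAt.eventually_ne (by simp [hk0]))
      have hXne : ∀ᶠ s : ℝ in 𝓝 0, tangentField r (α₀ s) ≠ 0 := by
        refine hα₀.continuousAt.eventually (p := fun z => tangentField r z ≠ 0) ?_
        rw [hα₀0]
        exact (analyticAt_tangentField hr).continuousAt.eventually_ne hX0
      filter_upwards [hα₀r, hαα.eventually_nhds, hkk, hkne, hXne,
        hofr.eventually hα.eventually_analyticAt, hα₀.eventually_analyticAt,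
        hofr.eventually (ball_mem_nhds (0 : ℂ) hδ)] with s h1 h2 h3 h4 h5 h6 h7 h8
      have h9 := h2.self_of_nhds
      refine ⟨by rw [h9, h1], ?_, h4, h8⟩
      have h10 : HasDerivAt (fun s : ℝ => α s) (deriv α s) s :=
        h6.differentiableAt.hasDerivAt.comp_ofReal
      have h11 : HasDerivAt (fun s : ℝ => α s) (deriv α₀ s) s :=
        h7.differentiableAt.hasDerivAt.congr_of_eventuallyEq h2
      rw [h9, h3, div_mul_cancel₀ _ h5, ← h10.unique h11]
      exact h6.differentiableAt.hasDerivAt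
    filter_upwards [hreal _ hP, hofr.eventually hσa.eventually_analyticAt,
      hofr.eventually hσr.eventually_nhds] with t ⟨s, ⟨h1, h2, h3, h4⟩, h5, h6⟩ h7 h8
    refine ⟨by rw [h6, h1], ?_⟩
    have h9 : HasDerivAt (fun z => Θ (σ z)) (k s * deriv σ t) t := by
      have := hΘ s h4
      rw [← h6] at this ⊢
      exact this.comp (t : ℂ) h7.differentiableAt.hasDerivAt
    have h10 : HasDerivAt (fun z => Θ (σ z)) 1 t :=
      (hasDerivAt_id (t : ℂ)).congr_of_eventuallyEq h8
    have h11 := h9.unique h10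
    have h12 : HasDerivAt (fun z => α (σ z)) (k s * tangentField r (α s) * deriv σ t) t := by
      rw [← h6] at h2 ⊢
      exact h2.comp (t : ℂ) h7.differentiableAt.hasDerivAt
    rw [h12.deriv, h6]
    linear_combination tangentField r (α s) * h11
  · intro U hU
    have h1 : ∀ᶠ s : ℝ in 𝓝 0, α s = α₀ s ∧ σ (Θ s) = s ∧ (Θ s).re ∈ U ∧ s ∈ ball (0 : ℝ) δ₁ := by
      have h2 : ∀ᶠ s : ℝ in 𝓝 0, (Θ s).re ∈ U := by
        rw [← hθ] at hU
        exact hU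
      filter_upwards [hαα, hofr.eventually hσl, h2, ball_mem_nhds (0 : ℝ) hδ₁] with s h1 h2 h3 h4
      exact ⟨h1, h2, h3, h4⟩
    filter_upwards [hα₀o _ h1] with z hz hrz
    obtain ⟨s, ⟨h2, h3, h4, h5⟩, rfl⟩ := hz hrz
    exact ⟨_, h4, by rw [hΘreal s h5, h3, h2]⟩

/-- `γ` is an integral curve of `X` on `s` staying in `b`. -/
def IsCurveIn (b : Set ℂ) (X : ℂ → ℂ) (γ : ℝ → ℂ) (s : Set ℝ) : Prop :=
  ∀ t ∈ s, γ t ∈ b ∧ HasDerivAt γ (X (γ t)) t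

theorem IsCurveIn.mono {b : Set ℂ} {X : ℂ → ℂ} {γ : ℝ → ℂ} {s t : Set ℝ} (h : IsCurveIn b X γ s)
    (hts : t ⊆ s) : IsCurveIn b X γ t := fun x hx => h x (hts hx)

theorem IsCurveIn.shift {b : Set ℂ} {X : ℂ → ℂ} {γ : ℝ → ℂ} {l u : ℝ}
    (h : IsCurveIn b X γ (Ioo l u)) (c : ℝ) :
    IsCurveIn b X (fun t => γ (t + c)) (Ioo (l - c) (u - c)) := by
  intro t ht
  have := h (t + c) ⟨by linarith [ht.1], by linarith [ht.2]⟩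
  exact ⟨this.1, this.2.comp_add_const t c⟩

theorem IsCurveIn.eqOn {b : Set ℂ} {X : ℂ → ℂ} {K : NNReal} (hX : LipschitzOnWith K X b)
    {γ₁ γ₂ : ℝ → ℂ} {l u t₀ : ℝ} (h₁ : IsCurveIn b X γ₁ (Ioo l u))
    (h₂ : IsCurveIn b X γ₂ (Ioo l u)) (ht₀ : t₀ ∈ Ioo l u) (h : γ₁ t₀ = γ₂ t₀) :
    EqOn γ₁ γ₂ (Ioo l u) :=
  ODE_solution_unique_of_mem_Ioo (v := fun _ => X) (s := fun _ => b) (fun _ _ => hX) ht₀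
    (fun t ht => (h₁ t ht).symm) (fun t ht => (h₂ t ht).symm) h

theorem exists_curve_extend {b : Set ℂ} {X : ℂ → ℂ} {K : NNReal} (hX : LipschitzOnWith K X b)
    {a : ℝ} (ha : 0 < a) (h : ∀ z ∈ b, ∃ γ : ℝ → ℂ, γ 0 = z ∧ IsCurveIn b X γ (Ioo (-a) a)) :
    ∀ z ∈ b, ∃ γ : ℝ → ℂ, γ 0 = z ∧ IsCurveIn b X γ (Ioo (-(3 / 2 * a)) (3 / 2 * a)) := by
  intro z hz
  obtain ⟨γ, hγ0, hγ⟩ := h z hz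
  obtain ⟨p, hp0, hp⟩ := h _ (hγ (a / 2) ⟨by linarith, by linarith⟩).1
  obtain ⟨q, hq0, hq⟩ := h _ (hγ (-(a / 2)) ⟨by linarith, by linarith⟩).1
  have hp' := hp.shift (-(a / 2))
  have hq' := hq.shift (a / 2)
  have e1 : EqOn γ (fun t => p (t + -(a / 2))) (Ioo (-(a / 2)) a) := by
    refine IsCurveIn.eqOn hX (t₀ := a / 2) (hγ.mono ?_) (hp'.mono ?_) ?_ ?_
    · exact Ioo_subset_Ioo (by linarith) le_rfl
    · exact Ioo_subset_Ioo (by linarith) (by linarith)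
    · exact ⟨by linarith, by linarith⟩
    · simp [hp0]
  have e2 : EqOn γ (fun t => q (t + a / 2)) (Ioo (-a) (a / 2)) := by
    refine IsCurveIn.eqOn hX (t₀ := -(a / 2)) (hγ.mono ?_) (hq'.mono ?_) ?_ ?_
    · exact Ioo_subset_Ioo le_rfl (by linarith)
    · exact Ioo_subset_Ioo (by linarith) (by linarith)
    · exact ⟨by linarith, by linarith⟩
    · simp [hq0]
  have hcongr : ∀ {f g : ℝ → ℂ} {t : ℝ}, f =ᶠ[𝓝 t] g → (g t ∈ b ∧ HasDerivAt g (X (g t)) t) →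
      f t ∈ b ∧ HasDerivAt f (X (f t)) t := fun {f g t} hfg hg => by
    rw [hfg.self_of_nhds]
    exact ⟨hg.1, hg.2.congr_of_eventuallyEq hfg⟩
  refine ⟨fun t => if t ≤ 0 then q (t + a / 2) else p (t + -(a / 2)), ?_, ?_⟩
  · have := e2 (x := 0) ⟨by linarith, by linarith⟩
    simp only [le_refl, if_true]
    rw [← hγ0, this]
  · intro t ht
    rcases lt_trichotomy t 0 with h0 | h0 | h0
    · refine hcongr (f := fun t => if t ≤ 0 then q (t + a / 2) else p (t + -(a / 2)))
        (g := fun t => q (t + a / 2)) ?_ (hq' t ⟨by linarith [ht.1], by linarith [ht.2]⟩)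
      filter_upwards [Iio_mem_nhds h0] with s hs
      simp [le_of_lt hs.out]
    · refine hcongr (f := fun t => if t ≤ 0 then q (t + a / 2) else p (t + -(a / 2)))
        (g := γ) ?_ (hγ t ⟨by linarith, by linarith⟩)
      filter_upwards [Ioo_mem_nhds (show -(a / 2) < t by linarith) (show t < a / 2 by linarith)]
        with s hs
      split_ifs with h1
      · exact (e2 ⟨by linarith [hs.1], hs.2⟩).symm
      · exact (e1 ⟨hs.1, by linarith [hs.2]⟩).symm
    · refine hcongr (f := fun t => if t ≤ 0 then q (t + a / 2) else p (t + -(a / 2)))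
        (g := fun t => p (t + -(a / 2))) ?_ (hp' t ⟨by linarith [ht.1], by linarith [ht.2]⟩)
      filter_upwards [Ioi_mem_nhds h0] with s hs
      simp [not_le.2 hs.out]

theorem exists_global_curve {b : Set ℂ} {X : ℂ → ℂ} {K : NNReal} (hX : LipschitzOnWith K X b)
    {a : ℝ} (ha : 0 < a) (h : ∀ z ∈ b, ∃ γ : ℝ → ℂ, γ 0 = z ∧ IsCurveIn b X γ (Ioo (-a) a)) :
    ∀ z ∈ b, ∃ γ : ℝ → ℂ, γ 0 = z ∧ IsCurveIn b X γ univ := by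
  have hn : ∀ n : ℕ, ∀ z ∈ b, ∃ γ : ℝ → ℂ, γ 0 = z ∧
      IsCurveIn b X γ (Ioo (-((3 / 2) ^ n * a)) ((3 / 2) ^ n * a)) := by
    intro n
    induction n with
    | zero => simpa using h
    | succ n ih =>
      have := exists_curve_extend hX (by positivity) ih
      simpa only [pow_succ', mul_assoc] using this
  intro z hz
  choose γ hγ0 hγ using fun n => hn n z hz
  have hlarge : ∀ t : ℝ, ∃ n : ℕ, |t| < (3 / 2) ^ n * a := fun t => by
    obtain ⟨n, hn⟩ := pow_unbounded_of_one_lt (|t| / a) (by norm_num : (1 : ℝ) < 3 / 2)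
    exact ⟨n, (div_lt_iff₀ ha).1 hn⟩
  choose N hN using hlarge
  have heq : ∀ m n t, |t| < (3 / 2) ^ m * a → |t| < (3 / 2) ^ n * a → γ m t = γ n t := by
    have key : ∀ m n t, m ≤ n → |t| < (3 / 2) ^ m * a → γ m t = γ n t := by
      intro m n t hmn ht
      have hpos : 0 < (3 / 2 : ℝ) ^ m * a := by positivity
      have hle : (3 / 2 : ℝ) ^ m * a ≤ (3 / 2) ^ n * a :=
        mul_le_mul_of_nonneg_right (pow_le_pow_right₀ (by norm_num) hmn) ha.le
      refine IsCurveIn.eqOn hX (hγ m) ((hγ n).mono ?_) (t₀ := 0) ?_ ?_ (abs_lt.1 ht)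
      · exact Ioo_subset_Ioo (by linarith) hle
      · exact ⟨by linarith, hpos⟩
      · rw [hγ0, hγ0]
    intro m n t hm hn
    rcases le_total m n with h | h
    · exact key m n t h hm
    · exact (key n m t h hn).symm
  refine ⟨fun t => γ (N t) t, hγ0 _, fun t _ => ?_⟩
  have hev : (fun t => γ (N t) t) =ᶠ[𝓝 t] γ (N t) := by
    filter_upwards [(continuous_abs.tendsto t).eventually_lt_const (hN t)] with s hs
    exact heq _ _ _ (hN s) hs
  have := hγ (N t) t (abs_lt.1 (hN t))
  exact ⟨this.1, this.2.congr_of_eventuallyEq hev⟩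

/-- A compact set which is locally the zero set of an analytic function without critical points. -/
structure IsRegularLevelSet (r : ℂ → ℝ) (b : Set ℂ) : Prop where
  isCompact : IsCompact b
  analyticAt : ∀ z ∈ b, AnalyticAt ℝ r z
  fderiv_ne_zero : ∀ z ∈ b, fderiv ℝ r z ≠ 0
  eventually_iff : ∀ z ∈ b, ∀ᶠ w in 𝓝 z, r w = 0 ↔ w ∈ b

/-- Uniform local holomorphic flow lines on a compact regular analytic level set. -/
theorem exists_uniform_flow {b : Set ℂ} {r : ℂ → ℝ} (hr : IsRegularLevelSet r b) :
    ∃ δ > 0, ∀ z ∈ b, ∃ Γ : ℂ → ℂ, Γ 0 = z ∧ DifferentiableOn ℂ Γ (ball 0 δ) ∧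
      ∀ t : ℝ, |t| < δ → Γ t ∈ b ∧ deriv Γ t = tangentField r (Γ t) := by
  suffices H : ∃ δ > 0, ∀ z ∈ b, z ∈ b → ∃ Γ : ℂ → ℂ, Γ 0 = z ∧ DifferentiableOn ℂ Γ (ball 0 δ) ∧
      ∀ t : ℝ, |t| < δ → Γ t ∈ b ∧ deriv Γ t = tangentField r (Γ t) by
    obtain ⟨δ, hδ, h⟩ := H
    exact ⟨δ, hδ, fun z hz => h z hz hz⟩
  refine hr.1.induction_on (p := fun s => ∃ δ > 0, ∀ z ∈ s, z ∈ b → ∃ Γ : ℂ → ℂ, Γ 0 = z ∧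
    DifferentiableOn ℂ Γ (ball 0 δ) ∧
      ∀ t : ℝ, |t| < δ → Γ t ∈ b ∧ deriv Γ t = tangentField r (Γ t)) ?_ ?_ ?_ ?_
  · exact ⟨1, one_pos, by simp⟩
  · rintro s t hst ⟨δ, hδ, h⟩
    exact ⟨δ, hδ, fun z hz => h z (hst hz)⟩
  · rintro s t ⟨δ, hδ, h⟩ ⟨δ', hδ', h'⟩
    refine ⟨min δ δ', lt_min hδ hδ', ?_⟩
    rintro z (hz | hz) hzb
    · obtain ⟨Γ, h1, h2, h3⟩ := h z hz hzb
      exact ⟨Γ, h1, h2.mono (ball_subset_ball (min_le_left _ _)),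
        fun t ht => h3 t (ht.trans_le (min_le_left _ _))⟩
    · obtain ⟨Γ, h1, h2, h3⟩ := h' z hz hzb
      exact ⟨Γ, h1, h2.mono (ball_subset_ball (min_le_right _ _)),
        fun t ht => h3 t (ht.trans_le (min_le_right _ _))⟩
  · intro z hz
    obtain ⟨Γ, hΓ, hΓ0, hΓr, hΓo⟩ := exists_holomorphic_flow_line (hr.2 z hz)
      ((hr.4 z hz).self_of_nhds.2 hz) (hr.3 z hz)
    have hofr : Tendsto (fun t : ℝ => Γ t) (𝓝 0) (𝓝 z) := by
      have h1 : Tendsto (fun t : ℝ => (t : ℂ)) (𝓝 0) (𝓝 0) := by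
        simpa using continuous_ofReal.tendsto 0
      rw [← hΓ0]
      exact hΓ.continuousAt.tendsto.comp h1
    obtain ⟨δ₁, hδ₁, h1⟩ := Metric.eventually_nhds_iff_ball.1 hΓ.eventually_analyticAt
    obtain ⟨δ₂, hδ₂, h2⟩ := Metric.eventually_nhds_iff_ball.1 (hΓr.and (hofr.eventually (hr.4 z hz)))
    have hU : ball (0 : ℝ) (min δ₁ δ₂ / 2) ∈ 𝓝 0 := ball_mem_nhds _ (half_pos (lt_min hδ₁ hδ₂))
    refine ⟨_, mem_nhdsWithin_of_mem_nhds (hΓo _ hU |>.and (hr.4 z hz)), min δ₁ δ₂ / 2,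
      half_pos (lt_min hδ₁ hδ₂), ?_⟩
    rintro w ⟨hw, hw'⟩ hwb
    obtain ⟨t, ht, rfl⟩ := hw (hw'.2 hwb)
    have ht' : |t| < min δ₁ δ₂ / 2 := by simpa using ht
    refine ⟨fun τ => Γ (t + τ), by simp, ?_, ?_⟩
    · intro τ hτ
      have : (t : ℂ) + τ ∈ ball (0 : ℂ) δ₁ := by
        have h3 : ‖(t : ℂ) + τ‖ ≤ |t| + ‖τ‖ := by simpa using norm_add_le (t : ℂ) τ
        have h4 : ‖τ‖ < min δ₁ δ₂ / 2 := by simpa using hτ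
        have := min_le_left δ₁ δ₂
        simp only [mem_ball, dist_zero_right]
        linarith
      exact ((h1 _ this).differentiableAt.comp τ
        (differentiableAt_id.const_add _)).differentiableWithinAt
    · intro s hs
      have : t + s ∈ ball (0 : ℝ) δ₂ := by
        have h3 := abs_add_le t s
        have := min_le_right δ₁ δ₂
        simp only [mem_ball, dist_zero_right, Real.norm_eq_abs]
        linarith
      obtain ⟨⟨h3, h4⟩, h5⟩ := h2 _ this
      push_cast at h3 h4 h5
      rw [deriv_comp_const_add]
      exact ⟨h5.1 h3, h4⟩

theorem exists_lipschitzOnWith_tangentField {b : Set ℂ} {r : ℂ → ℝ}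
    (hr : IsRegularLevelSet r b) : ∃ K, LipschitzOnWith K (tangentField r) b := by
  refine LocallyLipschitzOn.exists_lipschitzOnWith_of_compact hr.1 fun z hz => ?_
  obtain ⟨K, t, ht, h⟩ :=
    ((analyticAt_tangentField (hr.2 z hz)).contDiffAt (n := 1)).exists_lipschitzOnWith
  exact ⟨K, t, mem_nhdsWithin_of_mem_nhds ht, h⟩

theorem exists_strip_flow {b : Set ℂ} {r : ℂ → ℝ} (hr : IsRegularLevelSet r b) :
    ∃ δ > 0, ∀ z ∈ b, ∃ Γ : ℂ → ℂ, Γ 0 = z ∧ DifferentiableOn ℂ Γ {τ | |τ.im| < δ} ∧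
      IsCurveIn b (tangentField r) (fun t : ℝ => Γ t) univ ∧
      ∀ L : ℝ, (∀ t : ℝ, Γ (t + L : ℝ) = Γ t) → ∀ τ, Γ (τ + L) = Γ τ := by
  obtain ⟨K, hK⟩ := exists_lipschitzOnWith_tangentField hr
  obtain ⟨δ, hδ, H⟩ := exists_uniform_flow hr
  refine ⟨δ, hδ, fun z hz => ?_⟩
  choose! G hG0 hGd hGt using H
  have hcurve : ∀ z ∈ b, IsCurveIn b (tangentField r) (fun t : ℝ => G z t) (Ioo (-δ) δ) := by
    intro z hz t ht
    have ht' : |t| < δ := abs_lt.2 ht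
    refine ⟨(hGt z hz t ht').1, ?_⟩
    rw [← (hGt z hz t ht').2]
    have : DifferentiableAt ℂ (G z) t :=
      (hGd z hz).differentiableAt (isOpen_ball.mem_nhds (by simpa using ht'))
    exact this.hasDerivAt.comp_ofReal
  obtain ⟨γ, hγ0, hγ⟩ := exists_global_curve hK hδ
    (fun z hz => ⟨fun t : ℝ => G z t, by simpa using hG0 z hz, hcurve z hz⟩) z hz
  have hb' : ∀ t, γ t ∈ b := fun t => (hγ t (mem_univ t)).1
  have hre : ∀ t s : ℝ, |s| < δ → G (γ t) s = γ (t + s) := by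
    intro t s hs
    have h1 : IsCurveIn b (tangentField r) (fun s => γ (s + t)) (Ioo (-δ) δ) := fun x _ =>
      ⟨hb' _, (hγ (x + t) (mem_univ _)).2.comp_add_const x t⟩
    have := IsCurveIn.eqOn hK (t₀ := 0) (hcurve _ (hb' t)) h1 ⟨by linarith, by linarith⟩
      (by simpa using hG0 _ (hb' t)) (abs_lt.1 hs)
    simpa [add_comm] using this
  have key : ∀ t₀ t : ℝ, ∀ w : ℂ, ‖w‖ < δ → ‖w + (t - t₀ : ℝ)‖ < δ → |t - t₀| < δ →
      G (γ t) w = G (γ t₀) (w + (t - t₀ : ℝ)) := by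
    intro t₀ t w hw hw' ht
    set S := ball (0 : ℂ) δ ∩ ball (-((t - t₀ : ℝ) : ℂ)) δ
    have hSo : IsOpen S := isOpen_ball.inter isOpen_ball
    have hS : IsPreconnected S := ((convex_ball _ _).inter (convex_ball _ _)).isPreconnected
    have h1 : AnalyticOnNhd ℂ (G (γ t)) S :=
      ((hGd _ (hb' t)).mono inter_subset_left).analyticOnNhd hSo
    have h2 : AnalyticOnNhd ℂ (fun w => G (γ t₀) (w + (t - t₀ : ℝ))) S := by
      refine DifferentiableOn.analyticOnNhd ?_ hSo
      refine (hGd _ (hb' t₀)).comp (by fun_prop) ?_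
      intro w hw
      have := hw.2
      rw [mem_ball, dist_eq_norm, sub_neg_eq_add] at this
      simpa using this
    have h0 : (0 : ℂ) ∈ S := ⟨by simpa using hδ, by
      rw [mem_ball, dist_eq_norm, zero_sub, neg_neg, Complex.norm_real]; exact ht⟩
    refine h1.eqOn_of_preconnected_of_frequently_eq h2 hS h0 ?_ ⟨by simpa using hw, by
      rwa [mem_ball, dist_eq_norm, sub_neg_eq_add]⟩
    have hT : Tendsto (fun n : ℕ => (((1 / ((n : ℝ) + 1) : ℝ)) : ℂ)) atTop (𝓝[≠] 0) := by
      refine tendsto_nhdsWithin_iff.2 ⟨?_, Eventually.of_forall fun n => ?_⟩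
      · have := (Complex.continuous_ofReal.tendsto 0).comp
          (tendsto_one_div_add_atTop_nhds_zero_nat (𝕜 := ℝ))
        simpa [Function.comp_def] using this
      · simp only [mem_compl_iff, mem_singleton_iff, Complex.ofReal_eq_zero]
        positivity
    refine hT.frequently (Eventually.frequently ?_)
    have e1 : ∀ᶠ n : ℕ in atTop, |(1 / ((n : ℝ) + 1) : ℝ)| < δ :=
      (tendsto_one_div_add_atTop_nhds_zero_nat (𝕜 := ℝ)).abs.eventually_lt_const (by simpa using hδ)
    have e2 : ∀ᶠ n : ℕ in atTop, |(1 / ((n : ℝ) + 1) : ℝ) + (t - t₀)| < δ :=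
      ((tendsto_one_div_add_atTop_nhds_zero_nat (𝕜 := ℝ)).add_const (t - t₀)).abs.eventually_lt_const
        (by simpa using ht)
    filter_upwards [e1, e2] with n h1 h2
    rw [hre _ _ h1, ← Complex.ofReal_add, hre _ _ h2]
    congr 1; ring
  refine ⟨fun τ => G (γ τ.re) (I * τ.im), by simp [hγ0, hG0 z hz], ?_, fun t _ => ?_,
    fun L hL τ => ?_⟩
  · intro τ hτ
    set t₀ := τ.re
    have hloc : (fun τ : ℂ => G (γ τ.re) (I * τ.im)) =ᶠ[𝓝 τ] fun τ => G (γ t₀) (τ - t₀) := by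
      have hmem : τ ∈ ball (t₀ : ℂ) δ := by
        have : τ - t₀ = I * τ.im := by
          apply Complex.ext <;> simp [t₀]
        rw [mem_ball, dist_eq_norm, this]
        simpa using hτ
      filter_upwards [isOpen_ball.mem_nhds hmem] with σ hσ
      rw [mem_ball, dist_eq_norm] at hσ
      have e : I * σ.im + ((σ.re - t₀ : ℝ) : ℂ) = σ - t₀ := by
        apply Complex.ext <;> simp
      rw [← e] at hσ ⊢
      have h1 : |σ.re - t₀| < δ := by
        refine lt_of_le_of_lt ?_ hσ
        simpa using Complex.abs_re_le_norm (I * σ.im + ((σ.re - t₀ : ℝ) : ℂ))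
      have h2 : |σ.im| < δ := by
        refine lt_of_le_of_lt ?_ hσ
        simpa using Complex.abs_im_le_norm (I * σ.im + ((σ.re - t₀ : ℝ) : ℂ))
      exact key t₀ σ.re _ (by simpa using h2) hσ h1
    refine DifferentiableAt.differentiableWithinAt ?_
    refine (hloc.differentiableAt_iff).2 ?_
    have : DifferentiableAt ℂ (G (γ t₀)) (τ - t₀) := by
      refine (hGd _ (hb' t₀)).differentiableAt (isOpen_ball.mem_nhds ?_)
      have : τ - t₀ = I * τ.im := by
        apply Complex.ext <;> simp [t₀]
      rw [mem_ball, dist_zero_right, this]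
      simpa using hτ
    exact this.comp τ (by fun_prop)
  · have e : (fun t : ℝ => G (γ (t : ℂ).re) (I * (t : ℂ).im)) = γ := by
      funext t
      simpa using hG0 _ (hb' t)
    have e2 := hγ t (mem_univ t)
    rw [← e] at e2
    exact e2
  · have h := hL τ.re
    simp only [ofReal_re, ofReal_im, ofReal_zero, mul_zero, hG0 _ (hb' _)] at h
    simp [h]

theorem IsCurveIn.eq_of_univ {b : Set ℂ} {X : ℂ → ℂ} {K : NNReal} (hX : LipschitzOnWith K X b)
    {γ₁ γ₂ : ℝ → ℂ} {t₁ t₂ : ℝ} (h₁ : IsCurveIn b X γ₁ univ)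
    (h₂ : IsCurveIn b X γ₂ univ) (h : γ₁ t₁ = γ₂ t₂) (s : ℝ) : γ₁ (t₁ + s) = γ₂ (t₂ + s) := by
  have e : ∀ (γ : ℝ → ℂ) (c l : ℝ), IsCurveIn b X γ univ →
      IsCurveIn b X (fun t => γ (c + t)) (Ioo (-l) l) := fun γ c l h t _ =>
    ⟨(h _ (mem_univ _)).1, (h _ (mem_univ _)).2.comp_const_add c t⟩
  refine IsCurveIn.eqOn hX (t₀ := 0) (e γ₁ t₁ (|s| + 1) h₁) (e γ₂ t₂ (|s| + 1) h₂) ?_ (by simpa) ?_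
  · constructor <;> linarith [abs_nonneg s]
  · exact abs_lt.1 (by linarith)

theorem IsCurveIn.orbit_open {b : Set ℂ} {r : ℂ → ℝ} {K : NNReal}
    (hK : LipschitzOnWith K (tangentField r) b) (hr : IsRegularLevelSet r b) {γ : ℝ → ℂ}
    (hγ : IsCurveIn b (tangentField r) γ univ) (t : ℝ) :
    ∀ᶠ w in 𝓝 (γ t), w ∈ b → ∃ s : ℝ, |s| < 1 ∧ γ (t + s) = w := by
  have hb := (hγ t (mem_univ t)).1
  obtain ⟨Γ, hΓa, hΓ0, hΓt, hΓo⟩ :=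
    exists_holomorphic_flow_line (hr.2 _ hb) ((hr.4 _ hb).self_of_nhds.2 hb) (hr.3 _ hb)
  have hc : ContinuousAt (fun t : ℝ => Γ t) 0 :=
    ContinuousAt.comp (f := fun t : ℝ => (t : ℂ)) (by simpa using hΓa.continuousAt)
      Complex.continuous_ofReal.continuousAt
  have h1 : ∀ᶠ s : ℝ in 𝓝 0, (Γ s ∈ b ∧ HasDerivAt (fun t : ℝ => Γ t) (tangentField r (Γ s)) s) := by
    have h2 : ∀ᶠ s : ℝ in 𝓝 0, r (Γ s) = 0 ↔ Γ s ∈ b :=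
      hc.eventually (by simpa [hΓ0] using hr.4 _ hb)
    have h3 : ∀ᶠ s : ℝ in 𝓝 0, AnalyticAt ℂ Γ s := by
      have := hΓa.eventually_analyticAt
      have h4 : Tendsto (fun t : ℝ => (t : ℂ)) (𝓝 0) (𝓝 0) := by
        simpa using Complex.continuous_ofReal.tendsto 0
      exact h4.eventually this
    filter_upwards [hΓt, h2, h3] with s hs h2 h3
    refine ⟨h2.1 hs.1, ?_⟩
    rw [← hs.2]
    exact h3.differentiableAt.hasDerivAt.comp_ofReal
  obtain ⟨a, ha, ha1⟩ := Metric.eventually_nhds_iff_ball.1 h1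
  set a' := min a 1
  have ha' : 0 < a' := lt_min ha one_pos
  have e : EqOn (fun s => γ (t + s)) (fun s : ℝ => Γ s) (Ioo (-a') a') := by
    refine IsCurveIn.eqOn hK (t₀ := 0)
      (fun s _ => ⟨(hγ _ (mem_univ _)).1, (hγ _ (mem_univ _)).2.comp_const_add t s⟩)
      (fun s hs => ha1 s ?_) ⟨by linarith, ha'⟩ (by simp [hΓ0])
    rw [mem_ball_zero_iff, Real.norm_eq_abs]
    exact (abs_lt.2 hs).trans_le (min_le_left _ _)
  filter_upwards [hΓo _ (Ioo_mem_nhds (neg_lt_zero.2 ha') ha'), hr.4 _ hb] with w hw hw2 hwb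
  obtain ⟨s, hs, hsw⟩ := hw (hw2.2 hwb)
  exact ⟨s, (abs_lt.2 hs).trans_le (min_le_right _ _), (e hs).trans hsw⟩

theorem IsCurveIn.isCompact_range {b : Set ℂ} {r : ℂ → ℝ} (hr : IsRegularLevelSet r b) {γ : ℝ → ℂ}
    (hγ : IsCurveIn b (tangentField r) γ univ) : IsCompact (range γ) := by
  obtain ⟨K, hK⟩ := exists_lipschitzOnWith_tangentField hr
  obtain ⟨δ, hδ, hfl⟩ := exists_strip_flow hr
  have hsub : range γ ⊆ b := by rintro _ ⟨t, rfl⟩; exact (hγ t (mem_univ t)).1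
  refine hr.1.of_isClosed_subset ?_ hsub
  refine isClosed_of_closure_subset fun w hw => ?_
  have hwb : w ∈ b := hr.1.isClosed.closure_subset_iff.2 hsub hw
  obtain ⟨Γ, hΓ0, -, hΓ, -⟩ := hfl w hwb
  have := IsCurveIn.orbit_open hK hr hΓ 0
  simp only [ofReal_zero, hΓ0] at this
  obtain ⟨_, hw', t, rfl⟩ := mem_closure_iff_nhds.1 hw _ this
  obtain ⟨s, -, hs⟩ := hw' (hsub ⟨t, rfl⟩)
  have := IsCurveIn.eq_of_univ hK hΓ hγ hs (-s)
  simp only [zero_add, add_neg_cancel, ofReal_zero, hΓ0] at this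
  exact ⟨_, this.symm⟩

theorem IsCurveIn.exists_period {b : Set ℂ} {r : ℂ → ℝ} (hr : IsRegularLevelSet r b) {γ : ℝ → ℂ}
    (hγ : IsCurveIn b (tangentField r) γ univ) :
    ∃ L : ℝ, 0 < L ∧ (∀ t, γ (t + L) = γ t) ∧ ∀ s t, γ s = γ t → ∃ k : ℤ, s - t = k * L := by
  obtain ⟨K, hK⟩ := exists_lipschitzOnWith_tangentField hr
  have hcomp := IsCurveIn.isCompact_range hr hγ
  have hN : ∃ N : ℝ, ∀ w ∈ range γ, ∃ t, |t| < N ∧ γ t = w := by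
    suffices H : ∃ N : ℝ, ∀ w ∈ range γ, w ∈ range γ → ∃ t, |t| < N ∧ γ t = w by
      obtain ⟨N, h⟩ := H
      exact ⟨N, fun w hw => h w hw hw⟩
    refine hcomp.induction_on
      (p := fun S => ∃ N : ℝ, ∀ w ∈ S, w ∈ range γ → ∃ t, |t| < N ∧ γ t = w) ⟨0, by simp⟩ ?_ ?_ ?_
    · rintro s t hst ⟨N, h⟩
      exact ⟨N, fun w hw => h w (hst hw)⟩
    · rintro s t ⟨N, h⟩ ⟨N', h'⟩
      refine ⟨max N N', fun w hw hwr => ?_⟩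
      rcases hw with hw | hw
      · obtain ⟨t, ht, e⟩ := h w hw hwr
        exact ⟨t, ht.trans_le (le_max_left _ _), e⟩
      · obtain ⟨t, ht, e⟩ := h' w hw hwr
        exact ⟨t, ht.trans_le (le_max_right _ _), e⟩
    · rintro _ ⟨t, rfl⟩
      refine ⟨_, mem_nhdsWithin_of_mem_nhds (IsCurveIn.orbit_open hK hr hγ t),
        |t| + 1, fun w hw hwr => ?_⟩
      have hwb : w ∈ b := by
        obtain ⟨u, rfl⟩ := hwr
        exact (hγ u (mem_univ u)).1
      obtain ⟨s, hs, e⟩ := hw hwb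
      exact ⟨t + s, (abs_add_le _ _).trans_lt (by linarith), e⟩
  obtain ⟨N, hN⟩ := hN
  obtain ⟨t₁, ht₁, e₁⟩ := hN (γ (N)) ⟨_, rfl⟩
  let H : AddSubgroup ℝ :=
    { carrier := {P | ∀ t, γ (t + P) = γ t}
      add_mem' := fun {a b} ha hb t => by rw [← add_assoc, hb, ha]
      zero_mem' := fun t => by rw [add_zero]
      neg_mem' := fun {a} ha t => by
        have := ha (t + -a)
        rwa [neg_add_cancel_right, eq_comm] at this }
  have hH : ∀ s t, γ s = γ t → s - t ∈ H := by
    intro s t h u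
    have := IsCurveIn.eq_of_univ hK hγ hγ h (u - t)
    rw [add_sub_cancel] at this
    rw [← this]
    congr 1; ring
  have hd : tangentField r (γ 0) ≠ 0 := tangentField_ne_zero (hr.3 _ (hγ 0 (mem_univ 0)).1)
  have hne := (hγ 0 (mem_univ 0)).2.eventually_ne hd (c := γ 0)
  obtain ⟨a, ha, hane⟩ := Metric.eventually_nhds_iff_ball.1 (eventually_nhdsWithin_iff.1 hne)
  have hdis : Disjoint (H : Set ℝ) (Ioo 0 a) := by
    rw [Set.disjoint_left]
    intro P hP hPa
    refine hane P ?_ hPa.1.ne' ?_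
    · rw [mem_ball_zero_iff, Real.norm_eq_abs, abs_of_pos hPa.1]
      exact hPa.2
    · simpa using hP 0
  obtain ⟨L, hL⟩ := AddSubgroup.cyclic_of_isolated_zero ha hdis
  have hPpos : N - t₁ ∈ H := hH _ _ e₁.symm
  have hPne : N - t₁ ≠ 0 := by
    have := le_abs_self t₁
    linarith
  have hL0 : L ≠ 0 := by
    rintro rfl
    rw [hL, AddSubgroup.mem_closure_singleton] at hPpos
    obtain ⟨k, hk⟩ := hPpos
    exact hPne (by rw [← hk]; simp)
  have hLH : |L| ∈ H := by
    have : L ∈ H := by rw [hL]; exact AddSubgroup.mem_closure_singleton_self L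
    rcases abs_choice L with h | h <;> rw [h]
    · exact this
    · exact H.neg_mem this
  refine ⟨|L|, abs_pos.2 hL0, hLH, fun s t hst => ?_⟩
  have := hH s t hst
  rw [hL, AddSubgroup.mem_closure_singleton] at this
  obtain ⟨k, hk⟩ := this
  rcases abs_choice L with h | h
  · exact ⟨k, by rw [← hk, h]; simp⟩
  · exact ⟨-k, by rw [← hk, h]; simp⟩

/-- The open annulus `R < ‖w‖ < R⁻¹`. -/
def annulus (R : ℝ) : Set ℂ := {w | R < ‖w‖ ∧ ‖w‖ < R⁻¹}

theorem isOpen_annulus (R : ℝ) : IsOpen (annulus R) :=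
  (isOpen_lt continuous_const continuous_norm).inter (isOpen_lt continuous_norm continuous_const)

theorem annulus_anti {R R' : ℝ} (hR : 0 < R) (h : R ≤ R') : annulus R' ⊆ annulus R := fun _ hw =>
  ⟨h.trans_lt hw.1, hw.2.trans_le (inv_anti₀ hR h)⟩

theorem sphere_subset_annulus {R : ℝ} (hR : 0 < R) (h : R < 1) : sphere 0 1 ⊆ annulus R :=
  fun w hw => by
    rw [mem_sphere_zero_iff_norm] at hw
    exact ⟨by rw [hw]; exact h, by rw [hw]; exact (one_lt_inv₀ hR).2 h⟩

theorem exists_circle_orbit {b : Set ℂ} {r : ℂ → ℝ} (hr : IsRegularLevelSet r b) (z : ℂ) (hz : z ∈ b) :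
    ∃ (ψ : ℂ → ℂ) (γ : ℝ → ℂ), γ 0 = z ∧ IsCurveIn b (tangentField r) γ univ ∧
      ψ '' sphere 0 1 = range γ ∧ InjOn ψ (sphere 0 1) ∧
      (∃ R, 0 < R ∧ R < 1 ∧ DifferentiableOn ℂ ψ (annulus R)) ∧
      ∃ c : ℝ, 0 < c ∧ ∀ w ∈ sphere (0 : ℂ) 1, deriv ψ w * (I * w) = c * tangentField r (ψ w) := by
  obtain ⟨δ, hδ, H⟩ := exists_strip_flow hr
  obtain ⟨Γ, hΓ0, hΓd, hΓ, hΓp⟩ := H z hz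
  obtain ⟨L, hL, hper, hinj⟩ := IsCurveIn.exists_period hr hΓ
  have hP : Function.Periodic Γ (L : ℂ) := hΓp L hper
  set ψ := Function.Periodic.cuspFunction L Γ
  have hψ : ∀ τ, ψ (Function.Periodic.qParam L τ) = Γ τ :=
    Function.Periodic.eq_cuspFunction hL.ne' hP
  have hpi := Real.pi_pos
  have hsph : ∀ w ∈ sphere (0 : ℂ) 1, ∃ t : ℝ, Function.Periodic.qParam L t = w := by
    intro w hw
    rw [mem_sphere_zero_iff_norm] at hw
    have hw0 : w ≠ 0 := by rw [← norm_ne_zero_iff, hw]; exact one_ne_zero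
    have him := Function.Periodic.im_invQParam L w
    rw [hw, Real.log_one, mul_zero] at him
    refine ⟨(Function.Periodic.invQParam L w).re, ?_⟩
    rw [show (((Function.Periodic.invQParam L w).re : ℝ) : ℂ) = Function.Periodic.invQParam L w from
      Complex.ext (by simp) (by simp [him])]
    exact Function.Periodic.qParam_right_inv hL.ne' hw0
  have hsph' : ∀ t : ℝ, Function.Periodic.qParam L t ∈ sphere (0 : ℂ) 1 := by
    intro t
    rw [mem_sphere_zero_iff_norm, Function.Periodic.norm_qParam]
    simp
  refine ⟨ψ, fun t => Γ t, by simpa using hΓ0, hΓ, ?_, ?_, ?_, ?_⟩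
  · ext v
    constructor
    · rintro ⟨w, hw, rfl⟩
      obtain ⟨t, rfl⟩ := hsph w hw
      exact ⟨t, (hψ t).symm⟩
    · rintro ⟨t, rfl⟩
      exact ⟨_, hsph' t, hψ t⟩
  · intro w hw w' hw' h
    obtain ⟨t, rfl⟩ := hsph w hw
    obtain ⟨t', rfl⟩ := hsph w' hw'
    rw [hψ, hψ] at h
    obtain ⟨k, hk⟩ := hinj t t' h
    have : t = t' + k * L := by linarith
    subst this
    rw [Function.Periodic.qParam, Function.Periodic.qParam, Complex.exp_eq_exp_iff_exists_int]
    refine ⟨k, ?_⟩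
    have : (L : ℂ) ≠ 0 := by exact_mod_cast hL.ne'
    push_cast
    field_simp
  · refine ⟨Real.exp (-(2 * Real.pi * δ / L)), Real.exp_pos _, ?_, ?_⟩
    · rw [Real.exp_lt_one_iff]
      have : 0 < 2 * Real.pi * δ / L := by positivity
      linarith
    · rintro w ⟨hw1, hw2⟩
      have hw0 : 0 < ‖w‖ := (Real.exp_pos _).trans hw1
      rw [← Real.exp_neg, neg_neg] at hw2
      have h1 := (Real.lt_log_iff_exp_lt hw0).2 hw1
      have h2 := (Real.log_lt_iff_lt_exp hw0).2 hw2
      have hw : Function.Periodic.qParam L (Function.Periodic.invQParam L w) = w :=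
        Function.Periodic.qParam_right_inv hL.ne' (norm_pos_iff.1 hw0)
      rw [← hw]
      refine (Function.Periodic.differentiableAt_cuspFunction hL.ne' hP ?_).differentiableWithinAt
      refine hΓd.differentiableAt (IsOpen.mem_nhds ?_ ?_)
      · exact isOpen_lt (by fun_prop) continuous_const
      · rw [mem_ofPred_eq, Function.Periodic.im_invQParam, abs_mul, abs_div, abs_neg, abs_of_pos hL,
          abs_of_pos (by positivity : 0 < 2 * Real.pi)]
        rw [← lt_div_iff₀' (by positivity)]
        refine (abs_lt.2 ⟨h1, h2⟩).trans_eq ?_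
        field_simp
  · refine ⟨L / (2 * Real.pi), by positivity, fun w hw => ?_⟩
    obtain ⟨t, rfl⟩ := hsph w hw
    have hΓt : DifferentiableAt ℂ Γ t := hΓd.differentiableAt
      (IsOpen.mem_nhds (isOpen_lt (by fun_prop) continuous_const) (by simpa using hδ))
    have h1 : HasDerivAt (fun t : ℝ => Γ t) (tangentField r (Γ t)) t := (hΓ t (mem_univ t)).2
    have h2 : HasDerivAt (fun t : ℝ => Γ t) (deriv Γ t) t := hΓt.hasDerivAt.comp_ofReal
    have h3 := (Function.Periodic.differentiableAt_cuspFunction hL.ne' hP hΓt).hasDerivAt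
    have hq : HasDerivAt (Function.Periodic.qParam L)
        (Function.Periodic.qParam L t * (2 * Real.pi * I / L)) t := by
      simpa only [id_eq, mul_one] using!
        (((hasDerivAt_id (t : ℂ)).const_mul (2 * Real.pi * I)).div_const (L : ℂ)).cexp
    have h4 := h3.comp _ hq
    have h5 : Function.Periodic.cuspFunction L Γ ∘ Function.Periodic.qParam L = Γ := funext hψ
    rw [h5] at h4
    have h6 := h4.unique hΓt.hasDerivAt
    have h7 := h1.unique h2
    rw [hψ, h7, ← h6]
    have : (L : ℂ) ≠ 0 := by exact_mod_cast hL.ne'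
    have hpi' : (Real.pi : ℂ) ≠ 0 := by exact_mod_cast hpi.ne'
    push_cast
    field_simp
    exact mul_comm _ _

theorem exists_circle_orbits {b : Set ℂ} {r : ℂ → ℝ} (hr : IsRegularLevelSet r b) :
    ∃ (m : ℕ) (ψ : Fin m → ℂ → ℂ) (R : ℝ), 0 < R ∧ R < 1 ∧
      (∀ j, DifferentiableOn ℂ (ψ j) (annulus R)) ∧
      (∀ j, ∀ w ∈ sphere (0 : ℂ) 1, ψ j w ∈ b) ∧
      (∀ z ∈ b, ∃ j, ∃ w ∈ sphere (0 : ℂ) 1, ψ j w = z) ∧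
      (∀ j k, ∀ w ∈ sphere (0 : ℂ) 1, ∀ v ∈ sphere (0 : ℂ) 1, ψ j w = ψ k v → j = k ∧ w = v) ∧
      ∀ j, ∃ c : ℝ, 0 < c ∧
        ∀ w ∈ sphere (0 : ℂ) 1, deriv (ψ j) w * (I * w) = c * tangentField r (ψ j w) := by
  obtain ⟨K, hK⟩ := exists_lipschitzOnWith_tangentField hr
  choose! ψ γ hγ0 hγ himg hinj hR hc using exists_circle_orbit hr
  have hmem : ∀ z ∈ b, z ∈ range (γ z) := fun z hz => ⟨0, hγ0 z hz⟩
  have hsub : ∀ z ∈ b, range (γ z) ⊆ b := by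
    rintro z hz _ ⟨t, rfl⟩; exact (hγ z hz t (mem_univ t)).1
  have hdisj : ∀ z ∈ b, ∀ w ∈ b, ∀ v, v ∈ range (γ z) → v ∈ range (γ w) →
      range (γ z) = range (γ w) := by
    rintro z hz w hw _ ⟨s, rfl⟩ ⟨t, e⟩
    have key := IsCurveIn.eq_of_univ hK (hγ w hw) (hγ z hz) e
    ext u
    constructor
    · rintro ⟨x, rfl⟩
      exact ⟨t + (x - s), by rw [key]; congr 1; ring⟩
    · rintro ⟨x, rfl⟩
      exact ⟨s + (x - t), by rw [← key]; congr 1; ring⟩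
  have hnh : ∀ z ∈ b, {w | w ∈ b → w ∈ range (γ z)} ∈ 𝓝 z := by
    intro z hz
    have := IsCurveIn.orbit_open hK hr (hγ z hz) 0
    rw [hγ0 z hz] at this
    filter_upwards [this] with w hw hwb
    obtain ⟨s, -, h⟩ := hw hwb
    exact ⟨_, h⟩
  obtain ⟨T, hTb, hT⟩ := hr.1.elim_nhds_subcover _ hnh
  set S : Set (Set ℂ) := (fun z => range (γ z)) '' (T : Set ℂ)
  have hS : S.Finite := T.finite_toSet.image _
  have hrep : ∀ s : S, ∃ z ∈ b, range (γ z) = s := by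
    rintro ⟨_, z, hz, rfl⟩
    exact ⟨z, hTb z hz, rfl⟩
  choose rep hrepb hrep using hrep
  haveI : Finite S := hS
  obtain ⟨m, ⟨e⟩⟩ := Finite.exists_equiv_fin S
  choose! Rf hRf0 hRf1 hRfd using hR
  have hRex : ∃ R : ℝ, 0 < R ∧ R < 1 ∧ ∀ j : Fin m, Rf (rep (e.symm j)) ≤ R := by
    rcases isEmpty_or_nonempty (Fin m) with hm | hm
    · exact ⟨1 / 2, by norm_num, by norm_num, fun j => hm.elim j⟩
    · obtain ⟨j, hj⟩ := Finite.exists_max fun j : Fin m => Rf (rep (e.symm j))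
      exact ⟨_, hRf0 _ (hrepb _), hRf1 _ (hrepb _), hj⟩
  obtain ⟨R, hR0, hR1, hR⟩ := hRex
  have hin : ∀ j : Fin m, ∀ w ∈ sphere (0 : ℂ) 1, ψ (rep (e.symm j)) w ∈ ((e.symm j : S) : Set ℂ) := by
    intro j w hw
    rw [← hrep, ← himg _ (hrepb _)]
    exact ⟨w, hw, rfl⟩
  refine ⟨m, fun j => ψ (rep (e.symm j)), R, hR0, hR1, fun j => ?_, fun j w hw => ?_, fun z hz => ?_,
    fun j k w hw v hv h => ?_, fun j => hc _ (hrepb _)⟩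
  · exact (hRfd _ (hrepb _)).mono (annulus_anti (hRf0 _ (hrepb _)) (hR j))
  · refine hsub _ (hrepb (e.symm j)) ?_
    rw [hrep]
    exact hin j w hw
  · obtain ⟨y, hyT, hy⟩ := mem_iUnion₂.1 (hT hz)
    have hz' := hy hz
    refine ⟨e ⟨range (γ y), y, hyT, rfl⟩, ?_⟩
    have : z ∈ ψ (rep ⟨range (γ y), y, hyT, rfl⟩) '' sphere 0 1 := by
      rw [himg _ (hrepb _), hrep]
      exact hz'
    simpa using this
  · have h1 := hin j w hw
    have h2 := hin k v hv
    simp only at h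
    rw [h] at h1
    rw [← hrep] at h1 h2
    have := hdisj _ (hrepb _) _ (hrepb _) _ h1 h2
    rw [hrep, hrep] at this
    have hjk : j = k := e.symm.injective (Subtype.ext this)
    subst hjk
    exact ⟨rfl, hinj _ (hrepb _) hw hv h⟩

/-- Annular coordinates on both sides of the boundary of a planar domain. -/
structure Collar (M : Set ℂ) where
  m : ℕ
  R : ℝ
  ψ : Fin m → ℂ → ℂ
  R_pos : 0 < R
  R_lt : R < 1
  diff : ∀ j, DifferentiableOn ℂ (ψ j) (annulus R)
  inj : ∀ j k, ∀ w ∈ annulus R, ∀ v ∈ annulus R, ψ j w = ψ k v → j = k ∧ w = v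
  deriv_ne : ∀ j, ∀ w ∈ annulus R, deriv (ψ j) w ≠ 0
  inside : ∀ j, ∀ w ∈ annulus R, ‖w‖ < 1 → ψ j w ∈ M
  bdry : ∀ j, ∀ w ∈ sphere (0 : ℂ) 1, ψ j w ∈ frontier M
  outside : ∀ j, ∀ w ∈ annulus R, 1 < ‖w‖ → ψ j w ∉ closure M
  surj : ∀ z ∈ frontier M, ∃ j, ∃ w ∈ sphere (0 : ℂ) 1, ψ j w = z

theorem exists_annulus_subset {s : Set ℂ} (hs : s ∈ 𝓝ˢ (sphere (0 : ℂ) 1)) :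
    ∃ R, 0 < R ∧ R < 1 ∧ annulus R ⊆ s := by
  obtain ⟨o, ho, hso, hos⟩ := mem_nhdsSet_iff_exists.1 hs
  obtain ⟨δ, hδ, h⟩ := (isCompact_sphere (0 : ℂ) 1).exists_thickening_subset_open ho hso
  refine ⟨1 / (1 + δ), by positivity, ?_, fun w hw => hos (h ?_)⟩
  · rw [div_lt_one (by positivity)]; linarith
  · have h0 : 0 < ‖w‖ := lt_trans (by positivity) hw.1
    refine mem_thickening_iff.2 ⟨w / ‖w‖, ?_, ?_⟩
    · rw [mem_sphere_zero_iff_norm, norm_div, Complex.norm_real, norm_norm, div_self h0.ne']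
    · have h1 := hw.1
      have h2 := hw.2
      rw [one_div, inv_inv] at h2
      rw [div_lt_iff₀ (by positivity)] at h1
      have hw0 : (‖w‖ : ℂ) ≠ 0 := by exact_mod_cast h0.ne'
      have e : w - w / ‖w‖ = w / ‖w‖ * ((‖w‖ - 1 : ℝ) : ℂ) := by
        push_cast; field_simp
      rw [dist_eq_norm, e, norm_mul, norm_div, Complex.norm_real, norm_norm, div_self h0.ne',
        one_mul, Complex.norm_real, Real.norm_eq_abs, abs_lt]
      constructor <;> nlinarith

theorem eventually_eq_zero_iff_mem_frontier {M W : Set ℂ} {r : ℂ → ℝ} (hM : IsOpen M)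
    (hW : IsOpen W) (hr : AnalyticOnNhd ℝ r W) (hrdef : M ∩ W = {z ∈ W | r z < 0})
    {z : ℂ} (hzW : z ∈ W) (hD : fderiv ℝ r z ≠ 0) :
    ∀ᶠ w in 𝓝 z, r w = 0 ↔ w ∈ frontier M := by
  have hmem : ∀ w ∈ W, w ∈ M ↔ r w < 0 := by
    intro w hw
    constructor
    · intro h
      exact (hrdef.subset ⟨h, hw⟩).2
    · intro h
      exact (hrdef.superset ⟨hw, h⟩).1
  have hDc : ContinuousAt (fderiv ℝ r) z := (hr z hzW).fderiv.continuousAt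
  filter_upwards [hW.mem_nhds hzW, hDc.eventually_ne hD] with w hwW hwD
  rw [hM.frontier_eq]
  constructor
  · intro h0
    refine ⟨?_, fun hw => by have := (hmem w hwW).1 hw; linarith⟩
    by_contra hcl
    refine hwD (IsLocalMin.fderiv_eq_zero ?_)
    filter_upwards [hW.mem_nhds hwW, isClosed_closure.isOpen_compl.mem_nhds hcl] with v hvW hv
    rw [h0]
    by_contra hlt
    exact hv (subset_closure ((hmem v hvW).2 (not_le.1 hlt)))
  · rintro ⟨hcl, hnM⟩
    refine le_antisymm ?_ (not_lt.1 fun h => hnM ((hmem w hwW).2 h))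
    have hcont : ContinuousAt r w := (hr w hwW).continuousAt
    by_contra hpos
    have := (hcont.eventually (lt_mem_nhds (not_le.1 hpos))).and (hW.mem_nhds hwW)
    obtain ⟨v, ⟨hv, hvW⟩, hvM⟩ := mem_closure_iff_nhds.1 hcl _ this
    have := (hmem v hvW).1 hvM
    linarith

theorem isPreconnected_ring {a b : ℝ} (ha : 0 < a) : IsPreconnected {w : ℂ | a < ‖w‖ ∧ ‖w‖ < b} := by
  have : {w : ℂ | a < ‖w‖ ∧ ‖w‖ < b} = Complex.exp '' {τ | Real.log a < τ.re ∧ Real.exp τ.re < b} := by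
    ext w
    constructor
    · rintro ⟨h1, h2⟩
      have h0 := ha.trans h1
      refine ⟨Complex.log w, ⟨?_, ?_⟩, Complex.exp_log (norm_pos_iff.1 h0)⟩
      · rw [Complex.log_re]; exact Real.log_lt_log ha h1
      · rw [Complex.log_re, Real.exp_log h0]; exact h2
    · rintro ⟨τ, ⟨h1, h2⟩, rfl⟩
      refine ⟨?_, by rwa [Complex.norm_exp]⟩
      rw [Complex.norm_exp]
      exact (Real.log_lt_iff_lt_exp ha).1 h1
  rw [this]
  refine IsPreconnected.image ?_ _ Complex.continuous_exp.continuousOn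
  have hc : OrdConnected {x : ℝ | Real.log a < x ∧ Real.exp x < b} := by
    refine ⟨fun x hx y hy t ht => ⟨hx.1.trans_le ht.1, ?_⟩⟩
    exact (Real.exp_le_exp.2 ht.2).trans_lt hy.2
  have h3 : Convex ℝ {x : ℝ | Real.log a < x ∧ Real.exp x < b} := hc.convex
  exact (h3.linear_preimage Complex.reLm).isPreconnected

theorem exists_collar {M W : Set ℂ} {r : ℂ → ℝ} (hM : IsOpen M) (hMb : IsBounded M)
    (hW : IsOpen W) (hMW : frontier M ⊆ W) (hr : AnalyticOnNhd ℝ r W)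
    (hrdef : M ∩ W = {z ∈ W | r z < 0}) (hD : ∀ z ∈ frontier M, fderiv ℝ r z ≠ 0) :
    Nonempty (Collar M) := by
  have hlev : IsRegularLevelSet r (frontier M) := ⟨hMb.isCompact_closure.of_isClosed_subset
    isClosed_frontier frontier_subset_closure, fun z hz => hr z (hMW hz), hD, fun z hz =>
    eventually_eq_zero_iff_mem_frontier hM hW hr hrdef (hMW hz) (hD z hz)⟩
  obtain ⟨m, ψ, R, hR0, hR1, hd, hb, hsurj, hinj, hc⟩ :=
    exists_circle_orbits hlev
  have hS : sphere (0 : ℂ) 1 ⊆ annulus R := sphere_subset_annulus hR0 hR1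
  have hdA : ∀ j, ∀ w ∈ annulus R, AnalyticAt ℂ (ψ j) w := fun j w hw =>
    (hd j).analyticAt ((isOpen_annulus R).mem_nhds hw)
  have hd0 : ∀ j, ∀ w ∈ sphere (0 : ℂ) 1, deriv (ψ j) w ≠ 0 := by
    intro j w hw h
    obtain ⟨c, hc0, hc⟩ := hc j
    have := hc w hw
    rw [h, zero_mul, eq_comm, mul_eq_zero] at this
    rcases this with h | h
    · exact hc0.ne' (by exact_mod_cast h)
    · exact tangentField_ne_zero (hD _ (hb j w hw)) h
  -- joint injectivity near the circles
  have hinj' : ∃ R', 0 < R' ∧ R' < 1 ∧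
      ∀ j k, ∀ w ∈ annulus R', ∀ v ∈ annulus R', ψ j w = ψ k v → j = k ∧ w = v := by
    have h1 : ∃ t ∈ 𝓝ˢ ((univ : Set (Fin m)) ×ˢ sphere (0 : ℂ) 1),
        InjOn (fun p : Fin m × ℂ => ψ p.1 p.2) t := by
      refine Set.InjOn.exists_mem_nhdsSet ?_ (isCompact_univ.prod (isCompact_sphere _ _)) ?_ ?_
      · rintro ⟨j, w⟩ ⟨-, hw⟩ ⟨k, v⟩ ⟨-, hv⟩ h
        obtain ⟨rfl, rfl⟩ := hinj j k w hw v hv h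
        rfl
      · rintro ⟨j, w⟩ ⟨-, hw⟩
        have := (hdA j w (hS hw)).continuousAt
        rw [ContinuousAt, nhds_prod_eq, nhds_discrete, pure_prod, tendsto_map'_iff]
        exact this
      · rintro ⟨j, w⟩ ⟨-, hw⟩
        have hs := (hdA j w (hS hw)).hasStrictDerivAt
        have he := (hs.hasStrictFDerivAt_equiv (hd0 j w hw)).eventually_left_inverse
        refine ⟨{j} ×ˢ {x | _}, prod_mem_nhds (mem_nhds_discrete.2 rfl) he, ?_⟩
        rintro ⟨j', x⟩ ⟨hj, hx⟩ ⟨k', y⟩ ⟨hk, hy⟩ h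
        obtain rfl : j' = j := hj
        obtain rfl : k' = j' := hk
        simp only [mem_ofPred_eq] at hx hy h
        rw [h, hy] at hx
        rw [hx]
    obtain ⟨t, ht, hti⟩ := h1
    have h2 : (⋂ j : Fin m, {w | (j, w) ∈ t}) ∈ 𝓝ˢ (sphere (0 : ℂ) 1) := by
      rw [mem_nhdsSet_iff_forall] at ht ⊢
      intro w hw
      refine iInter_mem.2 fun j => ?_
      have := ht (j, w) ⟨mem_univ _, hw⟩
      exact (Continuous.prodMk_right j).continuousAt this
    obtain ⟨R', h0, h1, h⟩ := exists_annulus_subset h2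
    refine ⟨R', h0, h1, fun j k w hw v hv e => ?_⟩
    have := hti (mem_iInter.1 (h hw) j) (mem_iInter.1 (h hv) k) e
    exact ⟨congrArg Prod.fst this, congrArg Prod.snd this⟩
  obtain ⟨R₁, hR₁0, hR₁1, hinj₁⟩ := hinj'
  have hdn : ∃ R', 0 < R' ∧ R' < 1 ∧ ∀ j, ∀ w ∈ annulus R', deriv (ψ j) w ≠ 0 := by
    have h2 : (⋂ j : Fin m, {w | deriv (ψ j) w ≠ 0}) ∈ 𝓝ˢ (sphere (0 : ℂ) 1) := by
      rw [mem_nhdsSet_iff_forall]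
      intro w hw
      exact iInter_mem.2 fun j => (hdA j w (hS hw)).deriv.continuousAt.eventually_ne (hd0 j w hw)
    obtain ⟨R', h0, h1, h⟩ := exists_annulus_subset h2
    exact ⟨R', h0, h1, fun j w hw => mem_iInter.1 (h hw) j⟩
  obtain ⟨R₂, hR₂0, hR₂1, hdn₂⟩ := hdn
  set R₀ := max R (max R₁ R₂)
  have hR₀ : R₀ < 1 := max_lt hR1 (max_lt hR₁1 hR₂1)
  have hR₀0 : 0 < R₀ := hR0.trans_le (le_max_left _ _)
  have hA : annulus R₀ ⊆ annulus R := annulus_anti hR0 (le_max_left _ _)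
  have hA₁ : annulus R₀ ⊆ annulus R₁ :=
    annulus_anti hR₁0 ((le_max_left _ _).trans (le_max_right _ _))
  have hA₂ : annulus R₀ ⊆ annulus R₂ :=
    annulus_anti hR₂0 ((le_max_right _ _).trans (le_max_right _ _))
  have hS₀ : sphere (0 : ℂ) 1 ⊆ annulus R₀ := sphere_subset_annulus hR₀0 hR₀
  have hnb : ∀ j, ∀ w ∈ annulus R₀, ‖w‖ ≠ 1 → ψ j w ∉ frontier M := by
    intro j w hw hw1 h
    obtain ⟨k, v, hv, e⟩ := hsurj _ h
    obtain ⟨-, rfl⟩ := hinj₁ k j v (hA₁ (hS₀ hv)) w (hA₁ hw) e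
    exact hw1 (by simpa using hv)
  have hmem : ∀ w ∈ W, w ∈ M ↔ r w < 0 := by
    intro w hw
    constructor
    · intro h
      exact (hrdef.subset ⟨h, hw⟩).2
    · intro h
      exact (hrdef.superset ⟨hw, h⟩).1
  -- radial derivative of `r ∘ ψ j` at `1`
  have h1S : (1 : ℂ) ∈ sphere (0 : ℂ) 1 := by simp
  have hside : ∀ j, ∃ c : ℝ, 0 < c ∧ HasDerivAt (fun s : ℝ => r (ψ j s)) c 1 := by
    intro j
    obtain ⟨c, hc0, hc⟩ := hc j
    have h := hc 1 h1S
    set X := tangentField r (ψ j 1)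
    have hX : X ≠ 0 := tangentField_ne_zero (hD _ (hb j 1 h1S))
    have hψ : HasDerivAt (fun s : ℝ => ψ j s) (deriv (ψ j) 1) 1 := by
      have := (hdA j 1 (hS h1S)).differentiableAt.hasDerivAt
      have h2 : HasDerivAt (ψ j) (deriv (ψ j) 1) ((1 : ℝ) : ℂ) := by simpa using this
      exact h2.comp_ofReal
    have hrd : HasFDerivAt r (fderiv ℝ r (ψ j 1)) (ψ j (1 : ℝ)) := by
      have := (hr _ (hMW (hb j 1 h1S))).differentiableAt.hasFDerivAt
      simpa using this
    have := hrd.comp_hasDerivAt (1 : ℝ) hψ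
    refine ⟨_, ?_, this⟩
    rw [fderiv_eq_im_tangentField]
    have e : deriv (ψ j) 1 = -I * (c * X) := by
      rw [← h]; ring_nf; simp
    have e2 : deriv (ψ j) 1 * (starRingEnd ℂ) X = -I * (c * (X * (starRingEnd ℂ) X)) := by
      rw [e]; ring
    rw [show tangentField r (ψ j 1) = X from rfl, e2, Complex.mul_conj]
    have : 0 < Complex.normSq X := Complex.normSq_pos.2 hX
    simp
    positivity
  have hψc : ∀ j, Tendsto (fun s : ℝ => ψ j s) (𝓝 1) (𝓝 (ψ j 1)) := by
    intro j
    have h1 : Tendsto (fun s : ℝ => (s : ℂ)) (𝓝 1) (𝓝 1) := by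
      simpa using Complex.continuous_ofReal.tendsto 1
    exact (hdA j 1 (hS h1S)).continuousAt.tendsto.comp h1
  have hsign : ∀ j, (∀ᶠ s : ℝ in 𝓝[<] 1, r (ψ j s) < 0) ∧ (∀ᶠ s : ℝ in 𝓝[>] 1, 0 < r (ψ j s)) := by
    intro j
    obtain ⟨c, hc0, hc⟩ := hside j
    have h0 : r (ψ j (1 : ℝ)) = 0 := by
      simpa using (hlev.4 _ (hb j 1 h1S)).self_of_nhds.2 (hb j 1 h1S)
    have hs := hasDerivAt_iff_tendsto_slope.1 hc
    have hpos := hs.eventually (lt_mem_nhds hc0)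
    constructor
    · filter_upwards [nhdsWithin_mono _ (fun x hx => ne_of_lt hx) hpos, self_mem_nhdsWithin] with s h hs
      rw [slope_def_field, h0, sub_zero] at h
      have hs : s - 1 < 0 := by have : s < 1 := hs; linarith
      by_contra hcon
      exact absurd h (not_lt.2 (div_nonpos_of_nonneg_of_nonpos (not_lt.1 hcon) hs.le))
    · filter_upwards [nhdsWithin_mono _ (fun x hx => ne_of_gt hx) hpos, self_mem_nhdsWithin] with s h hs
      rw [slope_def_field, h0, sub_zero] at h
      have hs : 0 < s - 1 := by have : 1 < s := hs; linarith
      by_contra hcon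
      exact absurd h (not_lt.2 (div_nonpos_of_nonpos_of_nonneg (not_lt.1 hcon) hs.le))
  have hunion : ∀ j (S : Set ℂ), S ⊆ annulus R₀ → (∀ w ∈ S, ‖w‖ ≠ 1) →
      ψ j '' S ⊆ M ∪ (closure M)ᶜ := by
    rintro j S hSA hS1 _ ⟨w, hw, rfl⟩
    by_contra hcon
    rw [mem_union, not_or, mem_compl_iff, not_not] at hcon
    refine hnb j w (hSA hw) (hS1 w hw) ?_
    rw [hM.frontier_eq]
    exact ⟨hcon.2, hcon.1⟩
  have hopen2 : IsOpen (closure M)ᶜ := isClosed_closure.isOpen_compl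
  have hdisj : Disjoint M (closure M)ᶜ := disjoint_compl_right.mono_left subset_closure
  have hcontA : ∀ j (S : Set ℂ), S ⊆ annulus R₀ → ContinuousOn (ψ j) S := fun j S h =>
    (hd j).continuousOn.mono (h.trans hA)
  refine ⟨⟨m, R₀, ψ, hR₀0, hR₀, fun j => (hd j).mono hA,
    fun j k w hw v hv e => hinj₁ j k w (hA₁ hw) v (hA₁ hv) e, fun j w hw => hdn₂ j w (hA₂ hw),
    fun j w hw hw1 => ?_, hb, fun j w hw hw1 => ?_, hsurj⟩⟩
  · set S := {w : ℂ | R₀ < ‖w‖ ∧ ‖w‖ < 1}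
    have hSA : S ⊆ annulus R₀ := fun w hw => ⟨hw.1, hw.2.trans ((one_lt_inv₀ hR₀0).2 hR₀)⟩
    have hSp : IsPreconnected (ψ j '' S) := (isPreconnected_ring hR₀0).image _ (hcontA j S hSA)
    refine IsPreconnected.subset_left_of_subset_union hM hopen2 hdisj
      (hunion j S hSA fun w hw => hw.2.ne) ?_ hSp ⟨w, ⟨hw.1, hw1⟩, rfl⟩
    have e1 : ∀ᶠ s : ℝ in 𝓝[<] 1, ψ j s ∈ W :=
      ((hψc j).eventually (hW.mem_nhds (hMW (hb j 1 h1S)))).filter_mono nhdsWithin_le_nhds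
    have e2 : ∀ᶠ s : ℝ in 𝓝[<] 1, R₀ < s := (lt_mem_nhds hR₀).filter_mono nhdsWithin_le_nhds
    obtain ⟨s, hs1, hs2, hs3, hs4⟩ :=
      ((hsign j).1.and (e1.and (e2.and self_mem_nhdsWithin))).exists
    have hs0 : |s| = s := abs_of_pos (hR₀0.trans hs3)
    exact ⟨ψ j s, ⟨s, ⟨by simpa [hs0] using hs3, by simpa [hs0] using hs4⟩, rfl⟩,
      (hmem _ hs2).2 hs1⟩
  · set S := {w : ℂ | 1 < ‖w‖ ∧ ‖w‖ < R₀⁻¹}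
    have hSA : S ⊆ annulus R₀ := fun w hw => ⟨hR₀.trans hw.1, hw.2⟩
    have hSp : IsPreconnected (ψ j '' S) := (isPreconnected_ring one_pos).image _ (hcontA j S hSA)
    refine IsPreconnected.subset_right_of_subset_union hM hopen2 hdisj
      (hunion j S hSA fun w hw => hw.1.ne') ?_ hSp ⟨w, ⟨hw1, hw.2⟩, rfl⟩
    have e1 : ∀ᶠ s : ℝ in 𝓝[>] 1, ψ j s ∈ W ∧ (r (ψ j s) = 0 ↔ ψ j s ∈ frontier M) :=
      ((hψc j).eventually ((hW.eventually_mem (hMW (hb j 1 h1S))).and (hlev.4 _ (hb j 1 h1S)))).filter_mono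
        nhdsWithin_le_nhds
    have e2 : ∀ᶠ s : ℝ in 𝓝[>] 1, s < R₀⁻¹ :=
      (gt_mem_nhds ((one_lt_inv₀ hR₀0).2 hR₀)).filter_mono nhdsWithin_le_nhds
    obtain ⟨s, hs1, ⟨hs2, hs2'⟩, hs3, hs4⟩ :=
      ((hsign j).2.and (e1.and (e2.and self_mem_nhdsWithin))).exists
    have hs0 : |s| = s := abs_of_pos (one_pos.trans hs4)
    refine ⟨ψ j s, ⟨s, ⟨by simpa [hs0] using hs4, by simpa [hs0] using hs3⟩, rfl⟩, fun hcl => ?_⟩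
    have : ψ j s ∈ frontier M := by
      rw [hM.frontier_eq]
      exact ⟨hcl, fun h => by have := (hmem _ hs2).1 h; linarith⟩
    exact hs1.ne' (hs2'.2 this)

section

variable {E : Type*} [NormedAddCommGroup E] [NormedSpace ℂ E]

theorem differentiableAt_cauchy_integral [CompleteSpace E] {ϕ : ℝ → ℂ} {Φ : ℝ → E} (hϕ : Continuous ϕ)
    (hΦ : Continuous Φ) {a b : ℝ} {z₀ : ℂ} (h : ∀ θ, ϕ θ ∈ ϕ '' uIcc a b)
    (hz : ∀ θ, ϕ θ ≠ z₀) :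
    DifferentiableAt ℂ (fun z => ∫ θ in a..b, (ϕ θ - z)⁻¹ • Φ θ) z₀ := by
  have hcomp : IsCompact (ϕ '' uIcc a b) := isCompact_uIcc.image hϕ
  have hz' : z₀ ∈ (ϕ '' uIcc a b)ᶜ := by
    rintro ⟨θ, -, hθ⟩
    exact hz θ hθ
  obtain ⟨d, hd, hball⟩ := Metric.isOpen_iff.1 hcomp.isClosed.isOpen_compl z₀ hz'
  have hlow : ∀ θ, ∀ z ∈ ball z₀ (d / 2), d / 2 ≤ ‖ϕ θ - z‖ := by
    intro θ z hzb
    by_contra hlt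
    have : ϕ θ ∈ ball z₀ d := by
      rw [mem_ball, dist_eq_norm] at hzb ⊢
      have e : ϕ θ - z₀ = (ϕ θ - z) + (z - z₀) := by ring
      rw [e]
      exact (norm_add_le _ _).trans_lt (by linarith [not_le.1 hlt])
    exact hball this (h θ)
  have hne : ∀ θ, ∀ z ∈ ball z₀ (d / 2), ϕ θ - z ≠ 0 := fun θ z hzb h0 => by
    have := hlow θ z hzb
    rw [h0, norm_zero] at this
    linarith
  have hcF : ∀ z ∈ ball z₀ (d / 2), Continuous fun θ => (ϕ θ - z)⁻¹ • Φ θ := fun z hzb =>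
    ((hϕ.sub continuous_const).inv₀ fun θ => hne θ z hzb).smul hΦ
  have hz0 : z₀ ∈ ball z₀ (d / 2) := mem_ball_self (by linarith)
  have hcF' : Continuous fun θ => ((ϕ θ - z₀) ^ 2)⁻¹ • Φ θ :=
    (((hϕ.sub continuous_const).pow 2).inv₀ fun θ => pow_ne_zero _ (hne θ z₀ hz0)).smul hΦ
  refine (intervalIntegral.hasDerivAt_integral_of_dominated_loc_of_deriv_le
    (F := fun z θ => (ϕ θ - z)⁻¹ • Φ θ) (F' := fun z θ => ((ϕ θ - z) ^ 2)⁻¹ • Φ θ)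
    (bound := fun θ => ((d / 2) ^ 2)⁻¹ * ‖Φ θ‖) (ball_mem_nhds z₀ (by linarith : 0 < d / 2))
    ?_ ((hcF z₀ hz0).intervalIntegrable _ _) hcF'.aestronglyMeasurable ?_
    ((continuous_const.mul hΦ.norm).intervalIntegrable _ _) ?_).2.differentiableAt
  · filter_upwards [ball_mem_nhds z₀ (by linarith : 0 < d / 2)] with z hzb
    exact (hcF z hzb).aestronglyMeasurable
  · refine Eventually.of_forall fun θ _ z hzb => ?_
    rw [norm_smul, norm_inv, norm_pow]
    gcongr
    exact hlow θ z hzb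
  · refine Eventually.of_forall fun θ _ z hzb => ?_
    have h1 : HasDerivAt (fun z => (ϕ θ - z)) (-1) z := by
      simpa using (hasDerivAt_id z).const_sub (ϕ θ)
    have h2 := (h1.inv (hne θ z hzb)).smul_const (Φ θ)
    rw [neg_neg, one_div] at h2
    exact h2

theorem isOpen_ring (a b : ℝ) : IsOpen {w : ℂ | a < ‖w‖ ∧ ‖w‖ < b} :=
  (isOpen_lt continuous_const continuous_norm).inter (isOpen_lt continuous_norm continuous_const)

/-- Cauchy's formula on a ring domain, for two concentric circles. -/
theorem ring_cauchy [CompleteSpace E] {G : ℂ → E} {a b r₁ r₃ : ℝ} {w₀ : ℂ} (ha : 0 < a) (har : a < r₁)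
    (h1 : r₁ < ‖w₀‖) (h3 : ‖w₀‖ < r₃) (hb : r₃ < b)
    (hG : DifferentiableOn ℂ G {w | a < ‖w‖ ∧ ‖w‖ < b}) :
    (∮ w in C(0, r₃), (w - w₀)⁻¹ • G w) - (∮ w in C(0, r₁), (w - w₀)⁻¹ • G w) =
      (2 * Real.pi * I : ℂ) • G w₀ := by
  set A := {w : ℂ | a < ‖w‖ ∧ ‖w‖ < b}
  have hA : IsOpen A := isOpen_ring a b
  have hw₀ : w₀ ∈ A := ⟨by linarith, by linarith⟩
  have hr1 : 0 < r₁ := by linarith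
  have hr3 : 0 < r₃ := by linarith
  have hg : DifferentiableOn ℂ (dslope G w₀) A :=
    (Complex.differentiableOn_dslope (hA.mem_nhds hw₀)).2 hG
  have hsub : closedBall (0 : ℂ) r₃ \ ball 0 r₁ ⊆ A := by
    rintro w ⟨hw1, hw2⟩
    rw [mem_closedBall_zero_iff] at hw1
    rw [mem_ball_zero_iff, not_lt] at hw2
    exact ⟨by linarith, by linarith⟩
  have hI := Complex.circleIntegral_eq_of_differentiable_on_annulus_off_countable hr1
    (by linarith : r₁ ≤ r₃) countable_empty (hg.continuousOn.mono hsub) (fun w hw =>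
      (hg w (hsub ⟨ball_subset_closedBall hw.1.1, fun h => hw.1.2 (ball_subset_closedBall h)⟩)
        ).differentiableAt (hA.mem_nhds
        (hsub ⟨ball_subset_closedBall hw.1.1, fun h => hw.1.2 (ball_subset_closedBall h)⟩)))
  have hcirc : ∀ ρ, r₁ ≤ ρ → ρ ≤ r₃ → ‖w₀‖ ≠ ρ → (∮ w in C(0, ρ), (w - w₀)⁻¹ • G w) =
      (∮ w in C(0, ρ), dslope G w₀ w) + (∮ w in C(0, ρ), (w - w₀)⁻¹) • G w₀ := by
    intro ρ hρ1 hρ3 hne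
    have hρ : 0 < ρ := by linarith
    have hs : sphere (0 : ℂ) ρ ⊆ A := fun w hw => by
      rw [mem_sphere_zero_iff_norm] at hw
      exact ⟨by rw [hw]; linarith, by rw [hw]; linarith⟩
    have hsn : ∀ w ∈ sphere (0 : ℂ) ρ, w ≠ w₀ := fun w hw h => by
      rw [mem_sphere_zero_iff_norm, h] at hw
      exact hne hw
    have hci : ContinuousOn (fun w => (w - w₀)⁻¹) (sphere (0 : ℂ) ρ) :=
      (continuousOn_id.sub continuousOn_const).inv₀ fun w hw => sub_ne_zero.2 (hsn w hw)
    have h_intg : CircleIntegrable (fun w => (w - w₀)⁻¹ • G w₀) 0 ρ :=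
      ContinuousOn.circleIntegrable hρ.le (hci.smul continuousOn_const)
    rw [← circleIntegral.integral_smul_const, ← circleIntegral.integral_add
      ((hg.continuousOn.mono hs).circleIntegrable hρ.le) h_intg]
    refine circleIntegral.integral_congr hρ.le fun w hw => ?_
    rw [dslope_of_ne _ (hsn w hw), slope_def_module, ← smul_add, sub_add_cancel]
  rw [hcirc r₃ (by linarith) le_rfl h3.ne, hcirc r₁ le_rfl (by linarith) h1.ne', hI,
    circleIntegral.integral_sub_inv_of_mem_ball (by simpa using h3)]
  have h0 : (∮ w in C(0, r₁), (w - w₀)⁻¹) = 0 := by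
    have hne : ∀ w ∈ closedBall (0 : ℂ) r₁, w - w₀ ≠ 0 := fun w hw h => by
      rw [mem_closedBall_zero_iff, sub_eq_zero.1 h] at hw
      linarith
    refine Complex.circleIntegral_eq_zero_of_differentiable_on_off_countable hr1.le countable_empty
      ((continuousOn_id.sub continuousOn_const).inv₀ hne) fun w hw => ?_
    exact (differentiableAt_id.sub_const _).inv (hne w (ball_subset_closedBall hw.1))
  rw [h0, zero_smul]
  simp

end

namespace Collar

variable {E : Type*} [NormedAddCommGroup E] [NormedSpace ℂ E] {M : Set ℂ} (c : Collar M)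

theorem mem_annulus_of {r : ℝ} {w : ℂ} (hr : c.R < r) (hr' : r < c.R⁻¹) (hw : ‖w‖ = r) :
    w ∈ annulus c.R := ⟨by rw [hw]; exact hr, by rw [hw]; exact hr'⟩

theorem one_lt_inv : 1 < c.R⁻¹ := (one_lt_inv₀ c.R_pos).2 c.R_lt

theorem differentiableAt (j : Fin c.m) {w : ℂ} (hw : w ∈ annulus c.R) :
    DifferentiableAt ℂ (c.ψ j) w :=
  (c.diff j w hw).differentiableAt ((isOpen_annulus c.R).mem_nhds hw)

theorem analyticAt (j : Fin c.m) {w : ℂ} (hw : w ∈ annulus c.R) :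
    AnalyticAt ℂ (c.ψ j) w :=
  (c.diff j).analyticAt ((isOpen_annulus c.R).mem_nhds hw)

theorem hasStrictDerivAt (j : Fin c.m) {w : ℂ} (hw : w ∈ annulus c.R) :
    HasStrictDerivAt (c.ψ j) (deriv (c.ψ j) w) w :=
  (c.analyticAt j hw).hasStrictDerivAt

theorem map_nhds (j : Fin c.m) {w : ℂ} (hw : w ∈ annulus c.R) :
    map (c.ψ j) (𝓝 w) = 𝓝 (c.ψ j w) :=
  (c.hasStrictDerivAt j hw).map_nhds_eq (c.deriv_ne j w hw)

theorem isOpen_image (j : Fin c.m) {s : Set ℂ} (hs : IsOpen s) (hsR : s ⊆ annulus c.R) :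
    IsOpen (c.ψ j '' s) := by
  rw [isOpen_iff_mem_nhds]
  rintro _ ⟨w, hw, rfl⟩
  rw [← c.map_nhds j (hsR hw)]
  exact image_mem_map (hs.mem_nhds hw)

/-- A function is differentiable at a collar point as soon as it is so in the collar coordinate. -/
theorem differentiableAt_of_comp {j : Fin c.m} {w : ℂ} (hw : w ∈ annulus c.R) {f : ℂ → E}
    (h : DifferentiableAt ℂ (fun v => f (c.ψ j v)) w) : DifferentiableAt ℂ f (c.ψ j w) := by
  have hs := c.hasStrictDerivAt j hw
  have hne := c.deriv_ne j w hw
  set g := hs.localInverse _ _ _ hne with hg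
  have h1 : HasStrictDerivAt g _ (c.ψ j w) := hs.to_localInverse hne
  have hgw : g (c.ψ j w) = w := HasStrictFDerivAt.localInverse_apply_image _
  have h2 : ∀ᶠ z in 𝓝 (c.ψ j w), c.ψ j (g z) = z :=
    HasStrictFDerivAt.eventually_right_inverse _
  have h3 : DifferentiableAt ℂ (fun z => f (c.ψ j (g z))) (c.ψ j w) := by
    refine DifferentiableAt.comp (g := fun v => f (c.ψ j v)) (c.ψ j w) ?_
      h1.hasDerivAt.differentiableAt
    rw [hgw]
    exact h
  refine h3.congr_of_eventuallyEq ?_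
  filter_upwards [h2] with z hz
  rw [hz]

/-- The inward side of the collar. -/
theorem mem_closure_iff {j : Fin c.m} {w : ℂ} (hw : w ∈ annulus c.R) :
    c.ψ j w ∈ closure M ↔ ‖w‖ ≤ 1 := by
  constructor
  · intro h
    by_contra! h1
    exact c.outside j w hw h1 h
  · intro h
    rcases h.lt_or_eq with h | h
    · exact subset_closure (c.inside j w hw h)
    · exact frontier_subset_closure (c.bdry j w (mem_sphere_zero_iff_norm.2 h))

theorem mem_iff (hM : IsOpen M) {j : Fin c.m} {w : ℂ} (hw : w ∈ annulus c.R) :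
    c.ψ j w ∈ M ↔ ‖w‖ < 1 := by
  refine ⟨fun h => ?_, c.inside j w hw⟩
  refine ((c.mem_closure_iff hw).1 (subset_closure h)).lt_of_ne fun h1 => ?_
  have := c.bdry j w (mem_sphere_zero_iff_norm.2 h1)
  rw [hM.frontier_eq] at this
  exact this.2 h

theorem continuousWithinAt_of_comp {X : Type*} [TopologicalSpace X] {j : Fin c.m} {w : ℂ}
    (hw : w ∈ annulus c.R) {f : ℂ → X}
    (h : ContinuousWithinAt (fun v => f (c.ψ j v)) (closedBall 0 1) w) :
    ContinuousWithinAt f (closure M) (c.ψ j w) := by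
  unfold ContinuousWithinAt at h ⊢
  rw [nhdsWithin, ← c.map_nhds j hw]
  have : map (c.ψ j) (𝓝 w) ⊓ 𝓟 (closure M) ≤ map (c.ψ j) (𝓝[closedBall 0 1] w) := by
    intro s hs
    rw [mem_map, mem_nhdsWithin_iff_eventually] at hs
    rw [mem_inf_principal, mem_map]
    filter_upwards [hs, (isOpen_annulus c.R).mem_nhds hw] with v hv hva hvc
    exact hv (mem_closedBall_zero_iff.2 ((c.mem_closure_iff hva).1 hvc))
  exact (tendsto_map'_iff.2 h).mono_left this

/-- The complement in `closure M` of a thinner collar. -/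
def core (r : ℝ) : Set ℂ := closure M \ ⋃ j, c.ψ j '' annulus r

theorem core_subset (hM : IsOpen M) {r : ℝ} (hr0 : 0 < r) (hr : r < 1) : c.core r ⊆ M := by
  rintro z ⟨hz, hz'⟩
  by_contra hzM
  have hzf : z ∈ frontier M := by
    rw [hM.frontier_eq]
    exact ⟨hz, hzM⟩
  obtain ⟨j, w, hw, rfl⟩ := c.surj z hzf
  exact hz' (mem_iUnion.2 ⟨j, w, sphere_subset_annulus hr0 hr hw, rfl⟩)

theorem isCompact_core (hMb : IsBounded M) {r : ℝ} (hr : c.R ≤ r) : IsCompact (c.core r) :=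
  hMb.isCompact_closure.diff (isOpen_iUnion fun j =>
    c.isOpen_image j (isOpen_annulus r) (annulus_anti c.R_pos hr))

theorem mem_core_or (z : ℂ) (hz : z ∈ closure M) {r : ℝ} (hr : c.R ≤ r) :
    z ∈ c.core r ∨ ∃ j w, r < ‖w‖ ∧ ‖w‖ ≤ 1 ∧ c.ψ j w = z := by
  by_cases h : z ∈ ⋃ j, c.ψ j '' annulus r
  · right
    obtain ⟨j, w, hw, rfl⟩ := mem_iUnion.1 h
    exact ⟨j, w, hw.1, (c.mem_closure_iff (annulus_anti c.R_pos hr hw)).1 hz, rfl⟩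
  · exact Or.inl ⟨hz, h⟩

theorem exists_subset_core {K : Set ℂ} (hM : IsOpen M) (hK : IsCompact K) (hKM : K ⊆ M) :
    ∃ r, c.R ≤ r ∧ r < 1 ∧ ∀ r', r ≤ r' → K ⊆ c.core r' := by
  have h : ∀ᶠ w in 𝓝ˢ (sphere (0 : ℂ) 1), ∀ j, c.ψ j w ∉ K := by
    rw [eventually_all]
    intro j
    rw [eventually_nhdsSet_iff_forall]
    intro w hw
    have hwa := sphere_subset_annulus c.R_pos c.R_lt hw
    refine (c.differentiableAt j hwa).continuousAt.eventually_mem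
      (hK.isClosed.isOpen_compl.mem_nhds fun hwK => ?_)
    have := (c.mem_iff hM hwa).1 (hKM hwK)
    rw [mem_sphere_zero_iff_norm.1 hw] at this
    exact lt_irrefl _ this
  obtain ⟨r, hr0, hr1, hr⟩ := exists_annulus_subset h
  refine ⟨max c.R r, le_max_left _ _, max_lt c.R_lt hr1, fun r' hr' z hz => ?_⟩
  refine ⟨subset_closure (hKM hz), fun h => ?_⟩
  obtain ⟨j, w, hw, rfl⟩ := mem_iUnion.1 h
  exact hr (annulus_anti hr0 ((le_max_right _ _).trans hr') hw) j hz

/-- The Cauchy transform along the level curves `‖w‖ = r` of the collar. -/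
noncomputable def cauchy (r : ℝ) (q : Fin c.m → ℂ → E) (z : ℂ) : E :=
  ∑ k, (2 * Real.pi * I : ℂ)⁻¹ • ∮ w in C(0, r), (deriv (c.ψ k) w / (c.ψ k w - z)) • q k w

variable {c}

theorem continuousOn_sphere {r : ℝ} (hr : c.R < r) (hr' : r < c.R⁻¹) (k : Fin c.m) :
    ContinuousOn (c.ψ k) (sphere 0 r) ∧ ContinuousOn (deriv (c.ψ k)) (sphere 0 r) := by
  have hann : sphere 0 r ⊆ annulus c.R := fun w hw =>
    c.mem_annulus_of hr hr' (mem_sphere_zero_iff_norm.1 hw)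
  exact ⟨(c.diff k).continuousOn.mono hann,
    ((c.diff k).deriv (isOpen_annulus c.R)).continuousOn.mono hann⟩

theorem differentiableAt_cauchy [CompleteSpace E] {r : ℝ} (hr : c.R < r) (hr' : r < c.R⁻¹)
    {q : Fin c.m → ℂ → E} (hq : ∀ k, ContinuousOn (q k) (sphere 0 r)) {z : ℂ}
    (hz : ∀ k, ∀ w ∈ sphere (0 : ℂ) r, c.ψ k w ≠ z) : DifferentiableAt ℂ (c.cauchy r q) z := by
  have hr0 : 0 < r := c.R_pos.trans hr
  have hmem : ∀ θ, circleMap 0 r θ ∈ sphere (0 : ℂ) r := circleMap_mem_sphere 0 hr0.le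
  unfold cauchy
  refine DifferentiableAt.fun_sum fun k _ => DifferentiableAt.const_smul ?_ _
  obtain ⟨hψ, hd⟩ := continuousOn_sphere hr hr' k
  have key := differentiableAt_cauchy_integral (a := 0) (b := 2 * Real.pi) (z₀ := z)
    (ϕ := fun θ => c.ψ k (circleMap 0 r θ))
    (Φ := fun θ => (deriv (circleMap 0 r) θ * deriv (c.ψ k) (circleMap 0 r θ)) •
      q k (circleMap 0 r θ)) (hψ.comp_continuous (continuous_circleMap _ _) hmem) ?_ ?_
    (fun θ => hz k _ (hmem θ))
  · refine key.congr_of_eventuallyEq (Eventually.of_forall fun z => ?_)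
    refine intervalIntegral.integral_congr fun θ _ => ?_
    show _ • (_ • _) = _ • (_ • _)
    rw [smul_smul, smul_smul]
    congr 1
    rw [div_eq_mul_inv]
    ring
  · have h1 : Continuous (deriv (circleMap 0 r)) := by
      rw [show deriv (circleMap 0 r) = fun θ => circleMap 0 r θ * I from
        funext fun θ => deriv_circleMap 0 r θ]
      fun_prop
    exact (h1.mul (hd.comp_continuous (continuous_circleMap _ _) hmem)).smul
      ((hq k).comp_continuous (continuous_circleMap _ _) hmem)
  · intro θ
    obtain ⟨θ', hθ', h⟩ := (periodic_circleMap (0 : ℂ) r).exists_mem_Ico₀ Real.two_pi_pos θ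
    refine ⟨θ', ?_, by simp only [h]⟩
    rw [uIcc_of_le Real.two_pi_pos.le]
    exact ⟨hθ'.1, hθ'.2.le⟩

theorem exists_norm_cauchy_le {r : ℝ} (hr : c.R < r) (hr' : r < c.R⁻¹) {K : Set ℂ}
    (hK : IsCompact K) (hKr : ∀ k, ∀ w ∈ sphere (0 : ℂ) r, c.ψ k w ∉ K) :
    ∃ C, 0 < C ∧ ∀ (q : Fin c.m → ℂ → E) (s : ℝ), 0 ≤ s →
      (∀ k, ∀ w ∈ sphere (0 : ℂ) r, ‖q k w‖ ≤ s) → ∀ z ∈ K, ‖c.cauchy r q z‖ ≤ C * s := by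
  have hr0 : 0 < r := c.R_pos.trans hr
  have hb : ∀ k, ∃ B, ∀ p ∈ sphere (0 : ℂ) r ×ˢ K,
      ‖deriv (c.ψ k) p.1 / (c.ψ k p.1 - p.2)‖ ≤ B := by
    intro k
    refine ((isCompact_sphere 0 r).prod hK).exists_bound_of_continuousOn ?_
    obtain ⟨hψ, hd⟩ := continuousOn_sphere hr hr' k
    refine ContinuousOn.div (hd.comp continuousOn_fst fun p hp => hp.1)
      ((hψ.comp continuousOn_fst fun p hp => hp.1).sub continuousOn_snd) ?_
    · rintro p ⟨h1, h2⟩ h0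
      exact hKr k p.1 h1 (sub_eq_zero.1 h0 ▸ h2)
  choose B hB using hb
  refine ⟨∑ k, r * (|B k|) + 1, by positivity, fun q s hs hq z hz => ?_⟩
  unfold cauchy
  refine (norm_sum_le _ _).trans ?_
  rw [add_mul, Finset.sum_mul]
  refine le_add_of_le_of_nonneg (Finset.sum_le_sum fun k _ => ?_) (by linarith)
  have h := circleIntegral.norm_two_pi_i_inv_smul_integral_le_of_norm_le_const (c := 0) hr0.le
    (f := fun w => (deriv (c.ψ k) w / (c.ψ k w - z)) • q k w) (C := |B k| * s) fun w hw => by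
      rw [norm_smul]
      exact mul_le_mul ((hB k (w, z) ⟨hw, hz⟩).trans (le_abs_self _)) (hq k w hw)
        (norm_nonneg _) (abs_nonneg _)
  rw [mul_assoc r]
  exact h

theorem circleIntegrable_cauchy {r : ℝ} (hr : c.R < r) (hr' : r < c.R⁻¹) {q : ℂ → E} {k : Fin c.m}
    (hq : ContinuousOn q (sphere 0 r)) {z : ℂ} (hz : ∀ w ∈ sphere (0 : ℂ) r, c.ψ k w ≠ z) :
    CircleIntegrable (fun w => (deriv (c.ψ k) w / (c.ψ k w - z)) • q w) 0 r := by
  refine ContinuousOn.circleIntegrable (c.R_pos.trans hr).le (ContinuousOn.smul ?_ hq)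
  obtain ⟨hψ, hd⟩ := continuousOn_sphere hr hr' k
  exact hd.div (hψ.sub continuousOn_const) fun w hw => sub_ne_zero.2 (hz w hw)

theorem cauchy_sub {r : ℝ} (hr : c.R < r) (hr' : r < c.R⁻¹) {p q : Fin c.m → ℂ → E}
    (hp : ∀ k, ContinuousOn (p k) (sphere 0 r)) (hq : ∀ k, ContinuousOn (q k) (sphere 0 r)) {z : ℂ}
    (hz : ∀ k, ∀ w ∈ sphere (0 : ℂ) r, c.ψ k w ≠ z) :
    c.cauchy r (fun k w => p k w - q k w) z = c.cauchy r p z - c.cauchy r q z := by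
  unfold cauchy
  rw [← Finset.sum_sub_distrib]
  refine Finset.sum_congr rfl fun k _ => ?_
  rw [← smul_sub, ← circleIntegral.integral_sub (circleIntegrable_cauchy hr hr' (hp k) (hz k))
    (circleIntegrable_cauchy hr hr' (hq k) (hz k))]
  simp only [smul_sub]

/-- The jump relation between two Cauchy transforms. -/
theorem cauchy_sub_cauchy [CompleteSpace E] {a b r₁ r₃ : ℝ} (ha : c.R ≤ a) (har : a < r₁)
    (hrb : r₃ < b) (hb : b ≤ c.R⁻¹) {q : Fin c.m → ℂ → E}
    (hq : ∀ k, DifferentiableOn ℂ (q k) {w | a < ‖w‖ ∧ ‖w‖ < b}) {j : Fin c.m} {w₀ : ℂ}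
    (h1 : r₁ < ‖w₀‖) (h3 : ‖w₀‖ < r₃) :
    c.cauchy r₃ q (c.ψ j w₀) - c.cauchy r₁ q (c.ψ j w₀) = q j w₀ := by
  set A := {w : ℂ | a < ‖w‖ ∧ ‖w‖ < b} with hAdef
  have ha0 : 0 < a := c.R_pos.trans_le ha
  have hA : IsOpen A := isOpen_ring a b
  have hAR : A ⊆ annulus c.R := fun w hw => ⟨ha.trans_lt hw.1, hw.2.trans_le hb⟩
  have hw₀ : w₀ ∈ A := ⟨by linarith, by linarith⟩
  have hd : ∀ k, DifferentiableOn ℂ (deriv (c.ψ k)) A := fun k =>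
    ((c.diff k).deriv (isOpen_annulus c.R)).mono hAR
  unfold cauchy
  rw [← Finset.sum_sub_distrib, Finset.sum_eq_single j]
  · rw [← smul_sub]
    set G : ℂ → E := fun w => (deriv (c.ψ j) w / dslope (c.ψ j) w₀ w) • q j w with hG
    have hne : ∀ w ∈ A, dslope (c.ψ j) w₀ w ≠ 0 := by
      intro w hw
      by_cases hww : w = w₀
      · rw [hww, dslope_same]
        exact c.deriv_ne j w₀ (hAR hw₀)
      · rw [dslope_of_ne _ hww, slope_def_field]
        refine div_ne_zero (sub_ne_zero.2 fun h => hww ?_) (sub_ne_zero.2 hww)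
        exact (c.inj j j w (hAR hw) w₀ (hAR hw₀) h).2
    have hGd : DifferentiableOn ℂ G A := by
      refine DifferentiableOn.smul (DifferentiableOn.div (hd j) ?_ hne) (hq j)
      exact (Complex.differentiableOn_dslope (hA.mem_nhds hw₀)).2 ((c.diff j).mono hAR)
    have hG₀ : G w₀ = q j w₀ := by
      simp only [hG, dslope_same]
      rw [div_self (c.deriv_ne j w₀ (hAR hw₀)), one_smul]
    have key := ring_cauchy ha0 har h1 h3 hrb hGd
    have hcongr : ∀ r, 0 ≤ r → r ≠ ‖w₀‖ →
        (∮ w in C(0, r), (deriv (c.ψ j) w / (c.ψ j w - c.ψ j w₀)) • q j w) =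
          ∮ w in C(0, r), (w - w₀)⁻¹ • G w := by
      intro r hr hrw
      refine circleIntegral.integral_congr hr fun w hw => ?_
      have hww : w ≠ w₀ := fun h => hrw (by rw [← h, mem_sphere_zero_iff_norm.1 hw])
      simp only [hG, smul_smul]
      congr 1
      rw [dslope_of_ne _ hww, slope_def_field, div_div_eq_mul_div, mul_div_right_comm,
        mul_comm _ (w - w₀), inv_mul_cancel_left₀ (sub_ne_zero.2 hww)]
    rw [hcongr r₃ (by linarith) (by linarith), hcongr r₁ (by linarith) (by linarith), key, hG₀,
      smul_smul, inv_mul_cancel₀ (by simp [Real.pi_ne_zero]), one_smul]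
  · intro k _ hkj
    rw [← smul_sub]
    set G : ℂ → E := fun w => (deriv (c.ψ k) w / (c.ψ k w - c.ψ j w₀)) • q k w with hG
    have hGd : DifferentiableOn ℂ G A := by
      refine DifferentiableOn.smul (DifferentiableOn.div (hd k)
        (((c.diff k).mono hAR).sub_const _) fun w hw h => hkj ?_) (hq k)
      exact (c.inj k j w (hAR hw) w₀ (hAR hw₀) (sub_eq_zero.1 h)).1
    have hsub : closedBall (0 : ℂ) r₃ \ ball 0 r₁ ⊆ A := by
      rintro w ⟨hw1, hw2⟩
      rw [mem_closedBall_zero_iff] at hw1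
      rw [mem_ball_zero_iff, not_lt] at hw2
      exact ⟨by linarith, by linarith⟩
    have hI := Complex.circleIntegral_eq_of_differentiable_on_annulus_off_countable
      (by linarith : 0 < r₁)
      (by linarith : r₁ ≤ r₃) countable_empty (hGd.continuousOn.mono hsub) (fun w hw =>
        (hGd w (hsub ⟨ball_subset_closedBall hw.1.1, fun h => hw.1.2 (ball_subset_closedBall h)⟩)
          ).differentiableAt (hA.mem_nhds
          (hsub ⟨ball_subset_closedBall hw.1.1, fun h => hw.1.2 (ball_subset_closedBall h)⟩)))
    rw [hI, sub_self, smul_zero]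
  · simp

end Collar

namespace Collar

variable {E : Type*} [NormedAddCommGroup E] [NormedSpace ℂ E] {M : Set ℂ} {c : Collar M}

theorem differentiableAt_cauchy_comp [CompleteSpace E] {r : ℝ} (hr : c.R < r) (hr' : r < 1)
    {q : Fin c.m → ℂ → E} (hq : ∀ k, ContinuousOn (q k) (sphere 0 r)) {j : Fin c.m} {w : ℂ}
    (hw : r < ‖w‖) (hw' : ‖w‖ < c.R⁻¹) :
    DifferentiableAt ℂ (fun v => c.cauchy r q (c.ψ j v)) w := by
  have hwa : w ∈ annulus c.R := ⟨hr.trans hw, hw'⟩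
  refine DifferentiableAt.comp (g := c.cauchy r q) w
    (differentiableAt_cauchy hr (hr'.trans c.one_lt_inv) hq fun k v hv h => ?_)
    (c.differentiableAt j hwa)
  have hva := c.mem_annulus_of hr (hr'.trans c.one_lt_inv) (mem_sphere_zero_iff_norm.1 hv)
  have := (c.inj k j v hva w hwa h).2
  rw [← this, mem_sphere_zero_iff_norm.1 hv] at hw
  exact lt_irrefl _ hw

/-- Gluing a holomorphic map on the core with holomorphic maps on the collar. -/
theorem exists_glue [CompleteSpace E] (hM : IsOpen M) (hMb : IsBounded M) {a r₁ r₂ r₃ : ℝ}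
    (ha : c.R ≤ a) (har : a < r₁) (h12 : r₁ < r₂) (h23 : r₂ < r₃) (hr3 : r₃ < 1) :
    ∃ C, 0 < C ∧ ∀ (F : ℂ → E) (p : Fin c.m → ℂ → E), DifferentiableOn ℂ F M →
      (∀ j, DifferentiableOn ℂ (p j) {w | a < ‖w‖ ∧ ‖w‖ < 1}) →
      ∃ f : ℂ → E, DifferentiableOn ℂ f M ∧
        (∀ j w, r₁ < ‖w‖ → ‖w‖ < c.R⁻¹ →
          f (c.ψ j w) = p j w + c.cauchy r₁ (fun k w => p k w - F (c.ψ k w)) (c.ψ j w)) ∧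
        (∀ s, 0 ≤ s → (∀ k, ∀ w ∈ sphere (0 : ℂ) r₁, ‖p k w - F (c.ψ k w)‖ ≤ s) →
          ∀ j w, r₂ ≤ ‖w‖ → ‖w‖ ≤ 1 → ‖f (c.ψ j w) - p j w‖ ≤ C * s) ∧
        (∀ s, 0 ≤ s → (∀ k, ∀ w ∈ sphere (0 : ℂ) r₃, ‖p k w - F (c.ψ k w)‖ ≤ s) →
          ∀ z ∈ c.core r₂, ‖f z - F z‖ ≤ C * s) := by
  have h1R : c.R < r₁ := ha.trans_lt har
  have h3R : c.R < r₃ := by linarith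
  have h1i : r₁ < c.R⁻¹ := by linarith [c.one_lt_inv]
  have h3i : r₃ < c.R⁻¹ := by linarith [c.one_lt_inv]
  have hR0 := c.R_pos
  have hring : ∀ r, c.R < r → closedBall (0 : ℂ) 1 \ ball 0 r ⊆ annulus c.R := by
    rintro r hr w ⟨h1, h2⟩
    rw [mem_closedBall_zero_iff] at h1
    rw [mem_ball_zero_iff, not_lt] at h2
    exact ⟨by linarith, by linarith [c.one_lt_inv]⟩
  have hcomp : ∀ r, c.R < r → IsCompact (⋃ j, c.ψ j '' (closedBall 0 1 \ ball 0 r)) := fun r hr =>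
    isCompact_iUnion fun j => ((isCompact_closedBall 0 1).diff isOpen_ball).image_of_continuousOn
      ((c.diff j).continuousOn.mono (hring r hr))
  obtain ⟨C₁, hC₁, hb₁⟩ := exists_norm_cauchy_le (E := E) h1R h1i (hcomp r₂ (by linarith))
    (fun k w hw h => by
      obtain ⟨j, v, hv, hvw⟩ := mem_iUnion.1 h
      have hw' := mem_sphere_zero_iff_norm.1 hw
      have := (c.inj j k v (hring r₂ (by linarith) hv) w (c.mem_annulus_of h1R h1i hw') hvw).2
      rw [this] at hv
      exact hv.2 (mem_ball_zero_iff.2 (by rw [hw']; exact h12)))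
  obtain ⟨C₃, hC₃, hb₃⟩ := exists_norm_cauchy_le (E := E) h3R h3i
    (c.isCompact_core hMb (r := r₂) (by linarith))
    (fun k w hw h => h.2 (mem_iUnion.2 ⟨k, w, by
      have hw' := mem_sphere_zero_iff_norm.1 hw
      refine ⟨by rw [hw']; exact h23, ?_⟩
      rw [hw']
      exact hr3.trans ((one_lt_inv₀ (by linarith)).2 (by linarith)), rfl⟩))
  refine ⟨max C₁ C₃, lt_max_of_lt_left hC₁, fun F p hF hp => ?_⟩
  set q : Fin c.m → ℂ → E := fun k w => p k w - F (c.ψ k w) with hq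
  set A := {w : ℂ | a < ‖w‖ ∧ ‖w‖ < 1} with hAdef
  have hA : IsOpen A := isOpen_ring a 1
  have hAR : A ⊆ annulus c.R := fun w hw => ⟨ha.trans_lt hw.1, hw.2.trans c.one_lt_inv⟩
  have hqd : ∀ k, DifferentiableOn ℂ (q k) A := fun k => (hp k).sub
    (hF.comp ((c.diff k).mono hAR) fun w hw => c.inside k w (hAR hw) hw.2)
  have hqc : ∀ r, a < r → r < 1 → ∀ k, ContinuousOn (q k) (sphere 0 r) := fun r hr hr' k =>
    (hqd k).continuousOn.mono fun w hw => by
      rw [mem_sphere_zero_iff_norm] at hw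
      exact ⟨by rw [hw]; exact hr, by rw [hw]; exact hr'⟩
  classical
  set P : ℂ → Fin c.m × ℂ → Prop := fun z x => r₁ < ‖x.2‖ ∧ ‖x.2‖ < c.R⁻¹ ∧ c.ψ x.1 x.2 = z with hP
  set f : ℂ → E := fun z => if h : ∃ x, P z x then
    p h.choose.1 h.choose.2 + c.cauchy r₁ q z else F z + c.cauchy r₃ q z with hf
  have hcol : ∀ j w, r₁ < ‖w‖ → ‖w‖ < c.R⁻¹ →
      f (c.ψ j w) = p j w + c.cauchy r₁ q (c.ψ j w) := by
    intro j w h1 h2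
    have h : ∃ x, P (c.ψ j w) x := ⟨(j, w), h1, h2, rfl⟩
    have hs := h.choose_spec
    obtain ⟨e1, e2⟩ := c.inj _ _ _ ⟨h1R.trans hs.1, hs.2.1⟩ w ⟨h1R.trans h1, h2⟩ hs.2.2
    simp only [hf]
    rw [dif_pos h, e1, e2]
  have hcore : ∀ z ∈ M, (∀ j w, r₃ ≤ ‖w‖ → ‖w‖ ≤ 1 → c.ψ j w ≠ z) →
      f z = F z + c.cauchy r₃ q z := by
    intro z hz hzc
    by_cases h : ∃ x, P z x
    · obtain ⟨⟨j, w⟩, h1, h2, rfl⟩ := h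
      have hwa : w ∈ annulus c.R := ⟨h1R.trans h1, h2⟩
      have hw1 := (c.mem_iff hM hwa).1 hz
      have hw3 : ‖w‖ < r₃ := by
        by_contra! h3
        exact hzc j w h3 hw1.le rfl
      have h0 := cauchy_sub_cauchy ha har hr3 c.one_lt_inv.le hqd (j := j) h1 hw3
      rw [sub_eq_iff_eq_add] at h0
      simp only
      rw [hcol j w h1 h2, h0, ← add_assoc]
      simp only [hq, add_sub_cancel]
    · simp only [hf]
      rw [dif_neg h]
  refine ⟨f, fun z hz => ?_, hcol, ?_, ?_⟩
  · refine DifferentiableAt.differentiableWithinAt ?_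
    by_cases h : ∃ x, P z x
    · obtain ⟨⟨j, w⟩, h1, h2, rfl⟩ := h
      have hwa : w ∈ annulus c.R := ⟨h1R.trans h1, h2⟩
      have hw1 := (c.mem_iff hM hwa).1 hz
      refine c.differentiableAt_of_comp hwa ?_
      have hd : DifferentiableAt ℂ (fun v => p j v + c.cauchy r₁ q (c.ψ j v)) w :=
        ((hp j w ⟨har.trans h1, hw1⟩).differentiableAt (hA.mem_nhds ⟨har.trans h1, hw1⟩)).add
          (differentiableAt_cauchy_comp h1R (by linarith) (hqc r₁ har (by linarith)) h1 h2)
      refine hd.congr_of_eventuallyEq ?_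
      filter_upwards [(isOpen_lt continuous_const continuous_norm).mem_nhds h1,
        (isOpen_lt continuous_norm continuous_const).mem_nhds h2] with v hv1 hv2
      exact hcol j v hv1 hv2
    · have hzn : ∀ j w, r₃ ≤ ‖w‖ → ‖w‖ ≤ 1 → c.ψ j w ≠ z := fun j w h3 h4 he =>
        h ⟨(j, w), by simp only; linarith, by simp only; linarith [c.one_lt_inv], he⟩
      have hd : DifferentiableAt ℂ (fun z => F z + c.cauchy r₃ q z) z :=
        ((hF z hz).differentiableAt (hM.mem_nhds hz)).add
          (differentiableAt_cauchy h3R h3i (hqc r₃ (by linarith) hr3) fun k w hw =>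
            hzn k w (mem_sphere_zero_iff_norm.1 hw).ge
              ((mem_sphere_zero_iff_norm.1 hw).trans_le hr3.le))
      refine hd.congr_of_eventuallyEq ?_
      filter_upwards [hM.mem_nhds hz, (hcomp r₃ h3R).isClosed.isOpen_compl.mem_nhds
        (show z ∈ (⋃ j, c.ψ j '' (closedBall 0 1 \ ball 0 r₃))ᶜ from fun hm => by
          obtain ⟨j, w, hw, he⟩ := mem_iUnion.1 hm
          exact hzn j w (by simpa using hw.2) (by simpa using hw.1) he)] with y hy hyc
      refine hcore y hy fun j w h3 h4 he => hyc (mem_iUnion.2 ⟨j, w, ?_, he⟩)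
      exact ⟨by simpa using h4, by simpa using h3⟩
  · intro s hs hsq j w h2 hw1
    rw [hcol j w (by linarith) (by linarith [c.one_lt_inv]), add_sub_cancel_left]
    refine (hb₁ q s hs hsq _ (mem_iUnion.2 ⟨j, w, ⟨by simpa using hw1, by simpa using h2⟩, rfl⟩)).trans ?_
    gcongr
    exact le_max_left _ _
  · intro s hs hsq z hz
    have hzn : ∀ j w, r₃ ≤ ‖w‖ → ‖w‖ ≤ 1 → c.ψ j w ≠ z := fun j w h3 h4 he =>
      hz.2 (mem_iUnion.2 ⟨j, w, ⟨by linarith, h4.trans_lt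
        ((one_lt_inv₀ (by linarith)).2 (by linarith))⟩, he⟩)
    rw [hcore z (c.core_subset hM (by linarith) (by linarith) hz) hzn, add_sub_cancel_left]
    refine (hb₃ q s hs hsq z hz).trans ?_
    gcongr
    exact le_max_right _ _

/-- Analyticity up to the boundary is checked in the collar coordinates. -/
theorem analyticOnNhd_closure [CompleteSpace E] {f : ℂ → E} (hM : IsOpen M)
    (hf : DifferentiableOn ℂ f M)
    (h : ∀ j, ∀ w ∈ sphere (0 : ℂ) 1, AnalyticAt ℂ (fun v => f (c.ψ j v)) w) :
    AnalyticOnNhd ℂ f (closure M) := by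
  intro z hz
  by_cases hzM : z ∈ M
  · exact hf.analyticAt (hM.mem_nhds hzM)
  · obtain ⟨j, w, hw, rfl⟩ := c.surj z (by rw [hM.frontier_eq]; exact ⟨hz, hzM⟩)
    have hwa := sphere_subset_annulus c.R_pos c.R_lt hw
    rw [Complex.analyticAt_iff_eventually_differentiableAt, ← c.map_nhds j hwa, eventually_map]
    filter_upwards [(h j w hw).eventually_analyticAt, (isOpen_annulus c.R).mem_nhds hwa]
      with v hv hva
    exact c.differentiableAt_of_comp hva hv.differentiableAt

end Collar

section

theorem second_deriv_nonpos_of_isLocalMax {g g' : ℝ → ℝ} {t₀ s : ℝ}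
    (hg : ∀ᶠ t in 𝓝 t₀, HasDerivAt g (g' t) t) (hg' : HasDerivAt g' s t₀) (hmax : IsLocalMax g t₀) :
    s ≤ 0 := by
  by_contra! hs
  have he : deriv g =ᶠ[𝓝 t₀] g' := hg.mono fun t ht => ht.deriv
  have h1 : deriv g t₀ = 0 := hmax.deriv_eq_zero
  have h2 : deriv (deriv g) t₀ = s := by
    rw [he.deriv_eq]
    exact hg'.deriv
  have hmin : IsLocalMin g t₀ := isLocalMin_of_deriv_deriv_pos (by rw [h2]; exact hs) h1
    hg.self_of_nhds.continuousAt
  have hc : g =ᶠ[𝓝 t₀] fun _ => g t₀ := by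
    filter_upwards [hmin, hmax] with t h3 h4
    exact le_antisymm h4 h3
  have h5 : deriv g =ᶠ[𝓝 t₀] fun _ => 0 := by
    filter_upwards [hc.eventuallyEq_nhds] with t ht
    rw [ht.deriv_eq, deriv_const]
  rw [h5.deriv_eq, deriv_const] at h2
  exact hs.ne h2

variable {E : Type*} [NormedAddCommGroup E] [NormedSpace ℂ E]

theorem hasDerivAt_comp_line {f : ℂ → E} {z₀ e : ℂ} {t : ℝ} {f' : E}
    (hf : HasDerivAt f f' (z₀ + t * e)) :
    HasDerivAt (fun t : ℝ => f (z₀ + t * e)) (e • f') t := by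
  have h1 : HasDerivAt (fun t : ℝ => z₀ + t * e) e t := by
    simpa using ((hasDerivAt_id (t : ℂ)).comp_ofReal.mul_const e).const_add z₀
  exact hf.scomp t h1

/-- The Levi form of `ρ` is positive definite at every point of `U`. -/
def IsStrictPsh (ρ : E → ℝ) (U : Set E) : Prop := ∀ z ∈ U, ∀ w : E, w ≠ 0 → 0 < levi ρ z w

/-- The sum of the second derivatives of `ρ ∘ f` in the two coordinate directions is `4 levi`. -/
theorem levi_comp_nonpos [CompleteSpace E] {ρ : E → ℝ} {f : ℂ → E} {z₀ : ℂ} {κ : ℝ}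
    (hρ : ContDiffAt ℝ 2 ρ (f z₀)) (hf : AnalyticAt ℂ f z₀)
    (hmax : IsLocalMax (fun z => ρ (f z) + κ * ‖z‖ ^ 2) z₀) :
    levi ρ (f z₀) (deriv f z₀) + κ ≤ 0 := by
  have key : ∀ e : ℂ, ‖e‖ = 1 → D2 ρ (f z₀) (e • deriv f z₀) (e • deriv f z₀) +
      fderiv ℝ ρ (f z₀) (e • e • deriv (deriv f) z₀) + 2 * κ ≤ 0 := by
    intro e he
    have hline : ContinuousAt (fun t : ℝ => z₀ + t * e) 0 := by fun_prop
    have hline0 : z₀ + ((0 : ℝ) : ℂ) * e = z₀ := by simp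
    have hlt : Tendsto (fun t : ℝ => z₀ + t * e) (𝓝 0) (𝓝 z₀) := by
      have := hline.tendsto
      rwa [hline0] at this
    have hρe : ∀ᶠ y in 𝓝 (f z₀), DifferentiableAt ℝ ρ y :=
      (hρ.eventually (by simp)).mono fun y hy => hy.differentiableAt (by norm_num)
    have hn : ∀ t : ℝ, HasDerivAt (fun t : ℝ => κ * ‖z₀ + t * e‖ ^ 2)
        (κ * (2 * inner ℝ (z₀ + t * e) e)) t := fun t =>
      (((hasDerivAt_comp_line (f := fun z => z) (hasDerivAt_id _)).congr_deriv
        (by simp)).norm_sq).const_mul κ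
    refine second_deriv_nonpos_of_isLocalMax (t₀ := 0)
      (g := fun t : ℝ => ρ (f (z₀ + t * e)) + κ * ‖z₀ + t * e‖ ^ 2)
      (g' := fun t : ℝ => fderiv ℝ ρ (f (z₀ + t * e)) (e • deriv f (z₀ + t * e)) +
        κ * (2 * inner ℝ (z₀ + t * e) e)) ?_ ?_ ?_
    · filter_upwards [hlt.eventually hf.eventually_analyticAt,
        hlt.eventually (hf.continuousAt.eventually hρe)] with t h1 h2
      exact (h2.hasFDerivAt.comp_hasDerivAt t
        (hasDerivAt_comp_line h1.differentiableAt.hasDerivAt)).add (hn t)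
    · refine HasDerivAt.add ?_ ?_
      · have hD : HasFDerivAt (fderiv ℝ ρ) (fderiv ℝ (fderiv ℝ ρ) (f z₀))
            (f (z₀ + (0 : ℝ) * e)) := by
          rw [hline0]
          exact ((hρ.fderiv_right (m := 1) (by norm_num)).differentiableAt (by norm_num)).hasFDerivAt
        have hfd : HasDerivAt f (deriv f z₀) (z₀ + (0 : ℝ) * e) := by
          rw [hline0]
          exact hf.differentiableAt.hasDerivAt
        have hfd' : HasDerivAt (deriv f) (deriv (deriv f) z₀) (z₀ + (0 : ℝ) * e) := by
          rw [hline0]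
          exact hf.deriv.differentiableAt.hasDerivAt
        have hc : HasDerivAt (fun t : ℝ => fderiv ℝ ρ (f (z₀ + t * e)))
            (fderiv ℝ (fderiv ℝ ρ) (f z₀) (e • deriv f z₀)) 0 :=
          HasFDerivAt.comp_hasDerivAt (f := fun t : ℝ => f (z₀ + t * e)) (0 : ℝ) hD
            (hasDerivAt_comp_line hfd)
        have hu : HasDerivAt (fun t : ℝ => e • deriv f (z₀ + t * e))
            (e • e • deriv (deriv f) z₀) 0 := (hasDerivAt_comp_line hfd').const_smul e
        have := hc.clm_apply hu
        simp only [hline0] at this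
        exact this
      · have h1 : HasDerivAt (fun t : ℝ => inner ℝ (z₀ + t * e) e) (inner ℝ e e) 0 := by
          have := (hasDerivAt_comp_line (f := fun z => z) (z₀ := z₀) (e := e) (t := 0)
            (hasDerivAt_id _)).inner ℝ (hasDerivAt_const (0 : ℝ) e)
          simpa using this
        refine ((h1.const_mul 2).const_mul κ).congr_deriv ?_
        rw [real_inner_self_eq_norm_sq, he]
        ring
    · filter_upwards [hlt.eventually hmax] with t ht
      simp only [hline0]
      exact ht
  have h1 := key 1 (by simp)
  have h2 := key I (by simp)
  simp only [one_smul, smul_smul, I_mul_I, neg_smul, map_neg] at h1 h2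
  unfold levi
  linarith

variable [CompleteSpace E] {M : Set ℂ} {ρ : E → ℝ} {U : Set E} {f : ℂ → E}

theorem comp_le_of_frontier (hM : IsOpen M) (hMb : IsBounded M) (hU : IsOpen U)
    (hρ : ContDiffOn ℝ 2 ρ U) (hpsh : IsStrictPsh ρ U)
    (hfc : ContinuousOn f (closure M)) (hfd : DifferentiableOn ℂ f M)
    (hfU : MapsTo f (closure M) U) {s : ℝ} (hs : ∀ x ∈ frontier M, ρ (f x) ≤ s) :
    ∀ x ∈ closure M, ρ (f x) ≤ s := by
  obtain ⟨B, hB0, hB⟩ := hMb.closure.exists_pos_norm_le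
  have key : ∀ κ > 0, ∀ x ∈ closure M, ρ (f x) ≤ s + κ * B ^ 2 := by
    intro κ hκ x hx
    have hc : ContinuousOn (fun z => ρ (f z) + κ * ‖z‖ ^ 2) (closure M) :=
      (hρ.continuousOn.comp hfc hfU).add (by fun_prop)
    obtain ⟨z₀, hz₀, hmax⟩ := hMb.isCompact_closure.exists_isMaxOn ⟨x, hx⟩ hc
    have hfr : z₀ ∈ frontier M := by
      rw [hM.frontier_eq]
      refine ⟨hz₀, fun hz₀M => ?_⟩
      have hnh : closure M ∈ 𝓝 z₀ := mem_of_superset (hM.mem_nhds hz₀M) subset_closure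
      have h := levi_comp_nonpos (κ := κ) (hρ.contDiffAt (hU.mem_nhds (hfU hz₀)))
        (hfd.analyticAt (hM.mem_nhds hz₀M)) (hmax.isLocalMax hnh)
      have h0 : 0 ≤ levi ρ (f z₀) (deriv f z₀) := by
        by_cases hd : deriv f z₀ = 0
        · simp [levi, D2, hd]
        · exact (hpsh _ (hfU hz₀) _ hd).le
      linarith
    have h1 := hmax hx
    simp only [mem_ofPred_eq] at h1
    have h2 := hs z₀ hfr
    have h3 : κ * ‖z₀‖ ^ 2 ≤ κ * B ^ 2 := by
      gcongr
      exact hB z₀ hz₀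
    have h4 : 0 ≤ κ * ‖x‖ ^ 2 := by positivity
    linarith
  intro x hx
  refine le_of_forall_pos_le_add fun η hη => ?_
  have := key (η / B ^ 2) (by positivity) x hx
  rwa [div_mul_cancel₀ _ (by positivity)] at this

theorem comp_lt_of_frontier (hM : IsOpen M) (hMb : IsBounded M) (hU : IsOpen U)
    (hρ : ContDiffOn ℝ 2 ρ U) (hpsh : IsStrictPsh ρ U)
    (hfc : ContinuousOn f (closure M)) (hfd : DifferentiableOn ℂ f M)
    (hfU : MapsTo f (closure M) U) {s : ℝ} (hs : ∀ x ∈ frontier M, ρ (f x) ≤ s)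
    (himm : ∀ x ∈ M, deriv f x ≠ 0) : ∀ x ∈ M, ρ (f x) < s := by
  have h := comp_le_of_frontier hM hMb hU hρ hpsh hfc hfd hfU hs
  intro x hx
  refine (h x (subset_closure hx)).lt_of_ne fun he => ?_
  have hmax : IsLocalMax (fun z => ρ (f z) + 0 * ‖z‖ ^ 2) x := by
    filter_upwards [hM.mem_nhds hx] with y hy
    simp only [zero_mul, add_zero]
    rw [he]
    exact h y (subset_closure hy)
  have h1 := levi_comp_nonpos (hρ.contDiffAt (hU.mem_nhds (hfU (subset_closure hx))))
    (hfd.analyticAt (hM.mem_nhds hx)) hmax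
  have h2 := hpsh _ (hfU (subset_closure hx)) _ (himm x hx)
  linarith

theorem norm_sub_le_of_frontier {f g : ℂ → E} (hMb : IsBounded M)
    (hfc : ContinuousOn f (closure M)) (hfd : DifferentiableOn ℂ f M)
    (hgc : ContinuousOn g (closure M)) (hgd : DifferentiableOn ℂ g M) {s : ℝ}
    (h : ∀ x ∈ frontier M, ‖g x - f x‖ ≤ s) : ∀ x ∈ closure M, ‖g x - f x‖ ≤ s := fun _ hx =>
  Complex.norm_le_of_forall_mem_frontier_norm_le (f := fun x => g x - f x) hMb
    ⟨hgd.sub hfd, hgc.sub hfc⟩ h hx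

/-- A small perturbation whose boundary values lie in a sublevel set stays in it. -/
theorem exists_stability [ProperSpace E] {Ω : Set E} (hM : IsOpen M) (hMb : IsBounded M)
    (hU : IsOpen U) (hρ : ContDiffOn ℝ 2 ρ U)
    (hpsh : IsStrictPsh ρ U) (hΩ : IsBounded Ω) (hΩU : closure Ω ⊆ U) :
    ∃ δ > 0, (∀ z ∈ closure Ω, ball z δ ⊆ U) ∧
      ∀ f g : ℂ → E, ContinuousOn f (closure M) → DifferentiableOn ℂ f M →
      MapsTo f (closure M) (closure Ω) → ContinuousOn g (closure M) → DifferentiableOn ℂ g M →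
      (∀ x ∈ frontier M, ‖g x - f x‖ < δ) → ∀ s, (∀ x ∈ frontier M, ρ (g x) ≤ s) →
      ∀ x ∈ closure M, g x ∈ U ∧ ρ (g x) ≤ s := by
  obtain ⟨δ, hδ, hth⟩ := hΩ.isCompact_closure.exists_thickening_subset_open hU hΩU
  have hb : ∀ z ∈ closure Ω, ball z δ ⊆ U := fun z hz =>
    (ball_subset_thickening hz δ).trans hth
  refine ⟨δ / 2, by linarith, fun z hz => (ball_subset_ball (by linarith)).trans (hb z hz), ?_⟩
  intro f g hfc hfd hfΩ hgc hgd hgf s hs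
  have hcl := norm_sub_le_of_frontier hMb hfc hfd hgc hgd (s := δ / 2) fun x hx => (hgf x hx).le
  have hgU : MapsTo g (closure M) U := fun x hx =>
    hb _ (hfΩ hx) (by rw [mem_ball, dist_eq_norm]; linarith [hcl x hx])
  exact fun x hx => ⟨hgU hx, comp_le_of_frontier hM hMb hU hρ hpsh hgc hgd hgU hs x hx⟩

end

section

variable {E : Type*} [NormedAddCommGroup E] [InnerProductSpace ℂ E] [FiniteDimensional ℂ E]

theorem exists_common_kernel (hE : 3 ≤ Module.finrank ℂ E) (f g : E →ₗ[ℂ] ℂ) :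
    ∃ u, u ≠ 0 ∧ f u = 0 ∧ g u = 0 := by
  have h : LinearMap.ker (f.prod g) ≠ ⊥ := LinearMap.ker_ne_bot_of_finrank_lt (by
    rw [Module.finrank_prod, Module.finrank_self]
    omega)
  obtain ⟨u, hu, hu0⟩ := Submodule.exists_mem_ne_zero_of_ne_bot h
  have h0 := LinearMap.mem_ker.1 hu
  exact ⟨u, hu0, congrArg Prod.fst h0, congrArg Prod.snd h0⟩

theorem exists_sq_eq (a : ℂ) : ∃ b : ℂ, b ^ 2 = a := IsAlgClosed.exists_pow_nat_eq a two_pos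

/-- A quadratic form has a null vector in the kernel of a linear form, in dimension three. -/
theorem exists_null_vector (hE : 3 ≤ Module.finrank ℂ E) (l : E →ₗ[ℂ] ℂ)
    (Q : E →ₗ[ℂ] E →ₗ[ℂ] ℂ) (hQ : ∀ u v, Q u v = Q v u) :
    ∃ v, ‖v‖ = 1 ∧ l v = 0 ∧ Q v v = 0 := by
  suffices ∃ v, v ≠ 0 ∧ l v = 0 ∧ Q v v = 0 by
    obtain ⟨v, hv, h1, h2⟩ := this
    refine ⟨((‖v‖ : ℂ)⁻¹) • v, ?_, by simp [h1], by simp [h2]⟩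
    rw [norm_smul, norm_inv, norm_real, norm_norm, inv_mul_cancel₀ (norm_ne_zero_iff.2 hv)]
  obtain ⟨b, hb, hlb, -⟩ := exists_common_kernel hE l 0
  by_cases hbb : Q b b = 0
  · exact ⟨b, hb, hlb, hbb⟩
  obtain ⟨a, ha, hla, hba⟩ := exists_common_kernel hE l (Q b)
  obtain ⟨t, ht⟩ := exists_sq_eq (-(Q a a) / Q b b)
  refine ⟨a + t • b, fun h => ?_, by simp [hla, hlb], ?_⟩
  · have h1 : Q b (a + t • b) = 0 := by rw [h, map_zero]
    rw [map_add, map_smul, hba, zero_add, smul_eq_mul, mul_eq_zero] at h1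
    have ht0 : t = 0 := h1.resolve_right hbb
    rw [ht0, zero_smul, add_zero] at h
    exact ha h
  · simp only [map_add, map_smul, LinearMap.add_apply, LinearMap.smul_apply, smul_eq_mul]
    rw [hQ a b, hba]
    rw [eq_div_iff hbb] at ht
    linear_combination ht

theorem joinedIn_null_of_isotropic {Q : E →ₗ[ℂ] E →ₗ[ℂ] ℂ} (hQ : ∀ u v, Q u v = Q v u)
    {a b : E} (ha : a ≠ 0) (hb : b ≠ 0) (haa : Q a a = 0) (hbb : Q b b = 0) (hab : Q a b = 0) :
    JoinedIn {v | v ≠ 0 ∧ Q v v = 0} a b := by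
  set S : Submodule ℂ E := Submodule.span ℂ {a, b} with hS
  have haS : a ∈ S := Submodule.subset_span (by simp)
  have hbS : b ∈ S := Submodule.subset_span (by simp)
  have hr : 1 < Module.rank ℝ S := by
    have h1 : 1 ≤ Module.finrank ℂ S := by
      rw [Nat.one_le_iff_ne_zero, ne_eq, Submodule.finrank_eq_zero]
      intro h
      rw [h, Submodule.mem_bot] at haS
      exact ha haS
    have h2 := finrank_real_of_complex S
    have : FiniteDimensional ℝ S := FiniteDimensional.complexToReal S
    rw [← Module.finrank_eq_rank]
    exact_mod_cast (by omega : 1 < Module.finrank ℝ S)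
  have hp := isPathConnected_compl_singleton_of_one_lt_rank hr (0 : S)
  have hj := hp.joinedIn ⟨a, haS⟩ (by simpa [Subtype.ext_iff] using ha) ⟨b, hbS⟩
    (by simpa [Subtype.ext_iff] using hb)
  have hm := hj.map (f := ((↑) : S → E)) continuous_subtype_val
  refine hm.mono ?_
  rintro _ ⟨v, hv, rfl⟩
  refine ⟨by simpa using hv, ?_⟩
  obtain ⟨x, y, hxy⟩ := Submodule.mem_span_pair.1 v.2
  rw [← hxy]
  simp [haa, hbb, hab, hQ b a]

/-- The null cone of a quadratic form is path connected in dimension three. -/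
theorem joinedIn_null (hE : 3 ≤ Module.finrank ℂ E) {Q : E →ₗ[ℂ] E →ₗ[ℂ] ℂ}
    (hQ : ∀ u v, Q u v = Q v u) {a b : E} (ha : a ≠ 0) (hb : b ≠ 0) (haa : Q a a = 0)
    (hbb : Q b b = 0) : JoinedIn {v | v ≠ 0 ∧ Q v v = 0} a b := by
  by_cases hab : Q a b = 0
  · exact joinedIn_null_of_isotropic hQ ha hb haa hbb hab
  obtain ⟨u, hu, hau, hbu⟩ := exists_common_kernel hE (Q a) (Q b)
  by_cases huu : Q u u = 0
  · exact (joinedIn_null_of_isotropic hQ ha hu haa huu hau).trans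
      (joinedIn_null_of_isotropic hQ hb hu hbb huu hbu).symm
  obtain ⟨μ, hμ⟩ := exists_sq_eq (-(2 * Q a b) / Q u u)
  rw [eq_div_iff huu] at hμ
  have hμ0 : μ ≠ 0 := fun h => hab (by
    rw [h] at hμ
    linear_combination (1 / 2 : ℂ) * hμ)
  refine JoinedIn.ofLine (f := fun t : ℝ => ((1 - t : ℝ) : ℂ) • a + (t : ℂ) • b +
    ((Real.sqrt (t * (1 - t)) : ℂ) * μ) • u) ?_ (by simp) (by simp) ?_
  · refine Continuous.continuousOn ?_
    fun_prop
  · rintro _ ⟨t, ht, rfl⟩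
    have hsq : (Real.sqrt (t * (1 - t)) : ℂ) ^ 2 = t * (1 - t) := by
      rw [← ofReal_pow, Real.sq_sqrt (mul_nonneg ht.1 (by linarith [ht.2]))]
      push_cast
      ring
    refine ⟨fun h => ?_, ?_⟩
    · have h1 : Q u (((1 - t : ℝ) : ℂ) • a + (t : ℂ) • b +
        ((Real.sqrt (t * (1 - t)) : ℂ) * μ) • u) = 0 := by
        simp only at h
        rw [h, map_zero]
      simp only [map_add, map_smul, smul_eq_mul, hQ u a, hQ u b, hau, hbu, mul_zero, zero_add,
        mul_eq_zero, hμ0, huu, or_false] at h1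
      rw [h1] at hsq
      have hsq' : (t : ℂ) * (1 - t) = 0 := by rw [← hsq]; ring
      rcases mul_eq_zero.1 hsq' with h0 | h0
      · simp only [h1, h0] at h
        have : t = 0 := by exact_mod_cast h0
        simp [this] at h
        exact ha h
      · have : t = 1 := by
          have : (t : ℂ) = 1 := by linear_combination -h0
          exact_mod_cast this
        simp [this] at h
        exact hb h
    · simp only [map_add, map_smul, LinearMap.add_apply, LinearMap.smul_apply, smul_eq_mul,
        haa, hbb, hau, hbu, hQ b a, hQ u a, hQ u b]
      push_cast
      linear_combination (μ ^ 2 * Q u u) * hsq + (t : ℂ) * (1 - t) * hμ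

/-- The second coordinate of the quadratic disc removes the quadratic term of the polynomial. -/
def goodDiscs (κ s₁ s₂ : ℝ) (l : E →L[ℂ] ℂ) (Q : E →ₗ[ℂ] E →ₗ[ℂ] ℂ) : Set (E × E) :=
  {p | ‖p.1‖ + ‖p.2‖ ≤ 2 * s₂ ∧ ∀ ζ : ℂ, ‖ζ‖ = 1 → s₁ / 2 ≤ ‖ζ • p.1 + ζ ^ 2 • p.2‖ ∧
    ‖l (ζ • p.1 + ζ ^ 2 • p.2) + Q (ζ • p.1 + ζ ^ 2 • p.2) (ζ • p.1 + ζ ^ 2 • p.2)‖ ≤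
      κ * ‖ζ • p.1 + ζ ^ 2 • p.2‖ ^ 2}

theorem one_lt_rank_ker (hE : 3 ≤ Module.finrank ℂ E) (l : E →L[ℂ] ℂ) :
    1 < Module.rank ℝ (LinearMap.ker (l : E →ₗ[ℂ] ℂ)) := by
  set S : Submodule ℂ E := LinearMap.ker (l : E →ₗ[ℂ] ℂ) with hS
  have h1 : 2 ≤ Module.finrank ℂ S := by
    have h1 := LinearMap.finrank_range_add_finrank_ker (l : E →ₗ[ℂ] ℂ)
    rw [← hS] at h1
    have h2 : Module.finrank ℂ (LinearMap.range (l : E →ₗ[ℂ] ℂ)) ≤ 1 :=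
      (Submodule.finrank_le _).trans (by simp)
    omega
  have h2 := finrank_real_of_complex S
  have : FiniteDimensional ℝ S := FiniteDimensional.complexToReal S
  rw [← Module.finrank_eq_rank]
  exact_mod_cast (by omega : 1 < Module.finrank ℝ S)

theorem joinedIn_sphere_ker (hE : 3 ≤ Module.finrank ℂ E) (l : E →L[ℂ] ℂ) {v v' : E}
    (hv : ‖v‖ = 1) (hv' : ‖v'‖ = 1) (hlv : l v = 0) (hlv' : l v' = 0) :
    JoinedIn {x | ‖x‖ = 1 ∧ l x = 0} v v' := by
  have hp := isPathConnected_sphere (one_lt_rank_ker hE l) 0 zero_le_one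
  have hj := hp.joinedIn ⟨v, hlv⟩ (by simpa using hv) ⟨v', hlv'⟩ (by simpa using hv')
  refine (hj.map (f := Subtype.val) continuous_subtype_val).mono ?_
  rintro _ ⟨x, hx, rfl⟩
  exact ⟨by simpa using hx, x.2⟩

theorem joinedIn_ker_ne_zero (hE : 3 ≤ Module.finrank ℂ E) (l : E →L[ℂ] ℂ) {v v' : E}
    (hv : v ≠ 0) (hv' : v' ≠ 0) (hlv : l v = 0) (hlv' : l v' = 0) :
    JoinedIn {x | x ≠ 0 ∧ l x = 0} v v' := by
  have hp := isPathConnected_compl_singleton_of_one_lt_rank (one_lt_rank_ker hE l) 0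
  have hj := hp.joinedIn ⟨v, hlv⟩ (fun h => hv (congrArg Subtype.val h)) ⟨v', hlv'⟩
    (fun h => hv' (congrArg Subtype.val h))
  refine (hj.map (f := Subtype.val) continuous_subtype_val).mono ?_
  rintro _ ⟨x, hx, rfl⟩
  exact ⟨fun h => hx (Subtype.ext h), x.2⟩

theorem exists_joinedIn_goodDiscs (hE : 3 ≤ Module.finrank ℂ E) {C κ s₂ : ℝ} (hC : 0 < C)
    (hκ : 0 < κ) (hs₂ : 0 < s₂) : ∃ s₁, 0 < s₁ ∧ s₁ ≤ s₂ ∧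
      ∀ (l : E →L[ℂ] ℂ) (Q : E →ₗ[ℂ] E →ₗ[ℂ] ℂ), (∀ u v, Q u v = Q v u) →
      (∀ u v, ‖Q u v‖ ≤ C * ‖u‖ * ‖v‖) → ∀ v v', ‖v‖ = 1 → ‖v'‖ = 1 → l v = 0 → l v' = 0 →
      Q v v = 0 → Q v' v' = 0 →
      JoinedIn (goodDiscs κ s₁ s₂ l Q) ((s₁ : ℂ) • v, 0) ((s₁ : ℂ) • v', 0) := by
  set η := κ * s₂ with hη
  have hη0 : 0 < η := by positivity
  obtain ⟨τ, hτ0, hτ1, hτ⟩ : ∃ τ > 0, τ ≤ 1 / 2 ∧ 3 * C * τ ≤ κ / 4 := by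
    refine ⟨min (1 / 2) (κ / (12 * C)), lt_min (by norm_num) (by positivity), min_le_left _ _, ?_⟩
    calc 3 * C * min (1 / 2) (κ / (12 * C)) ≤ 3 * C * (κ / (12 * C)) := by
          gcongr
          exact min_le_right _ _
      _ = κ / 4 := by
          field_simp
          norm_num
  set s₁ := min s₂ (τ * η / C) with hs₁
  have hs₁0 : 0 < s₁ := lt_min hs₂ (by positivity)
  refine ⟨s₁, hs₁0, min_le_left _ _, fun l Q hsymm hQ v v' hv hv' hlv hlv' hQv hQv' => ?_⟩
  have hs₁2 : s₁ ≤ s₂ := min_le_left _ _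
  have hns : ∀ t : ℝ, 0 ≤ t → ∀ x : E, ‖(t : ℂ) • x‖ = t * ‖x‖ := fun t ht x => by
    rw [norm_smul, norm_real, Real.norm_of_nonneg ht]
  by_cases hl : η ≤ ‖l‖
  · obtain ⟨e, hle, hne⟩ : ∃ e, l e = 1 ∧ ‖e‖ ≤ 1 / η := by
      set ν := (InnerProductSpace.toDual ℂ E).symm l with hν
      have hνn : ‖ν‖ = ‖l‖ := LinearIsometryEquiv.norm_map _ _
      have hν0 : 0 < ‖ν‖ := by rw [hνn]; linarith
      have hlν : ∀ x, l x = inner ℂ ν x := fun x => by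
        rw [hν, InnerProductSpace.toDual_symm_apply]
      refine ⟨((‖ν‖ ^ 2 : ℝ) : ℂ)⁻¹ • ν, ?_, ?_⟩
      · rw [map_smul, hlν, inner_self_eq_norm_sq_to_K, smul_eq_mul]
        push_cast
        refine inv_mul_cancel₀ ?_
        exact pow_ne_zero _ (ofReal_ne_zero.2 hν0.ne')
      · rw [norm_smul, norm_inv, norm_real, Real.norm_of_nonneg (by positivity)]
        rw [show (‖ν‖ ^ 2)⁻¹ * ‖ν‖ = 1 / ‖ν‖ by field_simp, hνn]
        exact one_div_le_one_div_of_le hη0 hl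
    have hj := joinedIn_sphere_ker hE l hv hv' hlv hlv'
    have hQc : Continuous fun x => Q x x := by
      have h1 : Continuous fun p : E × E => Q p.1 p.2 := by
        have : Continuous fun x => LinearMap.toContinuousLinearMap (Q x) :=
          ((LinearMap.toContinuousLinearMap : (E →ₗ[ℂ] ℂ) ≃ₗ[ℂ] (E →L[ℂ] ℂ)).toLinearMap ∘ₗ
            Q).continuous_of_finiteDimensional
        exact (this.comp continuous_fst).clm_apply continuous_snd
      exact h1.comp (continuous_id.prodMk continuous_id)
    have hm := hj.map (f := fun x : E => ((s₁ : ℂ) • x, (-((s₁ : ℂ) ^ 2 * Q x x)) • e))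
      ((continuous_const_smul _).prodMk (((continuous_const.mul hQc).neg).smul continuous_const))
    simp only [hQv, hQv', mul_zero, neg_zero, zero_smul] at hm
    refine hm.mono ?_
    rintro _ ⟨x, ⟨hx, hlx⟩, rfl⟩
    set A : E := (s₁ : ℂ) • x with hA
    set B : E := (-((s₁ : ℂ) ^ 2 * Q x x)) • e with hB
    have hAn : ‖A‖ = s₁ := by rw [hA, hns _ hs₁0.le, hx, mul_one]
    have hBn : ‖B‖ ≤ τ * s₁ := by
      rw [hB, norm_smul, norm_neg, norm_mul, norm_pow, norm_real, Real.norm_of_nonneg hs₁0.le]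
      have h1 : ‖Q x x‖ ≤ C := by simpa [hx] using hQ x x
      calc s₁ ^ 2 * ‖Q x x‖ * ‖e‖ ≤ s₁ ^ 2 * C * (1 / η) := by gcongr
        _ = s₁ * (C / η) * s₁ := by ring
        _ ≤ (τ * η / C) * (C / η) * s₁ := by
            gcongr
            exact min_le_right _ _
        _ = τ * s₁ := by field_simp
    have hBn' : ‖B‖ ≤ s₁ / 2 := hBn.trans (by nlinarith)
    refine ⟨by simp only; rw [hAn]; linarith, fun ζ hζ => ?_⟩
    simp only
    have hlow : s₁ / 2 ≤ ‖ζ • A + ζ ^ 2 • B‖ := by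
      have h1 := norm_sub_le_norm_add (ζ • A) (ζ ^ 2 • B)
      rw [norm_smul _ A, norm_smul _ B, norm_pow, hζ, one_pow, one_mul, one_mul, hAn] at h1
      linarith
    refine ⟨hlow, ?_⟩
    have hP : l (ζ • A + ζ ^ 2 • B) + Q (ζ • A + ζ ^ 2 • B) (ζ • A + ζ ^ 2 • B) =
        2 * ζ ^ 3 * Q A B + ζ ^ 4 * Q B B := by
      have h1 : l A = 0 := by rw [hA, map_smul, hlx, smul_zero]
      have h2 : l B = -Q A A := by
        rw [hB, hA, map_smul, hle]
        simp only [map_smul, LinearMap.smul_apply, smul_eq_mul]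
        ring
      simp only [map_add, map_smul, LinearMap.add_apply, LinearMap.smul_apply, smul_eq_mul, h1, h2,
        hsymm B A]
      ring
    rw [hP]
    have h3 : ‖2 * ζ ^ 3 * Q A B + ζ ^ 4 * Q B B‖ ≤ 2 * ‖Q A B‖ + ‖Q B B‖ := by
      refine (norm_add_le _ _).trans ?_
      simp [hζ]
    have h4 : ‖Q A B‖ ≤ C * s₁ * (τ * s₁) := by
      refine (hQ A B).trans ?_
      rw [hAn]
      gcongr
    have h5 : ‖Q B B‖ ≤ C * s₁ * (τ * s₁) := by
      refine (hQ B B).trans ?_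
      gcongr
      linarith
    calc ‖2 * ζ ^ 3 * Q A B + ζ ^ 4 * Q B B‖ ≤ (3 * C * τ) * s₁ ^ 2 := by nlinarith
      _ ≤ κ / 4 * s₁ ^ 2 := by gcongr
      _ = κ * (s₁ / 2) ^ 2 := by ring
      _ ≤ _ := by gcongr
  · have hj := joinedIn_null hE hsymm (a := v) (b := v') (by rw [← norm_ne_zero_iff, hv]; simp)
      (by rw [← norm_ne_zero_iff, hv']; simp) hQv hQv'
    have hscale : ∀ x, ‖x‖ = 1 → l x = 0 → Q x x = 0 →
        JoinedIn (goodDiscs κ s₁ s₂ l Q) ((s₁ : ℂ) • x, 0) ((s₂ : ℂ) • x, 0) := by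
      intro x hx hlx hQx
      refine JoinedIn.ofLine (f := fun t : ℝ => (((s₁ + t * (s₂ - s₁) : ℝ) : ℂ) • x, (0 : E)))
        (Continuous.continuousOn (by fun_prop)) (by simp) (by simp) ?_
      rintro _ ⟨t, ht, rfl⟩
      have h0 : s₁ ≤ s₁ + t * (s₂ - s₁) := by nlinarith [ht.1]
      have h1 : s₁ + t * (s₂ - s₁) ≤ s₂ := by nlinarith [ht.2]
      refine ⟨?_, fun ζ hζ => ?_⟩
      · simp only [norm_zero, add_zero]
        rw [hns _ (by linarith), hx]
        linarith
      · simp only [smul_zero, add_zero]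
        refine ⟨?_, ?_⟩
        · rw [norm_smul, hζ, hns _ (by linarith), hx]
          linarith
        · simp only [map_smul, LinearMap.smul_apply, hlx, hQx, smul_zero, add_zero, norm_zero]
          positivity
    have hmid : JoinedIn (goodDiscs κ s₁ s₂ l Q) ((s₂ : ℂ) • v, 0) ((s₂ : ℂ) • v', 0) := by
      have hm := hj.map_continuousOn (f := fun x : E => (((s₂ * ‖x‖⁻¹ : ℝ) : ℂ) • x, (0 : E))) (by
        refine ContinuousOn.prodMk (ContinuousOn.smul ?_ continuousOn_id) continuousOn_const
        refine continuous_ofReal.comp_continuousOn (continuousOn_const.mul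
          (continuous_norm.continuousOn.inv₀ fun x hx => norm_ne_zero_iff.2 hx.1)))
      simp only [hv, hv', inv_one, mul_one] at hm
      refine hm.mono ?_
      rintro _ ⟨x, ⟨hx, hQx⟩, rfl⟩
      have hn : ‖((s₂ * ‖x‖⁻¹ : ℝ) : ℂ) • x‖ = s₂ := by
        rw [hns _ (by positivity), mul_assoc, inv_mul_cancel₀ (norm_ne_zero_iff.2 hx), mul_one]
      refine ⟨?_, fun ζ hζ => ?_⟩
      · simp only [norm_zero, add_zero]
        rw [hn]
        linarith
      · simp only [smul_zero, add_zero]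
        rw [norm_smul, hn, hζ, one_mul]
        refine ⟨by linarith, ?_⟩
        simp only [map_smul, LinearMap.smul_apply, hQx, smul_zero, add_zero]
        have h1 := l.le_opNorm (((s₂ * ‖x‖⁻¹ : ℝ) : ℂ) • x)
        rw [hn, map_smul] at h1
        rw [norm_smul, hζ, one_mul]
        refine h1.trans ?_
        rw [not_le] at hl
        calc ‖l‖ * s₂ ≤ η * s₂ := by gcongr
          _ = κ * s₂ ^ 2 := by rw [hη]; ring
    exact (hscale v hv hlv hQv).trans (hmid.trans (hscale v' hv' hlv' hQv').symm)

end

section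

variable {E : Type*} [NormedAddCommGroup E] [NormedSpace ℝ E] [FiniteDimensional ℝ E]

theorem exists_bound_fderiv {F : Type*} [NormedAddCommGroup F] [NormedSpace ℝ F] {g : E → F}
    {U K : Set E} (hU : IsOpen U) (hg : ContDiffOn ℝ 1 g U) (hK : IsCompact K) (hKU : K ⊆ U) :
    ∃ C, ∀ z ∈ K, ∃ g' : E →L[ℝ] F, HasFDerivAt g g' z ∧ ‖g'‖ ≤ C := by
  have hg1 : ContDiffOn ℝ 0 (fderiv ℝ g) U := hg.fderiv_of_isOpen hU (by norm_num)
  obtain ⟨C, hC⟩ := hK.exists_bound_of_continuousOn (hg1.continuousOn.mono hKU)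
  exact ⟨C, fun z hz => ⟨fderiv ℝ g z, ((hg.contDiffAt
    (hU.mem_nhds (hKU hz))).differentiableAt (by norm_num)).hasFDerivAt, hC z hz⟩⟩

/-- Uniform Taylor expansion of a `C³` function around a compact set. -/
theorem exists_uniform_taylor {ρ : E → ℝ} {U K : Set E} (hU : IsOpen U) (hρ : ContDiffOn ℝ 3 ρ U)
    (hK : IsCompact K) (hKU : K ⊆ U) : ∃ δ > 0, ∃ C > 0, ∀ z ∈ K, closedBall z δ ⊆ U ∧
      ∀ ξ, ‖ξ‖ ≤ δ → ‖fderiv ℝ ρ (z + ξ)‖ ≤ C ∧ ‖fderiv ℝ (fderiv ℝ ρ) (z + ξ)‖ ≤ C ∧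
        |ρ (z + ξ) - ρ z| ≤ C * ‖ξ‖ ∧
        ‖fderiv ℝ ρ (z + ξ) - fderiv ℝ ρ z - fderiv ℝ (fderiv ℝ ρ) z ξ‖ ≤ C * ‖ξ‖ ^ 2 ∧
        |ρ (z + ξ) - ρ z - fderiv ℝ ρ z ξ - 1 / 2 * fderiv ℝ (fderiv ℝ ρ) z ξ ξ| ≤
          C * ‖ξ‖ ^ 3 := by
  have hP : ProperSpace E := FiniteDimensional.proper ℝ E
  obtain ⟨δ, hδ, hth⟩ := hK.exists_cthickening_subset_open hU hKU
  have hK' : IsCompact (cthickening δ K) := hK.cthickening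
  have hρ1 : ContDiffOn ℝ 2 (fderiv ℝ ρ) U := hρ.fderiv_of_isOpen hU (by norm_num)
  have hρ2 : ContDiffOn ℝ 1 (fderiv ℝ (fderiv ℝ ρ)) U := hρ1.fderiv_of_isOpen hU (by norm_num)
  obtain ⟨C₁, hC₁⟩ := hK'.exists_bound_of_continuousOn (hρ1.continuousOn.mono hth)
  obtain ⟨C₂, hC₂⟩ := hK'.exists_bound_of_continuousOn (E := E →L[ℝ] E →L[ℝ] ℝ)
    (hρ2.continuousOn.mono hth)
  obtain ⟨C₃, hC₃⟩ := exists_bound_fderiv hU hρ2 hK' hth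
  have d0 : ∀ y ∈ U, HasFDerivAt ρ (fderiv ℝ ρ y) y := fun y hy =>
    ((hρ.contDiffAt (hU.mem_nhds hy)).differentiableAt (by norm_num)).hasFDerivAt
  have d1 : ∀ y ∈ U, HasFDerivAt (fderiv ℝ ρ) (fderiv ℝ (fderiv ℝ ρ) y) y := fun y hy =>
    ((hρ1.contDiffAt (hU.mem_nhds hy)).differentiableAt (by norm_num)).hasFDerivAt
  set C := |C₁| + |C₂| + |C₃| + 1 with hC
  have hCpos : 0 < C := by positivity
  have b1 : ∀ y ∈ cthickening δ K, ‖fderiv ℝ ρ y‖ ≤ C := fun y hy =>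
    (hC₁ y hy).trans (by rw [hC]; linarith [le_abs_self C₁, abs_nonneg C₂, abs_nonneg C₃])
  have b2 : ∀ y ∈ cthickening δ K, ‖fderiv ℝ (fderiv ℝ ρ) y‖ ≤ C := fun y hy =>
    (hC₂ y hy).trans (by rw [hC]; linarith [le_abs_self C₂, abs_nonneg C₁, abs_nonneg C₃])
  have hC₃C : C₃ ≤ C := by rw [hC]; linarith [le_abs_self C₃, abs_nonneg C₁, abs_nonneg C₂]
  refine ⟨δ, hδ, C, hCpos, fun z hz => ?_⟩
  have hball : closedBall z δ ⊆ cthickening δ K := closedBall_subset_cthickening hz δ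
  refine ⟨hball.trans hth, fun ξ hξ => ?_⟩
  have hsub : closedBall z ‖ξ‖ ⊆ cthickening δ K := (closedBall_subset_closedBall hξ).trans hball
  have hmem : z + ξ ∈ closedBall z ‖ξ‖ := by simp
  have hz0 : z ∈ closedBall z ‖ξ‖ := by simp
  have hconv := convex_closedBall z ‖ξ‖
  have e1 : ∀ y ∈ closedBall z ‖ξ‖,
      ‖fderiv ℝ (fderiv ℝ ρ) y - fderiv ℝ (fderiv ℝ ρ) z‖ ≤ C * ‖ξ‖ := fun y hy => by
    choose! D hD hDle using hC₃
    have h := hconv.norm_image_sub_le_of_norm_hasFDerivWithin_le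
      (fun x hx => (hD x (hsub hx)).hasFDerivWithinAt)
      (fun x hx => (hDle x (hsub hx)).trans hC₃C) hz0 hy
    refine h.trans ?_
    gcongr
    rwa [mem_closedBall, dist_eq_norm] at hy
  have e2 : ∀ y ∈ closedBall z ‖ξ‖,
      ‖fderiv ℝ ρ y - fderiv ℝ ρ z - fderiv ℝ (fderiv ℝ ρ) z (y - z)‖ ≤ C * ‖ξ‖ * ‖ξ‖ :=
    fun y hy => by
    have h := hconv.norm_image_sub_le_of_norm_hasFDerivWithin_le
      (f := fun x => fderiv ℝ ρ x - fderiv ℝ (fderiv ℝ ρ) z (x - z))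
      (f' := fun x => fderiv ℝ (fderiv ℝ ρ) x - fderiv ℝ (fderiv ℝ ρ) z)
      (fun x hx => ((d1 x (hth (hsub hx))).sub
        ((fderiv ℝ (fderiv ℝ ρ) z).hasFDerivAt.comp x
          ((hasFDerivAt_id x).sub_const z))).hasFDerivWithinAt) e1 hz0 hy
    simp only [sub_self, map_zero, sub_zero] at h
    rw [mem_closedBall, dist_eq_norm] at hy
    rw [sub_right_comm]
    exact h.trans (by gcongr)
  refine ⟨b1 _ (hsub hmem), b2 _ (hsub hmem), ?_, ?_, ?_⟩
  · have h := hconv.norm_image_sub_le_of_norm_hasFDerivWithin_le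
      (fun x hx => (d0 x (hth (hsub hx))).hasFDerivWithinAt) (fun x hx => b1 x (hsub hx)) hz0 hmem
    simpa using h
  · have h := e2 _ hmem
    rw [add_sub_cancel_left] at h
    rwa [pow_two, ← mul_assoc]
  · have hsymm : ∀ a b, fderiv ℝ (fderiv ℝ ρ) z a b = fderiv ℝ (fderiv ℝ ρ) z b a := fun a b =>
      (((hρ.contDiffAt (hU.mem_nhds (hKU hz))).of_le (m := 2) (by norm_num)).isSymmSndFDerivAt
        (by simp)) a b
    have h := hconv.norm_image_sub_le_of_norm_hasFDerivWithin_le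
      (f := fun x => ρ x - fderiv ℝ ρ z (x - z) -
        1 / 2 * fderiv ℝ (fderiv ℝ ρ) z (x - z) (x - z))
      (f' := fun x => fderiv ℝ ρ x - fderiv ℝ ρ z - fderiv ℝ (fderiv ℝ ρ) z (x - z))
      (fun x hx => by
        have hid : HasFDerivAt (fun x => x - z) (ContinuousLinearMap.id ℝ E) x :=
          (hasFDerivAt_id x).sub_const z
        have hlin : HasFDerivAt (fun x => fderiv ℝ (fderiv ℝ ρ) z (x - z))
            (fderiv ℝ (fderiv ℝ ρ) z) x :=
          ((fderiv ℝ (fderiv ℝ ρ) z).hasFDerivAt (x := x - z)).comp x hid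
        have hq := (hlin.clm_apply hid).const_mul (1 / 2)
        have hl : HasFDerivAt (fun x => fderiv ℝ ρ z (x - z)) (fderiv ℝ ρ z) x :=
          ((fderiv ℝ ρ z).hasFDerivAt (x := x - z)).comp x hid
        have := ((d0 x (hth (hsub hx))).sub hl).sub hq
        refine (this.congr_fderiv ?_).hasFDerivWithinAt
        ext v
        simp only [_root_.sub_apply, _root_.smul_apply, _root_.add_apply,
          ContinuousLinearMap.comp_apply, ContinuousLinearMap.flip_apply,
          ContinuousLinearMap.id_apply, smul_eq_mul]
        rw [hsymm v (x - z)]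
        ring) e2 hz0 hmem
    simp only [sub_self, map_zero, add_sub_cancel_left, mul_zero, sub_zero, Real.norm_eq_abs] at h
    calc |ρ (z + ξ) - ρ z - fderiv ℝ ρ z ξ - 1 / 2 * fderiv ℝ (fderiv ℝ ρ) z ξ ξ|
        = |ρ (z + ξ) - fderiv ℝ ρ z ξ - 1 / 2 * fderiv ℝ (fderiv ℝ ρ) z ξ ξ - ρ z| := by
          congr 1
          ring
      _ ≤ C * ‖ξ‖ * ‖ξ‖ * ‖ξ‖ := h
      _ = C * ‖ξ‖ ^ 3 := by ring

end

section

variable {E : Type*} [NormedAddCommGroup E] [NormedSpace ℂ E]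

/-- Twice the complex differential, as a complex linear form. -/
noncomputable def dform [FiniteDimensional ℂ E] (ρ : E → ℝ) (z : E) : E →L[ℂ] ℂ :=
  LinearMap.toContinuousLinearMap
    { toFun := fun w => (fderiv ℝ ρ z w : ℂ) - I * (fderiv ℝ ρ z (I • w) : ℂ)
      map_add' := fun v w => by
        simp only [map_add, smul_add, ofReal_add]
        ring
      map_smul' := fun a w => by
        have h : ∀ w, fderiv ℝ ρ z (a • w) = a.re * fderiv ℝ ρ z w + a.im * fderiv ℝ ρ z (I • w) := by
          intro w
          have : a • w = a.re • w + a.im • (I • w) := by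
            conv_lhs => rw [← re_add_im a, add_smul, mul_smul]
            simp
          rw [this, map_add, map_smul, map_smul, smul_eq_mul, smul_eq_mul]
        have hI : fderiv ℝ ρ z (I • I • w) = -fderiv ℝ ρ z w := by
          rw [smul_smul, I_mul_I, neg_one_smul, map_neg]
        rw [smul_comm I a w, h, h, hI]
        simp only [RingHom.id_apply, smul_eq_mul]
        conv_rhs => rw [← re_add_im a]
        push_cast
        linear_combination ((a.im : ℂ) * (fderiv ℝ ρ z (I • w))) * I_sq }

theorem dform_apply [FiniteDimensional ℂ E] (ρ : E → ℝ) (z w : E) :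
    dform ρ z w = (fderiv ℝ ρ z w : ℂ) - I * (fderiv ℝ ρ z (I • w) : ℂ) := rfl

theorem dform_re [FiniteDimensional ℂ E] (ρ : E → ℝ) (z w : E) :
    (dform ρ z w).re = fderiv ℝ ρ z w := by
  simp [dform_apply]

theorem D2_smul_left (ρ : E → ℝ) (z : E) (a : ℂ) (v w : E) :
    D2 ρ z (a • v) w = a.re * D2 ρ z v w + a.im * D2 ρ z (I • v) w := by
  have : a • v = a.re • v + a.im • (I • v) := by
    conv_lhs => rw [← re_add_im a, add_smul, mul_smul]
    simp
  unfold D2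
  rw [this]
  simp

theorem D2_smul_right (ρ : E → ℝ) (z : E) (a : ℂ) (v w : E) :
    D2 ρ z v (a • w) = a.re * D2 ρ z v w + a.im * D2 ρ z v (I • w) := by
  have : a • w = a.re • w + a.im • (I • w) := by
    conv_lhs => rw [← re_add_im a, add_smul, mul_smul]
    simp
  unfold D2
  rw [this]
  simp

theorem D2_I_I_left (ρ : E → ℝ) (z v w : E) : D2 ρ z (I • I • v) w = -D2 ρ z v w := by
  rw [smul_smul, I_mul_I, neg_one_smul]
  simp [D2]

theorem D2_I_I_right (ρ : E → ℝ) (z v w : E) : D2 ρ z v (I • I • w) = -D2 ρ z v w := by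
  rw [smul_smul, I_mul_I, neg_one_smul]
  simp [D2]

/-- The holomorphic part of the second derivative, as a complex bilinear form. -/
noncomputable def qform (ρ : E → ℝ) (z : E) : E →ₗ[ℂ] E →ₗ[ℂ] ℂ :=
  LinearMap.mk₂ ℂ (fun v w => 1 / 4 * (((D2 ρ z v w - D2 ρ z (I • v) (I • w) : ℝ) : ℂ) -
      I * ((D2 ρ z (I • v) w + D2 ρ z v (I • w) : ℝ) : ℂ)))
    (fun v v' w => by
      simp only [D2, smul_add, map_add, _root_.add_apply]
      push_cast
      ring)
    (fun a v w => by
      simp only [smul_comm I a v, D2_smul_left ρ z a, D2_I_I_left, smul_eq_mul]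
      conv_rhs => rw [← re_add_im a]
      push_cast
      linear_combination (1 / 4 * ((a.im : ℂ) * (D2 ρ z (I • v) w + D2 ρ z v (I • w)))) * I_sq)
    (fun v w w' => by
      simp only [D2, smul_add, map_add]
      push_cast
      ring)
    (fun a v w => by
      simp only [smul_comm I a w, D2_smul_right ρ z a, D2_I_I_right, smul_eq_mul]
      conv_rhs => rw [← re_add_im a]
      push_cast
      linear_combination (1 / 4 * ((a.im : ℂ) * (D2 ρ z (I • v) w + D2 ρ z v (I • w)))) * I_sq)

theorem qform_apply (ρ : E → ℝ) (z v w : E) :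
    qform ρ z v w = 1 / 4 * (((D2 ρ z v w - D2 ρ z (I • v) (I • w) : ℝ) : ℂ) -
      I * ((D2 ρ z (I • v) w + D2 ρ z v (I • w) : ℝ) : ℂ)) := rfl

theorem qform_re (ρ : E → ℝ) (z v : E) :
    (qform ρ z v v).re = 1 / 2 * D2 ρ z v v - levi ρ z v := by
  have h : (qform ρ z v v) = ((1 / 4 * (D2 ρ z v v - D2 ρ z (I • v) (I • v)) : ℝ) : ℂ) +
      ((-1 / 4 * (D2 ρ z (I • v) v + D2 ρ z v (I • v)) : ℝ) : ℂ) * I := by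
    rw [qform_apply]
    push_cast
    ring
  rw [h, levi, add_re, ofReal_re, re_ofReal_mul, I_re]
  ring

theorem D2_comm {ρ : E → ℝ} {z : E} (hρ : ContDiffAt ℝ 2 ρ z) (v w : E) :
    D2 ρ z v w = D2 ρ z w v :=
  (hρ.isSymmSndFDerivAt (by simp)) v w

theorem qform_comm {ρ : E → ℝ} {z : E} (hρ : ContDiffAt ℝ 2 ρ z) (v w : E) :
    qform ρ z v w = qform ρ z w v := by
  rw [qform_apply, qform_apply, D2_comm hρ v w, D2_comm hρ (I • v) (I • w), D2_comm hρ (I • v) w,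
    D2_comm hρ v (I • w), add_comm (D2 ρ z w (I • v))]

theorem norm_D2_le {ρ : E → ℝ} {z : E} (v w : E) :
    |D2 ρ z v w| ≤ ‖fderiv ℝ (fderiv ℝ ρ) z‖ * ‖v‖ * ‖w‖ :=
  (fderiv ℝ (fderiv ℝ ρ) z).le_opNorm₂ v w

theorem norm_qform_le {ρ : E → ℝ} {z : E} (v w : E) :
    ‖qform ρ z v w‖ ≤ ‖fderiv ℝ (fderiv ℝ ρ) z‖ * ‖v‖ * ‖w‖ := by
  have h1 := norm_D2_le (ρ := ρ) (z := z) v w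
  have h2 := norm_D2_le (ρ := ρ) (z := z) (I • v) (I • w)
  have h3 := norm_D2_le (ρ := ρ) (z := z) (I • v) w
  have h4 := norm_D2_le (ρ := ρ) (z := z) v (I • w)
  simp only [norm_smul, norm_I, one_mul] at h2 h3 h4
  rw [qform_apply, norm_mul]
  have h5 := norm_sub_le ((D2 ρ z v w - D2 ρ z (I • v) (I • w) : ℝ) : ℂ)
    (I * ((D2 ρ z (I • v) w + D2 ρ z v (I • w) : ℝ) : ℂ))
  rw [norm_mul, norm_I, one_mul, norm_real, norm_real, Real.norm_eq_abs, Real.norm_eq_abs] at h5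
  have h6 := abs_sub (D2 ρ z v w) (D2 ρ z (I • v) (I • w))
  have h7 := abs_add_le (D2 ρ z (I • v) w) (D2 ρ z v (I • w))
  have h8 : ‖(1 / 4 : ℂ)‖ = 1 / 4 := by norm_num
  rw [h8]
  linarith

theorem levi_smul {ρ : E → ℝ} {z : E} (hρ : ContDiffAt ℝ 2 ρ z) (a : ℂ) (v : E) :
    levi ρ z (a • v) = ‖a‖ ^ 2 * levi ρ z v := by
  unfold levi
  rw [smul_comm I a v]
  simp only [D2_smul_left ρ z a, D2_smul_right ρ z a, D2_I_I_left, D2_I_I_right]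
  rw [D2_comm hρ (I • v) v, ← normSq_eq_norm_sq, normSq_apply]
  ring

theorem continuousOn_D2 {ρ : E → ℝ} {U : Set E} (hU : IsOpen U) (hρ : ContDiffOn ℝ 2 ρ U) :
    ContinuousOn (fun p : E × E × E => D2 ρ p.1 p.2.1 p.2.2) (U ×ˢ univ) := by
  have h1 : ContDiffOn ℝ 1 (fderiv ℝ ρ) U := hρ.fderiv_of_isOpen hU (by norm_num)
  have h2 : ContDiffOn ℝ 0 (fderiv ℝ (fderiv ℝ ρ)) U := h1.fderiv_of_isOpen hU (by norm_num)
  have h3 : ContinuousOn (fun p : E × E × E => fderiv ℝ (fderiv ℝ ρ) p.1) (U ×ˢ univ) :=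
    h2.continuousOn.comp continuousOn_fst fun p hp => hp.1
  exact (h3.clm_apply (by fun_prop)).clm_apply (by fun_prop)

theorem exists_levi_lower_bound [FiniteDimensional ℂ E] {ρ : E → ℝ} {U K : Set E} (hU : IsOpen U)
    (hρ : ContDiffOn ℝ 2 ρ U) (hpsh : IsStrictPsh ρ U)
    (hK : IsCompact K) (hKU : K ⊆ U) : ∃ c > 0, ∀ z ∈ K, ∀ v, c * ‖v‖ ^ 2 ≤ levi ρ z v := by
  have hP : ProperSpace E := FiniteDimensional.proper ℂ E
  have hc : ContinuousOn (fun p : E × E => levi ρ p.1 p.2) (K ×ˢ sphere 0 1) := by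
    have h := continuousOn_D2 hU hρ
    unfold levi
    refine continuousOn_const.mul (ContinuousOn.add ?_ ?_)
    · exact h.comp (f := fun p : E × E => (p.1, p.2, p.2)) (by fun_prop)
        fun p hp => ⟨hKU hp.1, mem_univ _⟩
    · exact h.comp (f := fun p : E × E => (p.1, I • p.2, I • p.2)) (by fun_prop)
        fun p hp => ⟨hKU hp.1, mem_univ _⟩
  obtain ⟨c, hc0, hcle⟩ : ∃ c > 0, ∀ p ∈ K ×ˢ sphere (0 : E) 1, c ≤ levi ρ p.1 p.2 := by
    rcases (K ×ˢ sphere (0 : E) 1).eq_empty_or_nonempty with he | hne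
    · exact ⟨1, one_pos, fun p hp => by simp [he] at hp⟩
    · obtain ⟨p, hp, hmin⟩ := (hK.prod (isCompact_sphere 0 1)).exists_isMinOn hne hc
      refine ⟨levi ρ p.1 p.2, hpsh _ (hKU hp.1) _ fun h => ?_, fun q hq => hmin hq⟩
      have := mem_sphere_zero_iff_norm.1 hp.2
      rw [h, norm_zero] at this
      exact zero_ne_one this
  refine ⟨c, hc0, fun z hz v => ?_⟩
  by_cases hv : v = 0
  · simp [hv, levi, D2]
  have hv0 : 0 < ‖v‖ := norm_pos_iff.2 hv
  have h1 := hcle (z, ((‖v‖⁻¹ : ℝ) : ℂ) • v) ⟨hz, by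
    rw [mem_sphere_zero_iff_norm, norm_smul, norm_real, norm_inv, norm_norm,
      inv_mul_cancel₀ hv0.ne']⟩
  simp only [] at h1
  rw [levi_smul (hρ.contDiffAt (hU.mem_nhds (hKU hz))), norm_real, norm_inv, norm_norm] at h1
  calc c * ‖v‖ ^ 2 ≤ ‖v‖⁻¹ ^ 2 * levi ρ z v * ‖v‖ ^ 2 := by gcongr
    _ = levi ρ z v := by field_simp

end

section

variable {V : Type*} [NormedAddCommGroup V] [NormedSpace ℝ V]

/-- Being joined to `a` inside the fibre is an open condition. -/
theorem eventually_joinedIn {D : ℝ → Set V}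
    (hD : ∀ t, ∀ a ∈ D t, ∀ᶠ p : ℝ × V in 𝓝 (t, a), p.2 ∈ D p.1) {t : ℝ} {a b : V}
    (h : JoinedIn (D t) a b) : ∀ᶠ p : ℝ × V in 𝓝 (t, b), JoinedIn (D p.1) a p.2 := by
  obtain ⟨γ, hγ⟩ := h
  have h1 : ∀ᶠ s in 𝓝 t, ∀ τ, γ τ ∈ D s := by
    have : ∀ᶠ s in 𝓝 t, ∀ τ ∈ (univ : Set unitInterval), γ τ ∈ D s :=
      isCompact_univ.eventually_forall_of_forall_eventually fun τ _ => by
        have hc : ContinuousAt (fun x : ℝ × unitInterval => (x.1, γ x.2)) (t, τ) := by fun_prop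
        exact hc.eventually (hD t _ (hγ τ))
    filter_upwards [this] with s hs τ using hs τ (mem_univ τ)
  have hb : b ∈ D t := by simpa using hγ 1
  have h2 := hD t b hb
  rw [nhds_prod_eq, Filter.eventually_prod_iff] at h2
  obtain ⟨p, hp, q, hq, hpq⟩ := h2
  obtain ⟨r, hr, hball⟩ := Metric.eventually_nhds_iff_ball.1 hq
  have h3 : ∀ᶠ x : ℝ × V in 𝓝 (t, b), x.2 ∈ ball b r :=
    continuousAt_snd.eventually (ball_mem_nhds b hr)
  have h4 : ∀ᶠ x : ℝ × V in 𝓝 (t, b), p x.1 := continuousAt_fst.eventually hp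
  have h5 : ∀ᶠ x : ℝ × V in 𝓝 (t, b), ∀ τ, γ τ ∈ D x.1 :=
    (continuousAt_fst : ContinuousAt Prod.fst ((t, b) : ℝ × V)).eventually h1
  filter_upwards [h3, h4, h5] with x hx3 hx4 hx5
  have j1 : JoinedIn (D x.1) a b := ⟨γ, hx5⟩
  refine j1.trans (JoinedIn.of_segment_subset ?_)
  intro y hy
  exact hpq hx4 (hball y ((convex_ball b r).segment_subset (mem_ball_self hr) hx3 hy))

theorem eventually_joinedIn_fibre {D N : ℝ → Set V}
    (hD : ∀ t, ∀ a ∈ D t, ∀ᶠ p : ℝ × V in 𝓝 (t, a), p.2 ∈ D p.1)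
    (hN : ∀ a b, IsCompact {p : ℝ × V | p.1 ∈ Icc a b ∧ p.2 ∈ N p.1})
    (hND : ∀ t, ∀ a ∈ N t, ∀ b ∈ N t, JoinedIn (D t) a b) {t : ℝ} {a : V} (ha : a ∈ N t) :
    ∀ᶠ s in 𝓝 t, ∀ b ∈ N s, JoinedIn (D s) a b := by
  set O : Set (ℝ × V) := interior {p | JoinedIn (D p.1) a p.2} with hO
  have hc := ((hN (t - 1) (t + 1)).diff (isOpen_interior (s := {p : ℝ × V | JoinedIn (D p.1) a p.2}))
    ).image continuous_fst
  have ht : t ∉ Prod.fst '' ({p : ℝ × V | p.1 ∈ Icc (t - 1) (t + 1) ∧ p.2 ∈ N p.1} \ O) := by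
    rintro ⟨⟨s, b⟩, ⟨⟨-, hb⟩, hn⟩, rfl⟩
    exact hn (mem_interior_iff_mem_nhds.2 (eventually_joinedIn hD (hND _ _ ha _ hb)))
  filter_upwards [hc.isClosed.isOpen_compl.mem_nhds ht,
    Icc_mem_nhds (sub_one_lt t) (lt_add_one t)] with s hs hst b hb
  by_contra hcon
  refine hs ⟨(s, b), ⟨⟨hst, hb⟩, fun h => hcon ?_⟩, rfl⟩
  exact interior_subset (s := {p : ℝ × V | JoinedIn (D p.1) a p.2}) h

theorem exists_extend_section {D : ℝ → Set V}
    (hD : ∀ t, ∀ a ∈ D t, ∀ᶠ p : ℝ × V in 𝓝 (t, a), p.2 ∈ D p.1) {η T T' : ℝ} (hT : T < T')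
    {γ : ℝ → V} (hγ : ContinuousOn γ (Icc η T)) (hηT : η ≤ T) (hγD : ∀ s ∈ Icc η T, γ s ∈ D s)
    {b : V} (hb : ∀ s ∈ Icc T T', b ∈ D s) (hj : JoinedIn (D T) (γ T) b) :
    ∃ γ' : ℝ → V, ContinuousOn γ' (Icc η T') ∧ γ' η = γ η ∧ γ' T' = b ∧
      ∀ s ∈ Icc η T', γ' s ∈ D s := by
  obtain ⟨p, hp⟩ := hj
  have h1 : ∀ᶠ s in 𝓝 T, ∀ τ ∈ (univ : Set unitInterval), p τ ∈ D s :=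
    isCompact_univ.eventually_forall_of_forall_eventually fun τ _ => by
      have hc : ContinuousAt (fun x : ℝ × unitInterval => (x.1, p x.2)) (T, τ) := by fun_prop
      exact hc.eventually (hD T _ (hp τ))
  obtain ⟨e, he, hball⟩ := Metric.eventually_nhds_iff_ball.1 h1
  set κ := min (e / 2) (T' - T) with hκ
  have hκ0 : 0 < κ := lt_min (half_pos he) (sub_pos.2 hT)
  have hκe : κ < e := (min_le_left _ _).trans_lt (half_lt_self he)
  have hκT : κ ≤ T' - T := min_le_right _ _
  refine ⟨fun s => if s ≤ T then γ s else p.extend ((s - T) / κ), ?_, ?_, ?_, ?_⟩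
  · have hu : Icc η T' = Icc η T ∪ Icc T T' := (Icc_union_Icc_eq_Icc hηT hT.le).symm
    rw [hu]
    refine ContinuousOn.union_of_isClosed ?_ ?_ isClosed_Icc isClosed_Icc
    · exact hγ.congr fun s hs => by simp [hs.2]
    · have : ContinuousOn (fun s => p.extend ((s - T) / κ)) (Icc T T') := by fun_prop
      refine this.congr fun s hs => ?_
      rcases hs.1.eq_or_lt with h | h
      · simp [← h]
      · simp [not_le.2 h]
  · simp [hηT]
  · simp only [not_le.2 hT, if_false]
    exact p.extend_of_one_le ((one_le_div hκ0).2 hκT)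
  · intro s hs
    by_cases h : s ≤ T
    · simp only [h, if_true]
      exact hγD s ⟨hs.1, h⟩
    · simp only [h, if_false]
      push Not at h
      by_cases h2 : s - T < κ
      · have hmem : (s - T) / κ ∈ unitInterval :=
          ⟨div_nonneg (sub_nonneg.2 h.le) hκ0.le, (div_le_one hκ0).2 h2.le⟩
        rw [p.extend_apply hmem]
        refine hball s ?_ _ (mem_univ _)
        rw [mem_ball, Real.dist_eq, abs_of_pos (sub_pos.2 h)]
        linarith
      · rw [p.extend_of_one_le ((one_le_div hκ0).2 (not_lt.1 h2))]
        exact hb s ⟨h.le, hs.2⟩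

/-- A periodic family of fibrewise open sets containing a compact family of nonempty sets, any two
points of which can be joined in the fibre, has a periodic section. -/
theorem exists_periodic_section {D N : ℝ → Set V}
    (hD : ∀ t, ∀ a ∈ D t, ∀ᶠ p : ℝ × V in 𝓝 (t, a), p.2 ∈ D p.1)
    (hN : ∀ a b, IsCompact {p : ℝ × V | p.1 ∈ Icc a b ∧ p.2 ∈ N p.1})
    (hne : ∀ t, (N t).Nonempty)
    (hND : ∀ t, ∀ a ∈ N t, ∀ b ∈ N t, JoinedIn (D t) a b) {p : ℝ} (hp : 0 < p)
    (hDp : ∀ t, D (t + p) = D t) (hNp : ∀ t, N (t + p) = N t) :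
    ∃ η, ∃ γ : ℝ → V, ContinuousOn γ (Icc η (η + p)) ∧ γ (η + p) = γ η ∧
      ∀ s ∈ Icc η (η + p), γ s ∈ D s := by
  choose a ha using hne
  have hO := fun t => eventually_joinedIn_fibre hD hN hND (ha t)
  have hmem : ∀ t s, (∀ b ∈ N s, JoinedIn (D s) (a t) b) → a t ∈ D s := fun t s h =>
    (h _ (ha s)).source_mem
  obtain ⟨η₀, hη₀, hη⟩ := Metric.eventually_nhds_iff_ball.1 (hO 0)
  set η := min (η₀ / 2) p with hηdef
  have hη0 : 0 < η := lt_min (half_pos hη₀) hp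
  have hηη : η < η₀ := (min_le_left _ _).trans_lt (half_lt_self hη₀)
  have hηp : η ≤ p := min_le_right _ _
  have hη' : ∀ s ∈ Icc 0 η, ∀ b ∈ N s, JoinedIn (D s) (a 0) b := fun s hs => by
    refine hη s ?_
    rw [mem_ball, Real.dist_eq, sub_zero, abs_of_nonneg hs.1]
    linarith [hs.2]
  choose r hr hrb using fun t => Metric.eventually_nhds_iff_ball.1 (hO t)
  obtain ⟨δ, hδ, hleb⟩ := lebesgue_number_lemma_of_metric (s := Icc η p)
    (c := fun t => ball t (r t)) isCompact_Icc (fun t => isOpen_ball)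
    (fun t _ => mem_iUnion.2 ⟨t, mem_ball_self (hr t)⟩)
  have key : ∀ k : ℕ, ∃ γ : ℝ → V, ContinuousOn γ (Icc η (min (η + k * (δ / 2)) p)) ∧ γ η = a 0 ∧
      (∀ s ∈ Icc η (min (η + k * (δ / 2)) p), γ s ∈ D s) ∧
      ∀ b ∈ N (min (η + k * (δ / 2)) p),
        JoinedIn (D (min (η + k * (δ / 2)) p)) (γ (min (η + k * (δ / 2)) p)) b := by
    intro k
    induction k with
    | zero =>
      have h0 : min (η + (0 : ℕ) * (δ / 2)) p = η := by simp [hηp]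
      rw [h0]
      refine ⟨fun _ => a 0, continuousOn_const, rfl, fun s hs => ?_, hη' η ⟨hη0.le, le_rfl⟩⟩
      have : s = η := le_antisymm hs.2 hs.1
      rw [this]
      exact hmem _ _ (hη' η ⟨hη0.le, le_rfl⟩)
    | succ k ih =>
      obtain ⟨γ, h1, h2, h3, h4⟩ := ih
      set T := min (η + k * (δ / 2)) p with hTdef
      set T' := min (η + (k + 1 : ℕ) * (δ / 2)) p with hTdef'
      have hηT : η ≤ T := le_min (by have : 0 ≤ (k : ℝ) * (δ / 2) := by positivity
                                     linarith) hηp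
      have hTp : T ≤ p := min_le_right _ _
      have hTT : T ≤ T' := by
        refine min_le_min_right _ ?_
        push_cast
        linarith
      have hTT' : T' ≤ T + δ / 2 := by
        rcases min_choice (η + k * (δ / 2)) p with h | h
        · rw [hTdef, h, hTdef']
          refine (min_le_left _ _).trans (le_of_eq ?_)
          push_cast
          ring
        · rw [hTdef, h, hTdef']
          exact (min_le_right _ _).trans (by linarith)
      rcases hTT.eq_or_lt with h | h
      · rw [← h]
        exact ⟨γ, h1, h2, h3, h4⟩
      obtain ⟨i, hi⟩ := hleb T ⟨hηT, hTp⟩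
      have hi' : ∀ s ∈ Icc T T', ∀ b ∈ N s, JoinedIn (D s) (a i) b := fun s hs =>
        hrb i s (hi (by
          rw [mem_ball, Real.dist_eq, abs_of_nonneg (sub_nonneg.2 hs.1)]
          linarith [hs.2]))
      obtain ⟨γ', g1, g2, g3, g4⟩ := exists_extend_section hD h h1 hηT h3
        (fun s hs => hmem _ _ (hi' s hs))
        ((h4 _ (ha T)).trans (hi' T ⟨le_rfl, h.le⟩ _ (ha T)).symm)
      refine ⟨γ', g1, g2.trans h2, g4, ?_⟩
      rw [g3]
      exact hi' T' ⟨h.le, le_rfl⟩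
  obtain ⟨k, hk⟩ := exists_nat_gt (p / (δ / 2))
  obtain ⟨γ, h1, h2, h3, h4⟩ := key k
  have hkp : min (η + k * (δ / 2)) p = p := by
    rw [div_lt_iff₀ (by linarith)] at hk
    exact min_eq_right (by linarith)
  rw [hkp] at h1 h3 h4
  have hN0 : N p = N 0 := by rw [← hNp 0, zero_add]
  obtain ⟨γ', g1, g2, g3, g4⟩ := exists_extend_section (T' := η + p) (b := a 0) hD (by linarith) h1
    hηp h3 (fun s hs => by
      have : D s = D (s - p) := by rw [← hDp (s - p), sub_add_cancel]
      rw [this]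
      exact hmem _ _ (hη' _ ⟨by linarith [hs.1], by linarith [hs.2]⟩))
    (h4 _ (hN0 ▸ ha 0))
  exact ⟨η, γ', g1, by rw [g3, g2, h2], g4⟩

/-- Selection of a continuous section over the unit circle. -/
theorem exists_circle_section {D N : ℂ → Set V}
    (hD : ∀ w ∈ sphere (0 : ℂ) 1, ∀ a ∈ D w, ∀ᶠ p : ℂ × V in 𝓝[sphere 0 1 ×ˢ univ] (w, a),
      p.2 ∈ D p.1)
    (hN : IsCompact {p : ℂ × V | p.1 ∈ sphere (0 : ℂ) 1 ∧ p.2 ∈ N p.1})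
    (hne : ∀ w ∈ sphere (0 : ℂ) 1, (N w).Nonempty)
    (hND : ∀ w ∈ sphere (0 : ℂ) 1, ∀ a ∈ N w, ∀ b ∈ N w, JoinedIn (D w) a b) :
    ∃ σ : ℂ → V, ContinuousOn σ (sphere 0 1) ∧ ∀ w ∈ sphere (0 : ℂ) 1, σ w ∈ D w := by
  set e : ℝ → ℂ := fun t => exp (t * I) with he
  have hes : ∀ t, e t ∈ sphere (0 : ℂ) 1 := fun t => by simp [he, norm_exp_ofReal_mul_I]
  have hec : Continuous e := by fun_prop
  have hep : ∀ t, e (t + 2 * Real.pi) = e t := fun t => by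
    simp only [he]
    push_cast
    rw [add_mul, exp_add, exp_two_pi_mul_I, mul_one]
  obtain ⟨η, γ, h1, h2, h3⟩ := exists_periodic_section (D := fun t => D (e t))
    (N := fun t => N (e t)) (fun t a ha => by
      have h := hD _ (hes t) a ha
      refine (tendsto_nhdsWithin_iff.2 ⟨?_, ?_⟩ : Tendsto (fun p : ℝ × V => (e p.1, p.2))
        (𝓝 (t, a)) (𝓝[sphere 0 1 ×ˢ univ] (e t, a))).eventually h
      · exact ((hec.comp continuous_fst).prodMk continuous_snd).continuousAt
      · exact Eventually.of_forall fun p => ⟨hes _, mem_univ _⟩)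
    (fun a b => by
      have hcomp := (isCompact_Icc (a := a) (b := b)).prod (hN.image continuous_snd)
      have hclosed : IsClosed {p : ℝ × V | (e p.1, p.2) ∈
          {p : ℂ × V | p.1 ∈ sphere (0 : ℂ) 1 ∧ p.2 ∈ N p.1}} :=
        hN.isClosed.preimage ((hec.comp continuous_fst).prodMk continuous_snd)
      refine (hcomp.inter_right hclosed).of_isClosed_subset ?_ ?_
      · have : {p : ℝ × V | p.1 ∈ Icc a b ∧ p.2 ∈ N (e p.1)} = {p | p.1 ∈ Icc a b} ∩
            {p : ℝ × V | (e p.1, p.2) ∈ {p : ℂ × V | p.1 ∈ sphere (0 : ℂ) 1 ∧ p.2 ∈ N p.1}} := by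
          ext p
          exact ⟨fun h => ⟨h.1, hes _, h.2⟩, fun h => ⟨h.1, h.2.2⟩⟩
        rw [this]
        exact (isClosed_Icc.preimage continuous_fst).inter hclosed
      · exact fun p hp => ⟨⟨hp.1, ⟨(e p.1, p.2), ⟨hes _, hp.2⟩, rfl⟩⟩, hes _, hp.2⟩)
    (fun t => hne _ (hes t)) (fun t => hND _ (hes t)) (p := 2 * Real.pi) (by positivity)
    (fun t => by simp only [hep]) (fun t => by simp only [hep])
  have hpos : Fact (0 < 2 * Real.pi) := ⟨by positivity⟩
  set g : AddCircle (2 * Real.pi) → V := AddCircle.liftIco (2 * Real.pi) η γ with hg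
  have hgc : Continuous g := AddCircle.liftIco_continuous h2.symm h1
  set H := AddCircle.homeomorphCircle'
  have hgD : ∀ x : AddCircle (2 * Real.pi), g x ∈ D (H x) := by
    intro x
    obtain ⟨t, ht, rfl⟩ : ∃ t ∈ Ico η (η + 2 * Real.pi), (t : AddCircle (2 * Real.pi)) = x :=
      ⟨_, (AddCircle.equivIco (2 * Real.pi) η x).2, AddCircle.coe_equivIco⟩
    rw [hg, AddCircle.liftIco_coe_apply ht]
    have : ((H (t : AddCircle (2 * Real.pi)) : Circle) : ℂ) = e t := by
      simp [H, he, AddCircle.homeomorphCircle'_apply_mk]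
    rw [this]
    exact h3 t (Ico_subset_Icc_self ht)
  have hcirc : ∀ w ∈ sphere (0 : ℂ) 1, w ∈ Submonoid.unitSphere ℂ := fun w hw => by
    simpa [Submonoid.unitSphere] using hw
  classical
  refine ⟨fun w => if h : w ∈ sphere (0 : ℂ) 1 then
    g (H.symm (⟨w, hcirc w h⟩ : Circle)) else 0, ?_, ?_⟩
  · rw [continuousOn_iff_continuous_domRestrict]
    have : Continuous fun w : sphere (0 : ℂ) 1 => g (H.symm (⟨w, hcirc w w.2⟩ : Circle)) :=
      hgc.comp (H.symm.continuous.comp (Continuous.subtype_mk continuous_subtype_val _))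
    refine this.congr fun w => ?_
    simp only [Set.domRestrict, w.2, dite_true]
  · intro w hw
    simp only [hw, dite_true]
    have h := hgD (H.symm (⟨w, hcirc w hw⟩ : Circle))
    rwa [H.apply_symm_apply (⟨w, hcirc w hw⟩ : Circle)] at h

end

section

/-- Scalar continuous functions on the circle are uniformly approximated by Laurent polynomials. -/
theorem exists_laurent_approx_scalar {σ : ℂ → ℂ} (hσ : ContinuousOn σ (sphere 0 1)) {ε : ℝ}
    (hε : 0 < ε) : ∃ (n : ℕ) (P : ℂ → ℂ), Differentiable ℂ P ∧
      ∀ w ∈ sphere (0 : ℂ) 1, ‖(w ^ n)⁻¹ * P w - σ w‖ < ε := by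
  have hpos : Fact (0 < 2 * Real.pi) := ⟨by positivity⟩
  have hH : ∀ x : AddCircle (2 * Real.pi), (x.toCircle : ℂ) ∈ sphere (0 : ℂ) 1 := fun x => by
    rw [mem_sphere_zero_iff_norm, Circle.norm_coe]
  set f : C(AddCircle (2 * Real.pi), ℂ) := ⟨fun x => σ x.toCircle,
    hσ.comp_continuous (by fun_prop) hH⟩ with hf
  have hmem : f ∈ (Submodule.span ℂ (range (fourier (T := 2 * Real.pi)))).topologicalClosure := by
    rw [span_fourier_closure_eq_top]
    trivial
  rw [← SetLike.mem_coe, Submodule.topologicalClosure_coe, Metric.mem_closure_iff] at hmem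
  obtain ⟨g, hg, hfg⟩ := hmem ε hε
  have key : ∃ (n : ℕ) (P : ℂ → ℂ), Differentiable ℂ P ∧
      ∀ x : AddCircle (2 * Real.pi), g x = ((x.toCircle : ℂ) ^ n)⁻¹ * P x.toCircle := by
    rw [SetLike.mem_coe] at hg
    clear hfg
    induction hg using Submodule.span_induction with
    | mem g hg =>
      obtain ⟨k, rfl⟩ := hg
      obtain ⟨n, rfl | rfl⟩ := k.eq_nat_or_neg
      · exact ⟨0, fun w => w ^ n, by fun_prop, fun x => by
          simp [fourier_apply, AddCircle.toCircle_nsmul]⟩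
      · exact ⟨n, fun _ => 1, by fun_prop, fun x => by
          simp [fourier_apply, AddCircle.toCircle_neg, AddCircle.toCircle_nsmul]⟩
    | zero => exact ⟨0, fun _ => 0, by fun_prop, fun x => by simp⟩
    | add g g' _ _ ih ih' =>
      obtain ⟨n, P, hP, h⟩ := ih
      obtain ⟨n', P', hP', h'⟩ := ih'
      refine ⟨n + n', fun w => w ^ n' * P w + w ^ n * P' w, by fun_prop, fun x => ?_⟩
      have hx : (x.toCircle : ℂ) ≠ 0 := Circle.coe_ne_zero _
      rw [ContinuousMap.add_apply, h, h', pow_add]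
      field_simp
    | smul a g _ ih =>
      obtain ⟨n, P, hP, h⟩ := ih
      exact ⟨n, fun w => a * P w, by fun_prop, fun x => by
        rw [ContinuousMap.smul_apply, h, smul_eq_mul]; ring⟩
  obtain ⟨n, P, hP, h⟩ := key
  refine ⟨n, P, hP, fun w hw => ?_⟩
  obtain ⟨x, hxw⟩ : ∃ x : AddCircle (2 * Real.pi), (x.toCircle : ℂ) = w := by
    refine ⟨(arg w : ℝ), ?_⟩
    rw [AddCircle.toCircle_apply_mk, div_self (by positivity), one_mul, Circle.coe_exp]
    have := norm_mul_exp_arg_mul_I w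
    rwa [mem_sphere_zero_iff_norm.1 hw, ofReal_one, one_mul] at this
  have h1 := (ContinuousMap.dist_apply_le_dist x).trans_lt hfg
  rw [h, hf, ContinuousMap.coe_mk, hxw, dist_comm, dist_eq_norm] at h1
  exact h1

/-- Continuous functions on the circle are uniformly approximated by Laurent polynomials. -/
theorem exists_laurent_approx {n : ℕ} {σ : ℂ → EuclideanSpace ℂ (Fin n)}
    (hσ : ContinuousOn σ (sphere 0 1)) {ε : ℝ} (hε : 0 < ε) :
    ∃ (m : ℕ) (P : ℂ → EuclideanSpace ℂ (Fin n)), Differentiable ℂ P ∧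
      ∀ w ∈ sphere (0 : ℂ) 1, ‖(w ^ m)⁻¹ • P w - σ w‖ < ε := by
  have hn : (0 : ℝ) < n + 1 := by positivity
  have h : ∀ i, ∃ (m : ℕ) (P : ℂ → ℂ), Differentiable ℂ P ∧
      ∀ w ∈ sphere (0 : ℂ) 1, ‖(w ^ m)⁻¹ * P w - σ w i‖ < ε / (n + 1) := fun i =>
    exists_laurent_approx_scalar (σ := fun w => σ w i)
      ((PiLp.continuous_apply 2 _ i).comp_continuousOn hσ) (by positivity)
  choose m P hP hPw using h
  refine ⟨∑ i, m i, fun w => ∑ i, (w ^ (∑ k, m k - m i) * P i w) • EuclideanSpace.single i 1,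
    by fun_prop, fun w hw => ?_⟩
  have hw0 : w ≠ 0 := ne_zero_of_mem_unit_sphere ⟨w, hw⟩
  have hsum : (w ^ ∑ i, m i)⁻¹ • ∑ i, (w ^ (∑ k, m k - m i) * P i w) •
      EuclideanSpace.single i (1 : ℂ) - σ w =
      ∑ i, ((w ^ m i)⁻¹ * P i w - σ w i) • EuclideanSpace.single i (1 : ℂ) := by
    have h1 : σ w = ∑ i, σ w i • EuclideanSpace.single i (1 : ℂ) := by
      ext j
      simp [Finset.sum_apply, Pi.single_apply]
    conv_lhs => rw [h1]
    rw [Finset.smul_sum, ← Finset.sum_sub_distrib]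
    refine Finset.sum_congr rfl fun i _ => ?_
    rw [smul_smul, ← sub_smul, ← mul_assoc]
    congr 3
    have hle : m i ≤ ∑ k, m k := Finset.single_le_sum (fun _ _ => Nat.zero_le _) (Finset.mem_univ i)
    rw [pow_sub₀ _ hw0 hle]
    field_simp
  rw [hsum]
  calc _ ≤ ∑ i, ‖((w ^ m i)⁻¹ * P i w - σ w i) • EuclideanSpace.single i (1 : ℂ)‖ :=
        norm_sum_le _ _
    _ ≤ ∑ _i : Fin n, ε / (n + 1) := by
        refine Finset.sum_le_sum fun i _ => ?_
        rw [norm_smul, PiLp.norm_single, norm_one, mul_one]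
        exact (hPw i w hw).le
    _ = n * (ε / (n + 1)) := by simp
    _ < ε := by
        rw [mul_div_assoc', div_lt_iff₀ hn]
        linarith

end

namespace Collar

variable {E : Type*} [NormedAddCommGroup E] [NormedSpace ℂ E] {M : Set ℂ} {c : Collar M}

theorem exists_glue_analytic [CompleteSpace E] (hM : IsOpen M) (hMb : IsBounded M)
    {a r₁ r₂ r₃ : ℝ} (ha : c.R ≤ a) (har : a < r₁) (h12 : r₁ < r₂) (h23 : r₂ < r₃) (hr3 : r₃ < 1) :
    ∃ C, 0 < C ∧ ∀ (F : ℂ → E) (p : Fin c.m → ℂ → E) (b : ℝ), 1 < b → DifferentiableOn ℂ F M →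
      (∀ j, DifferentiableOn ℂ (p j) {w | a < ‖w‖ ∧ ‖w‖ < b}) →
      ∃ f : ℂ → E, AnalyticOnNhd ℂ f (closure M) ∧
        (∀ s, 0 ≤ s → (∀ k, ∀ w ∈ sphere (0 : ℂ) r₁, ‖p k w - F (c.ψ k w)‖ ≤ s) →
          ∀ j w, r₂ ≤ ‖w‖ → ‖w‖ ≤ 1 → ‖f (c.ψ j w) - p j w‖ ≤ C * s) ∧
        (∀ s, 0 ≤ s → (∀ k, ∀ w ∈ sphere (0 : ℂ) r₃, ‖p k w - F (c.ψ k w)‖ ≤ s) →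
          ∀ z ∈ c.core r₂, ‖f z - F z‖ ≤ C * s) := by
  obtain ⟨C, hC, h⟩ := exists_glue (E := E) (c := c) hM hMb ha har h12 h23 hr3
  refine ⟨C, hC, fun F p b hb hF hp => ?_⟩
  obtain ⟨f, hf, hf1, hf2, hf3⟩ := h F p hF fun j =>
    (hp j).mono fun w hw => ⟨hw.1, hw.2.trans hb⟩
  refine ⟨f, analyticOnNhd_closure (c := c) hM hf fun j w hw => ?_, hf2, hf3⟩
  rw [mem_sphere_zero_iff_norm] at hw
  set O : Set ℂ := {v | r₁ < ‖v‖ ∧ ‖v‖ < min b c.R⁻¹} with hO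
  have hOo : IsOpen O := (isOpen_lt continuous_const continuous_norm).inter
    (isOpen_lt continuous_norm continuous_const)
  have hwO : w ∈ O := ⟨by linarith, by rw [hw]; exact lt_min hb c.one_lt_inv⟩
  have hq : ∀ k, ContinuousOn (fun v => p k v - F (c.ψ k v)) (sphere 0 r₁) := fun k => by
    refine ContinuousOn.sub ((hp k).continuousOn.mono fun v hv => ?_) (hF.continuousOn.comp
      (c.diff k |>.continuousOn |>.mono fun v hv => ?_) fun v hv => ?_)
    · rw [mem_sphere_zero_iff_norm] at hv
      exact ⟨by linarith, by linarith⟩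
    · rw [mem_sphere_zero_iff_norm] at hv
      exact c.mem_annulus_of (by linarith) (by linarith [c.one_lt_inv]) hv
    · rw [mem_sphere_zero_iff_norm] at hv
      exact c.inside k v (c.mem_annulus_of (by linarith) (by linarith [c.one_lt_inv]) hv)
        (by linarith)
  have hd : DifferentiableOn ℂ (fun v => f (c.ψ j v)) O := by
    have : DifferentiableOn ℂ (fun v => p j v +
        c.cauchy r₁ (fun k w => p k w - F (c.ψ k w)) (c.ψ j v)) O := fun v hv =>
      (((hp j v ⟨by linarith [hv.1], hv.2.trans_le (min_le_left _ _)⟩).mono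
        fun u hu => ⟨by linarith [hu.1], hu.2.trans_le (min_le_left _ _)⟩)).add
        (differentiableAt_cauchy_comp (by linarith) (by linarith) hq hv.1
          (hv.2.trans_le (min_le_right _ _))).differentiableWithinAt
    exact this.congr fun v hv => hf1 j v hv.1 (hv.2.trans_le (min_le_right _ _))
  exact hd.analyticAt (hOo.mem_nhds hwO)

/-- Intermediate radii for gluing which leave a given compact set in the core. -/
theorem exists_radii (c : Collar M) (hM : IsOpen M) {K : Set ℂ} (hK : IsCompact K) (hKM : K ⊆ M) :
    ∃ r₁ r₂ r₃, c.R < r₁ ∧ r₁ < r₂ ∧ r₂ < r₃ ∧ r₃ < 1 ∧ K ⊆ c.core r₂ := by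
  obtain ⟨r, hr, hr1, hrK⟩ := c.exists_subset_core hM hK hKM
  exact ⟨r + (1 - r) / 4, r + (1 - r) / 2, r + 3 * (1 - r) / 4, by linarith, by linarith,
    by linarith, by linarith, hrK _ (by linarith)⟩

/-- Highly oscillating boundary data on the collar can be globalised with small error. -/
theorem exists_globalize [CompleteSpace E] (c : Collar M) (hM : IsOpen M) (hMb : IsBounded M)
    (q : Fin c.m → ℂ → E) (hq : ∀ j, DifferentiableOn ℂ (q j) {0}ᶜ) {K : Set ℂ} (hK : IsCompact K)
    (hKM : K ⊆ M) {ε : ℝ} (hε : 0 < ε) : ∀ᶠ N : ℕ in atTop, ∃ V : ℂ → E,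
      AnalyticOnNhd ℂ V (closure M) ∧
      (∀ j, ∀ w ∈ sphere (0 : ℂ) 1, ‖V (c.ψ j w) - w ^ N • q j w‖ ≤ ε) ∧ ∀ z ∈ K, ‖V z‖ ≤ ε := by
  obtain ⟨r₁, r₂, r₃, h1, h2, h3, h4, hKr⟩ := c.exists_radii hM hK hKM
  have hR := c.R_pos
  obtain ⟨C, hC, hglue⟩ := exists_glue_analytic (E := E) (c := c) hM hMb le_rfl h1 h2 h3 h4
  have hbd : ∀ r, 0 < r → ∃ A, 0 < A ∧ ∀ j, ∀ w ∈ sphere (0 : ℂ) r, ‖q j w‖ ≤ A := by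
    intro r hr
    have : ∀ j, ∃ A, ∀ w ∈ sphere (0 : ℂ) r, ‖q j w‖ ≤ A := fun j =>
      (isCompact_sphere 0 r).exists_bound_of_continuousOn ((hq j).continuousOn.mono fun w hw => by
        rw [mem_sphere_zero_iff_norm] at hw
        exact norm_ne_zero_iff.1 (by rw [hw]; exact hr.ne'))
    choose A hA using this
    refine ⟨1 + ∑ j, |A j|, by positivity, fun j w hw => (hA j w hw).trans ?_⟩
    have := Finset.single_le_sum (f := fun j => |A j|) (fun _ _ => abs_nonneg _)
      (Finset.mem_univ j)
    linarith [le_abs_self (A j)]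
  have hsmall : ∀ r, 0 < r → r < 1 → ∀ᶠ N : ℕ in atTop, ∀ j, ∀ w ∈ sphere (0 : ℂ) r,
      ‖w ^ N • q j w - (0 : ℂ → E) (c.ψ j w)‖ ≤ ε / C := by
    intro r hr hr1
    obtain ⟨A, hA, hAq⟩ := hbd r hr
    have ht := (tendsto_pow_atTop_nhds_zero_of_lt_one hr.le hr1).mul_const A
    rw [zero_mul] at ht
    filter_upwards [ht.eventually_lt_const (div_pos hε hC)] with N hN j w hw
    rw [Pi.zero_apply, sub_zero, norm_smul, norm_pow, mem_sphere_zero_iff_norm.1 hw]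
    refine le_trans ?_ hN.le
    gcongr
    exact hAq j w hw
  filter_upwards [hsmall r₁ (by linarith) (by linarith), hsmall r₃ (by linarith) h4] with N hN1 hN3
  obtain ⟨V, hV, hV1, hV2⟩ := hglue 0 (fun j w => w ^ N • q j w) 2 one_lt_two
    (differentiableOn_const 0) fun j => by
      refine DifferentiableOn.smul (by fun_prop) ((hq j).mono fun w hw => ?_)
      exact norm_ne_zero_iff.1 (hR.trans hw.1).ne'
  have hCε : C * (ε / C) = ε := by field_simp
  refine ⟨V, hV, fun j w hw => ?_, fun z hz => ?_⟩
  · rw [mem_sphere_zero_iff_norm] at hw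
    have := hV1 (ε / C) (by positivity) hN1 j w (by linarith) hw.le
    rwa [hCε] at this
  · have := hV2 (ε / C) (by positivity) hN3 z (hKr hz)
    rwa [hCε, Pi.zero_apply, sub_zero] at this

/-- Functions continuous on the closure and holomorphic inside are uniform limits of functions
analytic on a neighbourhood of the closure. -/
theorem exists_analytic_approx [CompleteSpace E] (c : Collar M) (hM : IsOpen M) (hMb : IsBounded M)
    {f₀ : ℂ → E} (hf₀ : ContinuousOn f₀ (closure M)) (hf₀d : DifferentiableOn ℂ f₀ M) {ε : ℝ}
    (hε : 0 < ε) : ∃ f : ℂ → E, AnalyticOnNhd ℂ f (closure M) ∧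
      ∀ z ∈ closure M, ‖f z - f₀ z‖ < ε := by
  have hR := c.R_pos
  have hR1 := c.R_lt
  obtain ⟨d, hd⟩ : ∃ d, d = (1 - c.R) / 6 := ⟨_, rfl⟩
  have hd0 : 0 < d := by linarith
  obtain ⟨C, hC, hglue⟩ := exists_glue_analytic (E := E) (c := c) hM hMb (a := c.R + 2 * d)
    (r₁ := c.R + 3 * d) (r₂ := c.R + 4 * d) (r₃ := c.R + 5 * d) (by linarith) (by linarith)
    (by linarith) (by linarith) (by linarith)
  set S : Set ℂ := closedBall 0 1 \ ball 0 (c.R + d) with hS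
  have hmemS : ∀ w, w ∈ S ↔ ‖w‖ ≤ 1 ∧ c.R + d ≤ ‖w‖ := fun w => by
    rw [hS, Set.mem_sdiff, mem_closedBall_zero_iff, mem_ball_zero_iff, not_lt]
  have hSc : IsCompact S := (isCompact_closedBall 0 1).diff isOpen_ball
  have hSann : S ⊆ annulus c.R := fun w hw => by
    rw [hmemS] at hw
    exact ⟨by linarith [hw.2], hw.1.trans_lt c.one_lt_inv⟩
  have hcont : ∀ j, ContinuousOn (fun w => f₀ (c.ψ j w)) S := fun j =>
    hf₀.comp ((c.diff j).continuousOn.mono hSann) fun w hw =>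
      (c.mem_closure_iff (hSann hw)).2 ((hmemS w).1 hw).1
  obtain ⟨s, hs⟩ : ∃ s, s = ε / (2 * (C + 1)) := ⟨_, rfl⟩
  have hs0 : 0 < s := by rw [hs]; positivity
  have hCs : C * s + s < ε := by
    have : C * s + s = ε / 2 := by rw [hs]; field_simp
    linarith
  have huc : ∀ j, ∃ δ > 0, ∀ x ∈ S, ∀ y ∈ S, dist x y < δ → dist (f₀ (c.ψ j x)) (f₀ (c.ψ j y)) < s :=
    fun j => Metric.uniformContinuousOn_iff.1 (hSc.uniformContinuousOn_of_continuous (hcont j)) s hs0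
  choose δ hδ0 hδ using huc
  obtain ⟨δ', hδ'0, hδ'⟩ : ∃ δ' > 0, ∀ j, δ' ≤ δ j := by
    rcases isEmpty_or_nonempty (Fin c.m) with he | hne
    · exact ⟨1, one_pos, fun j => he.elim j⟩
    · obtain ⟨j, hj⟩ := Finite.exists_min δ
      exact ⟨δ j, hδ0 j, hj⟩
  obtain ⟨t, ht0, ht1, ht2⟩ : ∃ t, 0 < t ∧ t < δ' ∧ t < d := by
    refine ⟨min δ' d / 2, by positivity, ?_, ?_⟩
    · linarith [min_le_left δ' d, lt_min hδ'0 hd0]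
    · linarith [min_le_right δ' d, lt_min hδ'0 hd0]
  have hl0 : 0 < 1 - t := by linarith
  have hnorm : ∀ w : ℂ, ‖((1 - t : ℝ) : ℂ) * w‖ = (1 - t) * ‖w‖ := fun w => by
    rw [norm_mul, norm_real, Real.norm_eq_abs, abs_of_pos hl0]
  have hlow : ∀ w : ℂ, ‖w‖ ≤ 1 → c.R + 2 * d ≤ ‖w‖ → ((1 - t : ℝ) : ℂ) * w ∈ S ∧ w ∈ S := by
    intro w hw hw'
    rw [hmemS, hmemS, hnorm]
    refine ⟨⟨by nlinarith, by nlinarith⟩, hw, by linarith⟩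
  have hclose : ∀ j w, ‖w‖ ≤ 1 → c.R + 2 * d ≤ ‖w‖ →
      ‖f₀ (c.ψ j (((1 - t : ℝ) : ℂ) * w)) - f₀ (c.ψ j w)‖ ≤ s := by
    intro j w hw hw'
    obtain ⟨h1, h2⟩ := hlow w hw hw'
    rw [← dist_eq_norm]
    refine (hδ j _ h1 _ h2 ?_).le
    have : ((1 - t : ℝ) : ℂ) * w - w = -(t * w) := by push_cast; ring
    rw [dist_eq_norm, this, norm_neg, norm_mul, norm_real, Real.norm_eq_abs, abs_of_pos ht0]
    have := hδ' j
    nlinarith [norm_nonneg w]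
  obtain ⟨f, hf, hf1, hf2⟩ := hglue f₀ (fun j w => f₀ (c.ψ j (((1 - t : ℝ) : ℂ) * w)))
    (1 - t)⁻¹ ((one_lt_inv₀ hl0).2 (by linarith)) hf₀d fun j w hw => by
      have hw1 : ‖((1 - t : ℝ) : ℂ) * w‖ < 1 := by
        rw [hnorm]
        calc (1 - t) * ‖w‖ < (1 - t) * (1 - t)⁻¹ := mul_lt_mul_of_pos_left hw.2 hl0
          _ = 1 := mul_inv_cancel₀ hl0.ne'
      have hw2 : c.R < ‖((1 - t : ℝ) : ℂ) * w‖ := by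
        rw [hnorm]
        rcases le_total ‖w‖ 1 with h | h
        · nlinarith [hw.1]
        · nlinarith [hw.1]
      have hann : ((1 - t : ℝ) : ℂ) * w ∈ annulus c.R := ⟨hw2, hw1.trans c.one_lt_inv⟩
      have e1 := hf₀d.differentiableAt (hM.mem_nhds (c.inside j _ hann hw1))
      have e2 := c.differentiableAt j hann
      exact (DifferentiableAt.comp w e1 (DifferentiableAt.comp (g := c.ψ j) w e2
        (by fun_prop : DifferentiableAt ℂ (fun w : ℂ => ((1 - t : ℝ) : ℂ) * w) w))).differentiableWithinAt
  refine ⟨f, hf, fun z hz => ?_⟩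
  rcases c.mem_core_or z hz (r := c.R + 4 * d) (by linarith) with h | ⟨j, w, hw, hw', rfl⟩
  · have := hf2 s hs0.le (fun k w hw => by
      rw [mem_sphere_zero_iff_norm] at hw
      exact hclose k w (by linarith) (by linarith)) z h
    linarith
  · have e1 := hf1 s hs0.le (fun k w hw => by
      rw [mem_sphere_zero_iff_norm] at hw
      exact hclose k w (by linarith) (by linarith)) j w hw.le hw'
    have e2 := hclose j w hw' (by linarith)
    have e3 := norm_sub_le_norm_sub_add_norm_sub (f (c.ψ j w))
      (f₀ (c.ψ j (((1 - t : ℝ) : ℂ) * w))) (f₀ (c.ψ j w))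
    linarith

end Collar

section

variable {E : Type*} [NormedAddCommGroup E] [NormedSpace ℂ E] [FiniteDimensional ℂ E]

/-- Uniform lower bound for a strongly plurisubharmonic function near a compact set. -/
theorem exists_taylor_lower {ρ : E → ℝ} {U K : Set E} (hU : IsOpen U) (hρ : ContDiffOn ℝ 3 ρ U)
    (hpsh : IsStrictPsh ρ U) (hK : IsCompact K) (hKU : K ⊆ U) :
    ∃ s₀ > 0, ∃ c₀ > 0, ∃ C > 0, ∀ z ∈ K,
      (∀ u v, ‖qform ρ z u v‖ ≤ C * ‖u‖ * ‖v‖) ∧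
      ∀ ξ, ‖ξ‖ ≤ s₀ → z + ξ ∈ U ∧ |ρ (z + ξ) - ρ z| ≤ C * ‖ξ‖ ∧
        ρ z + (dform ρ z ξ + qform ρ z ξ ξ).re + c₀ * ‖ξ‖ ^ 2 ≤ ρ (z + ξ) := by
  obtain ⟨δ, hδ, C, hC, hT⟩ := exists_uniform_taylor hU hρ hK hKU
  obtain ⟨c, hc, hL⟩ := exists_levi_lower_bound hU (hρ.of_le (by norm_num)) hpsh hK hKU
  refine ⟨min δ (c / (2 * C)), by positivity, c / 2, by positivity, C, hC, fun z hz => ?_⟩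
  obtain ⟨hball, hT⟩ := hT z hz
  refine ⟨fun u v => (norm_qform_le u v).trans ?_, fun ξ hξ => ?_⟩
  · have := (hT 0 (by simpa using hδ.le)).2.1
    rw [add_zero] at this
    gcongr
  obtain ⟨-, -, h1, -, h2⟩ := hT ξ (hξ.trans (min_le_left _ _))
  refine ⟨hball (by simpa using hξ.trans (min_le_left _ _)), h1, ?_⟩
  have h3 := (abs_le.1 h2).1
  have h4 : C * ‖ξ‖ ^ 3 ≤ c / 2 * ‖ξ‖ ^ 2 := by
    have : C * ‖ξ‖ ≤ c / 2 := by
      calc C * ‖ξ‖ ≤ C * (c / (2 * C)) := by gcongr; exact hξ.trans (min_le_right _ _)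
        _ = c / 2 := by field_simp
    nlinarith [sq_nonneg ‖ξ‖]
  have h5 := hL z hz ξ
  have h6 := qform_re ρ z ξ
  rw [D2] at h6
  rw [add_re, dform_re, h6]
  linarith

/-- Pairs of coefficients of quadratic discs which increase `ρ`. -/
def pushDiscs (ρ : E → ℝ) (η δ c : ℝ) (z : E) : Set (E × E) :=
  {p | ‖p.1‖ + ‖p.2‖ < η ∧ ∀ ζ ∈ sphere (0 : ℂ) 1,
    min (ρ z + c) (-2 * δ) < ρ (z + (ζ • p.1 + ζ ^ 2 • p.2)) ∧
      ρ (z + (ζ • p.1 + ζ ^ 2 • p.2)) < 0}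

theorem norm_disc_le {p : E × E} {ζ : ℂ} (hζ : ‖ζ‖ = 1) :
    ‖ζ • p.1 + ζ ^ 2 • p.2‖ ≤ ‖p.1‖ + ‖p.2‖ := by
  refine (norm_add_le _ _).trans (le_of_eq ?_)
  rw [norm_smul, norm_smul, norm_pow, hζ, one_pow, one_mul, one_mul]

theorem eventually_mem_pushDiscs {ρ : E → ℝ} {U : Set E} (hU : IsOpen U) (hρ : ContinuousOn ρ U)
    {η δ c : ℝ} {F : ℂ → E} {w : ℂ} (hF : ContinuousAt F w)
    (hFU : ∀ ξ, ‖ξ‖ ≤ η → F w + ξ ∈ U) {p : E × E} (hp : p ∈ pushDiscs ρ η δ c (F w)) :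
    ∀ᶠ q : ℂ × E × E in 𝓝 (w, p), q.2 ∈ pushDiscs ρ η δ c (F q.1) := by
  have h1 : ∀ᶠ q : ℂ × E × E in 𝓝 (w, p), ‖q.2.1‖ + ‖q.2.2‖ < η :=
    ContinuousAt.eventually_lt (by fun_prop) continuousAt_const hp.1
  have h2 : ∀ᶠ q : ℂ × E × E in 𝓝 (w, p), ∀ ζ ∈ sphere (0 : ℂ) 1,
      min (ρ (F q.1) + c) (-2 * δ) < ρ (F q.1 + (ζ • q.2.1 + ζ ^ 2 • q.2.2)) ∧
      ρ (F q.1 + (ζ • q.2.1 + ζ ^ 2 • q.2.2)) < 0 := by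
    refine (isCompact_sphere 0 1).eventually_forall_of_forall_eventually fun ζ hζ => ?_
    have hη : 0 ≤ η := by linarith [hp.1, norm_nonneg p.1, norm_nonneg p.2]
    have hζn := mem_sphere_zero_iff_norm.1 hζ
    have hc1 : ContinuousAt (fun x : (ℂ × E × E) × ℂ => F x.1.1) ((w, p), ζ) :=
      ContinuousAt.comp (g := F) (f := fun x : (ℂ × E × E) × ℂ => x.1.1) hF (by fun_prop)
    have hρ1 : ContinuousAt (fun x : (ℂ × E × E) × ℂ => ρ (F x.1.1)) ((w, p), ζ) :=
      ContinuousAt.comp (g := ρ) (f := fun x : (ℂ × E × E) × ℂ => F x.1.1)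
        (hρ.continuousAt (hU.mem_nhds (by simpa using hFU 0 (by simpa using hη)))) hc1
    have hρ2 : ContinuousAt (fun x : (ℂ × E × E) × ℂ =>
        ρ (F x.1.1 + (x.2 • x.1.2.1 + x.2 ^ 2 • x.1.2.2))) ((w, p), ζ) :=
      ContinuousAt.comp (g := ρ)
        (f := fun x : (ℂ × E × E) × ℂ => F x.1.1 + (x.2 • x.1.2.1 + x.2 ^ 2 • x.1.2.2))
        (hρ.continuousAt (hU.mem_nhds (hFU _ ((norm_disc_le hζn).trans hp.1.le))))
        (hc1.add (by fun_prop))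
    exact (ContinuousAt.eventually_lt ((hρ1.add continuousAt_const).min continuousAt_const) hρ2
      (hp.2 ζ hζ).1).and (ContinuousAt.eventually_lt hρ2 continuousAt_const (hp.2 ζ hζ).2)
  filter_upwards [h1, h2] with q hq1 hq2 using ⟨hq1, hq2⟩

theorem continuousOn_dform {ρ : E → ℝ} {U : Set E} (hU : IsOpen U) (hρ : ContDiffOn ℝ 1 ρ U) :
    ContinuousOn (fun p : E × E => dform ρ p.1 p.2) (U ×ˢ univ) := by
  have h1 : ContinuousOn (fun p : E × E => fderiv ℝ ρ p.1) (U ×ˢ univ) :=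
    (hρ.continuousOn_fderiv_of_isOpen hU le_rfl).comp continuousOn_fst fun p hp => hp.1
  simp only [dform_apply]
  have h2 : ContinuousOn (fun p : E × E => fderiv ℝ ρ p.1 p.2) (U ×ˢ univ) :=
    h1.clm_apply continuousOn_snd
  have h3 : ContinuousOn (fun p : E × E => fderiv ℝ ρ p.1 (I • p.2)) (U ×ˢ univ) :=
    h1.clm_apply (by fun_prop)
  exact (continuous_ofReal.comp_continuousOn h2).sub
    (continuousOn_const.mul (continuous_ofReal.comp_continuousOn h3))

theorem continuousOn_qform {ρ : E → ℝ} {U : Set E} (hU : IsOpen U) (hρ : ContDiffOn ℝ 2 ρ U) :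
    ContinuousOn (fun p : E × E => qform ρ p.1 p.2 p.2) (U ×ˢ univ) := by
  have h := continuousOn_D2 hU hρ
  have e : ∀ f g : E → E, Continuous f → Continuous g →
      ContinuousOn (fun p : E × E => D2 ρ p.1 (f p.2) (g p.2)) (U ×ˢ univ) := fun f g hf hg =>
    h.comp (f := fun p : E × E => (p.1, f p.2, g p.2)) (by fun_prop)
      fun p hp => ⟨hp.1, mem_univ _⟩
  simp only [qform_apply]
  have e1 := (e id id continuous_id continuous_id).sub
    (e (fun v => I • v) (fun v => I • v) (by fun_prop) (by fun_prop))
  have e2 := (e (fun v => I • v) id (by fun_prop) continuous_id).add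
    (e id (fun v => I • v) continuous_id (by fun_prop))
  exact continuousOn_const.mul ((continuous_ofReal.comp_continuousOn e1).sub
    (continuousOn_const.mul (continuous_ofReal.comp_continuousOn e2)))

end

section

variable {E : Type*} [NormedAddCommGroup E] [InnerProductSpace ℂ E] [FiniteDimensional ℂ E]

set_option maxHeartbeats 1000000 in
theorem exists_push_section (hE : 3 ≤ Module.finrank ℂ E) {ρ : E → ℝ} {U K : Set E} (hU : IsOpen U)
    (hρ : ContDiffOn ℝ 3 ρ U) (hpsh : IsStrictPsh ρ U)
    (hK : IsCompact K) (hKU : K ⊆ U) {δ η : ℝ} (hδ : 0 < δ) (hη : 0 < η) : ∃ c > 0, ∀ F : ℂ → E,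
      (∀ w ∈ sphere (0 : ℂ) 1, ContinuousAt F w ∧ F w ∈ K ∧ ρ (F w) < 0) →
      ∃ σ : ℂ → E × E, ContinuousOn σ (sphere 0 1) ∧
        ∀ w ∈ sphere (0 : ℂ) 1, ∀ᶠ p in 𝓝 (w, σ w), p.2 ∈ pushDiscs ρ η δ c (F p.1) := by
  obtain ⟨s₀, hs₀, c₀, hc₀, C, hC, hlow⟩ := exists_taylor_lower hU hρ hpsh hK hKU
  obtain ⟨η', hη', hη'η, hη's⟩ : ∃ η' > 0, η' ≤ η ∧ η' ≤ s₀ :=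
    ⟨min η s₀, lt_min hη hs₀, min_le_left _ _, min_le_right _ _⟩
  obtain ⟨s₂, hs₂, hs₂η, hs₂δ⟩ : ∃ s₂ > 0, 2 * s₂ < η' ∧ C * (2 * s₂) < δ := by
    refine ⟨min (η' / 4) (δ / (4 * C)), by positivity, ?_, ?_⟩
    · linarith [min_le_left (η' / 4) (δ / (4 * C))]
    · calc C * (2 * min (η' / 4) (δ / (4 * C))) ≤ C * (2 * (δ / (4 * C))) := by
            gcongr
            exact min_le_right _ _
        _ = δ / 2 := by field_simp; norm_num
        _ < δ := by linarith
  obtain ⟨s₁, hs₁, hs₁₂, hjoin⟩ := exists_joinedIn_goodDiscs hE hC (half_pos hc₀) hs₂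
  have hρc := hρ.continuousOn
  refine ⟨c₀ * s₁ ^ 2 / 16, by positivity, fun F hF => ?_⟩
  have hsub : ∀ z, pushDiscs ρ η' δ (c₀ * s₁ ^ 2 / 16) z ⊆ pushDiscs ρ η δ (c₀ * s₁ ^ 2 / 16) z :=
    fun z p hp => ⟨hp.1.trans_le hη'η, hp.2⟩
  have hgood : ∀ z ∈ K, ρ z ≤ -3 / 2 * δ → goodDiscs (c₀ / 2) s₁ s₂ (dform ρ z) (qform ρ z) ⊆
      pushDiscs ρ η' δ (c₀ * s₁ ^ 2 / 16) z := by
    intro z hz hzρ p hp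
    refine ⟨by linarith [hp.1], fun ζ hζ => ?_⟩
    have hζn := mem_sphere_zero_iff_norm.1 hζ
    obtain ⟨h1, h2⟩ := hp.2 ζ hζn
    set ξ := ζ • p.1 + ζ ^ 2 • p.2 with hξ
    have hn : ‖ξ‖ ≤ 2 * s₂ := (norm_disc_le hζn).trans hp.1
    obtain ⟨-, h3, h4⟩ := (hlow z hz).2 ξ (by linarith)
    have h5 := (abs_le.1 ((abs_re_le_norm _).trans h2)).1
    have h6 : (s₁ / 2) ^ 2 ≤ ‖ξ‖ ^ 2 := by gcongr
    have h7 : C * ‖ξ‖ ≤ C * (2 * s₂) := by gcongr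
    refine ⟨(min_le_left _ _).trans_lt ?_, ?_⟩
    · nlinarith [mul_pos hc₀ (pow_pos hs₁ 2)]
    · linarith [(abs_le.1 h3).2]
  have hnull : ∀ z ∈ K, -3 / 2 * δ ≤ ρ z → ∀ v, ‖v‖ ≤ s₁ → ρ z + C * ‖v‖ < 0 → dform ρ z v = 0 →
      qform ρ z v v = 0 → (v, (0 : E)) ∈ pushDiscs ρ η' δ (c₀ * s₁ ^ 2 / 16) z := by
    intro z hz hzρ v hv hv0 hl hq
    refine ⟨by simpa using by linarith, fun ζ hζ => ?_⟩
    have hζn := mem_sphere_zero_iff_norm.1 hζ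
    simp only [smul_zero, add_zero]
    have hn : ‖ζ • v‖ = ‖v‖ := by rw [norm_smul, hζn, one_mul]
    obtain ⟨-, h3, h4⟩ := (hlow z hz).2 (ζ • v) (by linarith)
    have h5 : (dform ρ z (ζ • v) + qform ρ z (ζ • v) (ζ • v)).re = 0 := by
      simp [hl, hq]
    rw [h5] at h4
    rw [hn] at h3
    refine ⟨(min_le_right _ _).trans_lt ?_, by linarith [(abs_le.1 h3).2]⟩
    nlinarith [mul_nonneg hc₀.le (sq_nonneg ‖ζ • v‖)]
  have hρ2 : ContDiffOn ℝ 2 ρ U := hρ.of_le (by norm_num)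
  have hsymm : ∀ z ∈ K, ∀ u v, qform ρ z u v = qform ρ z v u := fun z hz =>
    qform_comm (hρ2.contDiffAt (hU.mem_nhds (hKU hz)))
  have hFU : ∀ w ∈ sphere (0 : ℂ) 1, ∀ ξ, ‖ξ‖ ≤ η' → F w + ξ ∈ U := fun w hw ξ hξ =>
    ((hlow _ (hF w hw).2.1).2 ξ (hξ.trans hη's)).1
  have hFc : ContinuousOn F (sphere 0 1) := fun w hw => (hF w hw).1.continuousWithinAt
  refine Exists.elim (exists_circle_section (V := E × E)
    (D := fun w => pushDiscs ρ η' δ (c₀ * s₁ ^ 2 / 16) (F w))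
    (N := fun w => {p | p.2 = 0 ∧ ((ρ (F w) ≤ -3 / 2 * δ ∧ ‖p.1‖ = s₁ ∧ dform ρ (F w) p.1 = 0 ∧
      qform ρ (F w) p.1 p.1 = 0) ∨ (-3 / 2 * δ ≤ ρ (F w) ∧ p.1 = 0))})
    (fun w hw p hp => (eventually_mem_pushDiscs hU hρc (hF w hw).1 (hFU w hw) hp).filter_mono
      nhdsWithin_le_nhds) ?_ ?_ ?_) ?_
  · have hcomp : IsCompact (sphere (0 : ℂ) 1 ×ˢ closedBall (0 : E) s₁ ×ˢ ({0} : Set E)) :=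
      (isCompact_sphere 0 1).prod ((isCompact_closedBall 0 s₁).prod isCompact_singleton)
    set T := sphere (0 : ℂ) 1 ×ˢ closedBall (0 : E) s₁ ×ˢ ({0} : Set E) with hT
    have hFT : ContinuousOn (fun p : ℂ × E × E => F p.1) T :=
      hFc.comp continuousOn_fst fun p hp => hp.1
    have hFT2 : ContinuousOn (fun p : ℂ × E × E => (F p.1, p.2.1)) T := hFT.prodMk (by fun_prop)
    have hmap : MapsTo (fun p : ℂ × E × E => (F p.1, p.2.1)) T (U ×ˢ univ) := fun p hp =>
      ⟨hKU (hF _ hp.1).2.1, mem_univ _⟩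
    have c1 : ContinuousOn (fun p : ℂ × E × E => ρ (F p.1)) T :=
      hρc.comp hFT fun p hp => hKU (hF _ hp.1).2.1
    have c2 := (continuousOn_dform hU (hρ.of_le (by norm_num))).comp hFT2 hmap
    have c3 := (continuousOn_qform hU hρ2).comp hFT2 hmap
    have k1 := c1.preimage_isClosed_of_isClosed hcomp.isClosed (isClosed_Iic (a := -3 / 2 * δ))
    have k2 := c1.preimage_isClosed_of_isClosed hcomp.isClosed (isClosed_Ici (a := -3 / 2 * δ))
    have k3 := c2.preimage_isClosed_of_isClosed hcomp.isClosed (isClosed_singleton (x := 0))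
    have k4 := c3.preimage_isClosed_of_isClosed hcomp.isClosed (isClosed_singleton (x := 0))
    have k5 : IsClosed {p : ℂ × E × E | ‖p.2.1‖ = s₁} :=
      isClosed_eq (by fun_prop) continuous_const
    have k6 : IsClosed {p : ℂ × E × E | p.2.1 = 0} :=
      isClosed_eq (by fun_prop) continuous_const
    have kk := ((k1.inter k3).inter (k4.inter k5)).union (k2.inter k6)
    refine (hcomp.inter_right kk).of_isClosed_subset ?_ ?_
    · convert hcomp.isClosed.inter kk using 1
      ext p
      constructor
      · rintro ⟨h1, h2, ⟨h3, h4, h5, h6⟩ | ⟨h3, h4⟩⟩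
        · have hpT : p ∈ T := ⟨h1, mem_closedBall_zero_iff.2 h4.le, h2⟩
          exact ⟨hpT, Or.inl ⟨⟨⟨hpT, h3⟩, hpT, h5⟩, ⟨hpT, h6⟩, h4⟩⟩
        · have hpT : p ∈ T := ⟨h1, mem_closedBall_zero_iff.2 (by rw [h4, norm_zero]; exact hs₁.le),
            h2⟩
          exact ⟨hpT, Or.inr ⟨⟨hpT, h3⟩, h4⟩⟩
      · rintro ⟨hpT, ⟨⟨⟨-, h3⟩, -, h5⟩, ⟨-, h6⟩, h4⟩ | ⟨⟨-, h3⟩, h4⟩⟩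
        · exact ⟨hpT.1, hpT.2.2, Or.inl ⟨h3, h4, h5, h6⟩⟩
        · exact ⟨hpT.1, hpT.2.2, Or.inr ⟨h3, h4⟩⟩
    · rintro p ⟨h1, h2, ⟨h3, h4, h5, h6⟩ | ⟨h3, h4⟩⟩
      · have hpT : p ∈ T := ⟨h1, mem_closedBall_zero_iff.2 h4.le, h2⟩
        exact ⟨hpT, Or.inl ⟨⟨⟨hpT, h3⟩, hpT, h5⟩, ⟨hpT, h6⟩, h4⟩⟩
      · have hpT : p ∈ T := ⟨h1, mem_closedBall_zero_iff.2 (by rw [h4, norm_zero]; exact hs₁.le),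
          h2⟩
        exact ⟨hpT, Or.inr ⟨⟨hpT, h3⟩, h4⟩⟩
  · intro w hw
    rcases le_total (ρ (F w)) (-3 / 2 * δ) with h | h
    · obtain ⟨v, hv, hl, hq⟩ := exists_null_vector hE (dform ρ (F w) : E →ₗ[ℂ] ℂ) (qform ρ (F w))
        (hsymm _ (hF w hw).2.1)
      refine ⟨((s₁ : ℂ) • v, 0), rfl, Or.inl ⟨h, ?_, ?_, ?_⟩⟩
      · rw [norm_smul, hv, norm_real, Real.norm_eq_abs, abs_of_pos hs₁, mul_one]
      · have hl' : dform ρ (F w) v = 0 := hl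
        simp [hl']
      · simp [hq]
    · exact ⟨0, rfl, Or.inr ⟨h, rfl⟩⟩
  · have key : ∀ w ∈ sphere (0 : ℂ) 1, ∀ a : E, ρ (F w) ≤ -3 / 2 * δ → ‖a‖ = s₁ →
        -3 / 2 * δ ≤ ρ (F w) → dform ρ (F w) a = 0 → qform ρ (F w) a a = 0 →
        JoinedIn (pushDiscs ρ η' δ (c₀ * s₁ ^ 2 / 16) (F w)) (a, 0) 0 := by
      intro w hw a h1 h2 h3 h4 h5
      refine JoinedIn.of_segment_subset ?_
      rintro _ ⟨x, y, hx, hy, hxy, rfl⟩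
      have hxa : ‖(x : ℂ) • a‖ ≤ s₁ := by
        rw [norm_smul, h2, norm_real, Real.norm_eq_abs, abs_of_nonneg hx]
        nlinarith
      have := hnull _ (hF w hw).2.1 h3 ((x : ℂ) • a) hxa (by
        have : C * ‖(x : ℂ) • a‖ ≤ C * (2 * s₂) := by
          gcongr
          linarith
        linarith) (by simp [h4]) (by simp [h5])
      simpa using this
    rintro w hw ⟨a, a'⟩ ⟨ha, hA⟩ ⟨b, b'⟩ ⟨hb, hB⟩
    obtain rfl : a' = 0 := ha
    obtain rfl : b' = 0 := hb
    rcases hA with ⟨h3, h4, h5, h6⟩ | ⟨h3, h4⟩ <;> rcases hB with ⟨g3, g4, g5, g6⟩ | ⟨g3, g4⟩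
    · have hnorm : ∀ v : E, ‖v‖ = s₁ → ‖((s₁⁻¹ : ℝ) : ℂ) • v‖ = 1 := fun v hv => by
        rw [norm_smul, norm_real, Real.norm_eq_abs, abs_of_pos (inv_pos.2 hs₁), hv,
          inv_mul_cancel₀ hs₁.ne']
      have hcancel : ∀ v : E, (s₁ : ℂ) • ((s₁⁻¹ : ℝ) : ℂ) • v = v := fun v => by
        rw [smul_smul, ← ofReal_mul, mul_inv_cancel₀ hs₁.ne', ofReal_one, one_smul]
      simp only at h4 h5 h6 g4 g5 g6
      have := hjoin (dform ρ (F w)) (qform ρ (F w)) (hsymm _ (hF w hw).2.1)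
        (hlow _ (hF w hw).2.1).1 (((s₁⁻¹ : ℝ) : ℂ) • a) (((s₁⁻¹ : ℝ) : ℂ) • b) (hnorm a h4)
        (hnorm b g4) (by simp [h5]) (by simp [g5]) (by simp [h6]) (by simp [g6])
      rw [hcancel, hcancel] at this
      exact this.mono (hgood _ (hF w hw).2.1 h3)
    · obtain rfl : b = 0 := g4
      exact key w hw a h3 h4 g3 h5 h6
    · obtain rfl : a = 0 := h4
      exact (key w hw b g3 g4 h3 g5 g6).symm
    · obtain rfl : a = 0 := h4
      obtain rfl : b = 0 := g4
      refine JoinedIn.refl (hnull _ (hF w hw).2.1 h3 0 (by simpa using hs₁.le) ?_ (by simp) (by simp))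
      simpa using (hF w hw).2.2
  · rintro σ ⟨hσ, hσD⟩
    refine ⟨σ, hσ, fun w hw => ?_⟩
    filter_upwards [eventually_mem_pushDiscs hU hρc (hF w hw).1 (hFU w hw) (hσD w hw)] with p hp
      using hsub _ hp

end

namespace Collar

variable {M : Set ℂ} {n : ℕ}

theorem exists_globalize_continuous (c : Collar M) (hM : IsOpen M) (hMb : IsBounded M)
    (τ : Fin c.m → ℂ → EuclideanSpace ℂ (Fin n)) (hτ : ∀ j, ContinuousOn (τ j) (sphere 0 1))
    {K : Set ℂ} (hK : IsCompact K) (hKM : K ⊆ M) {ε : ℝ} (hε : 0 < ε) :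
    ∀ᶠ N : ℕ in atTop, ∃ V : ℂ → EuclideanSpace ℂ (Fin n), AnalyticOnNhd ℂ V (closure M) ∧
      (∀ j, ∀ w ∈ sphere (0 : ℂ) 1, ‖V (c.ψ j w) - w ^ N • τ j w‖ < ε) ∧ ∀ z ∈ K, ‖V z‖ < ε := by
  choose m P hP hPτ using fun j => exists_laurent_approx (hτ j) (half_pos hε)
  have hq : ∀ j, DifferentiableOn ℂ (fun w => (w ^ m j)⁻¹ • P j w) {0}ᶜ := fun j w hw =>
    (((differentiableAt_id.pow _).inv (pow_ne_zero _ hw)).smul (hP j w)).differentiableWithinAt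
  filter_upwards [c.exists_globalize hM hMb _ hq hK hKM (half_pos hε)] with N ⟨V, hV, h1, h2⟩
  refine ⟨V, hV, fun j w hw => ?_, fun z hz => (h2 z hz).trans_lt (by linarith)⟩
  have h3 : ‖w ^ N • ((w ^ m j)⁻¹ • P j w - τ j w)‖ < ε / 2 := by
    rw [norm_smul, norm_pow, mem_sphere_zero_iff_norm.1 hw, one_pow, one_mul]
    exact hPτ j w hw
  calc ‖V (c.ψ j w) - w ^ N • τ j w‖ = ‖(V (c.ψ j w) - w ^ N • ((w ^ m j)⁻¹ • P j w)) +
        w ^ N • ((w ^ m j)⁻¹ • P j w - τ j w)‖ := by rw [smul_sub, sub_add_sub_cancel]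
    _ ≤ _ := norm_add_le _ _
    _ < ε := by linarith [h1 j w hw]

variable {Ω U : Set (EuclideanSpace ℂ (Fin n))} {ρ : EuclideanSpace ℂ (Fin n) → ℝ}

theorem exists_push_step (c : Collar M) (hn : 3 ≤ n) (hM : IsOpen M) (hMb : IsBounded M)
    (hΩb : IsBounded Ω) (hU : IsOpen U) (hΩU : closure Ω ⊆ U) (hρ : ContDiffOn ℝ 3 ρ U)
    (hpsh : IsStrictPsh ρ U) (hΩ : Ω = {z ∈ U | ρ z < 0}) {δ : ℝ} (hδ : 0 < δ) :
    ∃ κ > 0, ∀ (f : ℂ → EuclideanSpace ℂ (Fin n)) (K : Set ℂ) (ε m : ℝ),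
      AnalyticOnNhd ℂ f (closure M) → MapsTo f (closure M) Ω → IsCompact K → K ⊆ M → 0 < ε →
      (∀ x ∈ frontier M, m ≤ ρ (f x)) →
      ∃ g : ℂ → EuclideanSpace ℂ (Fin n), AnalyticOnNhd ℂ g (closure M) ∧ MapsTo g (closure M) Ω ∧
        (∀ x ∈ K, ‖g x - f x‖ < ε) ∧ ∀ x ∈ frontier M, min (m + κ) (-2 * δ) ≤ ρ (g x) := by
  obtain ⟨η, hη, -, hstab⟩ := exists_stability (Ω := Ω) hM hMb hU (hρ.of_le (by norm_num)) hpsh hΩb hΩU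
  obtain ⟨κ, hκ, hpush⟩ := exists_push_section (by simpa using hn) hU hρ hpsh
    hΩb.isCompact_closure hΩU hδ hη
  refine ⟨κ, hκ, fun f K ε m hf hfΩ hK hKM hε hm => ?_⟩
  have hψ : ∀ j, ∀ w ∈ sphere (0 : ℂ) 1, c.ψ j w ∈ closure M := fun j w hw =>
    frontier_subset_closure (c.bdry j w hw)
  have hsec := fun j => hpush (fun w => f (c.ψ j w)) fun w hw =>
    ⟨ContinuousAt.comp (g := f) (hf _ (hψ j w hw)).continuousAt
      (c.differentiableAt j (sphere_subset_annulus c.R_pos c.R_lt hw)).continuousAt,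
      subset_closure (hfΩ (hψ j w hw)), (hΩ.subset (hfΩ (hψ j w hw))).2⟩
  choose σ hσ hσD using hsec
  have hmargin : ∀ j, ∃ r > 0, ∀ w ∈ sphere (0 : ℂ) 1, ∀ p, ‖p - σ j w‖ < r →
      p ∈ pushDiscs ρ η δ κ (f (c.ψ j w)) := by
    intro j
    obtain ⟨r, hr, hth⟩ := ((isCompact_sphere (0 : ℂ) 1).image_of_continuousOn
      (continuousOn_id.prodMk (hσ j))).exists_thickening_subset_open isOpen_interior
      (t := interior {p : ℂ × _ | p.2 ∈ pushDiscs ρ η δ κ (f (c.ψ j p.1))}) (by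
        rintro _ ⟨w, hw, rfl⟩
        exact mem_interior_iff_mem_nhds.2 (hσD j w hw))
    refine ⟨r, hr, fun w hw p hp => ?_⟩
    have : (w, p) ∈ thickening r ((fun w => (id w, σ j w)) '' sphere (0 : ℂ) 1) := by
      refine mem_thickening_iff.2 ⟨_, mem_image_of_mem _ hw, ?_⟩
      rw [Prod.dist_eq, id, dist_self, max_lt_iff, dist_eq_norm]
      exact ⟨hr, hp⟩
    have h2 := interior_subset (hth this)
    exact h2
  choose r hr hrD using hmargin
  obtain ⟨s, hs, hsr⟩ : ∃ s > 0, ∀ j, s ≤ r j := by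
    rcases isEmpty_or_nonempty (Fin c.m) with h | h
    · exact ⟨1, one_pos, fun j => isEmptyElim j⟩
    · obtain ⟨j, hj⟩ := Finite.exists_min r
      exact ⟨r j, hr j, hj⟩
  obtain ⟨ε', hε', hε's, hε'ε⟩ : ∃ ε' > 0, ε' ≤ s ∧ 2 * ε' ≤ ε :=
    ⟨min s (ε / 2), by positivity, min_le_left _ _, by linarith [min_le_right s (ε / 2)]⟩
  have hN1 := c.exists_globalize_continuous hM hMb (fun j w => (σ j w).1)
    (fun j => continuous_fst.comp_continuousOn (hσ j)) hK hKM hε'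
  have hN2 := (tendsto_id.const_mul_atTop' (r := 2) (by norm_num)).eventually
    (c.exists_globalize_continuous hM hMb (fun j w => (σ j w).2)
    (fun j => continuous_snd.comp_continuousOn (hσ j)) hK hKM hε')
  obtain ⟨N, ⟨V, hV, hV1, hV2⟩, W, hW, hW1, hW2⟩ := (hN1.and hN2).exists
  have key : ∀ x ∈ frontier M, ‖V x + W x‖ < η ∧
      min (ρ (f x) + κ) (-2 * δ) < ρ (f x + (V x + W x)) ∧ ρ (f x + (V x + W x)) < 0 := by
    intro x hx
    obtain ⟨j, w, hw, rfl⟩ := c.surj x hx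
    have hwn := mem_sphere_zero_iff_norm.1 hw
    have hζn : ‖w ^ N‖ = 1 := by rw [norm_pow, hwn, one_pow]
    have hζ0 : w ^ N ≠ 0 := norm_pos_iff.1 (by rw [hζn]; exact one_pos)
    set ζ := w ^ N with hζ
    have e2 : w ^ (2 * N) = ζ ^ 2 := by rw [hζ, ← pow_mul, mul_comm]
    set p : EuclideanSpace ℂ (Fin n) × EuclideanSpace ℂ (Fin n) :=
      (ζ⁻¹ • V (c.ψ j w), (ζ ^ 2)⁻¹ • W (c.ψ j w)) with hp
    have hp1 : ζ • p.1 = V (c.ψ j w) := smul_inv_smul₀ hζ0 _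
    have hp2 : ζ ^ 2 • p.2 = W (c.ψ j w) := smul_inv_smul₀ (pow_ne_zero 2 hζ0) _
    have hpσ : ‖p - σ j w‖ < r j := by
      have h1 := hV1 j w hw
      have h2 := hW1 j w hw
      simp only [id, e2] at h2
      rw [← hζ, ← hp1, ← smul_sub, norm_smul, hζn, one_mul] at h1
      rw [← hp2, ← smul_sub, norm_smul, norm_pow, hζn, one_pow, one_mul] at h2
      rw [Prod.norm_def, max_lt_iff]
      exact ⟨(h1.trans_le hε's).trans_le (hsr j), (h2.trans_le hε's).trans_le (hsr j)⟩
    obtain ⟨h1, h2⟩ := hrD j w hw p hpσ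
    have h3 := h2 ζ (mem_sphere_zero_iff_norm.2 hζn)
    have h4 := norm_disc_le (p := p) hζn
    rw [hp1, hp2] at h3 h4
    exact ⟨h4.trans_lt h1, h3⟩
  have hg : AnalyticOnNhd ℂ (fun x => f x + (V x + W x)) (closure M) := hf.add (hV.add hW)
  have hgc := hg.continuousOn
  have hst := hstab f _ hf.continuousOn (hf.mono subset_closure).differentiableOn
      (fun x hx => subset_closure (hfΩ hx)) hgc (hg.mono subset_closure).differentiableOn
      (fun x hx => by rw [add_sub_cancel_left]; exact (key x hx).1)
  have hfr : IsCompact (frontier M) := hMb.isCompact_closure.of_isClosed_subset isClosed_frontier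
    frontier_subset_closure
  have hfrU : ∀ x ∈ frontier M, f x + (V x + W x) ∈ U := fun x hx =>
    (hst 0 (fun x hx => (key x hx).2.2.le) x (frontier_subset_closure hx)).1
  obtain ⟨s', hs', hs'm⟩ : ∃ s' < 0, ∀ x ∈ frontier M, ρ (f x + (V x + W x)) ≤ s' := by
    rcases (frontier M).eq_empty_or_nonempty with h | h
    · exact ⟨-1, by norm_num, fun x hx => by rw [h] at hx; exact hx.elim⟩
    · obtain ⟨x, hx, hmax⟩ := hfr.exists_isMaxOn h (hρ.continuousOn.comp
        (hgc.mono frontier_subset_closure) hfrU)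
      exact ⟨_, (key x hx).2.2, fun y hy => hmax hy⟩
  refine ⟨_, hg, fun x hx => ?_, fun x hx => ?_, fun x hx => ?_⟩
  · have := hst s' hs'm x hx
    exact hΩ.superset ⟨this.1, this.2.trans_lt hs'⟩
  · rw [add_sub_cancel_left]
    exact (norm_add_le _ _).trans_lt (by linarith [hV2 x hx, hW2 x hx])
  · exact (min_le_min_right _ (by linarith [hm x hx])).trans (key x hx).2.1.le

/-- Analytic maps into `Ω` can be pushed towards the boundary while being kept fixed up to a small
error on a compact subset. -/
theorem exists_pushed (c : Collar M) (hn : 3 ≤ n) (hM : IsOpen M) (hMb : IsBounded M)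
    (hΩb : IsBounded Ω) (hU : IsOpen U) (hΩU : closure Ω ⊆ U) (hρ : ContDiffOn ℝ 3 ρ U)
    (hpsh : IsStrictPsh ρ U) (hΩ : Ω = {z ∈ U | ρ z < 0}) {δ : ℝ} (hδ : 0 < δ) {f₀ : ℂ → EuclideanSpace ℂ (Fin n)}
    (hf₀ : AnalyticOnNhd ℂ f₀ (closure M)) (hf₀Ω : MapsTo f₀ (closure M) Ω) {K : Set ℂ}
    (hK : IsCompact K) (hKM : K ⊆ M) {ε : ℝ} (hε : 0 < ε) :
    ∃ g : ℂ → EuclideanSpace ℂ (Fin n), AnalyticOnNhd ℂ g (closure M) ∧ MapsTo g (closure M) Ω ∧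
      (∀ x ∈ K, ‖g x - f₀ x‖ < ε) ∧ ∀ x ∈ frontier M, -δ ≤ ρ (g x) := by
  obtain ⟨κ, hκ, hstep⟩ := c.exists_push_step hn hM hMb hΩb hU hΩU hρ hpsh hΩ (half_pos hδ)
  have hfr : IsCompact (frontier M) := hMb.isCompact_closure.of_isClosed_subset isClosed_frontier
    frontier_subset_closure
  obtain ⟨m, hm⟩ := hfr.bddBelow_image (f := fun x => ρ (f₀ x)) (hρ.continuousOn.comp
    (hf₀.continuousOn.mono frontier_subset_closure) fun x hx =>
      hΩU (subset_closure (hf₀Ω (frontier_subset_closure hx))))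
  have main : ∀ k : ℕ, ∀ ε > 0, ∃ g : ℂ → EuclideanSpace ℂ (Fin n),
      AnalyticOnNhd ℂ g (closure M) ∧ MapsTo g (closure M) Ω ∧ (∀ x ∈ K, ‖g x - f₀ x‖ < ε) ∧
      ∀ x ∈ frontier M, min (m + k * κ) (-δ) ≤ ρ (g x) := by
    intro k
    induction k with
    | zero =>
      intro ε hε
      refine ⟨f₀, hf₀, hf₀Ω, fun x _ => by simpa using hε, fun x hx => (min_le_left _ _).trans ?_⟩
      simpa using hm (mem_image_of_mem _ hx)
    | succ k ih =>
      intro ε hε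
      obtain ⟨f, hf, hfΩ, hfK, hfm⟩ := ih (ε / 2) (half_pos hε)
      obtain ⟨g, hg, hgΩ, hgK, hgm⟩ := hstep f K (ε / 2) _ hf hfΩ hK hKM (half_pos hε) hfm
      refine ⟨g, hg, hgΩ, fun x hx => ?_, fun x hx => le_trans (le_min ?_ ?_) (hgm x hx)⟩
      · linarith [norm_sub_le_norm_sub_add_norm_sub (g x) (f x) (f₀ x), hgK x hx, hfK x hx]
      · push_cast
        rcases min_cases (m + k * κ) (-δ) with h | h <;> rw [h.1]
        · exact (min_le_left _ _).trans (by linarith)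
        · exact (min_le_right _ _).trans (by linarith)
      · exact (min_le_right _ _).trans (by linarith)
  obtain ⟨k, hk⟩ := exists_nat_gt ((-δ - m) / κ)
  rw [div_lt_iff₀ hκ] at hk
  obtain ⟨g, hg, hgΩ, hgK, hgm⟩ := main k ε hε
  exact ⟨g, hg, hgΩ, hgK, fun x hx => (le_min (by linarith) le_rfl).trans (hgm x hx)⟩

end Collar

section

theorem half_le_sq_two_sub_two_cos {t : ℝ} (h1 : 1 ≤ t) (h2 : t < 2) :
    1 / 2 ≤ (2 - 2 * Real.cos t) ^ 2 := by
  have h : Real.cos t ≤ Real.cos 1 := Real.cos_le_cos_of_nonneg_of_le_pi (by norm_num)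
    (by linarith [Real.pi_gt_three]) h1
  have h3 : Real.cos 1 ≤ 5 / 9 := Real.cos_one_le
  nlinarith

/-- Fourier coefficients of a function with small second differences in mean square. -/
theorem summable_rpow_mul_of_second_diff {a : ℕ → ℂ} {α s C h₀ : ℝ}
    (ha : Summable fun k => ‖a k‖ ^ 2) (hh₀ : 0 < h₀) (hs : 0 ≤ s) (hsα : s + 1 / 2 < α)
    (h : ∀ t ∈ Ioc 0 h₀, ∀ F : Finset ℕ,
      ∑ k ∈ F, (2 - 2 * Real.cos (k * t)) ^ 2 * ‖a k‖ ^ 2 ≤ C * t ^ (2 * α)) :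
    Summable fun k : ℕ => (k : ℝ) ^ s * ‖a k‖ := by
  obtain ⟨β, hβs, hβα⟩ : ∃ β, s + 1 / 2 < β ∧ β < α := exists_between hsα
  have hC : 0 ≤ C := by
    have := h h₀ ⟨hh₀, le_rfl⟩ ∅
    rw [Finset.sum_empty] at this
    exact nonneg_of_mul_nonneg_left this (by positivity)
  have hβ0 : 0 < β := by linarith
  set A : ℝ := 2 * 2 ^ (2 * β) * h₀ ^ (-(2 * β)) with hA
  have hA0 : 0 ≤ A := by positivity
  set q : ℝ := 2 ^ (2 * β - 2 * α) with hq
  have hq0 : 0 < q := by positivity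
  have hq1 : q < 1 := Real.rpow_lt_one_of_one_lt_of_neg (by norm_num) (by linarith)
  choose! j hj1 hj2 using fun (k : ℕ) (hk : 1 ≤ k * h₀) =>
    exists_nat_pow_near (x := (k : ℝ) * h₀) (y := 2) hk (by norm_num)
  have hterm : ∀ k : ℕ, 1 ≤ k * h₀ → (k : ℝ) ^ (2 * β) * ‖a k‖ ^ 2 ≤
      A * ((2 : ℝ) ^ (2 * β * j k) * ((2 - 2 * Real.cos (k * (h₀ / 2 ^ j k))) ^ 2 * ‖a k‖ ^ 2)) := by
    intro k hk
    have h1 := hj1 k hk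
    have h2 := hj2 k hk
    have hp : (0 : ℝ) < 2 ^ j k := by positivity
    have e : (k : ℝ) * (h₀ / 2 ^ j k) = k * h₀ / 2 ^ j k := by ring
    have h3 := half_le_sq_two_sub_two_cos (t := k * (h₀ / 2 ^ j k))
      (by rw [e, le_div_iff₀ hp]; linarith) (by rw [e, div_lt_iff₀ hp]; linarith [pow_succ (2 : ℝ) (j k)])
    have h4 : (k : ℝ) ^ (2 * β) ≤ 2 ^ (2 * β) * h₀ ^ (-(2 * β)) * 2 ^ (2 * β * j k) := by
      have h5 : (k : ℝ) ≤ 2 * h₀⁻¹ * 2 ^ j k := by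
        rw [pow_succ] at h2
        field_simp
        linarith
      calc (k : ℝ) ^ (2 * β) ≤ (2 * h₀⁻¹ * 2 ^ j k) ^ (2 * β) :=
            Real.rpow_le_rpow (by positivity) h5 (by positivity)
        _ = _ := by
          rw [Real.mul_rpow (by positivity) (by positivity), Real.mul_rpow (by positivity)
            (by positivity), Real.inv_rpow hh₀.le, ← Real.rpow_neg hh₀.le, ← Real.rpow_natCast,
            ← Real.rpow_mul (by norm_num), mul_comm (2 * β) (j k : ℝ)]
    calc (k : ℝ) ^ (2 * β) * ‖a k‖ ^ 2
        ≤ 2 ^ (2 * β) * h₀ ^ (-(2 * β)) * 2 ^ (2 * β * j k) * ‖a k‖ ^ 2 := by gcongr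
      _ = A * (2 ^ (2 * β * j k) * (1 / 2 * ‖a k‖ ^ 2)) := by rw [hA]; ring
      _ ≤ _ := by gcongr
  have hsum1 : Summable fun k : ℕ => (k : ℝ) ^ (2 * β) * ‖a k‖ ^ 2 := by
    have hlow : Summable fun k : ℕ => h₀ ^ (-(2 * β)) * ‖a k‖ ^ 2 := ha.mul_left _
    have hhigh : Summable fun k : ℕ =>
        if 1 ≤ (k : ℝ) * h₀ then (k : ℝ) ^ (2 * β) * ‖a k‖ ^ 2 else 0 := by
      refine summable_of_sum_le (c := A * (C * h₀ ^ (2 * α)) * (1 - q)⁻¹)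
        (fun k => by dsimp only; split_ifs <;> positivity) fun F => ?_
      set J := F.sup j + 1 with hJ
      have hjJ : ∀ k ∈ F, j k ∈ Finset.range J := fun k hk =>
        Finset.mem_range.2 (Nat.lt_succ_of_le (Finset.le_sup hk))
      calc ∑ k ∈ F, (if 1 ≤ (k : ℝ) * h₀ then (k : ℝ) ^ (2 * β) * ‖a k‖ ^ 2 else 0)
          ≤ ∑ k ∈ F, ∑ i ∈ Finset.range J,
            A * ((2 : ℝ) ^ (2 * β * i) *
              ((2 - 2 * Real.cos (k * (h₀ / 2 ^ i))) ^ 2 * ‖a k‖ ^ 2)) := by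
            refine Finset.sum_le_sum fun k hk => ?_
            have hnn : ∀ i ∈ Finset.range J, 0 ≤ A * ((2 : ℝ) ^ (2 * β * i) *
                ((2 - 2 * Real.cos (k * (h₀ / 2 ^ i))) ^ 2 * ‖a k‖ ^ 2)) := fun i _ => by positivity
            split_ifs with hkh
            · exact (hterm k hkh).trans (Finset.single_le_sum (f := fun i : ℕ => A *
                ((2 : ℝ) ^ (2 * β * i) * ((2 - 2 * Real.cos (k * (h₀ / 2 ^ i))) ^ 2 * ‖a k‖ ^ 2)))
                hnn (hjJ k hk))
            · exact Finset.sum_nonneg hnn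
        _ = ∑ i ∈ Finset.range J, A * ((2 : ℝ) ^ (2 * β * i) *
              ∑ k ∈ F, (2 - 2 * Real.cos (k * (h₀ / 2 ^ i))) ^ 2 * ‖a k‖ ^ 2) := by
            rw [Finset.sum_comm]
            simp only [Finset.mul_sum]
        _ ≤ ∑ i ∈ Finset.range J, A * ((2 : ℝ) ^ (2 * β * i) * (C * (h₀ / 2 ^ i) ^ (2 * α))) := by
            gcongr with i hi
            refine h _ ⟨by positivity, ?_⟩ F
            exact div_le_self hh₀.le (one_le_pow₀ (by norm_num))
        _ = ∑ i ∈ Finset.range J, A * (C * h₀ ^ (2 * α)) * q ^ i := by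
            refine Finset.sum_congr rfl fun i _ => ?_
            have : (2 : ℝ) ^ (2 * β * i) * ((2 : ℝ) ^ i) ^ (-(2 * α)) = q ^ i := by
              rw [hq, ← Real.rpow_natCast, ← Real.rpow_natCast, ← Real.rpow_mul (by norm_num),
                ← Real.rpow_mul (by norm_num), ← Real.rpow_add (by norm_num)]
              ring_nf
            rw [Real.div_rpow hh₀.le (by positivity), ← this, Real.rpow_neg (by positivity)]
            ring
        _ ≤ _ := by
            rw [← Finset.mul_sum]
            gcongr
            have := (summable_geometric_of_lt_one hq0.le hq1).sum_le_tsum (Finset.range J)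
              (fun i _ => by positivity)
            rwa [tsum_geometric_of_lt_one hq0.le hq1] at this
    refine Summable.of_nonneg_of_le (fun k => by positivity) (fun k => ?_) (hlow.add hhigh)
    split_ifs with hk
    · have : 0 ≤ h₀ ^ (-(2 * β)) * ‖a k‖ ^ 2 := by positivity
      linarith
    · rw [add_zero]
      gcongr
      have h5 : (k : ℝ) ≤ h₀⁻¹ := by
        rw [← one_div, le_div_iff₀ hh₀]
        linarith
      calc (k : ℝ) ^ (2 * β) ≤ h₀⁻¹ ^ (2 * β) := Real.rpow_le_rpow (by positivity) h5 (by positivity)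
        _ = _ := by rw [Real.inv_rpow hh₀.le, ← Real.rpow_neg hh₀.le]
  have hsum2 : Summable fun k : ℕ => (k : ℝ) ^ (2 * s - 2 * β) :=
    Real.summable_nat_rpow.2 (by linarith)
  refine (hsum1.add hsum2).of_norm_bounded_eventually_nat ?_
  filter_upwards [eventually_ge_atTop 1] with k hk
  have hk0 : (0 : ℝ) < k := by exact_mod_cast hk
  rw [Real.norm_of_nonneg (by positivity)]
  have e1 : (k : ℝ) ^ (2 * β) = ((k : ℝ) ^ β) ^ 2 := by
    rw [← Real.rpow_natCast, ← Real.rpow_mul hk0.le]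
    norm_num [mul_comm]
  have e2 : (k : ℝ) ^ (2 * s - 2 * β) = ((k : ℝ) ^ (s - β)) ^ 2 := by
    rw [← Real.rpow_natCast, ← Real.rpow_mul hk0.le]
    congr 1
    push_cast
    ring
  have e3 : (k : ℝ) ^ s = (k : ℝ) ^ β * (k : ℝ) ^ (s - β) := by
    rw [← Real.rpow_add hk0]
    congr 1
    ring
  rw [e1, e2, e3]
  have hp : 0 ≤ (k : ℝ) ^ β * (k : ℝ) ^ (s - β) * ‖a k‖ := by positivity
  nlinarith [sq_nonneg ((k : ℝ) ^ β * ‖a k‖ - (k : ℝ) ^ (s - β))]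

end

section

open MeasureTheory AddCircle

instance fact_zero_lt_two_pi : Fact (0 < 2 * Real.pi) := ⟨Real.two_pi_pos⟩

/-- The circle `ℝ / 2πℤ`. -/
abbrev Torus : Type := AddCircle (2 * Real.pi)

theorem hasSum_sq_fourierCoeff_of_memLp {F : Torus → ℂ} (hF : MemLp F 2 haarAddCircle) :
    HasSum (fun k : ℤ => ‖fourierCoeff F k‖ ^ 2) (∫ x, ‖F x‖ ^ 2 ∂haarAddCircle) := by
  have h := hasSum_sq_fourierCoeff hF.toLp
  have e1 : ∀ k, fourierCoeff (hF.toLp F) k = fourierCoeff F k := fun k =>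
    congrFun (fourierCoeff_congr_ae hF.coeFn_toLp) k
  have e2 : ∫ x, ‖hF.toLp F x‖ ^ 2 ∂haarAddCircle = ∫ x, ‖F x‖ ^ 2 ∂haarAddCircle :=
    integral_congr_ae (hF.coeFn_toLp.mono fun x hx => by simp only [hx])
  rw [e2] at h
  simpa only [e1] using h

theorem integral_sq_le_of_fourierCoeff {F u : Torus → ℂ} (hF : MemLp F 2 haarAddCircle)
    (hu : MemLp u 2 haarAddCircle) (h : ∀ k, ‖fourierCoeff F k‖ ≤ 2 * ‖fourierCoeff u k‖) :
    ∫ x, ‖F x‖ ^ 2 ∂haarAddCircle ≤ 4 * ∫ x, ‖u x‖ ^ 2 ∂haarAddCircle := by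
  refine hasSum_le (fun k => ?_) (hasSum_sq_fourierCoeff_of_memLp hF)
    ((hasSum_sq_fourierCoeff_of_memLp hu).mul_left 4)
  calc ‖fourierCoeff F k‖ ^ 2 ≤ (2 * ‖fourierCoeff u k‖) ^ 2 := by gcongr; exact h k
    _ = _ := by ring

theorem fourierCoeff_translate (F : Torus → ℂ) (y : Torus) (k : ℤ) :
    fourierCoeff (fun x => F (x + y)) k = fourier k y * fourierCoeff F k := by
  have h : ∀ x : Torus, fourier (-k) x • F (x + y) =
      fourier k y • (fun x => fourier (-k) x • F x) (x + y) := fun x => by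
    have h1 : (fourier (-k) (x + y) : ℂ) = fourier (-k) x * fourier (-k) y := by
      simp only [fourier_apply, smul_add, toCircle_add, Circle.coe_mul]
    have h2 : (fourier k y : ℂ) * fourier (-k) y = 1 := by
      rw [← fourier_add, add_neg_cancel, fourier_zero]
    simp only [smul_eq_mul, h1]
    linear_combination (-(fourier (-k) x * F (x + y))) * h2
  simp only [fourierCoeff, h, integral_smul]
  rw [integral_add_right_eq_self (fun x => fourier (-k) x • F x) y, smul_eq_mul]

theorem memLp_translate {F : Torus → ℂ} (hF : MemLp F 2 haarAddCircle) (y : Torus) :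
    MemLp (fun x => F (x + y)) 2 haarAddCircle :=
  hF.comp_measurePreserving (measurePreserving_add_right haarAddCircle y)

theorem memLp_secondDiff {F : Torus → ℂ} (hF : MemLp F 2 haarAddCircle) (y : Torus) :
    MemLp (fun x => F (x + y) + F (x + -y) - 2 * F x) 2 haarAddCircle :=
  ((memLp_translate hF y).add (memLp_translate hF (-y))).sub (hF.const_mul 2)

theorem memLp_firstDiff {F : Torus → ℂ} (hF : MemLp F 2 haarAddCircle) (y : Torus) :
    MemLp (fun x => F (x + y) - F x) 2 haarAddCircle := (memLp_translate hF y).sub hF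

theorem fourierCoeff_sub_of_memLp {F G : Torus → ℂ} (hF : MemLp F 2 haarAddCircle)
    (hG : MemLp G 2 haarAddCircle) (k : ℤ) :
    fourierCoeff (fun x => F x - G x) k = fourierCoeff F k - fourierCoeff G k := by
  have e : (fun x => F x - G x) = F + (fun x => (-1 : ℂ) * G x) := by
    ext x
    simp [sub_eq_add_neg]
  have h : fourierCoeff (F + fun x => (-1 : ℂ) * G x) = _ := fourierCoeff.add
    (hF.integrable (by norm_num)) ((hG.const_mul (-1)).integrable (by norm_num))
  rw [e, h, Pi.add_apply, fourierCoeff.const_mul]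
  ring

theorem fourierCoeff_firstDiff {F : Torus → ℂ} (hF : MemLp F 2 haarAddCircle) (y : Torus) (k : ℤ) :
    fourierCoeff (fun x => F (x + y) - F x) k = (fourier k y - 1) * fourierCoeff F k := by
  rw [fourierCoeff_sub_of_memLp (memLp_translate hF y) hF, fourierCoeff_translate]
  ring

theorem fourierCoeff_secondDiff {F : Torus → ℂ} (hF : MemLp F 2 haarAddCircle) (y : Torus) (k : ℤ) :
    fourierCoeff (fun x => F (x + y) + F (x + -y) - 2 * F x) k =
      (fourier k y + fourier k (-y) - 2) * fourierCoeff F k := by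
  have h : fourierCoeff ((fun x => F (x + y)) + fun x => F (x + -y)) = _ := fourierCoeff.add
    ((memLp_translate hF y).integrable (by norm_num))
    ((memLp_translate hF (-y)).integrable (by norm_num))
  have h2 := fourierCoeff_sub_of_memLp ((memLp_translate hF y).add (memLp_translate hF (-y)))
    (hF.const_mul 2) k
  rw [h, Pi.add_apply, fourierCoeff_translate, fourierCoeff_translate, fourierCoeff.const_mul] at h2
  simp only [Pi.add_apply] at h2
  rw [h2]
  ring

theorem fourier_coe_two_pi (k : ℤ) (t : ℝ) :
    fourier k (t : Torus) = exp (k * t * I) := by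
  rw [fourier_coe_apply]
  congr 1
  have : (Real.pi : ℂ) ≠ 0 := ofReal_ne_zero.2 Real.pi_ne_zero
  push_cast
  field_simp

theorem norm_fourier_add_fourier_neg_sub_two (k : ℤ) (t : ℝ) :
    ‖fourier k (t : Torus) + fourier k (-(t : Torus)) - 2‖ ^ 2 = (2 - 2 * Real.cos (k * t)) ^ 2 := by
  have e : fourier k (t : Torus) + fourier k (-(t : Torus)) - 2 =
      ((-(2 - 2 * Real.cos (k * t)) : ℝ) : ℂ) := by
    rw [← AddCircle.coe_neg, fourier_coe_two_pi, fourier_coe_two_pi]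
    push_cast
    rw [Complex.cos]
    ring_nf
  rw [e, norm_real, Real.norm_eq_abs, sq_abs, neg_sq]

/-- Multipliers of the operator sending a real function to the analytic function with this real part
and real constant term. -/
noncomputable def schwarzMul (k : ℤ) : ℂ := if k < 0 then 0 else if k = 0 then 1 else 2

theorem norm_schwarzMul_le (k : ℤ) : ‖schwarzMul k‖ ≤ 2 := by
  unfold schwarzMul
  split_ifs <;> norm_num

theorem exists_fourierCoeff_eq_schwarzMul {u : Torus → ℂ} (hu : MemLp u 2 haarAddCircle) :
    ∃ G : Lp ℂ 2 (haarAddCircle (T := 2 * Real.pi)), ∀ k, fourierCoeff G k =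
      schwarzMul k * fourierCoeff u k := by
  have hs : Summable fun k => ‖schwarzMul k * fourierCoeff u k‖ ^ 2 := by
    refine Summable.of_nonneg_of_le (fun k => by positivity) (fun k => ?_)
      ((hasSum_sq_fourierCoeff_of_memLp hu).summable.mul_left 4)
    rw [norm_mul, mul_pow]
    gcongr
    nlinarith [norm_schwarzMul_le k, norm_nonneg (schwarzMul k)]
  have hm : Memℓp (fun k => schwarzMul k * fourierCoeff u k) 2 := by
    refine memℓp_gen ?_
    simpa using hs
  refine ⟨fourierBasis.repr.symm ⟨_, hm⟩, fun k => ?_⟩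
  rw [← fourierBasis_repr, LinearIsometryEquiv.apply_symm_apply]

end

section

open MeasureTheory AddCircle ComplexConjugate

theorem integral_sq_le_of_pointwise {F v : Torus → ℂ} {A : Torus → ℝ}
    (hF : MemLp F 2 haarAddCircle) (hv : MemLp v 2 haarAddCircle) (hA : MemLp A 2 haarAddCircle)
    (h : ∀ k, ‖fourierCoeff F k‖ ≤ 2 * ‖fourierCoeff v k‖)
    (hle : ∀ x, ‖v x‖ ≤ A x + 1 / 8 * ‖F x‖) :
    ∫ x, ‖F x‖ ^ 2 ∂haarAddCircle ≤ 16 * ∫ x, A x ^ 2 ∂haarAddCircle := by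
  have h1 := integral_sq_le_of_fourierCoeff hF hv h
  have iF : Integrable (fun x => ‖F x‖ ^ 2) haarAddCircle := hF.integrable_norm_pow (by norm_num)
  have iA : Integrable (fun x => A x ^ 2) haarAddCircle := hA.integrable_sq
  have iv : Integrable (fun x => ‖v x‖ ^ 2) haarAddCircle := hv.integrable_norm_pow (by norm_num)
  have h2 : ∫ x, ‖v x‖ ^ 2 ∂haarAddCircle ≤ ∫ x, (2 * A x ^ 2 + 1 / 32 * ‖F x‖ ^ 2) ∂haarAddCircle := by
    refine integral_mono iv ((iA.const_mul 2).add (iF.const_mul _)) fun x => ?_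
    have := hle x
    have h3 := norm_nonneg (v x)
    dsimp only
    nlinarith [sq_nonneg (A x - 1 / 8 * ‖F x‖)]
  rw [integral_add (iA.const_mul 2) (iF.const_mul _), integral_const_mul, integral_const_mul] at h2
  have h0 : 0 ≤ ∫ x, A x ^ 2 ∂haarAddCircle := integral_nonneg fun x => sq_nonneg _
  linarith

theorem sum_le_integral_secondDiff {G : Torus → ℂ} (hG : MemLp G 2 haarAddCircle) (t : ℝ)
    (F : Finset ℕ) : ∑ k ∈ F, (2 - 2 * Real.cos (k * t)) ^ 2 * ‖fourierCoeff G k‖ ^ 2 ≤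
      ∫ x : Torus, ‖G (x + (t : Torus)) + G (x + -(t : Torus)) - 2 * G x‖ ^ 2 ∂haarAddCircle := by
  have h := hasSum_sq_fourierCoeff_of_memLp (memLp_secondDiff hG t)
  refine le_trans (le_of_eq ?_) (sum_le_hasSum (F.map Nat.castEmbedding) (fun k _ => by positivity) h)
  rw [Finset.sum_map]
  refine Finset.sum_congr rfl fun k _ => ?_
  rw [fourierCoeff_secondDiff hG, norm_mul, mul_pow, norm_fourier_add_fourier_neg_sub_two]
  simp

theorem summable_nat_of_integral_secondDiff {G : Torus → ℂ} (hG : MemLp G 2 haarAddCircle)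
    {α s C h₀ : ℝ} (hh₀ : 0 < h₀) (hs : 0 ≤ s) (hsα : s + 1 / 2 < α)
    (h : ∀ t ∈ Ioc 0 h₀, ∫ x : Torus, ‖G (x + (t : Torus)) + G (x + -(t : Torus)) - 2 * G x‖ ^ 2 ∂haarAddCircle ≤
      C * t ^ (2 * α)) : Summable fun k : ℕ => (k : ℝ) ^ s * ‖fourierCoeff G k‖ :=
  summable_rpow_mul_of_second_diff (a := fun k : ℕ => fourierCoeff G k)
    ((hasSum_sq_fourierCoeff_of_memLp hG).summable.comp_injective Nat.cast_injective) hh₀ hs hsα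
    fun t ht F => (sum_le_integral_secondDiff hG t F).trans (h t ht)

theorem summable_norm_of_mul_rpow {a : ℕ → ℂ} {s : ℝ} (hs : 0 ≤ s)
    (h : Summable fun k : ℕ => (k : ℝ) ^ s * ‖a k‖) : Summable fun k => ‖a k‖ := by
  refine h.of_norm_bounded_eventually_nat ?_
  filter_upwards [eventually_ge_atTop 1] with k hk
  rw [norm_norm]
  exact le_mul_of_one_le_left (norm_nonneg _) (Real.one_le_rpow (by exact_mod_cast hk) hs)

theorem norm_exp_mul_I_sub_one_le {y s : ℝ} (hs : 0 ≤ s) (hs1 : s ≤ 1) :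
    ‖exp (y * I) - 1‖ ≤ 2 * |y| ^ s := by
  have h1 : ‖exp (y * I) - 1‖ ≤ 2 := by
    refine (norm_sub_le _ _).trans ?_
    rw [norm_exp_ofReal_mul_I, norm_one]
    norm_num
  rcases le_total 1 |y| with h | h
  · linarith [Real.one_le_rpow h hs]
  · have h2 : ‖exp (y * I) - 1‖ ≤ |y| := by
      have := Real.norm_exp_I_mul_ofReal_sub_one_le (x := y)
      rwa [mul_comm I, Real.norm_eq_abs] at this
    rcases eq_or_ne y 0 with rfl | hy
    · simp only [ofReal_zero, zero_mul, Complex.exp_zero, sub_self, norm_zero]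
      positivity
    · have h3 : |y| ^ (1 : ℝ) ≤ |y| ^ s :=
        Real.rpow_le_rpow_of_exponent_ge (abs_pos.2 hy) h hs1
      rw [Real.rpow_one] at h3
      linarith [abs_nonneg y]

/-- The boundary values on the circle of a power series. -/
noncomputable def circleSeries (a : ℕ → ℂ) (x : Torus) : ℂ := ∑' k : ℕ, a k * fourier k x

theorem norm_mul_fourier (z : ℂ) (k : ℤ) (x : Torus) : ‖z * fourier k x‖ = ‖z‖ := by
  rw [norm_mul, fourier_apply, Circle.norm_coe, mul_one]

theorem continuous_circleSeries {a : ℕ → ℂ} (ha : Summable fun k => ‖a k‖) :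
    Continuous (circleSeries a) :=
  continuous_tsum (fun k => by fun_prop) ha fun k x => (norm_mul_fourier _ _ _).le

theorem hasSum_circleSeries {a : ℕ → ℂ} (ha : Summable fun k => ‖a k‖) (x : Torus) :
    HasSum (fun k : ℕ => a k * fourier k x) (circleSeries a x) :=
  (Summable.of_norm (by simpa only [norm_mul_fourier] using ha)).hasSum

theorem norm_circleSeries_sub_le {a : ℕ → ℂ} {s : ℝ} (hs : 0 ≤ s) (hs1 : s ≤ 1)
    (ha : Summable fun k : ℕ => (k : ℝ) ^ s * ‖a k‖) (x : Torus) (t : ℝ) :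
    ‖circleSeries a (x + t) - circleSeries a x‖ ≤
      2 * (∑' k : ℕ, (k : ℝ) ^ s * ‖a k‖) * |t| ^ s := by
  have ha' := summable_norm_of_mul_rpow hs ha
  have h := (hasSum_circleSeries ha' (x + t)).sub (hasSum_circleSeries ha' x)
  rw [← h.tsum_eq]
  have hb := (ha.hasSum.mul_left 2).mul_right (|t| ^ s)
  refine tsum_of_norm_bounded hb fun k => ?_
  have e : (fourier k (x + (t : Torus)) : ℂ) = fourier k x * exp ((k * t : ℝ) * I) := by
    have := fourier_coe_two_pi k t
    push_cast at this ⊢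
    rw [← this]
    simp only [fourier_apply, smul_add, toCircle_add, Circle.coe_mul]
  calc ‖a k * fourier k (x + (t : Torus)) - a k * fourier k x‖
      = ‖a k * (exp ((k * t : ℝ) * I) - 1) * fourier k x‖ := by
        rw [e]
        ring_nf
    _ = ‖a k‖ * ‖exp ((k * t : ℝ) * I) - 1‖ := by rw [norm_mul_fourier, norm_mul]
    _ ≤ ‖a k‖ * (2 * |(k : ℝ) * t| ^ s) := by
        gcongr
        exact norm_exp_mul_I_sub_one_le hs hs1
    _ = 2 * ((k : ℝ) ^ s * ‖a k‖) * |t| ^ s := by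
        rw [abs_mul, Nat.abs_cast, Real.mul_rpow (by positivity) (by positivity)]
        ring

theorem summable_int_of_nat {b : ℤ → ℂ} (hneg : ∀ k < 0, b k = 0)
    (h : Summable fun k : ℕ => ‖b k‖) : Summable fun k : ℤ => ‖b k‖ := by
  refine Summable.of_nat_of_neg h ?_
  refine summable_of_hasFiniteSupport ((finite_singleton 0).subset fun k hk => ?_)
  by_contra hk0
  refine hk ?_
  change ‖b (-(k : ℤ))‖ = 0
  rw [hneg _ (by simp only [mem_singleton_iff] at hk0; omega), norm_zero]

theorem ae_eq_circleSeries {G : Torus → ℂ} (hG : MemLp G 2 haarAddCircle)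
    (hneg : ∀ k < 0, fourierCoeff G k = 0) (h : Summable fun k : ℕ => ‖fourierCoeff G k‖) :
    G =ᵐ[haarAddCircle] circleSeries (fun k => fourierCoeff G k) := by
  have h' := summable_int_of_nat hneg h
  have hsum : Summable fun k : ℤ => fourierCoeff G k • (fourier k : C(Torus, ℂ)) := by
    refine Summable.of_norm (h'.congr fun k => ?_)
    rw [norm_smul, fourier_norm, mul_one]
  obtain ⟨g, hg⟩ := hsum
  have h1 := hasSum_fourier_series_L2 hG.toLp
  have h2 : HasSum (fun k : ℤ => fourierCoeff G k • fourierLp (T := 2 * Real.pi) 2 k)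
      (ContinuousMap.toLp 2 haarAddCircle ℂ g) := by
    have := (ContinuousMap.toLp (E := ℂ) 2 haarAddCircle ℂ).hasSum hg
    simpa [Function.comp_def, fourierLp] using this
  have e : ∀ k, fourierCoeff (hG.toLp G) k = fourierCoeff G k := fun k =>
    congrFun (fourierCoeff_congr_ae hG.coeFn_toLp) k
  simp only [e] at h1
  have h3 := h1.unique h2
  have h4 : ∀ x, g x = circleSeries (fun k => fourierCoeff G k) x := by
    intro x
    have h5 : HasSum (fun k : ℤ => fourierCoeff G k * fourier k x) (g x) := by
      have := (ContinuousMap.evalCLM ℂ x).hasSum hg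
      simpa [Function.comp_def] using this
    have h6 := (Function.Injective.hasSum_iff (f := fun k : ℤ => fourierCoeff G k * fourier k x)
      (Nat.cast_injective (R := ℤ)) (fun k hk => ?_)).2 h5
    · exact h6.unique (hasSum_circleSeries h x)
    · rw [hneg, zero_mul]
      by_contra hk0
      exact hk ⟨k.toNat, by omega⟩
  have h5 := hG.coeFn_toLp
  rw [h3] at h5
  filter_upwards [h5, ContinuousMap.coeFn_toLp (p := 2) (𝕜 := ℂ) haarAddCircle g] with x hx hx'
  rw [← hx, hx', h4]

theorem fourierCoeff_ofReal_neg (u : Torus → ℝ) (k : ℤ) :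
    fourierCoeff (fun x => (u x : ℂ)) (-k) = conj (fourierCoeff (fun x => (u x : ℂ)) k) := by
  simp only [fourierCoeff, ← integral_conj, smul_eq_mul, map_mul, conj_ofReal, fourier_neg]

/-- Real parts of analytic boundary values are recovered from the multiplier equation. -/
theorem re_circleSeries {a : ℕ → ℂ} (ha : Summable fun k => ‖a k‖) {u : Torus → ℝ}
    (hu : Continuous u)
    (hau : ∀ k : ℕ, a k = schwarzMul k * fourierCoeff (fun x => (u x : ℂ)) k) (x : Torus) :
    (circleSeries a x).re = u x := by
  set uc : C(Torus, ℂ) := ⟨fun x => (u x : ℂ), by fun_prop⟩ with huc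
  set b : ℤ → ℂ := fun k => schwarzMul k * fourierCoeff uc k with hb
  have hba : ∀ k : ℕ, b k = a k := fun k => (hau k).symm
  have hbneg : ∀ k < 0, b k = 0 := fun k hk => by simp [hb, schwarzMul, hk]
  have hbs : Summable fun k : ℤ => ‖b k‖ := summable_int_of_nat hbneg (by simpa only [hba] using ha)
  have hconj : ∀ k, fourierCoeff uc k = (b k + conj (b (-k))) / 2 := by
    intro k
    have h1 := fourierCoeff_ofReal_neg u k
    have h2 : schwarzMul k + conj (schwarzMul (-k)) = 2 := by
      unfold schwarzMul
      rcases lt_trichotomy k 0 with h | rfl | h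
      · have h3 : ¬ (-k < 0) := by omega
        have h4 : -k ≠ 0 := by omega
        rw [if_pos h, if_neg h3, if_neg h4, zero_add, map_ofNat]
      · norm_num
      · have h3 : ¬ (k < 0) := by omega
        have h4 : k ≠ 0 := by omega
        simp [h, h3, h4]
    have h3 : fourierCoeff uc (-k) = conj (fourierCoeff uc k) := h1
    simp only [hb, map_mul, h3, conj_conj]
    linear_combination (-(fourierCoeff uc k) / 2) * h2
  have hbx : HasSum (fun k : ℤ => b k * fourier k x) (circleSeries a x) := by
    refine (Function.Injective.hasSum_iff (Nat.cast_injective (R := ℤ)) fun k hk => ?_).1 ?_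
    · rw [hbneg, zero_mul]
      by_contra hk0
      exact hk ⟨k.toNat, by omega⟩
    · simpa only [Function.comp_def, hba] using hasSum_circleSeries ha x
  have hbx' : HasSum (fun k : ℤ => conj (b (-k)) * fourier k x) (conj (circleSeries a x)) := by
    have h1 : HasSum (fun k : ℤ => conj (b k * fourier k x)) (conj (circleSeries a x)) :=
      (Complex.hasSum_conj' (f := fun k : ℤ => b k * fourier k x)).2 (by simpa using hbx)
    have h2 := (Equiv.neg ℤ).hasSum_iff.2 h1
    refine h2.congr_fun fun k => ?_
    simp [Function.comp_def, fourier_neg]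
  have h1 : HasSum (fun k : ℤ => fourierCoeff uc k * fourier k x)
      ((circleSeries a x + conj (circleSeries a x)) / 2) := by
    refine ((hbx.add hbx').div_const 2).congr_fun fun k => ?_
    rw [hconj]
    ring
  have hus : Summable (fourierCoeff uc) := by
    refine Summable.of_norm (Summable.of_nonneg_of_le (fun k => norm_nonneg _) (fun k => ?_)
      ((hbs.add ((Equiv.neg ℤ).summable_iff.2 hbs)).div_const 2))
    rw [hconj, norm_div]
    simp only [Function.comp_def, Equiv.neg_apply]
    gcongr
    · exact (norm_add_le _ _).trans (by rw [norm_conj])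
    · norm_num
  have h2 := h1.unique (has_pointwise_sum_fourier_series_of_summable hus x)
  have h3 := congrArg re h2
  rw [add_conj] at h3
  simpa [huc] using h3

end

section

open MeasureTheory AddCircle ComplexConjugate

theorem memLp_ofReal_comp {Ξ : Torus → ℂ → ℝ} (hΞ : Continuous fun p : Torus × ℂ => Ξ p.1 p.2)
    (hΞb : ∀ x g, |Ξ x g| ≤ 1) {G : Torus → ℂ} (hG : MemLp G 2 haarAddCircle) :
    MemLp (fun x => (Ξ x (G x) : ℂ)) 2 haarAddCircle := by
  have h : Continuous fun p : Torus × ℂ => (Ξ p.1 p.2 : ℂ) := by fun_prop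
  refine MemLp.of_bound (h.comp_aestronglyMeasurable
    (continuous_id.aestronglyMeasurable.prodMk hG.1)) 1 (ae_of_all _ fun x => ?_)
  rw [norm_real]
  exact hΞb _ _

theorem integral_sq_firstDiff_le {G : Torus → ℂ} (hG : MemLp G 2 haarAddCircle) {u : Torus → ℂ}
    (hu : MemLp u 2 haarAddCircle)
    (hcoef : ∀ k, fourierCoeff G k = schwarzMul k * fourierCoeff u k) {L t : ℝ}
    (h : ∀ x : Torus, ‖u (x + (t : Torus)) - u x‖ ≤
      L * |t| + 1 / 8 * ‖G (x + (t : Torus)) - G x‖) :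
    ∫ x : Torus, ‖G (x + (t : Torus)) - G x‖ ^ 2 ∂haarAddCircle ≤ 16 * L ^ 2 * t ^ 2 := by
  refine (integral_sq_le_of_pointwise (A := fun _ => L * |t|) (memLp_firstDiff hG t)
    (memLp_firstDiff hu t) (memLp_const _) (fun k => ?_) h).trans (le_of_eq ?_)
  · rw [fourierCoeff_firstDiff hG, fourierCoeff_firstDiff hu, hcoef, norm_mul, norm_mul, norm_mul]
    have := mul_le_mul_of_nonneg_right (norm_schwarzMul_le k)
      (mul_nonneg (norm_nonneg (fourier k (t : Torus) - 1 : ℂ)) (norm_nonneg (fourierCoeff u k)))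
    linarith
  · simp only [integral_const, probReal_univ, smul_eq_mul, mul_pow, sq_abs]
    ring

theorem integral_sq_secondDiff_le_firstDiff {G : Torus → ℂ} (hG : MemLp G 2 haarAddCircle) {B : ℝ}
    (h : ∀ t : ℝ, ∫ x : Torus, ‖G (x + (t : Torus)) - G x‖ ^ 2 ∂haarAddCircle ≤ B * t ^ 2) (t : ℝ) :
    ∫ x : Torus, ‖G (x + (t : Torus)) + G (x + -(t : Torus)) - 2 * G x‖ ^ 2 ∂haarAddCircle ≤
      4 * B * t ^ 2 := by
  have i1 := (memLp_firstDiff hG t).integrable_norm_pow (by norm_num)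
  have i2 := (memLp_firstDiff hG (-(t : Torus))).integrable_norm_pow (by norm_num)
  have i3 := (memLp_secondDiff hG t).integrable_norm_pow (by norm_num)
  have h2 := h (-t)
  rw [AddCircle.coe_neg] at h2
  refine (integral_mono i3 ((i1.const_mul 2).add (i2.const_mul 2)) fun x => ?_).trans
    (le_of_eq_of_le (integral_add (i1.const_mul 2) (i2.const_mul 2)) ?_)
  · have e : G (x + (t : Torus)) + G (x + -(t : Torus)) - 2 * G x =
      (G (x + (t : Torus)) - G x) + (G (x + -(t : Torus)) - G x) := by ring
    have h3 := norm_add_le (G (x + (t : Torus)) - G x) (G (x + -(t : Torus)) - G x)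
    have h4 := norm_nonneg (G (x + (t : Torus)) - G x)
    have h5 := norm_nonneg (G (x + -(t : Torus)) - G x)
    have h6 := norm_nonneg ((G (x + (t : Torus)) - G x) + (G (x + -(t : Torus)) - G x))
    simp only [e, Pi.add_apply]
    nlinarith [sq_nonneg (‖G (x + (t : Torus)) - G x‖ - ‖G (x + -(t : Torus)) - G x‖)]
  · rw [integral_const_mul, integral_const_mul]
    have := h t
    nlinarith

theorem exists_integral_sq_secondDiff_le {G : Torus → ℂ} (hGc : Continuous G) {u : Torus → ℂ}
    (huc : Continuous u) (hcoef : ∀ k, fourierCoeff G k = schwarzMul k * fourierCoeff u k)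
    {S B C s h₀ : ℝ} (hh₀ : h₀ ≤ 1) (hs1 : s ≤ 1)
    (hGS : ∀ (x : Torus) (t : ℝ), ‖G (x + (t : Torus)) - G x‖ ≤ S * |t| ^ s)
    (hGB : ∀ t : ℝ, ∫ x : Torus, ‖G (x + (t : Torus)) - G x‖ ^ 2 ∂haarAddCircle ≤ B * t ^ 2)
    (h : ∀ t ∈ Ioc 0 h₀, ∀ x : Torus, ‖u (x + (t : Torus)) + u (x + -(t : Torus)) - 2 * u x‖ ≤
      C * t ^ 2 + C * (‖G (x + (t : Torus)) - G x‖ ^ 2 + ‖G (x + -(t : Torus)) - G x‖ ^ 2) +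
      1 / 8 * ‖G (x + (t : Torus)) + G (x + -(t : Torus)) - 2 * G x‖) :
    ∃ C', ∀ t ∈ Ioc 0 h₀,
      ∫ x : Torus, ‖G (x + (t : Torus)) + G (x + -(t : Torus)) - 2 * G x‖ ^ 2 ∂haarAddCircle ≤
        C' * t ^ (2 * (1 + s)) := by
  have mG : MemLp G 2 haarAddCircle :=
    hGc.memLp_of_hasCompactSupport (HasCompactSupport.of_compactSpace G)
  have mu : MemLp u 2 haarAddCircle :=
    huc.memLp_of_hasCompactSupport (HasCompactSupport.of_compactSpace u)
  refine ⟨16 * (2 * C ^ 2 + 8 * C ^ 2 * S ^ 2 * B), fun t ht => ?_⟩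
  have ht0 : 0 < t := ht.1
  set p : Torus → ℝ := fun x => ‖G (x + (t : Torus)) - G x‖ with hp
  set q : Torus → ℝ := fun x => ‖G (x + -(t : Torus)) - G x‖ with hq
  have hpc : Continuous p := by fun_prop
  have hqc : Continuous q := by fun_prop
  have hA : MemLp (fun x => C * t ^ 2 + C * (p x ^ 2 + q x ^ 2)) 2 haarAddCircle :=
    (show Continuous fun x => C * t ^ 2 + C * (p x ^ 2 + q x ^ 2) by
      fun_prop).memLp_of_hasCompactSupport (HasCompactSupport.of_compactSpace _)
  have h1 := integral_sq_le_of_pointwise (memLp_secondDiff mG t) (memLp_secondDiff mu t) hA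
    (fun k => ?_) (h t ht)
  · refine h1.trans ?_
    rw [mul_assoc]
    refine mul_le_mul_of_nonneg_left ?_ (by norm_num)
    have i1 := (memLp_firstDiff mG t).integrable_norm_pow (p := 2) (by norm_num)
    have i2 := (memLp_firstDiff mG (-(t : Torus))).integrable_norm_pow (p := 2) (by norm_num)
    have b1 := hGB t
    have b2 := hGB (-t)
    rw [AddCircle.coe_neg, neg_sq] at b2
    have h_intg : ∫ x, (p x ^ 2 + q x ^ 2) ∂haarAddCircle =
        (∫ x, p x ^ 2 ∂haarAddCircle) + ∫ x, q x ^ 2 ∂haarAddCircle := integral_add i1 i2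
    have hsum : Integrable (fun x => 4 * C ^ 2 * (S * t ^ s) ^ 2 * (p x ^ 2 + q x ^ 2))
        haarAddCircle := (i1.add i2).const_mul _
    have h2 : ∫ x, (C * t ^ 2 + C * (p x ^ 2 + q x ^ 2)) ^ 2 ∂haarAddCircle ≤
        ∫ x, (2 * C ^ 2 * t ^ 4 + 4 * C ^ 2 * (S * t ^ s) ^ 2 * (p x ^ 2 + q x ^ 2))
          ∂haarAddCircle := by
      refine integral_mono hA.integrable_sq ((integrable_const _).add hsum) fun x => ?_
      have c1 : p x ≤ S * t ^ s := by
        have := hGS x t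
        rwa [abs_of_pos ht0] at this
      have c2 : q x ≤ S * t ^ s := by
        have := hGS x (-t)
        rwa [abs_neg, abs_of_pos ht0, AddCircle.coe_neg] at this
      have c3 : p x ^ 2 ≤ (S * t ^ s) ^ 2 := by gcongr
      have c4 : q x ^ 2 ≤ (S * t ^ s) ^ 2 := by gcongr
      have c5 : p x ^ 4 ≤ (S * t ^ s) ^ 2 * p x ^ 2 := by
        nlinarith [sq_nonneg (p x)]
      have c6 : q x ^ 4 ≤ (S * t ^ s) ^ 2 * q x ^ 2 := by
        nlinarith [sq_nonneg (q x)]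
      have c7 : (C * t ^ 2 + C * (p x ^ 2 + q x ^ 2)) ^ 2 ≤
          2 * C ^ 2 * t ^ 4 + 4 * C ^ 2 * (p x ^ 4 + q x ^ 4) := by
        have a1 := mul_nonneg (sq_nonneg C) (sq_nonneg (t ^ 2 - (p x ^ 2 + q x ^ 2)))
        have a2 := mul_nonneg (sq_nonneg C) (sq_nonneg (p x ^ 2 - q x ^ 2))
        nlinarith
      have c8 := mul_le_mul_of_nonneg_left (add_le_add c5 c6)
        (mul_nonneg (by norm_num : (0 : ℝ) ≤ 4) (sq_nonneg C))
      dsimp only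
      linarith
    refine h2.trans ?_
    rw [integral_add (integrable_const _) hsum, integral_const_mul (4 * C ^ 2 * (S * t ^ s) ^ 2),
      h_intg]
    simp only [integral_const, probReal_univ, smul_eq_mul, one_mul]
    have e1 : t ^ (2 * (1 + s)) = t ^ 2 * (t ^ s) ^ 2 := by
      rw [← Real.rpow_natCast (t ^ s), ← Real.rpow_mul ht0.le, ← Real.rpow_natCast t,
        ← Real.rpow_add ht0]
      congr 1
      push_cast
      ring
    have e2 : t ^ 4 ≤ t ^ (2 * (1 + s)) := by
      rw [← Real.rpow_natCast t 4]
      refine Real.rpow_le_rpow_of_exponent_ge ht0 (ht.2.trans hh₀) ?_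
      push_cast
      linarith
    have e3 := mul_le_mul_of_nonneg_left (add_le_add b1 b2)
      (show 0 ≤ 4 * C ^ 2 * (S * t ^ s) ^ 2 by positivity)
    have e4 := mul_le_mul_of_nonneg_left e2 (show 0 ≤ 2 * C ^ 2 by positivity)
    calc _ ≤ 2 * C ^ 2 * t ^ (2 * (1 + s)) +
          4 * C ^ 2 * (S * t ^ s) ^ 2 * (B * t ^ 2 + B * t ^ 2) := add_le_add e4 e3
      _ = _ := by rw [e1]; ring
  · rw [fourierCoeff_secondDiff mG, fourierCoeff_secondDiff mu, hcoef, norm_mul, norm_mul, norm_mul]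
    have := mul_le_mul_of_nonneg_right (norm_schwarzMul_le k)
      (mul_nonneg (norm_nonneg (fourier k (t : Torus) + fourier k (-(t : Torus)) - 2 : ℂ))
        (norm_nonneg (fourierCoeff u k)))
    linarith

theorem exists_circleSeries_eq {Ξ : Torus → ℂ → ℝ}
    (hΞ : Continuous fun p : Torus × ℂ => Ξ p.1 p.2) (hΞb : ∀ x g, |Ξ x g| ≤ 1) {L : ℝ}
    (h1 : ∀ (x : Torus) (t : ℝ) g g',
      |Ξ (x + (t : Torus)) g' - Ξ x g| ≤ L * |t| + 1 / 8 * ‖g' - g‖)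
    (h2 : ∀ G : Torus → ℂ, Continuous G → (∀ x, (G x).re = Ξ x (G x)) →
      ∃ C h₀ : ℝ, 0 ≤ C ∧ 0 < h₀ ∧ h₀ ≤ 1 ∧ ∀ t ∈ Ioc 0 h₀, ∀ x : Torus,
        |Ξ (x + (t : Torus)) (G (x + (t : Torus))) + Ξ (x + -(t : Torus)) (G (x + -(t : Torus))) -
          2 * Ξ x (G x)| ≤ C * t ^ 2 +
          C * (‖G (x + (t : Torus)) - G x‖ ^ 2 + ‖G (x + -(t : Torus)) - G x‖ ^ 2) +
          1 / 8 * ‖G (x + (t : Torus)) + G (x + -(t : Torus)) - 2 * G x‖)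
    {G : Torus → ℂ} (hG : MemLp G 2 haarAddCircle)
    (hcoef : ∀ k, fourierCoeff G k = schwarzMul k * fourierCoeff (fun x => (Ξ x (G x) : ℂ)) k) :
    (Summable fun k : ℕ => (k : ℝ) * ‖fourierCoeff G k‖) ∧
      ∀ x, (circleSeries (fun k => fourierCoeff G k) x).re =
        Ξ x (circleSeries (fun k => fourierCoeff G k) x) := by
  have hstep : ∀ (G : Torus → ℂ) (t : ℝ) (x : Torus),
      ‖(Ξ (x + (t : Torus)) (G (x + (t : Torus))) : ℂ) - (Ξ x (G x) : ℂ)‖ ≤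
        L * |t| + 1 / 8 * ‖G (x + (t : Torus)) - G x‖ := by
    intro G t x
    rw [← ofReal_sub, norm_real]
    exact h1 x t _ _
  have hB : ∀ t : ℝ, ∫ x : Torus, ‖G (x + (t : Torus)) - G x‖ ^ 2 ∂haarAddCircle ≤
      16 * L ^ 2 * t ^ 2 := fun t =>
    integral_sq_firstDiff_le hG (memLp_ofReal_comp hΞ hΞb hG) hcoef (hstep G t)
  have s4 : Summable fun k : ℕ => (k : ℝ) ^ (2 / 5 : ℝ) * ‖fourierCoeff G k‖ := by
    refine summable_nat_of_integral_secondDiff hG (α := 1) (C := 4 * (16 * L ^ 2)) one_pos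
      (by norm_num) (by norm_num) fun t ht => ?_
    have := integral_sq_secondDiff_le_firstDiff hG hB t
    rwa [mul_one, Real.rpow_ofNat]
  have s0 := summable_norm_of_mul_rpow (a := fun k : ℕ => fourierCoeff G k) (by norm_num) s4
  have hneg : ∀ k < 0, fourierCoeff G k = 0 := fun k hk => by
    rw [hcoef, schwarzMul, if_pos hk, zero_mul]
  have hae := ae_eq_circleSeries hG hneg s0
  set G' : Torus → ℂ := circleSeries (fun k => fourierCoeff G k) with hG'
  have hGc : Continuous G' := continuous_circleSeries s0
  have hcG : ∀ k, fourierCoeff G k = fourierCoeff G' k := fun k =>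
    congrFun (fourierCoeff_congr_ae hae) k
  have hcu : ∀ k, fourierCoeff (fun x => (Ξ x (G x) : ℂ)) k =
      fourierCoeff (fun x => (Ξ x (G' x) : ℂ)) k := fun k =>
    congrFun (fourierCoeff_congr_ae (hae.mono fun x hx => by simp only [hx])) k
  have huc : Continuous fun x => Ξ x (G' x) := hΞ.comp (continuous_id.prodMk hGc)
  have hre : ∀ x, (G' x).re = Ξ x (G' x) :=
    re_circleSeries s0 huc fun k => by rw [hcoef, hcu]
  refine ⟨?_, hre⟩
  obtain ⟨C, h₀, hC, hh₀, hh₁, hsec⟩ := h2 G' hGc hre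
  have hB' : ∀ t : ℝ, ∫ x : Torus, ‖G' (x + (t : Torus)) - G' x‖ ^ 2 ∂haarAddCircle ≤
      16 * L ^ 2 * t ^ 2 := by
    intro t
    refine integral_sq_firstDiff_le (u := fun x => (Ξ x (G' x) : ℂ)) ((memLp_congr_ae hae).1 hG)
      (memLp_ofReal_comp hΞ hΞb ((memLp_congr_ae hae).1 hG)) (fun k => ?_) (hstep G' t)
    rw [← hcG, hcoef, hcu]
  have hsec' : ∀ t ∈ Ioc 0 h₀, ∀ x : Torus,
      ‖(Ξ (x + (t : Torus)) (G' (x + (t : Torus))) : ℂ) +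
        (Ξ (x + -(t : Torus)) (G' (x + -(t : Torus))) : ℂ) - 2 * (Ξ x (G' x) : ℂ)‖ ≤ C * t ^ 2 +
          C * (‖G' (x + (t : Torus)) - G' x‖ ^ 2 + ‖G' (x + -(t : Torus)) - G' x‖ ^ 2) +
          1 / 8 * ‖G' (x + (t : Torus)) + G' (x + -(t : Torus)) - 2 * G' x‖ := by
    intro t ht x
    have := hsec t ht x
    rw [← Real.norm_eq_abs, ← norm_real] at this
    push_cast at this
    exact this
  have hboot : ∀ s s' : ℝ, 0 ≤ s → s ≤ 1 → 0 ≤ s' → s' + 1 / 2 < 1 + s →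
      (Summable fun k : ℕ => (k : ℝ) ^ s * ‖fourierCoeff G k‖) →
      Summable fun k : ℕ => (k : ℝ) ^ s' * ‖fourierCoeff G k‖ := by
    intro s s' hs hs1 hs' hss hsum
    obtain ⟨C', hC'⟩ := exists_integral_sq_secondDiff_le hGc (u := fun x => (Ξ x (G' x) : ℂ))
      (by fun_prop) (fun k => by rw [← hcG, hcoef, hcu]) hh₁ hs1
      (norm_circleSeries_sub_le hs hs1 hsum) hB' hsec'
    have := summable_nat_of_integral_secondDiff ((memLp_congr_ae hae).1 hG) hh₀ hs' hss hC'
    simpa only [← hcG] using this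
  have s8 := hboot (2 / 5) (4 / 5) (by norm_num) (by norm_num) (by norm_num) (by norm_num) s4
  have s1 := hboot (4 / 5) 1 (by norm_num) (by norm_num) (by norm_num) (by norm_num) s8
  simpa only [Real.rpow_one] using s1

end

section

open MeasureTheory AddCircle ComplexConjugate

theorem norm_sq_eq_integral (F : Lp ℂ 2 (haarAddCircle (T := 2 * Real.pi))) :
    ‖F‖ ^ 2 = ∫ x, ‖F x‖ ^ 2 ∂haarAddCircle := by
  have h := @L2.inner_def (AddCircle (2 * Real.pi)) ℂ ℂ _ _ _ _ _ F F
  simp only [inner_self_eq_norm_sq_to_K, RCLike.ofReal_eq_complex_ofReal, ← ofReal_pow] at h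
  rw [integral_complex_ofReal] at h
  exact ofReal_injective h

theorem norm_le_of_fourierCoeff {F : Lp ℂ 2 (haarAddCircle (T := 2 * Real.pi))} {u : Torus → ℂ}
    (hu : MemLp u 2 haarAddCircle) (h : ∀ k, ‖fourierCoeff F k‖ ≤ 2 * ‖fourierCoeff u k‖) {s : ℝ}
    (hs : 0 ≤ s) (hus : ∫ x, ‖u x‖ ^ 2 ∂haarAddCircle ≤ s ^ 2) : ‖F‖ ≤ 2 * s := by
  have h1 := integral_sq_le_of_fourierCoeff (Lp.memLp F) hu h
  rw [← norm_sq_eq_integral] at h1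
  exact abs_le_of_sq_le_sq' (by linarith [h1]) (by positivity) |>.2

/-- A system of singular integral equations on circles has a solution. -/
theorem exists_fixed_fourierCoeff {ι : Type*} [Fintype ι]
    {Ξ : (ι → Lp ℂ 2 (haarAddCircle (T := 2 * Real.pi))) → ι → Torus → ℂ → ℝ}
    (hΞ : ∀ a j, Continuous fun p : Torus × ℂ => Ξ a j p.1 p.2)
    (hΞb : ∀ a j x g, |Ξ a j x g| ≤ 1 / 50)
    (hΞL : ∀ a a', ‖a‖ ≤ 1 → ‖a'‖ ≤ 1 → ∀ j x g g',
      |Ξ a j x g - Ξ a' j x g'| ≤ 1 / 8 * (‖g - g'‖ + ‖a - a'‖)) :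
    ∃ a, ‖a‖ ≤ 1 ∧ ∀ j k, fourierCoeff (a j) k =
      schwarzMul k * fourierCoeff (fun x => (Ξ a j x (a j x) : ℂ)) k := by
  have hmem : ∀ a j, MemLp (fun x => (Ξ a j x ((a j : Torus → ℂ) x) : ℂ)) 2 haarAddCircle :=
    fun a j => memLp_ofReal_comp (hΞ a j) (fun x g => (hΞb a j x g).trans (by norm_num))
      (Lp.memLp (a j))
  choose T hT using fun a j => exists_fourierCoeff_eq_schwarzMul (hmem a j)
  have hcoef : ∀ k (z : ℂ), ‖schwarzMul k * z‖ ≤ 2 * ‖z‖ := fun k z => by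
    rw [norm_mul]
    exact mul_le_mul_of_nonneg_right (norm_schwarzMul_le k) (norm_nonneg _)
  have hmaps : ∀ a, ‖T a‖ ≤ 1 := by
    intro a
    refine (pi_norm_le_iff_of_nonneg zero_le_one).2 fun j => ?_
    refine (norm_le_of_fourierCoeff (hmem a j) (fun k => ?_) (s := 1 / 50) (by norm_num)
      ?_).trans (by norm_num)
    · rw [hT]
      exact hcoef _ _
    · refine (integral_mono ((hmem a j).integrable_norm_pow (by norm_num))
        (integrable_const ((1 / 50 : ℝ) ^ 2)) fun x => ?_).trans (by simp)
      have := hΞb a j x ((a j : Torus → ℂ) x)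
      rw [← Real.norm_eq_abs, ← norm_real] at this
      dsimp only
      gcongr
  have hcon : ∀ a a', ‖a‖ ≤ 1 → ‖a'‖ ≤ 1 → ‖T a - T a'‖ ≤ 1 / 2 * ‖a - a'‖ := by
    intro a a' ha ha'
    refine (pi_norm_le_iff_of_nonneg (by positivity)).2 fun j => ?_
    have hsub := (hmem a j).sub (hmem a' j)
    have e1 : ∀ k, fourierCoeff (T a j - T a' j : Lp ℂ 2 (haarAddCircle (T := 2 * Real.pi))) k =
        schwarzMul k * fourierCoeff (fun x => (Ξ a j x ((a j : Torus → ℂ) x) : ℂ) -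
          (Ξ a' j x ((a' j : Torus → ℂ) x) : ℂ)) k := by
      intro k
      rw [congrFun (fourierCoeff_congr_ae (Lp.coeFn_sub (T a j) (T a' j))) k]
      have h1 := fourierCoeff_sub_of_memLp (Lp.memLp (T a j)) (Lp.memLp (T a' j)) k
      have h2 := fourierCoeff_sub_of_memLp (hmem a j) (hmem a' j) k
      rw [h2, mul_sub, ← hT, ← hT]
      exact h1
    have h1 := norm_le_of_fourierCoeff (F := (T a j - T a' j)) hsub (fun k => by
      rw [e1]
      exact hcoef _ _) (s := 1 / 4 * ‖a - a'‖) (by positivity) ?_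
    · exact h1.trans (le_of_eq (by ring))
    · have i1 := (Lp.memLp (a j - a' j)).integrable_norm_pow (p := 2) (by norm_num)
      have n1 := norm_sq_eq_integral (a j - a' j)
      have n2 : ‖a j - a' j‖ ≤ ‖a - a'‖ := norm_le_pi_norm (a - a') j
      have hae := Lp.coeFn_sub (a j) (a' j)
      refine (integral_mono_ae (hsub.integrable_norm_pow (by norm_num))
        (((i1.add (integrable_const (‖a - a'‖ ^ 2))).const_mul (1 / 32)))
        (hae.mono fun x hx => ?_)).trans ?_
      · have h2 := hΞL a a' ha ha' j x ((a j : Torus → ℂ) x) ((a' j : Torus → ℂ) x)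
        have e2 : ‖(Ξ a j x ((a j : Torus → ℂ) x) : ℂ) - (Ξ a' j x ((a' j : Torus → ℂ) x) : ℂ)‖ =
            |Ξ a j x ((a j : Torus → ℂ) x) - Ξ a' j x ((a' j : Torus → ℂ) x)| := by
          rw [← ofReal_sub, norm_real, Real.norm_eq_abs]
        simp only [Pi.sub_apply, Pi.add_apply] at hx ⊢
        rw [e2, hx]
        have h3 := pow_le_pow_left₀ (abs_nonneg _) h2 2
        nlinarith [sq_nonneg (‖(a j : Torus → ℂ) x - (a' j : Torus → ℂ) x‖ - ‖a - a'‖)]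
      · rw [integral_const_mul, integral_add' i1 (integrable_const _), ← n1]
        simp only [integral_const, probReal_univ, smul_eq_mul, one_mul]
        have := pow_le_pow_left₀ (norm_nonneg _) n2 2
        nlinarith
  have hball : MapsTo T (closedBall 0 1) (closedBall 0 1) := fun a _ => by
    rw [mem_closedBall_zero_iff]
    exact hmaps a
  have hcw : ContractingWith (1 / 2) (hball.restrict T _ _) := by
    refine ⟨by norm_num, LipschitzWith.of_dist_le_mul fun a a' => ?_⟩
    have := hcon a a' (mem_closedBall_zero_iff.1 a.2) (mem_closedBall_zero_iff.1 a'.2)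
    rw [Subtype.dist_eq, Subtype.dist_eq, dist_eq_norm, dist_eq_norm]
    simpa using this
  obtain ⟨a, ha, hfix, -⟩ := ContractingWith.exists_fixedPoint'
    (isClosed_closedBall.isComplete) hball hcw (mem_closedBall_self zero_le_one) (edist_ne_top _ _)
  refine ⟨a, mem_closedBall_zero_iff.1 ha, fun j k => ?_⟩
  have h := congrFun hfix j
  rw [← hT a j k, h]

end

/-- Truncation of the real part to `[-1/50, 1/50]`. -/
noncomputable def clampRe (g : ℂ) : ℂ := ⟨max (-(1 / 50)) (min (1 / 50) g.re), g.im⟩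

theorem abs_clampRe_re_le (g : ℂ) : |(clampRe g).re| ≤ 1 / 50 :=
  abs_le.2 ⟨le_max_left _ _, max_le (by norm_num) (min_le_left _ _)⟩

theorem clampRe_eq {g : ℂ} (h : |g.re| ≤ 1 / 50) : clampRe g = g := by
  obtain ⟨h1, h2⟩ := abs_le.1 h
  exact Complex.ext (by rw [clampRe, min_eq_right h2, max_eq_right h1]) rfl

theorem abs_clampRe_re_sub_le (g g' : ℂ) :
    |(clampRe g).re - (clampRe g').re| ≤ |g.re - g'.re| :=
  (abs_max_sub_max_le_max _ _ _ _).trans (by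
    rw [sub_self, abs_zero]
    refine max_le (abs_nonneg _) ((abs_min_sub_min_le_max _ _ _ _).trans ?_)
    rw [sub_self, abs_zero, max_eq_right (abs_nonneg _)])

theorem norm_clampRe_sub_le (g g' : ℂ) : ‖clampRe g - clampRe g'‖ ≤ ‖g - g'‖ := by
  rw [Complex.norm_eq_sqrt_sq_add_sq, Complex.norm_eq_sqrt_sq_add_sq]
  refine Real.sqrt_le_sqrt (add_le_add (sq_le_sq.2 ?_) (le_of_eq rfl))
  exact abs_clampRe_re_sub_le g g'

theorem continuous_clampRe : Continuous clampRe :=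
  (LipschitzWith.of_dist_le_mul (K := 1) fun g g' => by
    simpa [dist_eq_norm] using norm_clampRe_sub_le g g').continuous

theorem exp_le_of_abs_le {x : ℝ} (hx : |x| ≤ 1 / 50) : Real.exp x ≤ 26 / 25 := by
  have := Real.abs_exp_sub_one_le (x := x) (hx.trans (by norm_num))
  linarith [le_abs_self (Real.exp x - 1)]

theorem norm_exp_clampRe_le (g : ℂ) : ‖exp (clampRe g)‖ ≤ 26 / 25 := by
  rw [norm_exp]
  exact exp_le_of_abs_le (abs_clampRe_re_le g)

theorem norm_exp_clampRe_sub_le (g g' : ℂ) :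
    ‖exp (clampRe g) - exp (clampRe g')‖ ≤ 26 / 25 * ‖g - g'‖ := by
  have hconv : Convex ℝ {z : ℂ | |z.re| ≤ 1 / 50} := by
    have : {z : ℂ | |z.re| ≤ 1 / 50} = reLm ⁻¹' (Icc (-(1 / 50)) (1 / 50)) := by
      ext z
      exact abs_le (a := z.re)
    rw [this]
    exact (convex_Icc _ _).linear_preimage _
  refine (hconv.norm_image_sub_le_of_norm_deriv_le (f := Complex.exp) (C := 26 / 25)
    (fun z _ => differentiable_exp z) (fun z hz => ?_) (abs_clampRe_re_le g')
    (abs_clampRe_re_le g)).trans ?_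
  · rw [Complex.deriv_exp, norm_exp]
    exact exp_le_of_abs_le hz
  · exact mul_le_mul_of_nonneg_left (norm_clampRe_sub_le g g') (by norm_num)

theorem abs_sub_half_exp_sub_le {s t : ℝ} (hs : |s| ≤ 1 / 50) (ht : |t| ≤ 1 / 50) :
    |(s - 1 / 2 * Real.exp (2 * s)) - (t - 1 / 2 * Real.exp (2 * t))| ≤ 2 / 25 * |s - t| := by
  have h : ∀ x ∈ Icc (-(1 / 50)) (1 / 50 : ℝ),
      HasDerivWithinAt (fun x : ℝ => x - 1 / 2 * Real.exp (2 * x)) (1 - Real.exp (2 * x))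
        (Icc (-(1 / 50)) (1 / 50)) x := by
    intro x _
    have h1 := (((hasDerivAt_id x).const_mul 2).exp).const_mul (1 / 2)
    refine (((hasDerivAt_id x).sub h1).congr_deriv ?_).hasDerivWithinAt
    simp only [id, mul_one]
    ring
  refine (convex_Icc _ _).norm_image_sub_le_of_norm_hasDerivWithin_le h (fun x hx => ?_)
    (abs_le.1 ht) (abs_le.1 hs)
  have hx' : |x| ≤ 1 / 50 := abs_le.2 hx
  have h2 : |2 * x| = 2 * |x| := by rw [abs_mul, abs_two]
  have := Real.abs_exp_sub_one_le (x := 2 * x) (by rw [h2]; linarith)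
  rw [Real.norm_eq_abs, abs_sub_comm]
  linarith

/-- The right hand side of the boundary integral equation. -/
noncomputable def circleRhs (P : ℂ → ℂ → ℝ) (N : ℕ) (w b g : ℂ) : ℝ :=
  (clampRe g).re - 1 / 2 * P w (w ^ N * exp (clampRe g) + b)

theorem norm_arg_le {N : ℕ} {w b : ℂ} (hw : w ∈ sphere (0 : ℂ) 1) (hb : ‖b‖ ≤ 1 / 100) (g : ℂ) :
    w ^ N * exp (clampRe g) + b ∈ closedBall (0 : ℂ) 2 := by
  rw [mem_closedBall_zero_iff]
  refine (norm_add_le _ _).trans ?_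
  rw [norm_mul, norm_pow, mem_sphere_zero_iff_norm.1 hw, one_pow, one_mul]
  linarith [norm_exp_clampRe_le g]

theorem norm_pow_mul_exp_clampRe {N : ℕ} {w : ℂ} (hw : w ∈ sphere (0 : ℂ) 1) (g : ℂ) :
    ‖w ^ N * exp (clampRe g)‖ = ‖exp (clampRe g)‖ := by
  rw [norm_mul, norm_pow, mem_sphere_zero_iff_norm.1 hw, one_pow, one_mul]

theorem circleRhs_eq (P : ℂ → ℂ → ℝ) (N : ℕ) {w : ℂ} (hw : w ∈ sphere (0 : ℂ) 1) (b g : ℂ) :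
    circleRhs P N w b g = ((clampRe g).re - 1 / 2 * Real.exp (2 * (clampRe g).re)) + 1 / 2 -
      inner ℝ (w ^ N * exp (clampRe g)) b - 1 / 2 * ‖b‖ ^ 2 -
      1 / 2 * (P w (w ^ N * exp (clampRe g) + b) - (‖w ^ N * exp (clampRe g) + b‖ ^ 2 - 1)) := by
  have h1 := norm_add_sq_real (w ^ N * exp (clampRe g)) b
  rw [norm_pow_mul_exp_clampRe hw, norm_exp, ← Real.exp_nat_mul] at h1
  push_cast at h1
  rw [h1, circleRhs]
  ring

theorem abs_circleRhs_le {P : ℂ → ℂ → ℝ} {N : ℕ} {w b : ℂ} (hw : w ∈ sphere (0 : ℂ) 1)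
    (hP : ∀ ζ ∈ closedBall (0 : ℂ) 2, |P w ζ - (‖ζ‖ ^ 2 - 1)| ≤ 1 / 100)
    (hb : ‖b‖ ≤ 1 / 100) (g : ℂ) : |circleRhs P N w b g| ≤ 1 / 55 := by
  rw [circleRhs_eq P N hw]
  have h1 := abs_clampRe_re_le g
  have h2 : |2 * (clampRe g).re| = 2 * |(clampRe g).re| := by rw [abs_mul, abs_two]
  have h3 := Real.abs_exp_sub_one_sub_id_le (x := 2 * (clampRe g).re) (by rw [h2]; linarith)
  have h4 : (2 * (clampRe g).re) ^ 2 ≤ (1 / 25) ^ 2 := sq_le_sq.2 (by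
    rw [h2, abs_of_pos (by norm_num : (0 : ℝ) < 1 / 25)]
    linarith)
  have h5 := abs_real_inner_le_norm (w ^ N * exp (clampRe g)) b
  rw [norm_pow_mul_exp_clampRe hw] at h5
  have h6 : ‖exp (clampRe g)‖ * ‖b‖ ≤ 26 / 25 * (1 / 100) :=
    mul_le_mul (norm_exp_clampRe_le g) hb (norm_nonneg _) (by norm_num)
  have h7 := hP _ (norm_arg_le (N := N) hw hb g)
  have h8 : ‖b‖ ^ 2 ≤ (1 / 100) ^ 2 := by gcongr
  have h9 := sq_nonneg ‖b‖
  rw [abs_le] at h3 h5 h7 ⊢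
  constructor <;> linarith [h3.1, h3.2, h5.1, h5.2, h7.1, h7.2]

theorem abs_circleRhs_sub_le {P : ℂ → ℂ → ℝ} {N : ℕ} {w b b' : ℂ} (hw : w ∈ sphere (0 : ℂ) 1)
    (hP : ∀ ζ ∈ closedBall (0 : ℂ) 2, ∀ ζ' ∈ closedBall (0 : ℂ) 2,
      |(P w ζ - (‖ζ‖ ^ 2 - 1)) - (P w ζ' - (‖ζ'‖ ^ 2 - 1))| ≤ 1 / 100 * ‖ζ - ζ'‖)
    (hb : ‖b‖ ≤ 1 / 100) (hb' : ‖b'‖ ≤ 1 / 100) (g g' : ℂ) :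
    |circleRhs P N w b g - circleRhs P N w b' g'| ≤ 1 / 8 * ‖g - g'‖ + 2 * ‖b - b'‖ := by
  rw [circleRhs_eq P N hw, circleRhs_eq P N hw]
  have h1 := abs_sub_half_exp_sub_le (abs_clampRe_re_le g) (abs_clampRe_re_le g')
  have h2 : |(clampRe g).re - (clampRe g').re| ≤ ‖g - g'‖ := by
    refine (abs_clampRe_re_sub_le g g').trans ?_
    rw [← sub_re]
    exact abs_re_le_norm _
  have hE : ‖w ^ N * exp (clampRe g) - w ^ N * exp (clampRe g')‖ ≤ 26 / 25 * ‖g - g'‖ := by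
    rw [← mul_sub, norm_mul, norm_pow, mem_sphere_zero_iff_norm.1 hw, one_pow, one_mul]
    exact norm_exp_clampRe_sub_le g g'
  have hE' : ‖w ^ N * exp (clampRe g')‖ ≤ 26 / 25 := by
    rw [norm_pow_mul_exp_clampRe hw]
    exact norm_exp_clampRe_le g'
  have h3 := hP _ (norm_arg_le (N := N) hw hb g) _ (norm_arg_le (N := N) hw hb' g')
  set e := w ^ N * exp (clampRe g)
  set e' := w ^ N * exp (clampRe g')
  have h4 : ‖e + b - (e' + b')‖ ≤ ‖e - e'‖ + ‖b - b'‖ := by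
    have : e + b - (e' + b') = (e - e') + (b - b') := by ring
    rw [this]
    exact norm_add_le _ _
  have h5 : |inner ℝ e b - inner ℝ e' b'| ≤ ‖e - e'‖ * ‖b‖ + ‖e'‖ * ‖b - b'‖ := by
    have : inner ℝ e b - inner ℝ e' b' = inner ℝ (e - e') b + inner ℝ e' (b - b') := by
      rw [inner_sub_left, inner_sub_right]
      ring
    rw [this]
    exact (abs_add_le _ _).trans (add_le_add (abs_real_inner_le_norm _ _)
      (abs_real_inner_le_norm _ _))
  have h6 : ‖e - e'‖ * ‖b‖ ≤ 26 / 25 * ‖g - g'‖ * (1 / 100) :=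
    mul_le_mul hE hb (norm_nonneg _) (by positivity)
  have h7 : ‖e'‖ * ‖b - b'‖ ≤ 26 / 25 * ‖b - b'‖ :=
    mul_le_mul_of_nonneg_right hE' (norm_nonneg _)
  have h8 : |‖b‖ ^ 2 - ‖b'‖ ^ 2| ≤ 1 / 50 * ‖b - b'‖ := by
    have : ‖b‖ ^ 2 - ‖b'‖ ^ 2 = (‖b‖ + ‖b'‖) * (‖b‖ - ‖b'‖) := by ring
    rw [this, abs_mul, abs_of_nonneg (by positivity)]
    exact mul_le_mul (by linarith) (abs_norm_sub_norm_le _ _) (abs_nonneg _) (by norm_num)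
  have n1 := norm_nonneg (g - g')
  have n2 := norm_nonneg (b - b')
  rw [abs_le] at h1 h3 h5 h8 ⊢
  constructor <;> linarith [h1.1, h1.2, h3.1, h3.2, h5.1, h5.2, h8.1, h8.2]

section

open MeasureTheory AddCircle

theorem fourier_one_coe (s : ℝ) : (fourier 1 (s : Torus) : ℂ) = exp (s * I) := by
  rw [fourier_coe_two_pi]
  simp

theorem fourier_one_mem_sphere (x : Torus) : (fourier 1 x : ℂ) ∈ sphere (0 : ℂ) 1 := by
  rw [mem_sphere_zero_iff_norm, fourier_apply, Circle.norm_coe]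

theorem exp_ofReal_mul_I_mem_sphere (s : ℝ) : exp (s * I) ∈ sphere (0 : ℂ) 1 := by
  rw [mem_sphere_zero_iff_norm, norm_exp_ofReal_mul_I]

/-- A smooth family of functions on the closed disc of radius `2` which are close to
`‖ζ‖ ^ 2 - 1`. -/
structure IsNearDisc (P : ℂ → ℂ → ℝ) : Prop where
  contDiffAt : ∀ w ∈ sphere (0 : ℂ) 1, ∀ ζ ∈ closedBall (0 : ℂ) 2,
    ContDiffAt ℝ 3 (fun p : ℂ × ℂ => P p.1 p.2) (w, ζ)
  abs_sub_le : ∀ w ∈ sphere (0 : ℂ) 1, ∀ ζ ∈ closedBall (0 : ℂ) 2, |P w ζ - (‖ζ‖ ^ 2 - 1)| ≤ 1 / 100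
  lipschitz : ∀ w ∈ sphere (0 : ℂ) 1, ∀ ζ ∈ closedBall (0 : ℂ) 2, ∀ ζ' ∈ closedBall (0 : ℂ) 2,
    |(P w ζ - (‖ζ‖ ^ 2 - 1)) - (P w ζ' - (‖ζ'‖ ^ 2 - 1))| ≤ 1 / 100 * ‖ζ - ζ'‖

/-- A smooth family of small translations. -/
structure IsSmallShift (β : ℂ → ℂ) : Prop where
  contDiffAt : ∀ w ∈ sphere (0 : ℂ) 1, ContDiffAt ℝ 3 β w
  norm_le : ∀ w ∈ sphere (0 : ℂ) 1, ‖β w‖ ≤ 1 / 100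

/-- The boundary equation in the angular variable. -/
noncomputable def angular (P : ℂ → ℂ → ℝ) (N : ℕ) (β : ℂ → ℂ) (p : ℝ × ℂ) : ℝ :=
  P (exp (p.1 * I)) (exp (p.1 * I) ^ N * p.2 + β (exp (p.1 * I)))

variable {P : ℂ → ℂ → ℝ} {N : ℕ} {β : ℂ → ℂ}

theorem contDiffAt_angular (hP : IsNearDisc P) (hβ : IsSmallShift β)
    {p : ℝ × ℂ} (hp : ‖p.2‖ ≤ 26 / 25) : ContDiffAt ℝ 3 (angular P N β) p := by
  have hw := exp_ofReal_mul_I_mem_sphere p.1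
  have h1 : ContDiffAt ℝ 3 (fun q : ℝ × ℂ => exp (q.1 * I)) p := by
    have h2 : ContDiff ℝ 3 (fun q : ℝ × ℂ => (q.1 : ℂ)) := ofRealCLM.contDiff.comp contDiff_fst
    exact (h2.contDiffAt.mul contDiffAt_const).cexp
  have h3 : ContDiffAt ℝ 3 (fun q : ℝ × ℂ => β (exp (q.1 * I))) p :=
    ContDiffAt.comp p (hβ.1 _ hw) h1
  have h4 : ContDiffAt ℝ 3
      (fun q : ℝ × ℂ => exp (q.1 * I) ^ N * q.2 + β (exp (q.1 * I))) p :=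
    ((h1.pow N).mul contDiffAt_snd).add h3
  refine ContDiffAt.comp (g := fun p : ℂ × ℂ => P p.1 p.2) p (hP.1 _ hw _ ?_) (h1.prodMk h4)
  rw [mem_closedBall_zero_iff]
  refine (norm_add_le _ _).trans ?_
  rw [norm_mul, norm_pow, norm_exp_ofReal_mul_I, one_pow, one_mul]
  linarith [hβ.2 _ hw]

theorem isOpen_contDiffAt {E : Type*} [NormedAddCommGroup E] [NormedSpace ℝ E] (f : E → ℝ) :
    IsOpen {p | ContDiffAt ℝ 3 f p} :=
  isOpen_iff_mem_nhds.2 fun _ hp => ContDiffAt.eventually hp (by simp)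

theorem circleRhs_eq_angular (s : ℝ) (g : ℂ) :
    circleRhs P N (exp (s * I)) (β (exp (s * I))) g =
      (clampRe g).re - 1 / 2 * angular P N β (s, exp (clampRe g)) := rfl

theorem exists_circleRhs_lipschitz (hP : IsNearDisc P) (hβ : IsSmallShift β) :
    ∃ L, ∀ (x : Torus) (t : ℝ) g g',
      |circleRhs P N (fourier 1 (x + (t : Torus))) (β (fourier 1 (x + (t : Torus)))) g' -
        circleRhs P N (fourier 1 x) (β (fourier 1 x)) g| ≤ L * |t| + 1 / 8 * ‖g' - g‖ := by
  have hK : IsCompact (Icc (-1) 8 ×ˢ closedBall (0 : ℂ) (26 / 25) : Set (ℝ × ℂ)) :=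
    isCompact_Icc.prod (isCompact_closedBall _ _)
  obtain ⟨C, hC⟩ := exists_bound_fderiv (g := angular P N β) (isOpen_contDiffAt _)
    (fun p hp => ((show ContDiffAt ℝ 3 (angular P N β) p from hp).of_le (by norm_num)).contDiffWithinAt) hK
    (fun p hp => contDiffAt_angular hP hβ (mem_closedBall_zero_iff.1 hp.2))
  choose! A hA hAC using hC
  have hconv : Convex ℝ (Icc (-1) 8 ×ˢ closedBall (0 : ℂ) (26 / 25) : Set (ℝ × ℂ)) :=
    (convex_Icc _ _).prod (convex_closedBall _ _)
  refine ⟨1 / 2 * |C| + 1, fun x t g g' => ?_⟩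
  set w' : ℂ := fourier 1 (x + (t : Torus)) with hw'
  have hw's : w' ∈ sphere (0 : ℂ) 1 := fourier_one_mem_sphere _
  have h1 := abs_circleRhs_sub_le (N := N) hw's (hP.3 _ hw's) (hβ.2 _ hw's) (hβ.2 _ hw's) g' g
  rw [sub_self, norm_zero, mul_zero, add_zero] at h1
  have h2 : |circleRhs P N w' (β w') g - circleRhs P N (fourier 1 x) (β (fourier 1 x)) g| ≤
      (1 / 2 * |C| + 1) * |t| := by
    rcases le_total |t| 1 with ht | ht
    · obtain ⟨s, hs, rfl⟩ := x.eq_coe_Ico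
      rw [hw', ← AddCircle.coe_add, fourier_one_coe, fourier_one_coe, circleRhs_eq_angular,
        circleRhs_eq_angular]
      obtain ⟨ht1, ht2⟩ := abs_le.1 ht
      have hpi : 2 * Real.pi < 7 := by linarith [Real.pi_lt_d2]
      have hE := mem_closedBall_zero_iff.2 (norm_exp_clampRe_le g)
      have h3 := hconv.norm_image_sub_le_of_norm_hasFDerivWithin_le (𝕜 := ℝ)
        (f := angular P N β) (C := C) (fun p hp => (hA p hp).hasFDerivWithinAt) hAC
        (x := (s, exp (clampRe g))) (y := (s + t, exp (clampRe g)))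
        ⟨⟨by linarith [hs.1], by linarith [hs.2]⟩, hE⟩
        ⟨⟨by linarith [hs.1], by linarith [hs.2]⟩, hE⟩
      rw [Prod.mk_sub_mk, sub_self, add_sub_cancel_left, Prod.norm_mk, norm_zero,
        max_eq_left (norm_nonneg _), Real.norm_eq_abs, Real.norm_eq_abs] at h3
      have h4 : C * |t| ≤ |C| * |t| := mul_le_mul_of_nonneg_right (le_abs_self C) (abs_nonneg t)
      have h5 := abs_nonneg t
      have h6 : |(clampRe g).re - 1 / 2 * angular P N β (s + t, exp (clampRe g)) -
          ((clampRe g).re - 1 / 2 * angular P N β (s, exp (clampRe g)))| =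
          1 / 2 * |angular P N β (s + t, exp (clampRe g)) -
            angular P N β (s, exp (clampRe g))| := by
        rw [← abs_of_pos (by norm_num : (0 : ℝ) < 1 / 2), ← abs_mul, ← abs_neg]
        rw [abs_of_pos (by norm_num : (0 : ℝ) < 1 / 2)]
        congr 1
        ring
      rw [h6]
      linarith
    · have hx := fourier_one_mem_sphere x
      have a1 := abs_circleRhs_le (N := N) hw's (hP.2 _ hw's) (hβ.2 _ hw's) g
      have a2 := abs_circleRhs_le (N := N) hx (hP.2 _ hx) (hβ.2 _ hx) g
      have a3 := abs_sub (circleRhs P N w' (β w') g)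
        (circleRhs P N (fourier 1 x) (β (fourier 1 x)) g)
      have a4 : 0 ≤ 1 / 2 * |C| * |t| := by positivity
      linarith
  have h3 := abs_sub_le (circleRhs P N w' (β w') g') (circleRhs P N w' (β w') g)
    (circleRhs P N (fourier 1 x) (β (fourier 1 x)) g)
  linarith

theorem exists_circleRhs_secondDiff (hP : IsNearDisc P) (hβ : IsSmallShift β) {Ξ : Torus → ℂ → ℝ}
    (hΞ : ∀ x g, Ξ x g = circleRhs P N (fourier 1 x) (β (fourier 1 x)) g) {G : Torus → ℂ}
    (hG : Continuous G) (hGre : ∀ x, (G x).re = Ξ x (G x)) :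
    ∃ C h₀ : ℝ, 0 ≤ C ∧ 0 < h₀ ∧ h₀ ≤ 1 ∧ ∀ t ∈ Ioc 0 h₀, ∀ x : Torus,
      |Ξ (x + (t : Torus)) (G (x + (t : Torus))) + Ξ (x + -(t : Torus)) (G (x + -(t : Torus))) -
        2 * Ξ x (G x)| ≤ C * t ^ 2 +
        C * (‖G (x + (t : Torus)) - G x‖ ^ 2 + ‖G (x + -(t : Torus)) - G x‖ ^ 2) +
        1 / 8 * ‖G (x + (t : Torus)) + G (x + -(t : Torus)) - 2 * G x‖ := by
  set Ψ : ℝ × ℂ → ℝ := fun p => p.2.re - 1 / 2 * angular P N β (p.1, exp p.2) with hΨ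
  have hΨΞ : ∀ (s : ℝ) (g : ℂ), |g.re| ≤ 1 / 50 → Ξ (s : Torus) g = Ψ (s, g) := by
    intro s g hg
    rw [hΞ, fourier_one_coe, circleRhs_eq_angular, clampRe_eq hg]
  have hGb : ∀ x, |(G x).re| ≤ 1 / 55 := by
    intro x
    rw [hGre, hΞ]
    have hx := fourier_one_mem_sphere x
    exact abs_circleRhs_le hx (hP.2 _ hx) (hβ.2 _ hx) _
  have hGΨ : ∀ s : ℝ, Ξ (s : Torus) (G s) = Ψ (s, G s) := fun s =>
    hΨΞ s _ ((hGb _).trans (by norm_num))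
  obtain ⟨R, hR⟩ := isCompact_univ.exists_bound_of_continuousOn hG.continuousOn
  set K : Set (ℝ × ℂ) := Icc 0 (2 * Real.pi) ×ˢ (closedBall 0 R ∩ {g | |g.re| ≤ 1 / 55}) with hK
  have hKc : IsCompact K := isCompact_Icc.prod ((isCompact_closedBall _ _).inter_right
    (isClosed_le (by fun_prop) continuous_const))
  have hKU : K ⊆ {p | ContDiffAt ℝ 3 Ψ p} := by
    intro p hp
    have h1 : ContDiffAt ℝ 3 (fun q : ℝ × ℂ => (q.1, exp q.2)) p :=
      contDiffAt_fst.prodMk contDiffAt_snd.cexp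
    have h2 : ContDiffAt ℝ 3 (fun q : ℝ × ℂ => angular P N β (q.1, exp q.2)) p := by
      refine ContDiffAt.comp (g := angular P N β) p (contDiffAt_angular hP hβ ?_) h1
      dsimp only
      rw [norm_exp]
      exact exp_le_of_abs_le (hp.2.2.trans (by norm_num))
    exact (reCLM.contDiff.contDiffAt.comp p contDiffAt_snd).sub (contDiffAt_const.mul h2)
  obtain ⟨δ, hδ, C, hC, hT⟩ := exists_uniform_taylor (isOpen_contDiffAt Ψ)
    (fun p hp => ContDiffAt.contDiffWithinAt hp) hKc hKU
  have hD : ∀ p ∈ K, ∀ η : ℂ, |fderiv ℝ Ψ p (0, η)| ≤ 1 / 8 * ‖η‖ := by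
    intro p hp η
    have hd : HasFDerivAt Ψ (fderiv ℝ Ψ p) p :=
      ((show ContDiffAt ℝ 3 Ψ p from hKU hp).differentiableAt (by norm_num)).hasFDerivAt
    have hd2 : HasFDerivAt (fun g : ℂ => Ψ (p.1, g))
        ((fderiv ℝ Ψ p).comp (ContinuousLinearMap.inr ℝ ℝ ℂ)) p.2 :=
      HasFDerivAt.comp (g := Ψ) (f := fun g : ℂ => (p.1, g)) p.2 hd (hasFDerivAt_prodMk_right p.1 p.2)
    have hle := hd2.le_of_lip' (C := 1 / 8) (by norm_num) ?_
    · have := ContinuousLinearMap.le_of_opNorm_le _ hle η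
      simpa using this
    · have hev : ∀ᶠ g : ℂ in 𝓝 p.2, |g.re| < 1 / 50 :=
        (show Continuous fun g : ℂ => |g.re| by fun_prop).continuousAt.eventually_lt
          continuousAt_const (lt_of_le_of_lt hp.2.2 (by norm_num))
      filter_upwards [hev] with g hg
      have hx := fourier_one_mem_sphere (p.1 : Torus)
      have := abs_circleRhs_sub_le (N := N) hx (hP.3 _ hx) (hβ.2 _ hx) (hβ.2 _ hx) g p.2
      rw [sub_self, norm_zero, mul_zero, add_zero, ← hΞ, ← hΞ, hΨΞ _ _ hg.le,
        hΨΞ _ _ (hp.2.2.trans (by norm_num))] at this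
      exact this
  have huc : UniformContinuous G := CompactSpace.uniformContinuous_of_continuous hG
  obtain ⟨d, hd, hdG⟩ := Metric.uniformContinuous_iff.1 huc (min δ 1) (lt_min hδ one_pos)
  have hsmall : ∀ (x : Torus) (t : ℝ), |t| < d → ‖G (x + (t : Torus)) - G x‖ ≤ min δ 1 := by
    intro x t ht
    rw [← dist_eq_norm]
    refine (hdG ?_).le
    rw [dist_eq_norm, add_sub_cancel_left]
    refine lt_of_le_of_lt ?_ ht
    exact QuotientAddGroup.norm_mk_le_norm
  refine ⟨4 * C, min (min (d / 2) δ) 1, by positivity,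
    lt_min (lt_min (by positivity) hδ) one_pos, min_le_right _ _, fun t ht x => ?_⟩
  have ht0 : 0 < t := ht.1
  have ht1 : t ≤ 1 := ht.2.trans (min_le_right _ _)
  have htδ : t ≤ δ := ht.2.trans ((min_le_left _ _).trans (min_le_right _ _))
  have htd : t < d := lt_of_le_of_lt (ht.2.trans ((min_le_left _ _).trans (min_le_left _ _)))
    (by linarith)
  obtain ⟨s, hs, rfl⟩ := x.eq_coe_Ico
  have hp : (s, G s) ∈ K :=
    ⟨⟨hs.1, hs.2.le⟩, mem_closedBall_zero_iff.2 (hR _ (mem_univ _)), hGb _⟩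
  have key : ∀ τ : ℝ, |τ| = t →
      |Ξ ((s : Torus) + (τ : Torus)) (G ((s : Torus) + (τ : Torus))) - Ξ s (G s) -
        fderiv ℝ Ψ (s, G s) (τ, G ((s : Torus) + (τ : Torus)) - G s)| ≤
      2 * C * (t ^ 2 + ‖G ((s : Torus) + (τ : Torus)) - G s‖ ^ 2) := by
    intro τ hτ
    have hsm := hsmall s τ (hτ ▸ htd)
    set η := G ((s : Torus) + (τ : Torus)) - G s with hη
    have hξ : ‖((τ, η) : ℝ × ℂ)‖ ≤ min δ 1 := by
      rw [Prod.norm_mk, Real.norm_eq_abs, hτ]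
      exact max_le (le_min htδ ht1) hsm
    have h0 := ((hT _ hp).2 0 (by rw [norm_zero]; exact hδ.le)).2.1
    rw [add_zero] at h0
    have h1 := ((hT _ hp).2 (τ, η) (hξ.trans (min_le_left _ _))).2.2.2.2
    have e1 : ((s, G s) : ℝ × ℂ) + (τ, η) = (s + τ, G ((s + τ : ℝ) : Torus)) := by
      rw [Prod.mk_add_mk, hη, AddCircle.coe_add, add_sub_cancel]
    rw [e1] at h1
    have h2 : |fderiv ℝ (fderiv ℝ Ψ) (s, G s) (τ, η) (τ, η)| ≤
        C * ‖((τ, η) : ℝ × ℂ)‖ ^ 2 := by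
      have a1 := ContinuousLinearMap.le_opNorm₂ (fderiv ℝ (fderiv ℝ Ψ) (s, G s)) (τ, η) (τ, η)
      refine (Real.norm_eq_abs _ ▸ a1).trans ?_
      rw [mul_assoc, ← sq]
      exact mul_le_mul_of_nonneg_right h0 (sq_nonneg _)
    have h3 : ‖((τ, η) : ℝ × ℂ)‖ ^ 2 ≤ t ^ 2 + ‖η‖ ^ 2 := by
      rw [Prod.norm_mk, Real.norm_eq_abs, hτ]
      rcases max_choice t ‖η‖ with h | h <;> rw [h] <;> nlinarith [sq_nonneg t, sq_nonneg ‖η‖]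
    have h4 : ‖((τ, η) : ℝ × ℂ)‖ ^ 3 ≤ ‖((τ, η) : ℝ × ℂ)‖ ^ 2 := by
      have := norm_nonneg ((τ, η) : ℝ × ℂ)
      exact pow_le_pow_of_le_one this (hξ.trans (min_le_right _ _)) (by norm_num)
    have e2 : Ξ ((s : Torus) + (τ : Torus)) (G ((s : Torus) + (τ : Torus))) =
        Ψ (s + τ, G ((s + τ : ℝ) : Torus)) := by
      rw [← hGΨ, AddCircle.coe_add]
    rw [e2, hGΨ]
    have h5 := mul_le_mul_of_nonneg_left h3 hC.le
    have h6 := mul_le_mul_of_nonneg_left h4 hC.le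
    have h7 : 0 ≤ C * ‖((τ, η) : ℝ × ℂ)‖ ^ 2 := by positivity
    rw [abs_le] at h1 h2 ⊢
    constructor <;> linarith [h1.1, h1.2, h2.1, h2.2]
  have k1 := key t (abs_of_pos ht0)
  have k2 := key (-t) (by rw [abs_neg, abs_of_pos ht0])
  rw [AddCircle.coe_neg] at k2
  have k3 := hD _ hp (G ((s : Torus) + (t : Torus)) + G ((s : Torus) + -(t : Torus)) - 2 * G s)
  have e3 : fderiv ℝ Ψ (s, G s) (0, G ((s : Torus) + (t : Torus)) +
      G ((s : Torus) + -(t : Torus)) - 2 * G s) =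
      fderiv ℝ Ψ (s, G s) (t, G ((s : Torus) + (t : Torus)) - G s) +
      fderiv ℝ Ψ (s, G s) (-t, G ((s : Torus) + -(t : Torus)) - G s) := by
    rw [← map_add, Prod.mk_add_mk, add_neg_cancel]
    congr 2
    ring
  rw [e3] at k3
  have n1 : 0 ≤ C * ‖G ((s : Torus) + (t : Torus)) - G s‖ ^ 2 := by positivity
  have n2 : 0 ≤ C * ‖G ((s : Torus) + -(t : Torus)) - G s‖ ^ 2 := by positivity
  rw [abs_le] at k1 k2 k3 ⊢
  constructor <;> linarith [k1.1, k1.2, k2.1, k2.2, k3.1, k3.2]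

end

section

open MeasureTheory AddCircle ComplexConjugate

/-- The power series with coefficients `a`. -/
noncomputable def powSeries (a : ℕ → ℂ) (v : ℂ) : ℂ := ∑' k : ℕ, a k * v ^ k

theorem powSeries_fourier (a : ℕ → ℂ) (x : Torus) : powSeries a (fourier 1 x) = circleSeries a x := by
  unfold powSeries circleSeries
  refine tsum_congr fun k => ?_
  rw [fourier_apply, fourier_apply, one_zsmul, AddCircle.toCircle_zsmul, zpow_natCast,
    Circle.coe_pow]

theorem norm_powSeries_term_le {a : ℕ → ℂ} {A r : ℝ} (ha : ∀ k, ‖a k‖ ≤ A) {v : ℂ} (hv : ‖v‖ ≤ r)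
    (k : ℕ) : ‖a k * v ^ k‖ ≤ A * r ^ k := by
  rw [norm_mul, norm_pow]
  exact mul_le_mul (ha k) (pow_le_pow_left₀ (norm_nonneg _) hv k) (by positivity)
    ((norm_nonneg _).trans (ha k))

theorem hasSum_powSeries {a : ℕ → ℂ} {A : ℝ} (ha : ∀ k, ‖a k‖ ≤ A) {v : ℂ} (hv : ‖v‖ < 1) :
    HasSum (fun k => a k * v ^ k) (powSeries a v) :=
  (Summable.of_norm_bounded ((summable_geometric_of_lt_one (norm_nonneg v) hv).mul_left A)
    (norm_powSeries_term_le ha le_rfl)).hasSum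

theorem norm_powSeries_sub_le {a b : ℕ → ℂ} {A B s r : ℝ} (ha : ∀ k, ‖a k‖ ≤ A)
    (hb : ∀ k, ‖b k‖ ≤ B) (hs : ∀ k, ‖a k - b k‖ ≤ s) (hr : r < 1) {v : ℂ} (hv : ‖v‖ ≤ r) :
    ‖powSeries a v - powSeries b v‖ ≤ s * (1 - r)⁻¹ := by
  have hr0 : 0 ≤ r := (norm_nonneg v).trans hv
  have h1 := (hasSum_powSeries ha (hv.trans_lt hr)).sub (hasSum_powSeries hb (hv.trans_lt hr))
  have h2 := (hasSum_geometric_of_lt_one hr0 hr).mul_left s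
  rw [← h1.tsum_eq]
  refine tsum_of_norm_bounded h2 fun k => ?_
  rw [← sub_mul]
  exact norm_powSeries_term_le (a := fun k => a k - b k) hs hv k

theorem norm_powSeries_le {a : ℕ → ℂ} {A r : ℝ} (ha : ∀ k, ‖a k‖ ≤ A) (hr : r < 1) {v : ℂ}
    (hv : ‖v‖ ≤ r) : ‖powSeries a v‖ ≤ A * (1 - r)⁻¹ := by
  have h := norm_powSeries_sub_le (b := 0) (B := 0) (s := A) ha (by simp) (by simpa using ha) hr hv
  have h0 : powSeries 0 v = 0 := by simp [powSeries]
  rwa [h0, sub_zero] at h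

theorem differentiableAt_powSeries {a : ℕ → ℂ} {A : ℝ} (ha : ∀ k, ‖a k‖ ≤ A) {v : ℂ}
    (hv : ‖v‖ < 1) : DifferentiableAt ℂ (powSeries a) v := by
  obtain ⟨r, hvr, hr⟩ := exists_between hv
  have hr0 : 0 ≤ r := (norm_nonneg v).trans hvr.le
  have h : DifferentiableOn ℂ (powSeries a) (ball 0 r) :=
    differentiableOn_tsum_of_summable_norm
      ((summable_geometric_of_lt_one hr0 hr).mul_left A)
      (fun k => ((differentiable_id.pow k).const_mul (a k)).differentiableOn) isOpen_ball
      fun k w hw => norm_powSeries_term_le ha (mem_ball_zero_iff.1 hw).le k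
  exact h.differentiableAt (isOpen_ball.mem_nhds (mem_ball_zero_iff.2 hvr))

theorem continuousOn_powSeries {a : ℕ → ℂ} (ha : Summable fun k => ‖a k‖) :
    ContinuousOn (powSeries a) (closedBall 0 1) := by
  refine continuousOn_tsum (fun k => (by fun_prop)) ha fun k v hv => ?_
  rw [norm_mul, norm_pow]
  exact mul_le_of_le_one_right (norm_nonneg _)
    (pow_le_one₀ (norm_nonneg _) (mem_closedBall_zero_iff.1 hv))

theorem exists_deriv_powSeries {a : ℕ → ℂ} (ha : Summable fun k : ℕ => (k : ℝ) * ‖a k‖) :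
    ∃ D : ℂ → ℂ, ContinuousOn D (closedBall 0 1) ∧
      ∀ v ∈ ball (0 : ℂ) 1, HasDerivAt (powSeries a) (D v) v := by
  have hb : ∀ k (v : ℂ), v ∈ closedBall (0 : ℂ) 1 → ‖a k * (k * v ^ (k - 1))‖ ≤ k * ‖a k‖ := by
    intro k v hv
    rw [norm_mul, norm_mul, norm_natCast, norm_pow, mul_comm (‖a k‖), mul_right_comm]
    exact mul_le_of_le_one_right (by positivity)
      (pow_le_one₀ (norm_nonneg _) (mem_closedBall_zero_iff.1 hv))
  refine ⟨fun v => ∑' k : ℕ, a k * (k * v ^ (k - 1)),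
    continuousOn_tsum (fun k => (by fun_prop)) ha fun k v hv => hb k v hv, fun v hv => ?_⟩
  refine hasDerivAt_tsum_of_isPreconnected ha isOpen_ball (convex_ball _ _).isPreconnected
    (fun k w _ => (hasDerivAt_pow k w).const_mul (a k))
    (fun k w hw => hb k w (ball_subset_closedBall hw)) (mem_ball_self one_pos) ?_ hv
  exact summable_of_ne_finset_zero (s := {0}) fun k hk => by
    rw [zero_pow (by simpa using hk), mul_zero]

theorem summable_norm_of_mul {a : ℕ → ℂ} (ha : Summable fun k : ℕ => (k : ℝ) * ‖a k‖) :
    Summable fun k => ‖a k‖ := by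
  rw [← summable_nat_add_iff 1] at ha ⊢
  refine ha.of_nonneg_of_le (fun _ => norm_nonneg _) fun k => ?_
  refine le_mul_of_one_le_left (norm_nonneg _) ?_
  push_cast
  linarith [(Nat.cast_nonneg k : (0 : ℝ) ≤ k)]

theorem norm_fourierCoeff_sub_le (F G : Lp ℂ 2 (haarAddCircle (T := 2 * Real.pi))) (k : ℤ) :
    ‖fourierCoeff F k - fourierCoeff G k‖ ≤ ‖F - G‖ := by
  rw [← fourierBasis_repr, ← fourierBasis_repr, ← Pi.sub_apply, ← lp.coeFn_sub, ← map_sub]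
  exact (lp.norm_apply_le_norm two_ne_zero _ k).trans (LinearIsometryEquiv.norm_map _ _).le

theorem norm_fourierCoeff_le (F : Lp ℂ 2 (haarAddCircle (T := 2 * Real.pi))) (k : ℤ) :
    ‖fourierCoeff F k‖ ≤ ‖F‖ := by
  rw [← fourierBasis_repr]
  exact (lp.norm_apply_le_norm two_ne_zero _ k).trans (LinearIsometryEquiv.norm_map _ _).le

theorem norm_exp_sub_exp_le {A : ℝ} {x y : ℂ} (hx : ‖x‖ ≤ A) (hy : ‖y‖ ≤ A) :
    ‖exp x - exp y‖ ≤ Real.exp A * ‖x - y‖ := by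
  refine (convex_closedBall (0 : ℂ) A).norm_image_sub_le_of_norm_deriv_le (f := Complex.exp)
    (fun z _ => differentiable_exp z) (fun z hz => ?_) (mem_closedBall_zero_iff.2 hy)
    (mem_closedBall_zero_iff.2 hx)
  rw [Complex.deriv_exp, norm_exp]
  exact Real.exp_le_exp.2 ((re_le_norm z).trans (mem_closedBall_zero_iff.1 hz))

namespace Collar

variable {M : Set ℂ} (c : Collar M)

/-- The term `v ^ N * exp (powSeries a v)`. -/
noncomputable def powExp (N : ℕ) (a : ℕ → ℂ) (v : ℂ) : ℂ := v ^ N * exp (powSeries a v)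

/-- The Cauchy correction of the collar functions `powExp N (a k)`. -/
noncomputable def correction (r : ℝ) (N : ℕ) (a : Fin c.m → ℕ → ℂ) : ℂ → ℂ :=
  c.cauchy r fun k v => powExp N (a k) v

variable {c}

theorem differentiableAt_powExp {N : ℕ} {a : ℕ → ℂ} {A : ℝ} (ha : ∀ k, ‖a k‖ ≤ A) {v : ℂ}
    (hv : ‖v‖ < 1) : DifferentiableAt ℂ (powExp N a) v :=
  (differentiableAt_id.pow N).mul (differentiableAt_powSeries ha hv).cexp

theorem continuousOn_powExp {N : ℕ} {a : ℕ → ℂ} {A : ℝ} (ha : ∀ k, ‖a k‖ ≤ A) {r : ℝ}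
    (hr : r < 1) : ContinuousOn (powExp N a) (sphere 0 r) := fun v hv =>
  (differentiableAt_powExp ha
    (by rwa [mem_sphere_zero_iff_norm.1 hv])).continuousAt.continuousWithinAt

theorem norm_powExp_le {N : ℕ} {a : ℕ → ℂ} (ha : ∀ k, ‖a k‖ ≤ 1) {r : ℝ} (hr : r < 1) {v : ℂ}
    (hv : v ∈ sphere (0 : ℂ) r) : ‖powExp N a v‖ ≤ r ^ N * Real.exp (1 - r)⁻¹ := by
  rw [mem_sphere_zero_iff_norm] at hv
  have h := norm_powSeries_le ha hr hv.le
  rw [one_mul] at h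
  rw [powExp, norm_mul, norm_pow, hv, norm_exp]
  exact mul_le_mul_of_nonneg_left (Real.exp_le_exp.2 ((re_le_norm _).trans h))
    (pow_nonneg (hv ▸ norm_nonneg v) _)

theorem norm_powExp_sub_le {N : ℕ} {a b : ℕ → ℂ} (ha : ∀ k, ‖a k‖ ≤ 1) (hb : ∀ k, ‖b k‖ ≤ 1)
    {s : ℝ} (hs : ∀ k, ‖a k - b k‖ ≤ s) {r : ℝ} (hr : r < 1) {v : ℂ}
    (hv : v ∈ sphere (0 : ℂ) r) :
    ‖powExp N a v - powExp N b v‖ ≤ r ^ N * (Real.exp (1 - r)⁻¹ * (s * (1 - r)⁻¹)) := by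
  rw [mem_sphere_zero_iff_norm] at hv
  have h1 := norm_powSeries_le ha hr hv.le
  have h2 := norm_powSeries_le hb hr hv.le
  rw [one_mul] at h1 h2
  rw [powExp, powExp, ← mul_sub, norm_mul, norm_pow, hv]
  refine mul_le_mul_of_nonneg_left ((norm_exp_sub_exp_le h1 h2).trans ?_)
    (pow_nonneg (hv ▸ norm_nonneg v) _)
  exact mul_le_mul_of_nonneg_left (norm_powSeries_sub_le ha hb hs hr hv.le) (Real.exp_pos _).le

theorem ne_of_mem_sphere {r : ℝ} (hr : c.R < r) (hr1 : r < 1) (j k : Fin c.m) {v w : ℂ}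
    (hv : v ∈ sphere (0 : ℂ) r) (hw : w ∈ sphere (0 : ℂ) 1) : c.ψ k v ≠ c.ψ j w := by
  intro h
  have hva := c.mem_annulus_of hr (hr1.trans c.one_lt_inv) (mem_sphere_zero_iff_norm.1 hv)
  have h1 := (c.inj k j v hva w (sphere_subset_annulus c.R_pos c.R_lt hw) h).2
  rw [h1, mem_sphere_zero_iff_norm, mem_sphere_zero_iff_norm.1 hw] at hv
  exact hr1.ne hv.symm

theorem exists_norm_correction_le (hMb : IsBounded M) {r : ℝ} (hr : c.R < r)
    (hr1 : r < 1) : ∃ C, 0 < C ∧ ∀ (N : ℕ) (a : Fin c.m → ℕ → ℂ), (∀ j k, ‖a j k‖ ≤ 1) →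
      (∀ j, ∀ w ∈ sphere (0 : ℂ) 1, ‖c.correction r N a (c.ψ j w)‖ ≤ C * r ^ N) ∧
      ∀ b : Fin c.m → ℕ → ℂ, (∀ j k, ‖b j k‖ ≤ 1) → ∀ s, 0 ≤ s → (∀ j k, ‖a j k - b j k‖ ≤ s) →
        ∀ j, ∀ w ∈ sphere (0 : ℂ) 1,
          ‖c.correction r N a (c.ψ j w) - c.correction r N b (c.ψ j w)‖ ≤ C * r ^ N * s := by
  have hr0 : 0 < r := c.R_pos.trans hr
  have hri : r < c.R⁻¹ := hr1.trans c.one_lt_inv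
  have hK : IsCompact (frontier M) := hMb.isCompact_closure.of_isClosed_subset isClosed_frontier
    frontier_subset_closure
  have hfr : ∀ j, ∀ w ∈ sphere (0 : ℂ) 1, c.ψ j w ∈ frontier M := fun j w hw => c.bdry j w hw
  have hKr : ∀ k, ∀ w ∈ sphere (0 : ℂ) r, c.ψ k w ∉ frontier M := by
    intro k w hw h
    obtain ⟨j, v, hv, hjv⟩ := c.surj _ h
    exact ne_of_mem_sphere hr hr1 j k hw hv hjv.symm
  obtain ⟨C, hC, h⟩ := exists_norm_cauchy_le (c := c) (E := ℂ) hr hri hK hKr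
  have h1r : 0 < (1 - r)⁻¹ := inv_pos.2 (by linarith)
  have h1r1 : 1 ≤ (1 - r)⁻¹ := (one_le_inv₀ (by linarith)).2 (by linarith)
  have hE := Real.exp_pos (1 - r)⁻¹
  refine ⟨C * (Real.exp (1 - r)⁻¹ * (1 - r)⁻¹), by positivity, fun N a ha => ⟨fun j w hw => ?_,
    fun b hb s hs hab j w hw => ?_⟩⟩
  · refine (h _ _ (by positivity) (fun k v hv => norm_powExp_le (ha k) hr1 hv) _
      (hfr j w hw)).trans ?_
    have : r ^ N * Real.exp (1 - r)⁻¹ ≤ r ^ N * Real.exp (1 - r)⁻¹ * (1 - r)⁻¹ :=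
      le_mul_of_one_le_right (by positivity) h1r1
    calc _ ≤ C * (r ^ N * Real.exp (1 - r)⁻¹ * (1 - r)⁻¹) := by gcongr
      _ = _ := by ring
  · rw [correction, correction, ← cauchy_sub hr hri (fun k => continuousOn_powExp (ha k) hr1)
      (fun k => continuousOn_powExp (hb k) hr1)
      (fun k v hv => ne_of_mem_sphere hr hr1 j k hv hw)]
    refine (h _ _ (by positivity) (fun k v hv => norm_powExp_sub_le (ha k) (hb k) (hab k) hr1 hv)
      _ (hfr j w hw)).trans (le_of_eq (by ring))

end Collar

end

section

open MeasureTheory AddCircle ComplexConjugate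

theorem continuous_circleRhs {P : ℂ → ℂ → ℝ} {N : ℕ} {β : ℂ → ℂ} (hP : IsNearDisc P) (hβ : IsSmallShift β) :
    Continuous fun p : Torus × ℂ =>
      circleRhs P N (fourier 1 p.1) (β (fourier 1 p.1)) p.2 := by
  rw [continuous_iff_continuousAt]
  intro p
  have hw := fourier_one_mem_sphere p.1
  have h1 : ContinuousAt (fun q : Torus × ℂ => (fourier 1 q.1 : ℂ)) p :=
    ((fourier 1).continuous.comp continuous_fst).continuousAt
  have h2 : ContinuousAt (fun q : Torus × ℂ => clampRe q.2) p :=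
    (continuous_clampRe.comp continuous_snd).continuousAt
  have h3 : ContinuousAt (fun q : Torus × ℂ => β (fourier 1 q.1)) p :=
    ContinuousAt.comp (g := β) (hβ.1 _ hw).continuousAt h1
  have h4 : ContinuousAt (fun q : Torus × ℂ =>
      ((fourier 1 q.1 : ℂ), (fourier 1 q.1 : ℂ) ^ N * exp (clampRe q.2) + β (fourier 1 q.1))) p :=
    h1.prodMk (((h1.pow N).mul h2.cexp).add h3)
  have h5 := ContinuousAt.comp (g := fun q : ℂ × ℂ => P q.1 q.2) (x := p)
    (hP.1 _ hw _ (norm_arg_le hw (hβ.2 _ hw) p.2)).continuousAt h4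
  exact (continuous_re.continuousAt.comp h2).sub (h5.const_mul _)

namespace Collar

variable {M : Set ℂ} {c : Collar M}

theorem analyticAt_correction {r : ℝ} (hr : c.R < r) (hr1 : r < 1) {N : ℕ}
    {a : Fin c.m → ℕ → ℂ} (ha : ∀ j k, ‖a j k‖ ≤ 1) (j : Fin c.m) {w : ℂ} (hw : r < ‖w‖)
    (hw' : ‖w‖ < c.R⁻¹) : AnalyticAt ℂ (fun v => c.correction r N a (c.ψ j v)) w := by
  rw [Complex.analyticAt_iff_eventually_differentiableAt]
  filter_upwards [(isOpen_lt continuous_const continuous_norm).mem_nhds hw,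
    (isOpen_lt continuous_norm continuous_const).mem_nhds hw'] with v hv hv'
  exact differentiableAt_cauchy_comp hr hr1 (fun k => continuousOn_powExp (ha k) hr1) hv hv'

/-- Solution of the nonlinear boundary problem on the collar. -/
theorem exists_collar_solution (hMb : IsBounded M) {r : ℝ} (hr : c.R < r) (hr1 : r < 1)
    {P : Fin c.m → ℂ → ℂ → ℝ}
    (hP : ∀ j, IsNearDisc (P j)) :
    ∀ᶠ N in atTop, ∃ a : Fin c.m → ℕ → ℂ, (∀ j k, ‖a j k‖ ≤ 1) ∧
      (∀ j, Summable fun k : ℕ => (k : ℝ) * ‖a j k‖) ∧ ∀ j, ∀ w ∈ sphere (0 : ℂ) 1,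
        powExp N (a j) w + c.correction r N a (c.ψ j w) ∈ closedBall (0 : ℂ) 2 ∧
        P j w (powExp N (a j) w + c.correction r N a (c.ψ j w)) = 0 := by
  obtain ⟨C, hC, hCor⟩ := exists_norm_correction_le (c := c) hMb hr hr1
  have hlim : Tendsto (fun N : ℕ => C * r ^ N) atTop (𝓝 0) := by
    simpa using (tendsto_pow_atTop_nhds_zero_of_lt_one (c.R_pos.trans hr).le hr1).const_mul C
  filter_upwards [hlim.eventually (eventually_le_nhds (by norm_num : (0 : ℝ) < 1 / 100))] with N hN
  let coef : (Fin c.m → Lp ℂ 2 (haarAddCircle (T := 2 * Real.pi))) → Fin c.m → ℕ → ℂ :=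
    fun a j k => fourierCoeff (a j) (k : ℤ)
  have hcoef : ∀ a, ‖a‖ ≤ 1 → ∀ j k, ‖coef a j k‖ ≤ 1 := fun a ha j k =>
    (norm_fourierCoeff_le _ _).trans ((norm_le_pi_norm a j).trans ha)
  have hcoefs : ∀ a b j k, ‖coef a j k - coef b j k‖ ≤ ‖a - b‖ := fun a b j k =>
    (norm_fourierCoeff_sub_le _ _ _).trans (norm_le_pi_norm (a - b) j)
  classical
  let β : (Fin c.m → Lp ℂ 2 (haarAddCircle (T := 2 * Real.pi))) → Fin c.m → ℂ → ℂ :=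
    fun a j w => if ‖a‖ ≤ 1 then c.correction r N (coef a) (c.ψ j w) else 0
  have hβ1 : ∀ a, ‖a‖ ≤ 1 → ∀ j w, β a j w = c.correction r N (coef a) (c.ψ j w) :=
    fun a ha j w => if_pos ha
  have hβb : ∀ a j, ∀ w ∈ sphere (0 : ℂ) 1, ‖β a j w‖ ≤ 1 / 100 := by
    intro a j w hw
    by_cases ha : ‖a‖ ≤ 1
    · rw [hβ1 a ha]
      exact ((hCor N _ (hcoef a ha)).1 j w hw).trans hN
    · simp [β, if_neg ha]
  have hβ : ∀ a j, ∀ w ∈ sphere (0 : ℂ) 1, ContDiffAt ℝ 3 (β a j) w := by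
    intro a j w hw
    rw [mem_sphere_zero_iff_norm] at hw
    by_cases ha : ‖a‖ ≤ 1
    · have h1 := (analyticAt_correction (c := c) (N := N) hr hr1 (hcoef a ha) j
        (by rwa [hw]) (by rw [hw]; exact c.one_lt_inv)).contDiffAt (n := 3)
      have h2 : β a j = fun v => c.correction r N (coef a) (c.ψ j v) := funext (hβ1 a ha j)
      rw [h2]
      exact h1.restrict_scalars ℝ
    · have h2 : β a j = fun _ => 0 := funext fun _ => if_neg ha
      rw [h2]
      exact contDiffAt_const
  let Ξ : (Fin c.m → Lp ℂ 2 (haarAddCircle (T := 2 * Real.pi))) → Fin c.m → Torus → ℂ → ℝ :=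
    fun a j x g => circleRhs (P j) N (fourier 1 x) (β a j (fourier 1 x)) g
  have hΞ : ∀ a j, Continuous fun p : Torus × ℂ => Ξ a j p.1 p.2 := fun a j =>
    continuous_circleRhs (hP j) ⟨hβ a j, hβb a j⟩
  have hΞb : ∀ a j x g, |Ξ a j x g| ≤ 1 / 55 := fun a j x g =>
    abs_circleRhs_le (fourier_one_mem_sphere x) ((hP j).2 _ (fourier_one_mem_sphere x))
      (hβb a j _ (fourier_one_mem_sphere x)) g
  obtain ⟨a, ha, hak⟩ := exists_fixed_fourierCoeff (Ξ := Ξ) hΞ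
    (fun a j x g => (hΞb a j x g).trans (by norm_num)) (fun a a' ha ha' j x g g' => by
      have hw := fourier_one_mem_sphere x
      refine (abs_circleRhs_sub_le hw ((hP j).3 _ hw) (hβb a j _ hw) (hβb a' j _ hw) g g').trans ?_
      rw [hβ1 a ha, hβ1 a' ha']
      have h1 := (hCor N _ (hcoef a ha)).2 _ (hcoef a' ha') _ (norm_nonneg (a - a'))
        (hcoefs a a') j _ hw
      have h2 : C * r ^ N * ‖a - a'‖ ≤ 1 / 100 * ‖a - a'‖ := by gcongr
      linarith [norm_nonneg (a - a')])
  have hsol : ∀ j, (Summable fun k : ℕ => (k : ℝ) * ‖coef a j k‖) ∧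
      ∀ x, (circleSeries (coef a j) x).re = Ξ a j x (circleSeries (coef a j) x) := by
    intro j
    obtain ⟨L, hL⟩ := exists_circleRhs_lipschitz (N := N) (hP j) ⟨hβ a j, hβb a j⟩
    exact exists_circleSeries_eq (Ξ := Ξ a j) (hΞ a j)
      (fun x g => (hΞb a j x g).trans (by norm_num)) hL
      (fun G hG hGre => exists_circleRhs_secondDiff (hP j) ⟨hβ a j, hβb a j⟩
        (fun _ _ => rfl) hG hGre) (Lp.memLp (a j)) (hak j)
  refine ⟨coef a, hcoef a ha, fun j => (hsol j).1, fun j w hw => ?_⟩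
  obtain ⟨x, rfl⟩ : ∃ x : Torus, (fourier 1 x : ℂ) = w := by
    refine ⟨(arg w : ℝ), ?_⟩
    rw [fourier_one_coe]
    have := norm_mul_exp_arg_mul_I w
    rwa [mem_sphere_zero_iff_norm.1 hw, ofReal_one, one_mul] at this
  have h1 := (hsol j).2 x
  rw [← powSeries_fourier] at h1
  have h2 : |(powSeries (coef a j) (fourier 1 x)).re| ≤ 1 / 50 := by
    rw [h1]
    exact (hΞb _ _ _ _).trans (by norm_num)
  have h3 := norm_arg_le (N := N) hw (hβb a j _ hw) (powSeries (coef a j) (fourier 1 x))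
  have h4 : Ξ a j x (powSeries (coef a j) (fourier 1 x)) =
    circleRhs (P j) N (fourier 1 x) (β a j (fourier 1 x)) (powSeries (coef a j) (fourier 1 x)) := rfl
  rw [h4, circleRhs, clampRe_eq h2, hβ1 a ha] at h1
  rw [clampRe_eq h2, hβ1 a ha] at h3
  exact ⟨h3, by
    have h5 : P j (fourier 1 x) (fourier 1 x ^ N * exp (powSeries (coef a j) (fourier 1 x)) +
      c.correction r N (coef a) (c.ψ j (fourier 1 x))) = 0 := by linarith
    exact h5⟩

end Collar

end

namespace Collar

variable {M : Set ℂ} {c : Collar M}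

theorem mem_nhdsWithin_closedBall {r : ℝ} {w : ℂ} (hw : r < ‖w‖) :
    {v : ℂ | r < ‖v‖ ∧ ‖v‖ ≤ 1} ∈ 𝓝[closedBall 0 1] w := by
  filter_upwards [nhdsWithin_le_nhds ((isOpen_lt continuous_const continuous_norm).mem_nhds hw),
    self_mem_nhdsWithin] with v hv hv'
  exact ⟨hv, mem_closedBall_zero_iff.1 hv'⟩

theorem mem_annulus_of_le {r : ℝ} (hr : c.R ≤ r) {w : ℂ} (hw : r < ‖w‖) (hw1 : ‖w‖ ≤ 1) :
    w ∈ annulus c.R := ⟨hr.trans_lt hw, hw1.trans_lt c.one_lt_inv⟩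

/-- A function on `M` which extends continuously in the collar extends continuously. -/
theorem exists_extension {X : Type*} [TopologicalSpace X] [Nonempty X] (hM : IsOpen M) {f : ℂ → X}
    (hf : ContinuousOn f M) {r : ℝ} (hr : c.R ≤ r) (hr1 : r < 1) {D : Fin c.m → ℂ → X}
    (hD : ∀ j, ContinuousOn (D j) {w | r < ‖w‖ ∧ ‖w‖ ≤ 1})
    (h : ∀ j w, r < ‖w‖ → ‖w‖ < 1 → f (c.ψ j w) = D j w) :
    ∃ g : ℂ → X, ContinuousOn g (closure M) ∧ ∀ x ∈ M, g x = f x := by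
  have hch : ∀ z, ∃ y, (z ∈ M → y = f z) ∧
      ∀ j w, r < ‖w‖ → ‖w‖ ≤ 1 → c.ψ j w = z → y = D j w := by
    intro z
    by_cases hz : z ∈ M
    · refine ⟨f z, fun _ => rfl, ?_⟩
      rintro j w hw hw1 rfl
      exact h j w hw ((c.mem_iff hM (mem_annulus_of_le hr hw hw1)).1 hz)
    · by_cases hex : ∃ j w, r < ‖w‖ ∧ ‖w‖ ≤ 1 ∧ c.ψ j w = z
      · obtain ⟨j, w, hw, hw1, rfl⟩ := hex
        refine ⟨D j w, fun h' => absurd h' hz, fun k v hv hv1 hvw => ?_⟩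
        obtain ⟨rfl, rfl⟩ := c.inj k j v (mem_annulus_of_le hr hv hv1) w
          (mem_annulus_of_le hr hw hw1) hvw
        rfl
      · exact ⟨Classical.arbitrary X, fun h' => absurd h' hz,
          fun j w hw hw1 hjw => absurd ⟨j, w, hw, hw1, hjw⟩ hex⟩
  choose g hg using hch
  refine ⟨g, fun z hz => ?_, fun x hx => (hg x).1 hx⟩
  by_cases hzM : z ∈ M
  · refine ContinuousAt.continuousWithinAt ((hf.continuousAt (hM.mem_nhds hzM)).congr ?_)
    filter_upwards [hM.mem_nhds hzM] with v hv using ((hg v).1 hv).symm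
  · obtain ⟨j, w, hw, rfl⟩ := c.surj z (by rw [hM.frontier_eq]; exact ⟨hz, hzM⟩)
    have hw1 : ‖w‖ = 1 := mem_sphere_zero_iff_norm.1 hw
    have hrw : r < ‖w‖ := by rwa [hw1]
    refine c.continuousWithinAt_of_comp (sphere_subset_annulus c.R_pos c.R_lt hw) ?_
    have hmem := mem_nhdsWithin_closedBall hrw
    have h1 : ContinuousWithinAt (D j) (closedBall 0 1) w :=
      (hD j w ⟨hrw, hw1.le⟩).mono_of_mem_nhdsWithin hmem
    refine h1.congr_of_eventuallyEq ?_ ((hg _).2 j w hrw hw1.le rfl)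
    filter_upwards [hmem] with v hv using (hg _).2 j v hv.1 hv.2 rfl

/-- A small holomorphic function, smooth up to the boundary, solving a nonlinear boundary
problem. -/
theorem exists_boundary_solution (c : Collar M) (hM : IsOpen M) (hMb : IsBounded M)
    {P : Fin c.m → ℂ → ℂ → ℝ}
    (hP : ∀ j, IsNearDisc (P j))
    {K : Set ℂ} (hK : IsCompact K) (hKM : K ⊆ M) {η : ℝ} (hη : 0 < η) :
    ∃ h hd : ℂ → ℂ, ContinuousOn h (closure M) ∧ DifferentiableOn ℂ h M ∧
      ContinuousOn hd (closure M) ∧ (∀ x ∈ M, hd x = deriv h x) ∧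
      (∀ x ∈ closure M, ‖h x‖ ≤ 2) ∧ (∀ x ∈ K, ‖h x‖ < η) ∧
      ∀ j, ∀ w ∈ sphere (0 : ℂ) 1, P j w (h (c.ψ j w)) = 0 := by
  obtain ⟨r₁, r₂, r₃, h1, h12, h23, h3, hKr⟩ := c.exists_radii hM hK hKM
  have hr1 : r₁ < 1 := by linarith
  have hr30 : 0 ≤ r₃ := by linarith [c.R_pos]
  obtain ⟨C, hC, hglue⟩ := exists_glue (c := c) (E := ℂ) hM hMb le_rfl h1 h12 h23 h3
  have hlim : Tendsto (fun N : ℕ => C * (r₃ ^ N * Real.exp (1 - r₃)⁻¹)) atTop (𝓝 0) := by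
    simpa using ((tendsto_pow_atTop_nhds_zero_of_lt_one hr30 h3).mul_const
      (Real.exp (1 - r₃)⁻¹)).const_mul C
  obtain ⟨N, ⟨a, ha, has, haP⟩, hN⟩ :=
    ((exists_collar_solution (c := c) hMb h1 hr1 hP).and
      (hlim.eventually (eventually_lt_nhds hη))).exists
  obtain ⟨h, hhd, hh1, -, hh3⟩ := hglue 0 (fun j => powExp N (a j)) (differentiableOn_const _)
    (fun j w hw => (differentiableAt_powExp (ha j) hw.2).differentiableWithinAt)
  have hh1' : ∀ j w, r₁ < ‖w‖ → ‖w‖ < c.R⁻¹ →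
      h (c.ψ j w) = powExp N (a j) w + c.correction r₁ N a (c.ψ j w) := by
    intro j w hw hw'
    rw [hh1 j w hw hw']
    simp only [Pi.zero_apply, sub_zero]
    rfl
  have hcor := fun j w (hw : r₁ < ‖w‖) (hw' : ‖w‖ < c.R⁻¹) =>
    analyticAt_correction (N := N) h1 hr1 ha j hw hw'
  have hhc : ContinuousOn h (closure M) := by
    intro z hz
    by_cases hzM : z ∈ M
    · exact (hhd.continuousOn.continuousAt (hM.mem_nhds hzM)).continuousWithinAt
    · obtain ⟨j, w, hw, rfl⟩ := c.surj z (by rw [hM.frontier_eq]; exact ⟨hz, hzM⟩)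
      have hw1 : ‖w‖ = 1 := mem_sphere_zero_iff_norm.1 hw
      have hrw : r₁ < ‖w‖ := by rwa [hw1]
      refine c.continuousWithinAt_of_comp (sphere_subset_annulus c.R_pos c.R_lt hw) ?_
      have hp : ContinuousWithinAt (powExp N (a j)) (closedBall 0 1) w :=
        (continuousWithinAt_id.pow N).mul
          (continuousOn_powSeries (summable_norm_of_mul (has j)) w
            (sphere_subset_closedBall hw)).cexp
      refine (hp.add (hcor j w hrw (by rw [hw1]; exact c.one_lt_inv)).continuousAt.continuousWithinAt
        ).congr_of_eventuallyEq ?_ (hh1' j w hrw (by rw [hw1]; exact c.one_lt_inv))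
      filter_upwards [mem_nhdsWithin_closedBall hrw] with v hv
      exact hh1' j v hv.1 (hv.2.trans_lt c.one_lt_inv)
  choose G hGc hGd using fun j => exists_deriv_powSeries (has j)
  obtain ⟨hd, hdc, hdd⟩ := exists_extension (c := c) hM
    ((hhd.analyticOnNhd hM).deriv.continuousOn) h1.le hr1
    (D := fun j w => (N * w ^ (N - 1) * exp (powSeries (a j) w) +
      w ^ N * (exp (powSeries (a j) w) * G j w) +
      deriv (fun v => c.correction r₁ N a (c.ψ j v)) w) / deriv (c.ψ j) w) (by
    intro j
    have hs : {w : ℂ | r₁ < ‖w‖ ∧ ‖w‖ ≤ 1} ⊆ closedBall 0 1 := fun w hw =>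
      mem_closedBall_zero_iff.2 hw.2
    have he : ContinuousOn (fun w => exp (powSeries (a j) w)) {w : ℂ | r₁ < ‖w‖ ∧ ‖w‖ ≤ 1} :=
      ((continuousOn_powSeries (summable_norm_of_mul (has j))).mono hs).cexp
    refine ContinuousOn.div ((ContinuousOn.add ?_ ?_).add ?_) ?_ fun w hw =>
      c.deriv_ne j w (mem_annulus_of_le h1.le hw.1 hw.2)
    · exact ContinuousOn.mul (by fun_prop) he
    · exact ContinuousOn.mul (by fun_prop) (he.mul ((hGc j).mono hs))
    · exact fun w hw => (hcor j w hw.1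
        (hw.2.trans_lt c.one_lt_inv)).deriv.continuousAt.continuousWithinAt
    · exact fun w hw => (c.analyticAt j
        (mem_annulus_of_le h1.le hw.1 hw.2)).deriv.continuousAt.continuousWithinAt)
    (by
    intro j w hw hw1
    have hwa := mem_annulus_of_le h1.le hw hw1.le
    rw [eq_div_iff (c.deriv_ne j w hwa)]
    have hz : c.ψ j w ∈ M := (c.mem_iff hM hwa).2 hw1
    have e1 : HasDerivAt (fun v => h (c.ψ j v)) (deriv h (c.ψ j w) * deriv (c.ψ j) w) w :=
      (hhd.differentiableAt (hM.mem_nhds hz)).hasDerivAt.comp w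
        (c.differentiableAt j hwa).hasDerivAt
    have e2 : HasDerivAt (fun v => powExp N (a j) v + c.correction r₁ N a (c.ψ j v))
        (N * w ^ (N - 1) * exp (powSeries (a j) w) +
          w ^ N * (exp (powSeries (a j) w) * G j w) +
          deriv (fun v => c.correction r₁ N a (c.ψ j v)) w) w :=
      ((hasDerivAt_pow N w).mul (hGd j w (mem_ball_zero_iff.2 hw1)).cexp).add
        (hcor j w hw (hw1.trans c.one_lt_inv)).differentiableAt.hasDerivAt
    refine e1.unique (e2.congr_of_eventuallyEq ?_)
    filter_upwards [(isOpen_lt continuous_const continuous_norm).mem_nhds hw,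
      (isOpen_lt continuous_norm continuous_const).mem_nhds (hw1.trans c.one_lt_inv)] with v hv hv'
    exact hh1' j v hv hv')
  have hsph : ∀ j, ∀ w ∈ sphere (0 : ℂ) 1,
      h (c.ψ j w) = powExp N (a j) w + c.correction r₁ N a (c.ψ j w) := fun j w hw =>
    hh1' j w (by rwa [mem_sphere_zero_iff_norm.1 hw])
      (by rw [mem_sphere_zero_iff_norm.1 hw]; exact c.one_lt_inv)
  refine ⟨h, hd, hhc, hhd, hdc, hdd, fun x hx => ?_, fun x hx => ?_, fun j w hw => ?_⟩
  · refine norm_le_of_forall_mem_frontier_norm_le hMb ⟨hhd, hhc⟩ (fun z hz => ?_) hx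
    obtain ⟨j, w, hw, rfl⟩ := c.surj z hz
    rw [hsph j w hw]
    exact mem_closedBall_zero_iff.1 (haP j w hw).1
  · have := hh3 (r₃ ^ N * Real.exp (1 - r₃)⁻¹) (by positivity) (fun k w hw => by
      simpa using norm_powExp_le (N := N) (ha k) h3 hw) x (hKr hx)
    rw [Pi.zero_apply, sub_zero] at this
    exact this.trans_lt hN
  · rw [hsph j w hw]
    exact (haP j w hw).2

end Collar

section

open ComplexConjugate

variable {E : Type*} [NormedAddCommGroup E] [NormedSpace ℂ E]

/-- The quadratic disc with coefficients `q`. -/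
noncomputable def quadDisc (q : E × E × E) (ζ : ℂ) : E := q.1 + (ζ • q.2.1 + ζ ^ 2 • q.2.2)

theorem continuous_quadDisc : Continuous fun p : (E × E × E) × ℂ => quadDisc p.1 p.2 := by
  unfold quadDisc
  fun_prop

theorem hasDerivAt_quadDisc (q : E × E × E) (ζ : ℂ) :
    HasDerivAt (quadDisc q) (q.2.1 + (2 * ζ) • q.2.2) ζ := by
  have h := (((hasDerivAt_id ζ).smul_const q.2.1).add
    ((hasDerivAt_pow 2 ζ).smul_const q.2.2)).const_add q.1
  exact h.congr_deriv (by simp)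

theorem norm_quadDisc_sub_le (q : E × E × E) {ζ : ℂ} (hζ : ‖ζ‖ ≤ 2) :
    ‖ζ • q.2.1 + ζ ^ 2 • q.2.2‖ ≤ 2 * ‖q.2.1‖ + 4 * ‖q.2.2‖ := by
  refine (norm_add_le _ _).trans ?_
  rw [norm_smul, norm_smul, norm_pow]
  have : ‖ζ‖ ^ 2 ≤ 2 ^ 2 := by gcongr
  gcongr
  linarith

variable [FiniteDimensional ℂ E]

/-- Coefficients of quadratic discs along which `ρ` is close to a multiple of `‖ζ‖ ^ 2 - 1`. -/
def exactDiscs (ρ : E → ℝ) (U : Set E) (η : ℝ) : Set (E × E × E) :=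
  {q | 2 * ‖q.2.1‖ + 4 * ‖q.2.2‖ < η ∧ ∀ ζ ∈ closedBall (0 : ℂ) 2, quadDisc q ζ ∈ U ∧
    ‖dform ρ (quadDisc q ζ) (q.2.1 + (2 * ζ) • q.2.2) + 2 * ρ q.1 * conj ζ‖ < -ρ q.1 / 200}

theorem exactDiscs_base {ρ : E → ℝ} {U : Set E} {η : ℝ} {q : E × E × E}
    (hq : q ∈ exactDiscs ρ U η) : q.1 ∈ U ∧ ρ q.1 < 0 := by
  obtain ⟨h1, h2⟩ := hq.2 0 (by simp)
  refine ⟨by simpa [quadDisc] using h1, ?_⟩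
  linarith [(norm_nonneg _).trans_lt h2]

theorem isOpen_exactDiscs {ρ : E → ℝ} {U : Set E} (hU : IsOpen U) (hρ : ContDiffOn ℝ 1 ρ U)
    (η : ℝ) : IsOpen (exactDiscs ρ U η) := by
  refine isOpen_iff_mem_nhds.2 fun q hq => ?_
  have h1 : ∀ᶠ p : E × E × E in 𝓝 q, 2 * ‖p.2.1‖ + 4 * ‖p.2.2‖ < η :=
    ContinuousAt.eventually_lt (by fun_prop) continuousAt_const hq.1
  have h2 : ∀ᶠ p : E × E × E in 𝓝 q, ∀ ζ ∈ closedBall (0 : ℂ) 2, quadDisc p ζ ∈ U ∧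
      ‖dform ρ (quadDisc p ζ) (p.2.1 + (2 * ζ) • p.2.2) + 2 * ρ p.1 * conj ζ‖ < -ρ p.1 / 200 := by
    refine (isCompact_closedBall 0 2).eventually_forall_of_forall_eventually fun ζ hζ => ?_
    obtain ⟨h3, h4⟩ := hq.2 ζ hζ
    have hc : ContinuousAt (fun x : (E × E × E) × ℂ => quadDisc x.1 x.2) (q, ζ) :=
      continuous_quadDisc.continuousAt
    have hd : ContinuousAt (fun x : (E × E × E) × ℂ =>
        dform ρ (quadDisc x.1 x.2) (x.1.2.1 + (2 * x.2) • x.1.2.2)) (q, ζ) :=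
      ContinuousAt.comp (g := fun p : E × E => dform ρ p.1 p.2)
        (f := fun x : (E × E × E) × ℂ =>
          (quadDisc x.1 x.2, x.1.2.1 + (2 * x.2) • x.1.2.2))
        ((continuousOn_dform hU hρ).continuousAt ((hU.prod isOpen_univ).mem_nhds ⟨h3, mem_univ _⟩))
        (hc.prodMk (by fun_prop))
    have hρ1 : ContinuousAt (fun x : (E × E × E) × ℂ => ρ x.1.1) (q, ζ) :=
      ContinuousAt.comp (g := ρ) (f := fun x : (E × E × E) × ℂ => x.1.1)
        (hρ.continuousOn.continuousAt (hU.mem_nhds (exactDiscs_base hq).1)) (by fun_prop)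
    have hρ2 : ContinuousAt (fun x : (E × E × E) × ℂ => 2 * (ρ x.1.1 : ℂ) * conj x.2) (q, ζ) :=
      (continuousAt_const.mul (continuous_ofReal.continuousAt.comp hρ1)).mul
        (continuous_conj.continuousAt.comp continuousAt_snd)
    exact (hc.eventually (hU.mem_nhds h3)).and
      (ContinuousAt.eventually_lt (hd.add hρ2).norm (hρ1.neg.div_const 200) h4)
  filter_upwards [h1, h2] with p hp1 hp2 using ⟨hp1, hp2⟩

theorem exactDiscs_smul {ρ : E → ℝ} {U : Set E} {η : ℝ} {q : E × E × E}
    (hq : q ∈ exactDiscs ρ U η) {a : ℂ} (ha : ‖a‖ = 1) :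
    (q.1, a • q.2.1, a ^ 2 • q.2.2) ∈ exactDiscs ρ U η := by
  refine ⟨by simpa [norm_smul, ha] using hq.1, fun ζ hζ => ?_⟩
  have haζ : a * ζ ∈ closedBall (0 : ℂ) 2 := by
    rw [mem_closedBall_zero_iff] at hζ ⊢
    rwa [norm_mul, ha, one_mul]
  obtain ⟨h1, h2⟩ := hq.2 (a * ζ) haζ
  have e1 : quadDisc (q.1, a • q.2.1, a ^ 2 • q.2.2) ζ = quadDisc q (a * ζ) := by
    simp only [quadDisc, smul_smul]
    rw [mul_comm ζ a, mul_pow, mul_comm (ζ ^ 2)]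
  have e2 : a • q.2.1 + (2 * ζ) • a ^ 2 • q.2.2 = a • (q.2.1 + (2 * (a * ζ)) • q.2.2) := by
    rw [smul_add, smul_smul, smul_smul]
    congr 2
    ring
  rw [e1]
  refine ⟨h1, ?_⟩
  simp only
  have haa : a * conj a = 1 := by rw [mul_conj, normSq_eq_norm_sq, ha]; simp
  have e3 : dform ρ (quadDisc q (a * ζ)) (a • q.2.1 + (2 * ζ) • a ^ 2 • q.2.2) +
      2 * ρ q.1 * conj ζ = a * (dform ρ (quadDisc q (a * ζ)) (q.2.1 + (2 * (a * ζ)) • q.2.2) +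
      2 * ρ q.1 * conj (a * ζ)) := by
    rw [e2, map_smul, map_mul, smul_eq_mul]
    linear_combination (-2 * ρ q.1 * conj ζ) * haa
  rw [e3, norm_mul, ha, one_mul]
  exact h2

theorem exactDiscs_spec {ρ : E → ℝ} {U : Set E} (hU : IsOpen U) (hρ : ContDiffOn ℝ 1 ρ U) {η : ℝ}
    {q : E × E × E} (hq : q ∈ exactDiscs ρ U η) {ζ ζ' : ℂ} (hζ : ζ ∈ closedBall (0 : ℂ) 2)
    (hζ' : ζ' ∈ closedBall (0 : ℂ) 2) :
    |(ρ (quadDisc q ζ) / -ρ q.1 - (‖ζ‖ ^ 2 - 1)) - (ρ (quadDisc q ζ') / -ρ q.1 - (‖ζ'‖ ^ 2 - 1))| ≤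
      1 / 200 * ‖ζ - ζ'‖ := by
  have hd := (exactDiscs_base hq).2
  set d := -ρ q.1 with hdd
  have hd0 : 0 < d := by linarith
  have hder : ∀ ζ ∈ closedBall (0 : ℂ) 2, ∃ L : ℂ →L[ℝ] ℝ,
      HasFDerivAt (fun ζ : ℂ => ρ (quadDisc q ζ) / d - (‖ζ‖ ^ 2 - 1)) L ζ ∧ ‖L‖ ≤ 1 / 200 := by
    intro ζ hζ
    obtain ⟨h1, h2⟩ := hq.2 ζ hζ
    have hρd : HasFDerivAt ρ (fderiv ℝ ρ (quadDisc q ζ)) (quadDisc q ζ) :=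
      ((hρ.contDiffAt (hU.mem_nhds h1)).differentiableAt (by norm_num)).hasFDerivAt
    have e1 := HasFDerivAt.comp ζ hρd ((hasDerivAt_quadDisc q ζ).hasFDerivAt.restrictScalars ℝ)
    have e2 : HasFDerivAt (fun ζ : ℂ => ‖ζ‖ ^ 2) (2 • innerSL ℝ ζ) ζ :=
      (hasStrictFDerivAt_norm_sq ζ).hasFDerivAt
    have e3 := (e1.mul_const d⁻¹).sub (e2.sub_const 1)
    refine ⟨_, e3.congr_of_eventuallyEq (Eventually.of_forall fun v => ?_), ?_⟩
    · simp [div_eq_mul_inv]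
    · refine ContinuousLinearMap.opNorm_le_bound _ (by norm_num) fun v => ?_
      have e4 : (d⁻¹ • (fderiv ℝ ρ (quadDisc q ζ)).comp
          ((ContinuousLinearMap.toSpanSingleton ℂ (q.2.1 + (2 * ζ) • q.2.2)).restrictScalars ℝ) -
          2 • innerSL ℝ ζ) v =
          ((d⁻¹ : ℝ) * ((dform ρ (quadDisc q ζ) (q.2.1 + (2 * ζ) • q.2.2) +
            2 * ρ q.1 * conj ζ) * v) : ℂ).re := by
        have e5 : (dform ρ (quadDisc q ζ) (q.2.1 + (2 * ζ) • q.2.2) + 2 * ρ q.1 * conj ζ) * v =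
            dform ρ (quadDisc q ζ) (v • (q.2.1 + (2 * ζ) • q.2.2)) -
              (d * 2 : ℝ) * (conj ζ * v) := by
          rw [map_smul, smul_eq_mul, hdd]
          push_cast
          ring
        rw [e5, re_ofReal_mul, sub_re, dform_re, re_ofReal_mul]
        have e6 : inner ℝ ζ v = (v * conj ζ).re := by rw [Complex.inner]
        simp only [_root_.sub_apply, _root_.smul_apply, ContinuousLinearMap.comp_apply,
          ContinuousLinearMap.coe_restrictScalars', ContinuousLinearMap.toSpanSingleton_apply,
          innerSL_apply_apply, e6, smul_eq_mul, nsmul_eq_mul]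
        rw [mul_comm (conj ζ)]
        push_cast
        field_simp
      refine (congrArg norm e4).le.trans ?_
      rw [Real.norm_eq_abs]
      refine (abs_re_le_norm _).trans ?_
      rw [norm_mul, norm_mul, norm_real, Real.norm_eq_abs, abs_of_pos (inv_pos.2 hd0)]
      calc d⁻¹ * (‖_‖ * ‖v‖) ≤ d⁻¹ * ((d / 200) * ‖v‖) := by gcongr
        _ = 1 / 200 * ‖v‖ := by field_simp
  choose! L hL hLn using hder
  exact (convex_closedBall (0 : ℂ) 2).norm_image_sub_le_of_norm_hasFDerivWithin_le
    (fun ζ hζ => (hL ζ hζ).hasFDerivWithinAt) hLn hζ' hζ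

theorem exactDiscs_abs_le {ρ : E → ℝ} {U : Set E} (hU : IsOpen U) (hρ : ContDiffOn ℝ 1 ρ U) {η : ℝ}
    {q : E × E × E} (hq : q ∈ exactDiscs ρ U η) {ζ : ℂ} (hζ : ζ ∈ closedBall (0 : ℂ) 2) :
    |ρ (quadDisc q ζ) / -ρ q.1 - (‖ζ‖ ^ 2 - 1)| ≤ 1 / 100 := by
  have h := exactDiscs_spec hU hρ hq hζ (mem_closedBall_self (by norm_num : (0 : ℝ) ≤ 2))
  have hd := (exactDiscs_base hq).2
  have h0 : ρ (quadDisc q 0) / -ρ q.1 - (‖(0 : ℂ)‖ ^ 2 - 1) = 0 := by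
    have : quadDisc q 0 = q.1 := by simp [quadDisc]
    rw [this, norm_zero, div_neg, div_self hd.ne]
    norm_num
  rw [h0, sub_zero, sub_zero] at h
  rw [mem_closedBall_zero_iff] at hζ
  linarith

end

section

open ComplexConjugate

variable {E : Type*} [NormedAddCommGroup E] [NormedSpace ℂ E]

/-- The derivative of `z ↦ dform ρ z u` in the direction `v`. -/
noncomputable def sform (ρ : E → ℝ) (z v u : E) : ℂ := (D2 ρ z v u : ℂ) - I * (D2 ρ z v (I • u) : ℂ)

theorem norm_ofReal_sub_I_mul_le {a b r : ℝ} (ha : |a| ≤ r) (hb : |b| ≤ r) :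
    ‖(a : ℂ) - I * b‖ ≤ 2 * r := by
  refine (norm_sub_le _ _).trans ?_
  rw [norm_mul, norm_I, one_mul, norm_real, norm_real, Real.norm_eq_abs, Real.norm_eq_abs]
  linarith

theorem norm_sform_le {ρ : E → ℝ} {z : E} {C : ℝ} (hC : ‖fderiv ℝ (fderiv ℝ ρ) z‖ ≤ C) (v u : E) :
    ‖sform ρ z v u‖ ≤ 2 * (C * ‖v‖ * ‖u‖) := by
  have h : ∀ u, |D2 ρ z v u| ≤ C * ‖v‖ * ‖u‖ := fun u => (norm_D2_le v u).trans (by gcongr)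
  exact norm_ofReal_sub_I_mul_le (h u) ((h _).trans (by rw [norm_smul, norm_I, one_mul]))

theorem sform_add (ρ : E → ℝ) (z v v' u u' : E) :
    sform ρ z (v + v') (u + u') = sform ρ z v u + sform ρ z v u' + sform ρ z v' (u + u') := by
  simp only [sform, D2, smul_add, map_add, _root_.add_apply]
  push_cast
  ring

theorem sform_smul_self {ρ : E → ℝ} {z : E} (hρ : ContDiffAt ℝ 2 ρ z) (ζ : ℂ) (v : E) :
    sform ρ z (ζ • v) v = 2 * ζ * qform ρ z v v + 2 * conj ζ * levi ρ z v := by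
  have h1 : ζ = ζ.re + ζ.im * I := (re_add_im ζ).symm
  have h2 : conj ζ = ζ.re - ζ.im * I := by apply Complex.ext <;> simp
  rw [sform, D2_smul_left ρ z ζ v v, D2_smul_left ρ z ζ v (I • v), qform_apply, levi, h2,
    D2_comm hρ (I • v) v]
  push_cast
  linear_combination (ζ.im * D2 ρ z v (I • v) : ℂ) * I_mul_I - (1 / 2 * (D2 ρ z v v -
    D2 ρ z (I • v) (I • v)) - I * D2 ρ z v (I • v) : ℂ) * h1

variable [FiniteDimensional ℂ E]

theorem mem_exactDiscs_of {ρ : E → ℝ} {U : Set E} {z v w : E} (hρ : ContDiffAt ℝ 2 ρ z)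
    {δ C B e η : ℝ} (hU : closedBall z δ ⊆ U) (hC : 0 < C)
    (hT : ∀ ξ, ‖ξ‖ ≤ δ → ‖fderiv ℝ (fderiv ℝ ρ) z‖ ≤ C ∧
      ‖fderiv ℝ ρ (z + ξ) - fderiv ℝ ρ z - fderiv ℝ (fderiv ℝ ρ) z ξ‖ ≤ C * ‖ξ‖ ^ 2)
    (hB : 1 ≤ B) (he : 0 < e) (he1 : e ≤ 1) (heη : 6 * B * e < η) (heδ : 6 * B * e ≤ δ)
    (heC : 416 * C * B ^ 3 * e < 1 / 200) (hv : ‖v‖ ≤ B * e) (hw : ‖w‖ ≤ B * e ^ 2)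
    (hl : dform ρ z v = 0) (hq : dform ρ z w + qform ρ z v v = 0) (hL : levi ρ z v = e ^ 2)
    (hρz : ρ z = -e ^ 2) : (z, v, w) ∈ exactDiscs ρ U η := by
  have hB0 : 0 < B := by linarith
  have hBe : B * e ^ 2 ≤ B * e := by
    gcongr
    nlinarith
  have hw1 : ‖w‖ ≤ B * e := hw.trans hBe
  refine ⟨by simp only; linarith, fun ζ hζ => ?_⟩
  rw [mem_closedBall_zero_iff] at hζ
  have hξn := norm_quadDisc_sub_le (z, v, w) hζ
  simp only [quadDisc] at hξn ⊢
  set ξ := ζ • v + ζ ^ 2 • w with hξ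
  set u := v + (2 * ζ) • w with hu
  have hξ6 : ‖ξ‖ ≤ 6 * B * e := by linarith
  have hζw : ‖ζ ^ 2 • w‖ ≤ 4 * (B * e ^ 2) := by
    rw [norm_smul, norm_pow]
    have : ‖ζ‖ ^ 2 ≤ 2 ^ 2 := by gcongr
    exact mul_le_mul (by linarith) hw (norm_nonneg _) (by norm_num)
  have hζw' : ‖(2 * ζ) • w‖ ≤ 4 * (B * e ^ 2) := by
    rw [norm_smul, norm_mul, RCLike.norm_ofNat]
    exact mul_le_mul (by linarith) hw (norm_nonneg _) (by norm_num)
  have hζv : ‖ζ • v‖ ≤ 2 * (B * e) := by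
    rw [norm_smul]
    exact mul_le_mul hζ hv (norm_nonneg _) (by norm_num)
  have hun : ‖u‖ ≤ 5 * (B * e) := (norm_add_le _ _).trans (by linarith)
  obtain ⟨hC2, hT⟩ := hT ξ (hξ6.trans heδ)
  refine ⟨hU (by simpa using hξ6.trans heδ), ?_⟩
  have e1 : ‖dform ρ (z + ξ) u - dform ρ z u - sform ρ z ξ u‖ ≤ 2 * (C * ‖ξ‖ ^ 2 * ‖u‖) := by
    have h : ∀ u, |fderiv ℝ ρ (z + ξ) u - fderiv ℝ ρ z u - D2 ρ z ξ u| ≤ C * ‖ξ‖ ^ 2 * ‖u‖ :=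
      fun u => ((fderiv ℝ ρ (z + ξ) - fderiv ℝ ρ z - fderiv ℝ (fderiv ℝ ρ) z ξ).le_opNorm u).trans
        (by gcongr)
    have := norm_ofReal_sub_I_mul_le (h u) ((h (I • u)).trans (by rw [norm_smul, norm_I, one_mul]))
    refine (congrArg norm ?_).le.trans this
    simp only [dform_apply, sform]
    push_cast
    ring
  have e2 := norm_sform_le hC2 (ζ • v) ((2 * ζ) • w)
  have e3 := norm_sform_le hC2 (ζ ^ 2 • w) u
  have e4 : dform ρ (z + ξ) u + 2 * ρ z * conj ζ = (dform ρ (z + ξ) u - dform ρ z u - sform ρ z ξ u) +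
      sform ρ z (ζ • v) ((2 * ζ) • w) + sform ρ z (ζ ^ 2 • w) u := by
    have e5 : dform ρ z u = 2 * ζ * dform ρ z w := by rw [hu, map_add, hl, map_smul, zero_add]; rfl
    rw [hξ, hu, sform_add, sform_smul_self hρ, ← hu, ← hξ, e5, hL, hρz]
    push_cast
    linear_combination (2 * ζ) * hq
  have b1 : C * ‖ξ‖ ^ 2 * ‖u‖ ≤ C * (6 * B * e) ^ 2 * (5 * (B * e)) := by gcongr
  have b2 : C * ‖ζ • v‖ * ‖(2 * ζ) • w‖ ≤ C * (2 * (B * e)) * (4 * (B * e ^ 2)) := by gcongr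
  have b3 : C * ‖ζ ^ 2 • w‖ * ‖u‖ ≤ C * (4 * (B * e ^ 2)) * (5 * (B * e)) := by gcongr
  have b4 : C * B ^ 2 * e ^ 3 ≤ C * B ^ 3 * e ^ 3 := by gcongr; norm_num
  have b5 : 416 * C * B ^ 3 * e * e ^ 2 < 1 / 200 * e ^ 2 := by gcongr
  rw [e4, hρz]
  refine ((norm_add_le _ _).trans (add_le_add (norm_add_le _ _) le_rfl)).trans_lt ?_
  nlinarith

end

section

variable {E : Type*} [NormedAddCommGroup E] [InnerProductSpace ℂ E] [FiniteDimensional ℂ E]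

theorem exists_apply_eq_one {ℓ : E →L[ℂ] ℂ} {c : ℝ} (hc : 0 < c) (h : c ≤ ‖ℓ‖) :
    ∃ a, ℓ a = 1 ∧ ‖a‖ ≤ 1 / c := by
  have : CompleteSpace E := FiniteDimensional.complete ℂ E
  obtain ⟨b, rfl⟩ := (InnerProductSpace.toDual ℂ E).surjective ℓ
  rw [LinearIsometryEquiv.norm_map] at h
  have hb : 0 < ‖b‖ := hc.trans_le h
  refine ⟨((‖b‖ ^ 2 : ℝ) : ℂ)⁻¹ • b, ?_, ?_⟩
  · rw [map_smul, InnerProductSpace.toDual_apply_apply, inner_self_eq_norm_sq_to_K, smul_eq_mul]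
    push_cast
    exact inv_mul_cancel₀ (mod_cast (pow_pos hb 2).ne')
  · rw [norm_smul, norm_inv, norm_real, Real.norm_eq_abs, abs_of_pos (by positivity), sq, mul_inv,
      mul_assoc, inv_mul_cancel₀ hb.ne', mul_one, one_div]
    gcongr

theorem norm_fderiv_le_norm_dform {ρ : E → ℝ} {z : E} : ‖fderiv ℝ ρ z‖ ≤ ‖dform ρ z‖ := by
  refine ContinuousLinearMap.opNorm_le_bound _ (norm_nonneg _) fun v => ?_
  rw [Real.norm_eq_abs, ← dform_re]
  exact (abs_re_le_norm _).trans ((dform ρ z).le_opNorm v)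

/-- The coefficients of the discs at `z` which are exact to second order. -/
def exactCoeffs (ρ : E → ℝ) (B : ℝ) (z : E) : Set (E × E) :=
  {p | dform ρ z p.1 = 0 ∧ levi ρ z p.1 = -ρ z ∧ dform ρ z p.2 + qform ρ z p.1 p.1 = 0 ∧
    ‖p.2‖ ≤ B * -ρ z}

theorem exactCoeffs_aux (hE : 3 ≤ Module.finrank ℂ E) {ρ : E → ℝ} {z : E}
    (hρ : ContDiffAt ℝ 2 ρ z) {c c' C B : ℝ} (hc : 0 < c) (hL : ∀ v, c * ‖v‖ ^ 2 ≤ levi ρ z v)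
    (hc' : 0 < c') (hd : c' ≤ ‖fderiv ℝ ρ z‖) (hC : ‖fderiv ℝ (fderiv ℝ ρ) z‖ ≤ C)
    (hB : C / c / c' ≤ B) (hρz : ρ z < 0) :
    (exactCoeffs ρ B z).Nonempty ∧
      ∀ p ∈ exactCoeffs ρ B z, ∀ q ∈ exactCoeffs ρ B z, JoinedIn (exactCoeffs ρ B z) p q := by
  obtain ⟨a, ha, han⟩ := exists_apply_eq_one hc' (hd.trans norm_fderiv_le_norm_dform)
  have hC0 : 0 ≤ C := (by positivity : 0 ≤ ‖fderiv ℝ (fderiv ℝ ρ) z‖).trans hC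
  have hLpos : ∀ v, v ≠ 0 → 0 < levi ρ z v := fun v hv =>
    (mul_pos hc (pow_pos (norm_pos_iff.2 hv) 2)).trans_le (hL v)
  have hwb : ∀ v, levi ρ z v = -ρ z → ‖-qform ρ z v v • a‖ ≤ B * -ρ z := by
    intro v hv
    have h1 : ‖v‖ ^ 2 ≤ -ρ z / c := by
      rw [le_div_iff₀ hc]
      linarith [hL v]
    calc ‖-qform ρ z v v • a‖ ≤ (C * ‖v‖ * ‖v‖) * (1 / c') := by
          rw [norm_smul, norm_neg]
          have := (norm_qform_le v v).trans (by gcongr : _ ≤ C * ‖v‖ * ‖v‖)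
          gcongr
      _ = C * ‖v‖ ^ 2 * (1 / c') := by ring
      _ ≤ C * (-ρ z / c) * (1 / c') := by gcongr
      _ = C / c / c' * -ρ z := by ring
      _ ≤ B * -ρ z := by gcongr; linarith
  set s : E → ℂ := fun v => (√(-ρ z / levi ρ z v) : ℝ) with hs
  have hsL : ∀ v, v ≠ 0 → levi ρ z (s v • v) = -ρ z := fun v hv => by
    rw [levi_smul hρ, hs, norm_real, Real.norm_eq_abs, sq_abs, Real.sq_sqrt, div_mul_cancel₀]
    · exact (hLpos v hv).ne'
    · exact div_nonneg (by linarith) (hLpos v hv).le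
  set G : E → E × E := fun v => (s v • v, -qform ρ z (s v • v) (s v • v) • a) with hG
  have hGm : ∀ v, v ≠ 0 → dform ρ z v = 0 → G v ∈ exactCoeffs ρ B z := fun v hv h0 =>
    ⟨by simp [hG, h0], hsL v hv, by simp [hG, ha], hwb _ (hsL v hv)⟩
  have hcl : Continuous fun v => levi ρ z v := by
    unfold levi D2
    fun_prop
  have hcq : Continuous fun v => qform ρ z v v := by
    simp only [qform_apply]
    unfold D2
    fun_prop
  have hcs : ContinuousOn (fun v => s v • v) {x | x ≠ 0 ∧ dform ρ z x = 0} := by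
    refine ContinuousOn.smul (continuous_ofReal.comp_continuousOn (Real.continuous_sqrt.comp_continuousOn
      (continuousOn_const.div hcl.continuousOn fun v hv => (hLpos v hv.1).ne'))) continuousOn_id
  have hcG : ContinuousOn G {x | x ≠ 0 ∧ dform ρ z x = 0} :=
    hcs.prodMk ((hcq.comp_continuousOn hcs).neg.smul continuousOn_const)
  have hne : ∀ p ∈ exactCoeffs ρ B z, p.1 ≠ 0 := fun p hp h => by
    have := hp.2.1
    rw [h] at this
    simp [levi, D2] at this
    linarith
  have hGp : ∀ p ∈ exactCoeffs ρ B z, JoinedIn (exactCoeffs ρ B z) p (G p.1) := by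
    rintro ⟨v, w⟩ hp
    have hsv : s v = 1 := by simp [hs, hp.2.1, hρz.ne]
    have hGv := hGm v (hne _ hp) hp.1
    have e : G v = (v, -qform ρ z v v • a) := by simp only [hG, hsv, one_smul]
    rw [e] at hGv ⊢
    refine JoinedIn.of_segment_subset ?_
    rintro _ ⟨x, y, hx, hy, hxy, rfl⟩
    have e1 : x • v + y • v = v := by rw [← add_smul, hxy, one_smul]
    obtain ⟨h1, h2, h3, h4⟩ := hp
    obtain ⟨-, -, g3, g4⟩ := hGv
    simp only [exactCoeffs, Prod.smul_mk, Prod.mk_add_mk, e1, mem_ofPred_eq] at h1 h2 h3 h4 g3 g4 ⊢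
    refine ⟨h1, h2, ?_, ?_⟩
    · have hxy' : (x : ℂ) + y = 1 := mod_cast hxy
      rw [← coe_smul x w, ← coe_smul y (_ • a), map_add, map_smul, map_smul, smul_eq_mul, smul_eq_mul]
      linear_combination (x : ℂ) * h3 + (y : ℂ) * g3 - qform ρ z v v * hxy'
    · refine (norm_add_le _ _).trans ?_
      rw [norm_smul, norm_smul, Real.norm_eq_abs, Real.norm_eq_abs, abs_of_nonneg hx,
        abs_of_nonneg hy]
      refine (add_le_add (mul_le_mul_of_nonneg_left h4 hx) (mul_le_mul_of_nonneg_left g4 hy)).trans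
        (le_of_eq ?_)
      rw [← add_mul, hxy, one_mul]
  constructor
  · obtain ⟨v, hv, h0, -⟩ := exists_common_kernel hE (dform ρ z : E →ₗ[ℂ] ℂ) 0
    exact ⟨_, hGm v hv h0⟩
  · intro p hp q hq
    have hj := (joinedIn_ker_ne_zero hE (dform ρ z) (hne p hp) (hne q hq) hp.1 hq.1).map_continuousOn
      hcG
    refine ((hGp p hp).trans (hj.mono ?_)).trans (hGp q hq).symm
    rintro _ ⟨v, hv, rfl⟩
    exact hGm v hv.1 hv.2

theorem exists_exact_section (hE : 3 ≤ Module.finrank ℂ E) {ρ : E → ℝ} {U Ω : Set E} (hU : IsOpen U)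
    (hρ : ContDiffOn ℝ 3 ρ U) (hpsh : IsStrictPsh ρ U)
    (hΩb : IsBounded Ω) (hΩU : closure Ω ⊆ U) (hΩ : Ω = {z ∈ U | ρ z < 0})
    (hDρ : ∀ z ∈ frontier Ω, fderiv ℝ ρ z ≠ 0) {η : ℝ} (hη : 0 < η) : ∃ δ > 0, ∀ F : ℂ → E,
      ContinuousOn F (sphere 0 1) → (∀ w ∈ sphere (0 : ℂ) 1, F w ∈ Ω ∧ -δ ≤ ρ (F w)) →
      ∃ σ : ℂ → E × E, ContinuousOn σ (sphere 0 1) ∧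
        ∀ w ∈ sphere (0 : ℂ) 1, (F w, σ w) ∈ exactDiscs ρ U η := by
  have hP : ProperSpace E := FiniteDimensional.proper ℂ E
  have hK : IsCompact (closure Ω) := hΩb.isCompact_closure
  have hρ2 : ContDiffOn ℝ 2 ρ U := hρ.of_le (by norm_num)
  have hρ1 : ContDiffOn ℝ 1 ρ U := hρ.of_le (by norm_num)
  obtain ⟨t, ht, C, hC, hT⟩ := exists_uniform_taylor hU hρ hK hΩU
  obtain ⟨c, hc, hL⟩ := exists_levi_lower_bound hU hρ2 hpsh hK hΩU
  have hdc : ContinuousOn (fun z => ‖fderiv ℝ ρ z‖) (closure Ω) :=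
    (hρ1.continuousOn_fderiv_of_isOpen hU le_rfl).norm.mono hΩU
  have hρc : ContinuousOn ρ (closure Ω) := hρ.continuousOn.mono hΩU
  obtain ⟨c', hc', hd⟩ : ∃ c' > 0, ∀ z ∈ closure Ω, -c' ≤ ρ z → c' ≤ ‖fderiv ℝ ρ z‖ := by
    have hm : ContinuousOn (fun z => max (-ρ z) ‖fderiv ℝ ρ z‖) (closure Ω) := hρc.neg.sup hdc
    have hpos : ∀ z ∈ closure Ω, 0 < max (-ρ z) ‖fderiv ℝ ρ z‖ := fun z hz => by
      by_cases hzΩ : z ∈ Ω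
      · exact lt_max_of_lt_left (by linarith [(hΩ.subset hzΩ).2])
      · have h := hDρ z ⟨hz, fun h => hzΩ (interior_subset h)⟩
        exact lt_max_of_lt_right (norm_pos_iff.2 h)
    obtain ⟨c', hc', h⟩ := hK.exists_forall_le' hm hpos
    refine ⟨c' / 2, by positivity, fun z hz hzρ => ?_⟩
    rcases le_max_iff.1 (h z hz) with h | h <;> linarith
  obtain ⟨B, hB1, hBc, hBC⟩ : ∃ B : ℝ, 1 ≤ B ∧ 1 / c ≤ B ∧ C / c / c' ≤ B :=
    ⟨max 1 (max (1 / c) (C / c / c')), le_max_left _ _, (le_max_left _ _).trans (le_max_right _ _),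
      (le_max_right _ _).trans (le_max_right _ _)⟩
  have hB0 : 0 < B := by linarith
  obtain ⟨e₀, he₀, he1, heη, het, heC⟩ : ∃ e > 0, e ≤ 1 ∧ 6 * B * e < η ∧ 6 * B * e ≤ t ∧
      416 * C * B ^ 3 * e < 1 / 200 := by
    have h : ∀ a : ℝ, Tendsto (fun e => a * e) (𝓝[>] 0) (𝓝 0) := fun a => by
      have : Tendsto (fun e => a * e) (𝓝 0) (𝓝 (a * 0)) := tendsto_id.const_mul a
      rw [mul_zero] at this
      exact this.mono_left nhdsWithin_le_nhds
    have h1 := (h 1).eventually_le_const one_pos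
    obtain ⟨e, h1, h2, h3, h4, h5⟩ := (h1.and (((h (6 * B)).eventually_lt_const hη).and
      (((h (6 * B)).eventually_le_const ht).and (((h (416 * C * B ^ 3)).eventually_lt_const
        (by norm_num : (0 : ℝ) < 1 / 200)).and self_mem_nhdsWithin)))).exists
    exact ⟨e, h5, by simpa using h1, h2, h3, h4⟩
  refine ⟨min c' (e₀ ^ 2), by positivity, fun F hF hFΩ => ?_⟩
  have hFK : ∀ w ∈ sphere (0 : ℂ) 1, F w ∈ closure Ω := fun w hw => subset_closure (hFΩ w hw).1
  have hFρ : ∀ w ∈ sphere (0 : ℂ) 1, ρ (F w) < 0 := fun w hw => (hΩ.subset (hFΩ w hw).1).2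
  have hcd : ∀ z ∈ closure Ω, ContDiffAt ℝ 2 ρ z := fun z hz =>
    hρ2.contDiffAt (hU.mem_nhds (hΩU hz))
  have hvb : ∀ w ∈ sphere (0 : ℂ) 1, ∀ p ∈ exactCoeffs ρ B (F w), ‖p.1‖ ≤ B * √(-ρ (F w)) := by
    intro w hw p hp
    have h1 := hL _ (hFK w hw) p.1
    rw [hp.2.1] at h1
    refine le_of_sq_le_sq ?_ (by positivity)
    have h2 : ‖p.1‖ ^ 2 ≤ 1 / c * -ρ (F w) := by
      field_simp
      linarith
    rw [mul_pow, Real.sq_sqrt (by linarith [hFρ w hw])]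
    refine h2.trans ?_
    exact mul_le_mul_of_nonneg_right (by nlinarith) (by linarith [hFρ w hw])
  have hsub : ∀ w ∈ sphere (0 : ℂ) 1, exactCoeffs ρ B (F w) ⊆ {p | (F w, p) ∈ exactDiscs ρ U η} := by
    intro w hw p hp
    have hneg := hFρ w hw
    have hse : √(-ρ (F w)) ≤ e₀ := Real.sqrt_le_iff.2
      ⟨he₀.le, by linarith [(hFΩ w hw).2, min_le_right c' (e₀ ^ 2)]⟩
    have hsq : √(-ρ (F w)) ^ 2 = -ρ (F w) := Real.sq_sqrt (by linarith)
    have hmono : ∀ a : ℝ, 0 < a → a * √(-ρ (F w)) ≤ a * e₀ := fun a ha => by gcongr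
    obtain ⟨hb, hT⟩ := hT _ (hFK w hw)
    have h6 := hmono (6 * B) (by positivity)
    have h4 := hmono (416 * C * B ^ 3) (by positivity)
    refine mem_exactDiscs_of (hcd _ (hFK w hw)) hb hC (fun ξ hξ => ⟨?_, (hT ξ hξ).2.2.2.1⟩) hB1
      (Real.sqrt_pos.2 (by linarith)) (hse.trans he1) (by linarith) (by linarith) (by linarith)
      (hvb w hw p hp) (by rw [hsq]; exact hp.2.2.2) hp.1 hp.2.2.1 (by rw [hsq]; exact hp.2.1)
      (by rw [hsq, neg_neg])
    simpa using (hT 0 (by simpa using ht.le)).2.1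
  have haux : ∀ w ∈ sphere (0 : ℂ) 1, _ := fun w hw => exactCoeffs_aux hE (hcd _ (hFK w hw)) hc
    (hL _ (hFK w hw)) hc' (hd _ (hFK w hw) (by linarith [(hFΩ w hw).2, min_le_left c' (e₀ ^ 2)]))
    (by simpa using ((hT _ (hFK w hw)).2 0 (by simpa using ht.le)).2.1) hBC (hFρ w hw)
  refine exists_circle_section (V := E × E) (D := fun w => {p | (F w, p) ∈ exactDiscs ρ U η})
    (N := fun w => exactCoeffs ρ B (F w)) ?_ ?_ (fun w hw => (haux w hw).1)
    fun w hw p hp q hq => ((haux w hw).2 p hp q hq).mono (hsub w hw)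
  · intro w hw p hp
    have h : ContinuousWithinAt (fun x : ℂ × E × E => (F x.1, x.2)) (sphere 0 1 ×ˢ univ) (w, p) :=
      ((hF w hw).comp (t := sphere 0 1) continuousWithinAt_fst fun x hx => hx.1).prodMk
        continuousWithinAt_snd
    exact h ((isOpen_exactDiscs hU hρ1 η).mem_nhds hp)
  · obtain ⟨D, hD⟩ : ∃ D, ∀ z ∈ closure Ω, -ρ z ≤ D := by
      obtain ⟨D, hD⟩ := hK.exists_bound_of_continuousOn hρc
      exact ⟨D, fun z hz => (neg_le_abs _).trans (hD z hz)⟩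
    have hcomp : IsCompact (sphere (0 : ℂ) 1 ×ˢ closedBall (0 : E) (B * √D) ×ˢ
        closedBall (0 : E) (B * D)) :=
      (isCompact_sphere 0 1).prod ((isCompact_closedBall _ _).prod (isCompact_closedBall _ _))
    set T := sphere (0 : ℂ) 1 ×ˢ closedBall (0 : E) (B * √D) ×ˢ closedBall (0 : E) (B * D) with hTd
    have hFT : ContinuousOn (fun p : ℂ × E × E => F p.1) T :=
      hF.comp continuousOn_fst fun p hp => hp.1
    have c1 : ContinuousOn (fun p : ℂ × E × E => ρ (F p.1)) T :=
      hρc.comp hFT fun p hp => hFK _ hp.1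
    have c2 : ∀ g : E × E → ℂ, ContinuousOn g (U ×ˢ univ) → ∀ f : E × E → E, Continuous f →
        ContinuousOn (fun p : ℂ × E × E => g (F p.1, f p.2)) T := fun g hg f hf =>
      hg.comp (hFT.prodMk (by fun_prop)) fun p hp => ⟨hΩU (hFK _ hp.1), mem_univ _⟩
    have hd := c2 _ (continuousOn_dform hU hρ1)
    have c4 : ContinuousOn (fun p : ℂ × E × E => levi ρ (F p.1) p.2.1) T := by
      have h : ∀ f : E → E, Continuous f →
          ContinuousOn (fun p : ℂ × E × E => D2 ρ (F p.1) (f p.2.1) (f p.2.1)) T := fun f hf =>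
        ContinuousOn.comp (g := fun p : E × E × E => D2 ρ p.1 p.2.1 p.2.2)
          (f := fun p : ℂ × E × E => (F p.1, f p.2.1, f p.2.1)) (continuousOn_D2 hU hρ2)
          (hFT.prodMk (by fun_prop)) fun p hp => ⟨hΩU (hFK _ hp.1), mem_univ _⟩
      exact continuousOn_const.mul ((h id continuous_id).add (h (fun v => I • v) (by fun_prop)))
    have k := ((((hd Prod.fst continuous_fst).prodMk (c4.add c1)).prodMk
      ((hd Prod.snd continuous_snd).add (c2 _ (continuousOn_qform hU hρ2) _ continuous_fst))).prodMk
        ((continuousOn_const (c := B)).mul c1 |>.add continuous_snd.snd.norm.continuousOn)).preimage_isClosed_of_isClosed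
        hcomp.isClosed
      ((isClosed_singleton (x := ((0 : ℂ), (0 : ℝ)))).prod (isClosed_singleton (x := (0 : ℂ))) |>.prod
        (isClosed_Iic (a := (0 : ℝ))))
    convert hcomp.of_isClosed_subset k inter_subset_left using 1
    ext p
    simp only [mem_ofPred_eq, exactCoeffs, mem_inter_iff, mem_preimage, mem_prod, mem_singleton_iff,
      Prod.mk.injEq, mem_Iic, Pi.add_apply, Pi.mul_apply]
    constructor
    · rintro ⟨h1, h2⟩
      have h3 := hD _ (hFK _ h1)
      refine ⟨⟨h1, ?_, ?_⟩, ⟨⟨h2.1, by linarith [h2.2.1]⟩, h2.2.2.1⟩, by linarith [h2.2.2.2]⟩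
      · rw [mem_closedBall_zero_iff]
        exact (hvb _ h1 _ h2).trans (by gcongr)
      · rw [mem_closedBall_zero_iff]
        exact h2.2.2.2.trans (by gcongr)
    · rintro ⟨h1, ⟨⟨h2, h3⟩, h4⟩, h5⟩
      exact ⟨h1.1, h2, by linarith, h4, by linarith⟩

end

section

variable {E : Type*} [NormedAddCommGroup E] [NormedSpace ℂ E] [FiniteDimensional ℂ E]

theorem dimH_image_le_finrank_sub_one {X : Type*} [NormedAddCommGroup X] [NormedSpace ℝ X]
    [FiniteDimensional ℝ X] {g : X → E} {s : Set X} (hg : ∀ x ∈ s, ContDiffAt ℝ 1 g x)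
    (hs : s.Nonempty → Module.finrank ℝ X ≤ 2 * Module.finrank ℂ E - 1) :
    dimH (g '' s) ≤ (2 * Module.finrank ℂ E - 1 : ℕ) := by
  rcases s.eq_empty_or_nonempty with rfl | hne
  · rw [image_empty, dimH_empty]
    exact zero_le
  · have := FiniteDimensional.proper ℝ X
    calc dimH (g '' s) ≤ dimH s := dimH_image_le_of_locally_lipschitzOn fun x hx => by
          obtain ⟨C, t, ht, h⟩ := (hg x hx).exists_lipschitzOnWith
          exact ⟨C, t, mem_nhdsWithin_of_mem_nhds ht, h⟩
      _ ≤ dimH univ := dimH_mono (subset_univ s)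
      _ = Module.finrank ℝ X := Real.dimH_univ_eq_finrank X
      _ ≤ _ := mod_cast hs hne

theorem exists_notMem_of_dimH_le (hE : 3 ≤ Module.finrank ℂ E) {Z : Set E}
    (hZ : dimH Z ≤ (2 * Module.finrank ℂ E - 1 : ℕ)) {r : ℝ} (hr : 0 < r) :
    ∃ a, ‖a‖ < r ∧ -a ∉ Z := by
  have : FiniteDimensional ℝ E := FiniteDimensional.complexToReal E
  have hlt : dimH Z < Module.finrank ℝ E :=
    hZ.trans_lt (by rw [finrank_real_of_complex]; exact_mod_cast (by omega))
  obtain ⟨a, ha, har⟩ := (dense_compl_of_dimH_lt_finrank hlt).exists_dist_lt 0 hr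
  refine ⟨-a, by rwa [norm_neg, ← dist_zero_left], by rwa [neg_neg]⟩

theorem contDiffAt_of_analyticAt {X : Type*} [NormedAddCommGroup X] [NormedSpace ℝ X] {f : ℂ → E}
    {g : X → ℂ} {x : X} {m : ℕ∞} (hf : AnalyticAt ℂ f (g x)) (hg : ContDiffAt ℝ m g x) :
    ContDiffAt ℝ m (fun x => f (g x)) x :=
  ContDiffAt.comp (g := f) (f := g) x (hf.contDiffAt.restrict_scalars ℝ) hg

/-- A continuous curve of affine lines avoids zero after a generic translation. -/
theorem exists_translate_ne_zero (hE : 3 ≤ Module.finrank ℂ E) {S : Set ℂ} {V W : ℂ → E}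
    (hV : AnalyticOnNhd ℂ V S) (hW : AnalyticOnNhd ℂ W S) {r : ℝ} (hr : 0 < r) :
    ∃ b, ‖b‖ < r ∧ ∀ x ∈ S, ∀ ζ : ℂ, V x + b + ζ • W x ≠ 0 := by
  obtain ⟨b, hbr, hb⟩ := exists_notMem_of_dimH_le hE (dimH_image_le_finrank_sub_one
    (g := fun q : ℂ × ℂ => V q.1 + q.2 • W q.1) (s := S ×ˢ univ) (fun q hq =>
      (contDiffAt_of_analyticAt (hV _ hq.1) contDiffAt_fst).add
        (contDiffAt_snd.smul (contDiffAt_of_analyticAt (hW _ hq.1) contDiffAt_fst)))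
    fun _ => by simp only [Module.finrank_prod, finrank_real_complex]; omega) hr
  refine ⟨b, hbr, fun x hx ζ h => hb ⟨(x, ζ), ⟨hx, mem_univ _⟩, ?_⟩⟩
  rw [eq_neg_iff_add_eq_zero, ← h]
  simp only
  abel

theorem continuousOn_dslope_diag {f : ℂ → E} {S : Set ℂ} (hf : AnalyticOnNhd ℂ f S) :
    ContinuousOn (fun p : ℂ × ℂ => dslope f p.2 p.1) (S ×ˢ S) := by
  rintro ⟨x, y⟩ ⟨hx, hy⟩
  refine ContinuousAt.continuousWithinAt ?_
  have hfst : ContinuousAt (fun p : ℂ × ℂ => f p.1) (x, y) :=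
    ContinuousAt.comp (g := f) (hf x hx).continuousAt continuousAt_fst
  have hsnd : ContinuousAt (fun p : ℂ × ℂ => f p.2) (x, y) :=
    ContinuousAt.comp (g := f) (hf y hy).continuousAt continuousAt_snd
  by_cases hxy : x = y
  · subst hxy
    have h1 := (hf x hx).hasStrictDerivAt
    have h2 : ContinuousAt (fun p : ℂ × ℂ => deriv f p.2) (x, x) :=
      ContinuousAt.comp (g := deriv f) (hf x hx).deriv.continuousAt continuousAt_snd
    rw [ContinuousAt, dslope_same, Metric.tendsto_nhds]
    intro ε hε
    have h3 : ∀ᶠ p : ℂ × ℂ in 𝓝 (x, x),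
        ‖f p.1 - f p.2 - (p.1 - p.2) • deriv f x‖ ≤ ε / 2 * ‖p.1 - p.2‖ :=
      h1.hasStrictFDerivAt.isLittleO.def (half_pos hε)
    filter_upwards [h3, Metric.tendsto_nhds.1 h2 ε hε] with p hp hp'
    by_cases h : p.1 = p.2
    · rw [h, dslope_same]
      exact hp'
    · rw [dslope_of_ne _ h, slope_def_module, dist_eq_norm]
      have h0 : p.1 - p.2 ≠ 0 := sub_ne_zero.2 h
      have e : (p.1 - p.2)⁻¹ • (f p.1 - f p.2) - deriv f x =
          (p.1 - p.2)⁻¹ • (f p.1 - f p.2 - (p.1 - p.2) • deriv f x) := by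
        rw [smul_sub _ (f p.1 - f p.2), smul_smul, inv_mul_cancel₀ h0, one_smul]
      rw [e, norm_smul, norm_inv]
      have h5 : 0 < ‖p.1 - p.2‖ := norm_pos_iff.2 h0
      calc ‖p.1 - p.2‖⁻¹ * _ ≤ ‖p.1 - p.2‖⁻¹ * (ε / 2 * ‖p.1 - p.2‖) := by gcongr
        _ = ε / 2 := by field_simp
        _ < ε := by linarith
  · have h : (fun p : ℂ × ℂ => dslope f p.2 p.1) =ᶠ[𝓝 (x, y)]
        fun p => (p.1 - p.2)⁻¹ • (f p.1 - f p.2) := by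
      filter_upwards [(isOpen_ne_fun continuous_fst continuous_snd).mem_nhds
        (show (x, y) ∈ {p : ℂ × ℂ | p.1 ≠ p.2} from hxy)] with p hp
      rw [dslope_of_ne _ hp, slope_def_module]
    refine ContinuousAt.congr ?_ h.symm
    exact ((continuousAt_fst.sub continuousAt_snd).inv₀ (sub_ne_zero.2 hxy)).smul (hfst.sub hsnd)

end

section

variable {E : Type*} [NormedAddCommGroup E] [NormedSpace ℂ E] [FiniteDimensional ℂ E]

/-- Divided difference of `x ↦ f x + ζ • V x + ζ ^ 2 • W x` when the values of `ζ` at `x` and `y`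
are `ζ` and `ξ`, with difference quotient `d`. -/
noncomputable def quadSlope (f V W : ℂ → E) (x y ζ ξ d : ℂ) : E :=
  dslope f y x + ζ • dslope V y x + ζ ^ 2 • dslope W y x + d • (V y + (ζ + ξ) • W y)

theorem sub_smul_quadSlope (f V W : ℂ → E) {x y ζ ξ d : ℂ} (h : ζ - ξ = d * (x - y)) :
    (x - y) • quadSlope f V W x y ζ ξ d =
      (f x + ζ • V x + ζ ^ 2 • W x) - (f y + ξ • V y + ξ ^ 2 • W y) := by
  have e : (x - y) • quadSlope f V W x y ζ ξ d = (x - y) • dslope f y x +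
      ζ • ((x - y) • dslope V y x) + ζ ^ 2 • ((x - y) • dslope W y x) +
      (d * (x - y)) • (V y + (ζ + ξ) • W y) := by
    simp only [quadSlope]
    module
  rw [e, ← h, sub_smul_dslope, sub_smul_dslope, sub_smul_dslope]
  module

theorem Collar.exists_generic {M : Set ℂ} (c : Collar M) (hM : IsOpen M)
    (hE : 3 ≤ Module.finrank ℂ E) {f V W : ℂ → E} (hf : AnalyticOnNhd ℂ f (closure M))
    (hV : AnalyticOnNhd ℂ V (closure M)) (hW : AnalyticOnNhd ℂ W (closure M))
    {r : ℝ} (hr : 0 < r) :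
    ∃ a, ‖a‖ < r ∧ ∀ x ∈ closure M, ∀ y ∈ closure M, (x = y ∨ 4 ≤ Module.finrank ℂ E) →
      ∀ ζ ξ d : ℂ, ζ - ξ = d * (x - y) → a + quadSlope f V W x y ζ ξ d = 0 →
      x ∈ M ∧ y ∈ M ∧ (ζ, ξ) ≠ 0 := by
  set γ : Fin c.m → ℝ → ℂ := fun j t => c.ψ j (cexp (t * I)) with hγ
  have hexp : ∀ t : ℝ, cexp (t * I) ∈ sphere (0 : ℂ) 1 := fun t => by
    rw [mem_sphere_zero_iff_norm, norm_exp_ofReal_mul_I]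
  have hann : ∀ t : ℝ, cexp (t * I) ∈ annulus c.R := fun t =>
    sphere_subset_annulus c.R_pos c.R_lt (hexp t)
  have hγcl : ∀ j t, γ j t ∈ closure M := fun j t =>
    (c.mem_closure_iff (hann t)).2 (mem_sphere_zero_iff_norm.1 (hexp t)).le
  have hγd : ∀ j t, ContDiffAt ℝ 1 (γ j) t := fun j t =>
    contDiffAt_of_analyticAt (g := fun t : ℝ => cexp (t * I)) (c.analyticAt j (hann t))
      ((ofRealCLM.contDiff.mul contDiff_const).cexp.contDiffAt)
  have hsurj : ∀ x ∈ frontier M, ∃ j t, γ j t = x := fun x hx => by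
    obtain ⟨j, w, hw, h⟩ := c.surj x hx
    refine ⟨j, arg w, ?_⟩
    have := norm_mul_exp_arg_mul_I w
    rw [mem_sphere_zero_iff_norm.1 hw, ofReal_one, one_mul] at this
    rw [hγ]
    simp only
    rw [this, h]
  set Φ : ℂ → ℂ → ℂ → E := fun x ζ d =>
    deriv f x + ζ • deriv V x + ζ ^ 2 • deriv W x + d • (V x + (2 * ζ) • W x) with hΦdef
  set Ψ : ℂ → ℂ → ℂ → ℂ → E := fun x y ζ ξ =>
    (x - y)⁻¹ • ((f x + ζ • V x + ζ ^ 2 • W x) - (f y + ξ • V y + ξ ^ 2 • W y)) with hΨdef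
  have hΦ : ∀ (X : Type) [NormedAddCommGroup X] [NormedSpace ℝ X] (g₁ g₂ g₃ : X → ℂ) (q : X),
      g₁ q ∈ closure M → ContDiffAt ℝ 1 g₁ q → ContDiffAt ℝ 1 g₂ q → ContDiffAt ℝ 1 g₃ q →
      ContDiffAt ℝ 1 (fun q => Φ (g₁ q) (g₂ q) (g₃ q)) q := by
    intro X _ _ g₁ g₂ g₃ q hq h₁ h₂ h₃
    exact (((contDiffAt_of_analyticAt (hf _ hq).deriv h₁).add
      (h₂.smul (contDiffAt_of_analyticAt (hV _ hq).deriv h₁))).add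
      ((h₂.pow 2).smul (contDiffAt_of_analyticAt (hW _ hq).deriv h₁))).add
      (h₃.smul ((contDiffAt_of_analyticAt (hV _ hq) h₁).add
        ((contDiffAt_const.mul h₂).smul (contDiffAt_of_analyticAt (hW _ hq) h₁))))
  have hF : ∀ (X : Type) [NormedAddCommGroup X] [NormedSpace ℝ X] (g₁ g₂ : X → ℂ) (q : X),
      g₁ q ∈ closure M → ContDiffAt ℝ 1 g₁ q → ContDiffAt ℝ 1 g₂ q →
      ContDiffAt ℝ 1 (fun q => f (g₁ q) + g₂ q • V (g₁ q) + g₂ q ^ 2 • W (g₁ q)) q := by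
    intro X _ _ g₁ g₂ q hq h₁ h₂
    exact ((contDiffAt_of_analyticAt (hf _ hq) h₁).add
      (h₂.smul (contDiffAt_of_analyticAt (hV _ hq) h₁))).add
      ((h₂.pow 2).smul (contDiffAt_of_analyticAt (hW _ hq) h₁))
  have hΨ : ∀ (X : Type) [NormedAddCommGroup X] [NormedSpace ℝ X] (g₁ g₂ g₃ g₄ : X → ℂ) (q : X),
      g₁ q ∈ closure M → g₂ q ∈ closure M → g₁ q ≠ g₂ q → ContDiffAt ℝ 1 g₁ q →
      ContDiffAt ℝ 1 g₂ q → ContDiffAt ℝ 1 g₃ q → ContDiffAt ℝ 1 g₄ q →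
      ContDiffAt ℝ 1 (fun q => Ψ (g₁ q) (g₂ q) (g₃ q) (g₄ q)) q := by
    intro X _ _ g₁ g₂ g₃ g₄ q hq hq' hne h₁ h₂ h₃ h₄
    exact ((h₁.sub h₂).inv (sub_ne_zero.2 hne)).smul ((hF X g₁ g₃ q hq h₁ h₃).sub
      (hF X g₂ g₄ q hq' h₂ h₄))
  set D₁ : Fin c.m → Set E := fun j =>
    (fun q : ℝ × ℂ × ℂ => Φ (γ j q.1) q.2.1 q.2.2) '' univ with hD₁
  set D₂ : Set E := (fun q : ℂ × ℂ => Φ q.1 0 q.2) '' (closure M ×ˢ univ) with hD₂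
  set O₁ : Fin c.m → Set E := fun j => (fun q : ℝ × ℂ × ℂ × ℂ => Ψ (γ j q.1) q.2.1 q.2.2.1 q.2.2.2)
    '' {q | q.2.1 ∈ closure M ∧ γ j q.1 ≠ q.2.1 ∧ 4 ≤ Module.finrank ℂ E} with hO₁
  set O₂ : Set E := (fun q : ℂ × ℂ => Ψ q.1 q.2 0 0)
    '' {q | q.1 ∈ closure M ∧ q.2 ∈ closure M ∧ q.1 ≠ q.2} with hO₂
  have hZ : dimH ((⋃ j, D₁ j) ∪ D₂ ∪ (⋃ j, O₁ j) ∪ O₂) ≤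
      (2 * Module.finrank ℂ E - 1 : ℕ) := by
    simp only [dimH_union, dimH_iUnion, max_le_iff, iSup_le_iff]
    refine ⟨⟨⟨fun j => ?_, ?_⟩, fun j => ?_⟩, ?_⟩
    · exact dimH_image_le_finrank_sub_one (fun q _ => hΦ _ (fun q : ℝ × ℂ × ℂ => γ j q.1)
        (fun q => q.2.1) (fun q => q.2.2) q (hγcl j q.1)
        (ContDiffAt.comp (g := γ j) q (hγd j q.1) contDiffAt_fst) (by fun_prop) (by fun_prop))
        fun _ => by simp only [Module.finrank_prod, finrank_real_complex, Module.finrank_self]; omega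
    · exact dimH_image_le_finrank_sub_one (fun q hq => hΦ _ (fun q : ℂ × ℂ => q.1)
        (fun _ => 0) (fun q => q.2) q hq.1 (by fun_prop) (by fun_prop) (by fun_prop))
        fun _ => by simp only [Module.finrank_prod, finrank_real_complex]; omega
    · refine dimH_image_le_finrank_sub_one (fun q hq => ?_) fun ⟨q, hq⟩ => ?_
      · exact hΨ _ (fun q : ℝ × ℂ × ℂ × ℂ => γ j q.1)
          (fun q => q.2.1) (fun q => q.2.2.1) (fun q => q.2.2.2) q (hγcl j q.1) hq.1 hq.2.1
          (ContDiffAt.comp (g := γ j) q (hγd j q.1) contDiffAt_fst) (by fun_prop) (by fun_prop)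
          (by fun_prop)
      · have := hq.2.2
        simp only [Module.finrank_prod, finrank_real_complex, Module.finrank_self]
        omega
    · exact dimH_image_le_finrank_sub_one (fun q hq => hΨ _ (fun q : ℂ × ℂ => q.1)
        (fun q => q.2) (fun _ => 0) (fun _ => 0) q hq.1 hq.2.1 hq.2.2 (by fun_prop) (by fun_prop)
        (by fun_prop) (by fun_prop))
        fun _ => by simp only [Module.finrank_prod, finrank_real_complex]; omega
  obtain ⟨a, har, ha⟩ := exists_notMem_of_dimH_le hE hZ hr
  simp only [mem_union, mem_iUnion, not_or, not_exists] at ha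
  obtain ⟨⟨⟨h₁, h₂⟩, h₃⟩, h₄⟩ := ha
  refine ⟨a, har, fun x hx y hy hxy ζ ξ d hd h0 => ?_⟩
  have hmem : ∀ z ∈ closure M, z ∉ frontier M → z ∈ M := fun z hz h => by
    by_contra hzM
    exact h (hM.frontier_eq ▸ ⟨hz, hzM⟩)
  by_cases he : x = y
  · subst he
    have hζ : ζ = ξ := by rwa [sub_self, mul_zero, sub_eq_zero] at hd
    subst hζ
    have hΦa : Φ x ζ d = -a := by
      rw [eq_neg_iff_add_eq_zero, add_comm, ← h0, quadSlope, dslope_same, dslope_same, dslope_same,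
        ← two_mul]
    have hxM := hmem x hx fun hxf => by
      obtain ⟨j, t, rfl⟩ := hsurj x hxf
      exact h₁ j ⟨(t, ζ, d), mem_univ _, hΦa⟩
    refine ⟨hxM, hxM, fun h => h₂ ⟨(x, d), ⟨hx, mem_univ _⟩, ?_⟩⟩
    rw [← hΦa, show ζ = 0 from (Prod.ext_iff.1 h).1]
  · have h4 := hxy.resolve_left he
    have e : quadSlope f V W x y ζ ξ d = -a := (neg_eq_of_add_eq_zero_right h0).symm
    have hs := sub_smul_quadSlope f V W hd
    have hΨa : Ψ x y ζ ξ = -a := by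
      rw [hΨdef]
      simp only
      rw [← hs, inv_smul_smul₀ (sub_ne_zero.2 he), e]
    have hΨb : Ψ y x ξ ζ = -a := by
      rw [← hΨa, hΨdef]
      simp only
      rw [← neg_sub x y, inv_neg, neg_smul, ← smul_neg, neg_sub]
    refine ⟨hmem x hx fun hxf => ?_, hmem y hy fun hyf => ?_, fun h => ?_⟩
    · obtain ⟨j, t, rfl⟩ := hsurj x hxf
      exact h₃ j ⟨(t, y, ζ, ξ), ⟨hy, he, h4⟩, hΨa⟩
    · obtain ⟨j, t, rfl⟩ := hsurj y hyf
      exact h₃ j ⟨(t, x, ξ, ζ), ⟨hx, Ne.symm he, h4⟩, hΨb⟩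
    · refine h₄ ⟨(x, y), ⟨hx, hy, he⟩, ?_⟩
      rw [← hΨa, show ζ = 0 from (Prod.ext_iff.1 h).1, show ξ = 0 from (Prod.ext_iff.1 h).2]

/-- After a generic affine translation, small solutions on a fixed compact subset of `M` have
nonvanishing divided differences. -/
theorem Collar.exists_generic_compact {M : Set ℂ} (c : Collar M) (hM : IsOpen M)
    (hMb : IsBounded M) (hE : 3 ≤ Module.finrank ℂ E) {f V W : ℂ → E}
    (hf : AnalyticOnNhd ℂ f (closure M)) (hV : AnalyticOnNhd ℂ V (closure M))
    (hW : AnalyticOnNhd ℂ W (closure M)) (hVW : ∀ x ∈ closure M, ∀ ζ : ℂ, V x + ζ • W x ≠ 0)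
    {r : ℝ} (hr : 0 < r) :
    ∃ a, ‖a‖ < r ∧ ∃ K ⊆ M, IsCompact K ∧ ∃ c₀ > 0, ∀ h : ℂ → ℂ,
      (∀ x ∈ closure M, ‖h x‖ ≤ 2) → (∀ x ∈ K, ‖h x‖ < c₀) →
      ∀ x ∈ closure M, ∀ y ∈ closure M, (x = y ∨ 4 ≤ Module.finrank ℂ E) → ∀ d : ℂ,
      h x - h y = d * (x - y) → a + quadSlope f V W x y (h x) (h y) d ≠ 0 := by
  obtain ⟨a, har, ha⟩ := c.exists_generic hM hE hf hV hW hr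
  have hcl : IsCompact (closure M) := hMb.isCompact_closure
  have hS : IsCompact ((closure M ×ˢ closure M) ×ˢ
    (closedBall (0 : ℂ) 2 ×ˢ closedBall (0 : ℂ) 2)) :=
    (hcl.prod hcl).prod ((isCompact_closedBall _ _).prod (isCompact_closedBall _ _))
  set S := (closure M ×ˢ closure M) ×ˢ (closedBall (0 : ℂ) 2 ×ˢ closedBall (0 : ℂ) 2) with hSdef
  have hds : ∀ {u : ℂ → E}, AnalyticOnNhd ℂ u (closure M) → ContinuousOn
      (fun q : (ℂ × ℂ) × (ℂ × ℂ) => dslope u q.1.2 q.1.1) S := fun hu =>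
    ContinuousOn.comp (f := Prod.fst) (continuousOn_dslope_diag hu) continuousOn_fst
      fun q hq => hq.1
  have hev : ∀ {u : ℂ → E}, AnalyticOnNhd ℂ u (closure M) → ContinuousOn
      (fun q : (ℂ × ℂ) × (ℂ × ℂ) => u q.1.2) S := fun hu =>
    ContinuousOn.comp (f := fun q : (ℂ × ℂ) × (ℂ × ℂ) => q.1.2) hu.continuousOn (by fun_prop)
      fun q hq => hq.1.2
  set A : (ℂ × ℂ) × (ℂ × ℂ) → E := fun q =>
    dslope f q.1.2 q.1.1 + q.2.1 • dslope V q.1.2 q.1.1 + q.2.1 ^ 2 • dslope W q.1.2 q.1.1 with hA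
  set B : (ℂ × ℂ) × (ℂ × ℂ) → E := fun q => V q.1.2 + (q.2.1 + q.2.2) • W q.1.2 with hB
  have hAc : ContinuousOn A S := ((hds hf).add ((by fun_prop : ContinuousOn
    (fun q : (ℂ × ℂ) × (ℂ × ℂ) => q.2.1) S).smul (hds hV))).add ((by fun_prop : ContinuousOn
    (fun q : (ℂ × ℂ) × (ℂ × ℂ) => q.2.1 ^ 2) S).smul (hds hW))
  have hBc : ContinuousOn B S := (hev hV).add ((by fun_prop : ContinuousOn
    (fun q : (ℂ × ℂ) × (ℂ × ℂ) => q.2.1 + q.2.2) S).smul (hev hW))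
  obtain ⟨CA, hCA⟩ := hS.exists_bound_of_continuousOn ((continuousOn_const (c := a)).add hAc)
  obtain ⟨m, hm, hmB⟩ := hS.exists_forall_le' hBc.norm (a := 0)
    fun q hq => norm_pos_iff.2 (hVW _ hq.1.2 _)
  have hT₀ : IsCompact (S ×ˢ closedBall (0 : ℂ) (CA / m)) := hS.prod (isCompact_closedBall _ _)
  have hGc : ContinuousOn (fun q : ((ℂ × ℂ) × (ℂ × ℂ)) × ℂ => a + (A q.1 + q.2 • B q.1))
      (S ×ˢ closedBall (0 : ℂ) (CA / m)) :=
    continuousOn_const.add ((ContinuousOn.comp (f := Prod.fst) hAc continuousOn_fst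
      fun q hq => hq.1).add (continuousOn_snd.smul (ContinuousOn.comp (f := Prod.fst) hBc
      continuousOn_fst fun q hq => hq.1)))
  set T : Set (((ℂ × ℂ) × (ℂ × ℂ)) × ℂ) := ((S ×ˢ closedBall (0 : ℂ) (CA / m)) ∩
    (fun q => a + (A q.1 + q.2 • B q.1)) ⁻¹' {0}) ∩
    ({q | q.1.2.1 - q.1.2.2 = q.2 * (q.1.1.1 - q.1.1.2)} ∩
      ({q | q.1.1.1 = q.1.1.2} ∪ {_q | 4 ≤ Module.finrank ℂ E})) with hTdef
  have hT : IsCompact T := by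
    refine (hT₀.of_isClosed_subset (hGc.preimage_isClosed_of_isClosed hT₀.isClosed
      isClosed_singleton) inter_subset_left).inter_right
      ((isClosed_eq (by fun_prop) (by fun_prop)).inter
      ((isClosed_eq (by fun_prop) (by fun_prop)).union isClosed_const))
  have hTa : ∀ q ∈ T, q.1.1.1 ∈ M ∧ q.1.1.2 ∈ M ∧ q.1.2 ≠ 0 := fun q hq =>
    ha _ hq.1.1.1.1.1 _ hq.1.1.1.1.2 hq.2.2 _ _ _ hq.2.1 hq.1.2
  obtain ⟨c₀, hc₀, hTc⟩ := hT.exists_forall_le' (f := fun q => ‖q.1.2‖) (a := 0)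
    (by fun_prop) fun q hq => norm_pos_iff.2 (hTa q hq).2.2
  refine ⟨a, har, (fun q => q.1.1.1) '' T ∪ (fun q => q.1.1.2) '' T, ?_,
    (hT.image (by fun_prop)).union (hT.image (by fun_prop)), c₀, hc₀,
    fun h hh2 hhK x hx y hy hxy d hd h0 => ?_⟩
  · rintro x (⟨q, hq, rfl⟩ | ⟨q, hq, rfl⟩)
    exacts [(hTa q hq).1, (hTa q hq).2.1]
  · have hqS : ((x, y), (h x, h y)) ∈ S :=
      ⟨⟨hx, hy⟩, mem_closedBall_zero_iff.2 (hh2 x hx), mem_closedBall_zero_iff.2 (hh2 y hy)⟩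
    have h0' : (a + A ((x, y), (h x, h y))) + d • B ((x, y), (h x, h y)) = 0 := by
      rw [← h0, add_assoc]
      rfl
    have hdn : ‖d‖ ≤ CA / m := by
      rw [le_div_iff₀ hm]
      calc ‖d‖ * m ≤ ‖d‖ * ‖B ((x, y), (h x, h y))‖ := by
            gcongr
            exact hmB _ hqS
        _ = ‖a + A ((x, y), (h x, h y))‖ := by
            rw [← norm_smul, eq_neg_of_add_eq_zero_left h0', norm_neg]
        _ ≤ CA := hCA _ hqS
    have hq : (((x, y), (h x, h y)), d) ∈ T :=
      ⟨⟨⟨hqS, mem_closedBall_zero_iff.2 hdn⟩, h0⟩, hd, hxy⟩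
    have h1 : max ‖h x‖ ‖h y‖ < c₀ :=
      max_lt (hhK x (Or.inl ⟨_, hq, rfl⟩)) (hhK y (Or.inr ⟨_, hq, rfl⟩))
    exact (hTc _ hq).not_gt h1

end

/-- A holomorphic family of quadratic discs in `Ω`, centred near `f₀`, which is nearly exact over
the boundary of `M`. -/
theorem Collar.exists_disc_family {M : Set ℂ} (c : Collar M) {n : ℕ} (hn : 3 ≤ n) (hM : IsOpen M)
    (hMb : IsBounded M) {Ω U : Set (EuclideanSpace ℂ (Fin n))} {ρ : EuclideanSpace ℂ (Fin n) → ℝ}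
    (hΩb : IsBounded Ω) (hΩo : IsOpen Ω) (hU : IsOpen U) (hΩU : closure Ω ⊆ U)
    (hρ : ContDiffOn ℝ 3 ρ U)
    (hpsh : IsStrictPsh ρ U) (hΩ : Ω = {z ∈ U | ρ z < 0})
    (hDρ : ∀ z ∈ frontier Ω, fderiv ℝ ρ z ≠ 0) {η : ℝ} (hη : 0 < η)
    {f₀ : ℂ → EuclideanSpace ℂ (Fin n)} (hf₀ : ContinuousOn f₀ (closure M))
    (hf₀d : DifferentiableOn ℂ f₀ M) (hf₀Ω : MapsTo f₀ (closure M) Ω) {K : Set ℂ}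
    (hK : IsCompact K) (hKM : K ⊆ M) {ε : ℝ} (hε : 0 < ε) :
    ∃ f V W : ℂ → EuclideanSpace ℂ (Fin n), AnalyticOnNhd ℂ f (closure M) ∧
      AnalyticOnNhd ℂ V (closure M) ∧ AnalyticOnNhd ℂ W (closure M) ∧ MapsTo f (closure M) Ω ∧
      (∀ x ∈ K, ‖f x - f₀ x‖ < ε) ∧ (∀ x ∈ frontier M, (f x, V x, W x) ∈ exactDiscs ρ U η) ∧
      ∀ x ∈ closure M, ∀ ζ : ℂ, V x + ζ • W x ≠ 0 := by
  have hE : 3 ≤ Module.finrank ℂ (EuclideanSpace ℂ (Fin n)) := by simpa using hn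
  obtain ⟨δ, hδ, hsec⟩ := exists_exact_section hE hU hρ hpsh hΩb hΩU hΩ hDρ hη
  obtain ⟨t, ht, hth⟩ := (hMb.isCompact_closure.image_of_continuousOn hf₀)
    |>.exists_thickening_subset_open hΩo hf₀Ω.image_subset
  obtain ⟨g, hg, hgf⟩ := c.exists_analytic_approx hM hMb hf₀ hf₀d (lt_min ht (half_pos hε))
  obtain ⟨f, hf, hfΩ, hfg, hfr⟩ := c.exists_pushed hn hM hMb hΩb hU hΩU hρ hpsh hΩ hδ hg
    (fun x hx => hth (mem_thickening_iff.2 ⟨_, mem_image_of_mem f₀ hx, by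
      rw [dist_eq_norm]
      exact (hgf x hx).trans_le (min_le_left _ _)⟩)) hK hKM (half_pos hε)
  have hψ : ∀ j, ContinuousOn (fun w => f (c.ψ j w)) (sphere 0 1) := fun j =>
    ContinuousOn.comp (g := f) hf.continuousOn ((c.diff j).continuousOn.mono
      (sphere_subset_annulus c.R_pos c.R_lt)) fun w hw => frontier_subset_closure (c.bdry j w hw)
  choose σ hσ hσe using fun j => hsec (fun w => f (c.ψ j w)) (hψ j) fun w hw =>
    ⟨hfΩ (frontier_subset_closure (c.bdry j w hw)), hfr _ (c.bdry j w hw)⟩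
  have hT : IsCompact (⋃ j, (fun p : ℂ × ℂ => (f (c.ψ j p.1), p.2 • (σ j p.1).1,
      p.2 ^ 2 • (σ j p.1).2)) '' (sphere 0 1 ×ˢ sphere 0 1)) := by
    refine isCompact_iUnion fun j => ((isCompact_sphere 0 1).prod
      (isCompact_sphere 0 1)).image_of_continuousOn ?_
    have hm : MapsTo Prod.fst (sphere (0 : ℂ) 1 ×ˢ sphere (0 : ℂ) 1) (sphere 0 1) :=
      fun p hp => hp.1
    have h1 := (hψ j).comp continuousOn_fst hm
    have h2 := (hσ j).comp continuousOn_fst hm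
    exact h1.prodMk ((continuousOn_snd.smul h2.fst).prodMk ((continuousOn_snd.pow 2).smul h2.snd))
  obtain ⟨s, hs, hsT⟩ := hT.exists_thickening_subset_open
    (isOpen_exactDiscs hU (hρ.of_le (by norm_num)) η) (iUnion_subset fun j => by
      rintro _ ⟨p, hp, rfl⟩
      exact exactDiscs_smul (hσe j p.1 hp.1) (mem_sphere_zero_iff_norm.1 hp.2))
  have hev := fun τ hτ => c.exists_globalize_continuous hM hMb (n := n) τ hτ isCompact_empty
    (empty_subset M) (half_pos hs)
  obtain ⟨N, ⟨V, hV, hVτ, -⟩, W, hW, hWτ, -⟩ := ((hev _ fun j => (hσ j).fst).and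
    ((tendsto_id.const_mul_atTop' (r := 2) (by norm_num)).eventually
      (hev _ fun j => (hσ j).snd))).exists
  obtain ⟨b, hb, hVW⟩ := exists_translate_ne_zero hE hV hW (half_pos hs)
  refine ⟨f, fun x => V x + b, W, hf, hV.add analyticOnNhd_const, hW, hfΩ, fun x hx => ?_,
    fun x hx => ?_, hVW⟩
  · have h1 := (hgf x (subset_closure (hKM hx))).trans_le (min_le_right _ _)
    linarith [norm_sub_le_norm_sub_add_norm_sub (f x) (g x) (f₀ x), hfg x hx]
  · obtain ⟨j, w, hw, rfl⟩ := c.surj x hx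
    have hwN : w ^ N ∈ sphere (0 : ℂ) 1 := by
      rw [mem_sphere_zero_iff_norm] at hw ⊢
      rw [norm_pow, hw, one_pow]
    refine hsT (mem_thickening_iff.2
      ⟨_, mem_iUnion.2 ⟨j, (w, w ^ N), ⟨hw, hwN⟩, rfl⟩, ?_⟩)
    simp only [Prod.dist_eq, dist_self]
    refine max_lt hs (max_lt ?_ ?_)
    · rw [dist_eq_norm, add_sub_right_comm]
      linarith [norm_add_le (V (c.ψ j w) - w ^ N • (σ j w).1) b, hVτ j w hw]
    · rw [dist_eq_norm, ← pow_mul, mul_comm N]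
      have : ‖W (c.ψ j w) - w ^ (2 * N) • (σ j w).2‖ < s / 2 := hWτ j w hw
      linarith

/-- For `n ≥ 3` the proper holomorphic map from a bounded connected open set `M ⊂ ℂ` with
real-analytic boundary into a bounded strongly pseudoconvex domain `Ω ⊂ ℂⁿ` can be chosen
an immersion up to the boundary, and for `n ≥ 4` in addition injective on `closure M`. -/
theorem immersed_embedded_bordered_surface_in_spsc_domain (n : ℕ) (hn : 3 ≤ n)
    (M : Set ℂ) (hMopen : IsOpen M) (hMbd : IsBounded M) (hMconn : IsConnected M)
    (W : Set ℂ) (hWopen : IsOpen W) (hMW : frontier M ⊆ W)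
    (r : ℂ → ℝ) (hr : AnalyticOnNhd ℝ r W)
    (hrdef : M ∩ W = {z ∈ W | r z < 0})
    (hDr : ∀ z ∈ frontier M, fderiv ℝ r z ≠ 0)
    (Ω U : Set (EuclideanSpace ℂ (Fin n))) (ρ : EuclideanSpace ℂ (Fin n) → ℝ)
    (hΩbd : IsBounded Ω) (hUopen : IsOpen U) (hΩU : closure Ω ⊆ U)
    (hρC : ContDiffOn ℝ 4 ρ U)
    (hpsh : ∀ z ∈ U, ∀ w : EuclideanSpace ℂ (Fin n), w ≠ 0 → 0 < levi ρ z w)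
    (hΩdef : Ω = {z ∈ U | ρ z < 0})
    (hDρ : ∀ z ∈ frontier Ω, fderiv ℝ ρ z ≠ 0)
    (f₀ : ℂ → EuclideanSpace ℂ (Fin n))
    (hf₀c : ContinuousOn f₀ (closure M))
    (hf₀h : DifferentiableOn ℂ f₀ M)
    (hf₀Ω : Set.MapsTo f₀ (closure M) Ω)
    (K : Set ℂ) (hKc : IsCompact K) (hKM : K ⊆ M)
    (ε : ℝ) (hε : 0 < ε) :
    ∃ f : ℂ → EuclideanSpace ℂ (Fin n),
      ContinuousOn f (closure M) ∧
      DifferentiableOn ℂ f M ∧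
      Set.MapsTo f M Ω ∧
      (∀ x ∈ frontier M, ρ (f x) = 0) ∧
      (∀ x ∈ K, ‖f x - f₀ x‖ < ε) ∧
      -- f′ extends continuously to closure M with nonvanishing extension
      (∃ g : ℂ → EuclideanSpace ℂ (Fin n),
        ContinuousOn g (closure M) ∧
        (∀ x ∈ M, g x = deriv f x) ∧
        (∀ x ∈ closure M, g x ≠ 0)) ∧
      -- if moreover n ≥ 4, f can be chosen injective on closure M
      (4 ≤ n → Set.InjOn f (closure M)) := by
  have hE : Module.finrank ℂ (EuclideanSpace ℂ (Fin n)) = n := by simp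
  have hρ3 : ContDiffOn ℝ 3 ρ U := hρC.of_le (by norm_num)
  have hρ2 : ContDiffOn ℝ 2 ρ U := hρC.of_le (by norm_num)
  have hρ1 : ContDiffOn ℝ 1 ρ U := hρC.of_le (by norm_num)
  have hΩo : IsOpen Ω := by
    rw [hΩdef]
    exact hρC.continuousOn.isOpen_inter_preimage hUopen isOpen_Iio
  have hcl : IsCompact (closure M) := hMbd.isCompact_closure
  have hfr : frontier M ⊆ closure M := frontier_subset_closure
  obtain ⟨c⟩ := exists_collar hMopen hMbd hWopen hMW hr hrdef hDr
  obtain ⟨δ, hδ, -, hstab⟩ := exists_stability (Ω := Ω) hMopen hMbd hUopen hρ2 hpsh hΩbd hΩU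
  obtain ⟨f₁, V, W, hf₁, hV, hW, hf₁Ω, hf₁K, hdisc, hVW⟩ := c.exists_disc_family hn hMopen hMbd
    hΩbd hΩo hUopen hΩU hρ3 hpsh hΩdef hDρ hδ hf₀c hf₀h hf₀Ω hKc hKM (ε := ε / 3) (by positivity)
  obtain ⟨t₁, ht₁, hth₁⟩ := ((hcl.of_isClosed_subset isClosed_frontier hfr).image_of_continuousOn
    ((hf₁.continuousOn.prodMk (hV.continuousOn.prodMk hW.continuousOn)).mono hfr))
    |>.exists_thickening_subset_open (isOpen_exactDiscs hUopen hρ1 δ) (image_subset_iff.2 hdisc)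
  obtain ⟨t₂, ht₂, hth₂⟩ := (hcl.image_of_continuousOn hf₁.continuousOn)
    |>.exists_thickening_subset_open hΩo hf₁Ω.image_subset
  obtain ⟨B, hB0, hB⟩ := hMbd.closure.exists_pos_norm_le
  obtain ⟨a, ha, K', hK'M, hK'c, c₀, hc₀, hgen⟩ := c.exists_generic_compact hMopen hMbd
    (hn.trans hE.ge) hf₁ hV hW hVW (r := min (min t₁ t₂) (ε / 3) / B) (by positivity)
  have hxa : ∀ x ∈ closure M, ‖x • a‖ < min (min t₁ t₂) (ε / 3) := fun x hx => by
    rw [lt_div_iff₀ hB0] at ha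
    rw [norm_smul, mul_comm]
    exact (mul_le_mul_of_nonneg_left (hB x hx) (norm_nonneg a)).trans_lt ha
  have hf₂ : AnalyticOnNhd ℂ (fun x => f₁ x + x • a) (closure M) :=
    hf₁.add (analyticOnNhd_id.smul analyticOnNhd_const)
  have hf₂Ω : ∀ x ∈ closure M, f₁ x + x • a ∈ Ω := fun x hx =>
    hth₂ (mem_thickening_iff.2 ⟨_, mem_image_of_mem f₁ hx, by
      rw [dist_eq_norm, add_sub_cancel_left]
      exact (hxa x hx).trans_le ((min_le_left _ _).trans (min_le_right _ _))⟩)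
  set q : ℂ → EuclideanSpace ℂ (Fin n) × EuclideanSpace ℂ (Fin n) × EuclideanSpace ℂ (Fin n) :=
    fun x => (f₁ x + x • a, V x, W x) with hq
  have hqd : ∀ x ∈ frontier M, q x ∈ exactDiscs ρ U δ := fun x hx =>
    hth₁ (mem_thickening_iff.2 ⟨_, mem_image_of_mem _ hx, by
      simp only [hq, Prod.dist_eq, dist_self]
      rw [dist_eq_norm, add_sub_cancel_left]
      exact max_lt ((hxa x (hfr hx)).trans_le ((min_le_left _ _).trans (min_le_left _ _)))
        ht₁⟩)
  have hψq : ∀ j, ∀ w ∈ sphere (0 : ℂ) 1, q (c.ψ j w) ∈ exactDiscs ρ U δ := fun j w hw =>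
    hqd _ (c.bdry j w hw)
  obtain ⟨CV, hCV⟩ := hcl.exists_bound_of_continuousOn hV.continuousOn
  obtain ⟨CW, hCW⟩ := hcl.exists_bound_of_continuousOn hW.continuousOn
  set L := |CV| + 2 * |CW| + 1 with hL
  obtain ⟨h, hd, hhc, hhd, hdc, hdh, hh2, hhK, hhP⟩ := c.exists_boundary_solution hMopen hMbd
    (P := fun j w ζ => ρ (quadDisc (q (c.ψ j w)) ζ) / -ρ (q (c.ψ j w)).1) (fun j => ⟨fun w hw ζ hζ => by
      have hw' := sphere_subset_annulus c.R_pos c.R_lt hw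
      have hcl' := hfr (c.bdry j w hw)
      have hb := exactDiscs_base (hψq j w hw)
      have h1 : ContDiffAt ℝ (3 : ℕ∞) (fun p : ℂ × ℂ => c.ψ j p.1) (w, ζ) :=
        contDiffAt_of_analyticAt (c.analyticAt j hw') contDiffAt_fst
      have h2 : ContDiffAt ℝ (3 : ℕ∞) (fun p : ℂ × ℂ => (q (c.ψ j p.1)).1) (w, ζ) :=
        contDiffAt_of_analyticAt (f := fun x => f₁ x + x • a)
          (g := fun p : ℂ × ℂ => c.ψ j p.1) (hf₂ _ hcl') h1
      have h3 : ContDiffAt ℝ (3 : ℕ∞) (fun p : ℂ × ℂ => quadDisc (q (c.ψ j p.1)) p.2) (w, ζ) :=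
        h2.add ((contDiffAt_snd.smul (contDiffAt_of_analyticAt (hV _ hcl') h1)).add
          ((contDiffAt_snd.pow 2).smul (contDiffAt_of_analyticAt (hW _ hcl') h1)))
      exact (ContDiffAt.comp (g := ρ) (f := fun p : ℂ × ℂ => quadDisc (q (c.ψ j p.1)) p.2) (w, ζ)
        (hρ3.contDiffAt (hUopen.mem_nhds ((hψq j w hw).2 ζ hζ).1)) h3).div
        (ContDiffAt.comp (g := ρ) (f := fun p : ℂ × ℂ => (q (c.ψ j p.1)).1) (w, ζ)
        (hρ3.contDiffAt (hUopen.mem_nhds hb.1)) h2).neg (neg_ne_zero.2 hb.2.ne),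
    fun w hw ζ hζ => exactDiscs_abs_le hUopen hρ1 (hψq j w hw) hζ,
    fun w hw ζ hζ ζ' hζ' => (exactDiscs_spec hUopen hρ1 (hψq j w hw) hζ hζ').trans (by
      gcongr
      norm_num)⟩)
    (hKc.union hK'c) (union_subset hKM hK'M) (lt_min hc₀ (by positivity : 0 < ε / 3 / L))
  set f : ℂ → EuclideanSpace ℂ (Fin n) := fun x => quadDisc (q x) (h x) with hf
  set g : ℂ → EuclideanSpace ℂ (Fin n) := fun x =>
    a + quadSlope f₁ V W x x (h x) (h x) (hd x) with hg
  have hh0 : ∀ x ∈ K', ‖h x‖ < c₀ := fun x hx => (hhK x (Or.inr hx)).trans_le (min_le_left _ _)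
  have hg0 : ∀ x ∈ closure M, g x ≠ 0 := fun x hx =>
    hgen h hh2 hh0 x hx x hx (Or.inl rfl) _ (by simp)
  have hfc : ContinuousOn f (closure M) := hf₂.continuousOn.add ((hhc.smul hV.continuousOn).add
    ((hhc.pow 2).smul hW.continuousOn))
  have hder : ∀ x ∈ M, HasDerivAt f (g x) x := fun x hx => by
    have hxc := subset_closure hx
    have h1 : HasDerivAt h (hd x) x := by
      rw [hdh x hx]
      exact (hhd.differentiableAt (hMopen.mem_nhds hx)).hasDerivAt
    have h2 := ((hf₁ x hxc).differentiableAt.hasDerivAt.add ((hasDerivAt_id x).smul_const a)).add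
      ((h1.smul (hV x hxc).differentiableAt.hasDerivAt).add
      ((h1.pow 2).smul (hW x hxc).differentiableAt.hasDerivAt))
    refine h2.congr_deriv ?_
    simp only [hg, quadSlope, dslope_same, Pi.pow_apply, Nat.cast_ofNat, Nat.add_one_sub_one,
      pow_one]
    module
  have hfd : DifferentiableOn ℂ f M := fun x hx =>
    (hder x hx).differentiableAt.differentiableWithinAt
  have hb0 : ∀ x ∈ frontier M, ρ (f x) = 0 := fun x hx => by
    obtain ⟨j, w, hw, rfl⟩ := c.surj x hx
    have h0 := exactDiscs_base (hqd _ hx)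
    exact (div_eq_zero_iff.1 (hhP j w hw)).resolve_right (neg_ne_zero.2 h0.2.ne)
  have hsub : ∀ x, f x - (f₁ x + x • a) = h x • V x + h x ^ 2 • W x := fun x =>
    add_sub_cancel_left _ _
  have hfU := hstab _ f hf₂.continuousOn (hf₂.differentiableOn.mono subset_closure)
    (fun x hx => subset_closure (hf₂Ω x hx)) hfc hfd (fun x hx => by
      rw [hsub]
      exact (norm_quadDisc_sub_le (q x) (hh2 x (hfr hx))).trans_lt (hqd x hx).1) 0
    fun x hx => (hb0 x hx).le
  refine ⟨f, hfc, hfd, fun x hx => ?_, hb0, fun x hx => ?_,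
    ⟨g, ?_, fun x hx => (hder x hx).deriv.symm, hg0⟩, fun hn4 x hx y hy hxy => ?_⟩
  · rw [hΩdef]
    exact ⟨(hfU x (subset_closure hx)).1, comp_lt_of_frontier hMopen hMbd hUopen hρ2 hpsh hfc hfd
      (fun x hx => (hfU x hx).1) (fun x hx => (hb0 x hx).le)
      (fun x hx => (hder x hx).deriv ▸ hg0 x (subset_closure hx)) x hx⟩
  · have hxc := subset_closure (hKM hx)
    have h1 : ‖h x • V x + h x ^ 2 • W x‖ ≤ ε / 3 := by
      have h2 : ‖h x‖ ≤ ε / 3 / L := ((hhK x (Or.inl hx)).trans_le (min_le_right _ _)).le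
      calc ‖h x • V x + h x ^ 2 • W x‖ ≤ ‖h x‖ * (‖V x‖ + ‖h x‖ * ‖W x‖) := by
            refine (norm_add_le _ _).trans_eq ?_
            rw [norm_smul, norm_smul, norm_pow]
            ring
        _ ≤ ε / 3 / L * (|CV| + 2 * |CW|) := by
            gcongr
            exacts [(hCV x hxc).trans (le_abs_self _), hh2 x hxc,
              (hCW x hxc).trans (le_abs_self _)]
        _ ≤ ε / 3 / L * L := by
            gcongr
            linarith
        _ = ε / 3 := div_mul_cancel₀ _ (by positivity)
    have h3 := (hxa x hxc).trans_le (min_le_right _ _)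
    rw [show f x - f₀ x = (h x • V x + h x ^ 2 • W x) + x • a + (f₁ x - f₀ x) by
      rw [← hsub]
      abel]
    linarith [norm_add₃_le (a := h x • V x + h x ^ 2 • W x) (b := x • a) (c := f₁ x - f₀ x),
      hf₁K x hx]
  · have hdf : ∀ {u : ℂ → EuclideanSpace ℂ (Fin n)}, AnalyticOnNhd ℂ u (closure M) →
        ContinuousOn (deriv u) (closure M) := fun hu => hu.deriv.continuousOn
    simp only [hg, quadSlope, dslope_same]
    exact continuousOn_const.add ((((hdf hf₁).add (hhc.smul (hdf hV))).add
      ((hhc.pow 2).smul (hdf hW))).add (hdc.smul (hV.continuousOn.add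
      ((hhc.add hhc).smul hW.continuousOn))))
  · by_contra hne
    have h0 : x - y ≠ 0 := sub_ne_zero.2 hne
    have hdv : h x - h y = (h x - h y) / (x - y) * (x - y) := (div_mul_cancel₀ _ h0).symm
    refine hgen h hh2 hh0 x hx y hy (Or.inr (hn4.trans hE.ge)) _ hdv ?_
    refine (smul_eq_zero.1 ?_).resolve_left h0
    rw [smul_add, sub_smul_quadSlope f₁ V W hdv, sub_smul]
    have e := sub_eq_zero.2 hxy
    simp only [hf, quadDisc, hq] at e
    rw [← e]
    abel
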